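/- Let f ∈ ℤ[X] be a monic irreducible cubic polynomial. Then there exist constants c > 0, κ > 0 and x₀ ≥ 1 such that for every real x ≥ x₀, the number of integers n with x < n ≤ 2x for which f(n) has a prime factor p with p > x^{1+c} is at least κ·x. -/

import Mathlib

set_option linter.all false

structure Cub where
  c0 : ℤ
  c1 : ℤ
  c2 : ℤ
namespace Cub
variable (k : Cub)
def f (n : ℤ) : ℤ := n ^ 3 + k.c2 * n ^ 2 + k.c1 * n + k.c0
def F (b c : ℤ) : ℤ := b ^ 3 + k.c2 * b ^ 2 * c + k.c1 * b * c ^ 2 + k.c0 * c ^ 3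
def B (a b c : ℤ) : ℤ := -a * b - k.c0 * c ^ 2
def Cc (a b c : ℤ) : ℤ := -a * c + b ^ 2 + k.c2 * b * c + k.c1 * c ^ 2
def e (a b c : ℤ) : ℤ := a * k.Cc a b c + (2 * b + k.c2 * c) * k.B a b c
def q (a b c : ℤ) : ℤ :=
  a ^ 3 + a ^ 2 * (-b * k.c2 - 2 * c * k.c1)
  + a * (b ^ 2 * k.c1 + 3 * b * c * k.c0 + b * c * k.c1 * k.c2 + c ^ 2 * k.c0 * k.c2
    + c ^ 2 * k.c1 ^ 2)
  + (- b ^ 3 * k.c0 - 2 * b ^ 2 * c * k.c0 * k.c2 - b * c ^ 2 * k.c0 * k.c1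
    - b * c ^ 2 * k.c0 * k.c2 ^ 2 + c ^ 3 * k.c0 ^ 2 - c ^ 3 * k.c0 * k.c1 * k.c2)
def Good : Prop := ∀ x y : ℤ, k.F x y = 0 → x = 0 ∧ y = 0
lemma F_eq (a b c : ℤ) : k.F b c = b * k.Cc a b c - c * k.B a b c := by
  simp only [F, Cc, B]; ring
lemma Fq_eq (a b c : ℤ) : k.F (k.B a b c) (k.Cc a b c) = - k.F b c * k.q a b c := by
  simp only [F, Cc, B, q]; ring
lemma c2q_eq (a b c : ℤ) : c ^ 2 * k.q a b c =
    a * k.Cc a b c ^ 2 + (b + k.c2 * c) * k.B a b c * k.Cc a b c + c * k.B a b c ^ 2 := by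
  simp only [Cc, B, q]; ring
lemma Ce_eq (a b c : ℤ) : k.Cc a b c * k.e a b c = k.B a b c * k.F b c + c ^ 2 * k.q a b c := by
  simp only [e, Cc, B, q, F]; ring
lemma q_mul (a b c n : ℤ) : k.q a b c = (a + (b + k.c2 * c) * n + c * n ^ 2) *
    ((a^2 - a*b*k.c2 - 2*a*c*k.c1 + b^2*k.c1 + b*c*k.c0 + b*c*k.c1*k.c2 + c^2*k.c1^2)
     + (k.B a b c + k.c2 * k.Cc a b c) * n + k.Cc a b c * n ^ 2)
    - k.f n * ((b * k.Cc a b c + c * k.B a b c + c * k.c2 * k.Cc a b c)+ c * k.Cc a b c * n) := by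
  simp only [Cc, B, q, f]; ring
lemma q_eq_zero (hk : k.Good) {a b c : ℤ} (h : k.q a b c = 0) : a = 0 ∧ b = 0 ∧ c = 0 := by
  have h1 := k.Fq_eq a b c
  rw [h, mul_zero] at h1
  obtain ⟨h2, h3⟩ := hk _ _ h1
  have h4 := k.F_eq a b c
  rw [h2, h3] at h4
  obtain ⟨h5, h6⟩ := hk b c (by simpa using h4)
  subst h5 h6
  refine ⟨?_, rfl, rfl⟩
  simpa [q] using h
lemma coprime_Cq {a b c : ℤ} (h : IsCoprime (k.Cc a b c) (k.F b c)) :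
    IsCoprime (k.Cc a b c) (k.q a b c) := by
  rw [k.F_eq a b c] at h
  have h1 : IsCoprime (k.Cc a b c) (c * k.B a b c) := by
    have := IsCoprime.add_mul_left_right h (-b)
    have h2 : b * k.Cc a b c - c * k.B a b c + k.Cc a b c * -b = - (c * k.B a b c) := by ring
    rw [h2] at this
    exact (IsCoprime.neg_right_iff _ _).1 this
  obtain ⟨h2, h3⟩ := IsCoprime.mul_right_iff.1 h1
  have h4 : IsCoprime (k.Cc a b c) (c ^ 2 * k.q a b c) := by
    rw [k.c2q_eq]
    have h5 : IsCoprime (k.Cc a b c) (c * k.B a b c ^ 2) := h2.mul_right (h3.pow_right)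
    have := IsCoprime.add_mul_left_right h5
      (a * k.Cc a b c + (b + k.c2 * c) * k.B a b c)
    have h6 : a * k.Cc a b c ^ 2 + (b + k.c2 * c) * k.B a b c * k.Cc a b c + c * k.B a b c ^ 2 =
      c * k.B a b c ^ 2 + k.Cc a b c * (a * k.Cc a b c + (b + k.c2 * c) * k.B a b c) := by ring
    rw [h6]; exact this
  exact (IsCoprime.mul_right_iff.1 h4).2
lemma exists_n {a b c r : ℤ} (hF : k.F b c ≠ 0) (h : IsCoprime (k.Cc a b c) (k.F b c))
    (hr : k.F b c ∣ r * k.Cc a b c + c ^ 2) :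
    ∃ n : ℤ, k.F b c * n = r * k.q a b c + k.e a b c ∧ k.q a b c ∣ k.f n ∧
      k.q a b c ∣ a + (b + k.c2 * c) * n + c * n ^ 2 := by
  obtain ⟨m, hm⟩ := hr
  have h1 : k.Cc a b c * (r * k.q a b c + k.e a b c) = k.F b c * (m * k.q a b c + k.B a b c) := by
    linear_combination k.q a b c * hm + k.Ce_eq a b c
  obtain ⟨n, hn⟩ : k.F b c ∣ r * k.q a b c + k.e a b c :=
    h.symm.dvd_of_dvd_mul_left ⟨_, h1⟩
  have hC : n * k.Cc a b c = m * k.q a b c + k.B a b c := by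
    rw [hn] at h1
    have : k.F b c * (n * k.Cc a b c) = k.F b c * (m * k.q a b c + k.B a b c) := by
      rw [← h1]; ring
    exact mul_left_cancel₀ hF this
  have hcop := k.coprime_Cq h
  have hB : k.B a b c = n * k.Cc a b c - m * k.q a b c := by rw [hC]; ring
  refine ⟨n, hn.symm, ?_, ?_⟩
  · have h3 : k.q a b c ∣ k.Cc a b c ^ 3 * k.f n := by
      have h4 := k.Fq_eq a b c
      generalize k.q a b c = Q at *
      generalize k.Cc a b c = C at *
      rw [hB] at h4
      refine ⟨-k.F b c + ((3 * n ^2* C^2* m - 3 * n*C*m^2*Q + m^3*Q^2) + k.c2 * C * (2*n*C*m - m^2*Q) + k.c1 * C^2*m), ?_⟩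
      simp only [F, f] at h4 ⊢
      linear_combination h4
    exact (hcop.symm.pow_right).dvd_of_dvd_mul_left h3
  · have h3 : k.q a b c ∣ k.Cc a b c ^ 2 * (a + (b + k.c2 * c) * n + c * n ^ 2) := by
      have h4 := k.c2q_eq a b c
      generalize k.q a b c = Q at *
      generalize k.Cc a b c = C at *
      rw [hB] at h4
      refine ⟨c^2 + (b+k.c2*c)*m*C + c * (2*n*C*m - m^2*Q), ?_⟩
      linear_combination -h4
    exact (hcop.symm.pow_right).dvd_of_dvd_mul_left h3
lemma q_dvd_sub {Q a b c a' b' c' n : ℤ} (hf : Q ∣ k.f n)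
    (h : Q ∣ a + (b + k.c2 * c) * n + c * n ^ 2)
    (h' : Q ∣ a' + (b' + k.c2 * c') * n + c' * n ^ 2) : Q ∣ k.q (a - a') (b - b') (c - c') := by
  rw [k.q_mul _ _ _ n]
  refine dvd_sub (Dvd.dvd.mul_right ?_ _) (Dvd.dvd.mul_right hf _)
  have := dvd_sub h h'
  convert this using 1; ring
open Polynomial in
lemma good_of_irreducible
    (hf : Irreducible (X ^ 3 + C k.c2 * X ^ 2 + C k.c1 * X + C k.c0 : ℤ[X])) : k.Good := by
  intro x y h
  have hm : (X ^ 3 + C k.c2 * X ^ 2 + C k.c1 * X + C k.c0 : ℤ[X]).Monic := by monicity!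
  have hd : (X ^ 3 + C k.c2 * X ^ 2 + C k.c1 * X + C k.c0 : ℤ[X]).natDegree = 3 := by
    compute_degree!
  have hq := (Polynomial.IsPrimitive.Int.irreducible_iff_irreducible_map_cast hm.isPrimitive).1 hf
  by_cases hy : y = 0
  · subst hy
    simp only [F] at h
    refine ⟨?_, rfl⟩
    have : x ^ 3 = 0 := by linarith
    exact pow_eq_zero_iff (by norm_num) |>.1 this
  · exfalso
    have hr : (Polynomial.map (Int.castRingHom ℚ)
        (X ^ 3 + C k.c2 * X ^ 2 + C k.c1 * X + C k.c0 : ℤ[X])).IsRoot ((x : ℚ) / y) := by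
      have hy' : (y : ℚ) ≠ 0 := by exact_mod_cast hy
      have h' : (x : ℚ) ^ 3 + k.c2 * x ^ 2 * y + k.c1 * x * y ^ 2 + k.c0 * y ^ 3 = 0 := by
        simp only [F] at h; exact_mod_cast h
      simp [IsRoot]
      field_simp
      linarith
    have := Polynomial.degree_eq_one_of_irreducible_of_root hq hr
    rw [hm.degree_map, Polynomial.degree_eq_natDegree hm.ne_zero, hd] at this
    norm_num at this
end Cub


namespace GB
open Finset
open scoped ComplexConjugate
noncomputable def U (p : ℕ) [NeZero p] : ℕ → (ZMod p → ℂ) → ℝ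
  | 0, φ => ‖∑ x, φ x‖ ^ 2 / (p : ℝ) ^ 2
  | r + 1, φ => (∑ s, ∑ s', U p r (fun x => φ (x + s) * conj (φ (x + s')))) / (p : ℝ) ^ 2
noncomputable def Z (p : ℕ) [NeZero p] : ℕ → (ZMod p → ZMod p) → ℝ
  | 0, Θ => (∑ x, ∑ x', if Θ x = Θ x' then 1 else 0) / (p : ℝ) ^ 2
  | r + 1, Θ => (∑ s, ∑ s', Z p r (fun x => Θ (x + s) - Θ (x + s'))) / (p : ℝ) ^ 2
variable {p : ℕ} [hp : Fact p.Prime]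
lemma U_nonneg (r : ℕ) (φ : ZMod p → ℂ) : 0 ≤ U p r φ := by
  induction r generalizing φ with
  | zero => simp only [U]; positivity
  | succ r ih => simp only [U]; exact div_nonneg (sum_nonneg fun s _ => sum_nonneg fun s' _ => ih _) (by positivity)
lemma U_scale (r : ℕ) (φ : ZMod p → ℂ) {l : ZMod p} (hl : l ≠ 0) :
    U p r (fun x => φ (l * x)) = U p r φ := by
  induction r generalizing φ with
  | zero =>
    simp only [U]
    rw [Fintype.sum_equiv (Equiv.mulLeft₀ l hl) (fun x => φ (l * x)) φ (fun x => rfl)]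
  | succ r ih =>
    simp only [U]
    congr 1
    refine Fintype.sum_equiv (Equiv.mulLeft₀ l hl) _ _ fun s => ?_
    refine Fintype.sum_equiv (Equiv.mulLeft₀ l hl) _ _ fun s' => ?_
    change _ = U p r (fun x => φ (x + l * s) * conj (φ (x + l * s')))
    rw [← ih (fun x => φ (x + l * s) * conj (φ (x + l * s')))]
    simp only [mul_add]
lemma sum_U (r : ℕ) (Θ : ZMod p → ZMod p) :
    ∑ h : ZMod p, U p r (fun x => ZMod.stdAddChar (h * Θ x)) = p * Z p r Θ := by
  induction r generalizing Θ with
  | zero =>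
    simp only [U, Z]
    rw [← sum_div, ← mul_div_assoc]
    congr 1
    have key : ((∑ h : ZMod p, ‖∑ x, (ZMod.stdAddChar (h * Θ x) : ℂ)‖ ^ 2 : ℝ) : ℂ) =
        ((p * ∑ x, ∑ x', if Θ x = Θ x' then (1:ℝ) else 0 : ℝ) : ℂ) := by
      push_cast
      have h1 : ∀ h : ZMod p, (‖∑ x, (ZMod.stdAddChar (h * Θ x) : ℂ)‖ : ℂ) ^ 2 =
          ∑ x, ∑ x', ZMod.stdAddChar (h * (Θ x - Θ x')) := by
        intro h
        rw [← Complex.mul_conj', map_sum, sum_mul_sum]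
        refine sum_congr rfl fun x _ => sum_congr rfl fun x' _ => ?_
        rw [mul_sub, sub_eq_add_neg, AddChar.map_add_eq_mul, AddChar.map_neg_eq_conj]
      simp_rw [h1]
      rw [sum_comm, mul_sum]
      refine sum_congr rfl fun x _ => ?_
      rw [sum_comm, mul_sum]
      refine sum_congr rfl fun x' _ => ?_
      rw [AddChar.sum_mulShift _ (ZMod.isPrimitive_stdAddChar p)]
      simp only [sub_eq_zero, ZMod.card]
      split_ifs <;> simp
    exact_mod_cast key
  | succ r ih =>
    simp only [U, Z]
    rw [← sum_div, ← mul_div_assoc]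
    congr 1
    rw [sum_comm, mul_sum]
    refine sum_congr rfl fun s _ => ?_
    rw [sum_comm, mul_sum]
    refine sum_congr rfl fun s' _ => ?_
    rw [← ih]
    refine sum_congr rfl fun h _ => ?_
    congr 1
    ext x
    rw [mul_sub, sub_eq_add_neg, AddChar.map_add_eq_mul, AddChar.map_neg_eq_conj]
lemma Z_le_one (r : ℕ) (Θ : ZMod p → ZMod p) : Z p r Θ ≤ 1 := by
  have hp0 : (0:ℝ) < p := by exact_mod_cast hp.out.pos
  induction r generalizing Θ with
  | zero =>
    simp only [Z]
    rw [div_le_one (by positivity)]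
    calc _ ≤ ∑ x : ZMod p, ∑ x' : ZMod p, (1:ℝ) := by gcongr; split_ifs <;> norm_num
      _ = _ := by simp [ZMod.card, sq]
  | succ r ih =>
    simp only [Z]
    rw [div_le_one (by positivity)]
    calc _ ≤ ∑ x : ZMod p, ∑ x' : ZMod p, (1:ℝ) := by gcongr; exact ih _
      _ = _ := by simp [ZMod.card, sq]
def Th (l : List (ZMod p × ZMod p)) (x : ZMod p) : ZMod p :=
  (l.map fun t => t.1 * (x + t.2)⁻¹).sum
lemma sum_map_neg' (g : ZMod p × ZMod p → ZMod p) (l : List (ZMod p × ZMod p)) :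
    (l.map fun u => - g u).sum = - (l.map g).sum := by
  induction l with
  | nil => simp
  | cons a l ih => simp only [List.map_cons, List.sum_cons, ih]; ring
def CZ : ℕ → ℕ → ℕ
  | 0, m => 2 * (m + 1)
  | r + 1, m => (m + 1) + CZ r (2 * m + 1)
open Polynomial in
lemma exists_num (l : List (ZMod p × ZMod p)) : ∃ R : (ZMod p)[X], R.natDegree ≤ l.length ∧
    ∀ x, (∀ t ∈ l, x + t.2 ≠ 0) →
      Th l x * (l.map fun t => x + t.2).prod = R.eval x := by
  induction l with
  | nil => exact ⟨0, by simp, by simp [Th]⟩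
  | cons t l ih =>
    obtain ⟨R, hR, h⟩ := ih
    refine ⟨C t.1 * (l.map fun t => (X + C t.2)).prod + (X + C t.2) * R, ?_, ?_⟩
    · refine (natDegree_add_le _ _).trans (max_le ?_ ?_)
      · refine (natDegree_C_mul_le _ _).trans ?_
        refine (natDegree_list_prod_le _).trans ?_
        rw [List.map_map]
        refine (List.sum_le_card_nsmul _ 1 ?_).trans (by simp)
        intro d hd
        rw [List.mem_map] at hd
        obtain ⟨u, _, rfl⟩ := hd
        simp
      · refine natDegree_mul_le.trans ?_
        simp; omega
    · intro x hx
      have h1 := h x (fun u hu => hx u (by simp [hu]))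
      have h2 := hx t (by simp)
      have h3 : Th (t :: l) x = t.1 * (x + t.2)⁻¹ + Th l x := by simp [Th]
      rw [h3]
      simp only [List.map_cons, List.prod_cons, eval_add, eval_mul, eval_C, eval_X, ← h1]
      have h4 : eval x (l.map fun t => (X + C t.2 : (ZMod p)[X])).prod =
        (l.map fun t => x + t.2).prod := by
        rw [eval_list_prod, List.map_map]
        congr 1
        apply List.map_congr_left
        intro a _
        simp
      rw [h4]
      field_simp
open Polynomial in
lemma count_le (t : ZMod p × ZMod p) (l : List (ZMod p × ZMod p)) (ht : t.1 ≠ 0)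
    (hl : ∀ u ∈ l, u.2 ≠ t.2) (v : ZMod p) :
    #{x | Th (t :: l) x = v} ≤ 2 * (l.length + 1) := by
  classical
  obtain ⟨R, hR, h⟩ := exists_num l
  set Q : (ZMod p)[X] := (l.map fun t => (X + C t.2)).prod with hQ
  have hQe : ∀ x, eval x Q = (l.map fun t => x + t.2).prod := by
    intro x
    rw [hQ, eval_list_prod, List.map_map]
    congr 1
    apply List.map_congr_left
    intro a _
    simp
  have hQd : Q.natDegree ≤ l.length := by
    refine (natDegree_list_prod_le _).trans ?_
    rw [List.map_map]
    refine (List.sum_le_card_nsmul _ 1 ?_).trans (by simp)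
    intro d hd
    rw [List.mem_map] at hd
    obtain ⟨u, _, rfl⟩ := hd
    simp
  set G : (ZMod p)[X] := C t.1 * Q + (X + C t.2) * R - C v * ((X + C t.2) * Q) with hG
  have hG0 : G ≠ 0 := by
    intro h0
    have h1 : eval (-t.2) G = 0 := by rw [h0]; simp
    rw [hG] at h1
    simp only [eval_sub, eval_add, eval_mul, eval_C, eval_X, neg_add_cancel, zero_mul, mul_zero,
      add_zero, sub_zero, mul_eq_zero, ht, false_or, hQe] at h1
    rw [List.prod_eq_zero_iff, List.mem_map] at h1
    obtain ⟨u, hu, h2⟩ := h1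
    exact hl u hu (by linear_combination h2)
  have hGd : G.natDegree ≤ l.length + 1 := by
    rw [hG]
    refine (natDegree_sub_le _ _).trans (max_le ((natDegree_add_le _ _).trans (max_le ?_ ?_)) ?_)
    · exact (natDegree_C_mul_le _ _).trans (by omega)
    · refine natDegree_mul_le.trans ?_
      simp; omega
    · refine (natDegree_C_mul_le _ _).trans (natDegree_mul_le.trans ?_)
      simp; omega
  have hsub : ({x | Th (t :: l) x = v} : Finset (ZMod p)) ⊆
      G.roots.toFinset ∪ ((t :: l).map fun u => - u.2).toFinset := by
    intro x hx
    simp only [mem_filter, mem_univ, true_and] at hx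
    rw [mem_union, List.mem_toFinset, Multiset.mem_toFinset, mem_roots hG0]
    by_cases hx2 : ∀ u ∈ t :: l, x + u.2 ≠ 0
    · left
      have h1 := h x (fun u hu => hx2 u (by simp [hu]))
      have h2 := hx2 t (by simp)
      have h3 : Th (t :: l) x = t.1 * (x + t.2)⁻¹ + Th l x := by simp [Th]
      rw [h3] at hx
      rw [IsRoot, hG]
      simp only [eval_sub, eval_add, eval_mul, eval_C, eval_X, hQe, ← h1, ← hx]
      field_simp
      ring
    · right
      push Not at hx2
      obtain ⟨u, hu, h2⟩ := hx2
      exact List.mem_map.2 ⟨u, hu, by linear_combination -h2⟩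
  refine (card_le_card hsub).trans ((card_union_le _ _).trans ?_)
  have h1 := (Multiset.toFinset_card_le G.roots).trans (card_roots' G)
  have h2 := List.toFinset_card_le ((t :: l).map fun u => - u.2)
  simp only [List.length_map, List.length_cons] at h2
  omega
lemma Z_le (r : ℕ) (t : ZMod p × ZMod p) (l : List (ZMod p × ZMod p)) (ht : t.1 ≠ 0)
    (hl : ∀ u ∈ l, u.2 ≠ t.2) : Z p r (Th (t :: l)) ≤ (CZ r l.length : ℝ) / p := by
  have hp0 : (0:ℝ) < p := by exact_mod_cast hp.out.pos
  induction r generalizing t l with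
  | zero =>
    simp only [Z, CZ]
    rw [div_le_div_iff₀ (by positivity) hp0]
    have : ∀ x : ZMod p, (∑ x', if Th (t :: l) x = Th (t :: l) x' then (1:ℝ) else 0) ≤
        (2 * (l.length + 1) : ℕ) := by
      intro x
      rw [sum_boole]
      have := count_le t l ht hl (Th (t :: l) x)
      simp_rw [eq_comm (a := Th (t :: l) x)]
      exact_mod_cast this
    have h2 := sum_le_sum (s := univ) fun x _ => this x
    simp only [sum_const, card_univ, ZMod.card, nsmul_eq_mul] at h2
    nlinarith
  | succ r ih =>
    simp only [Z, CZ]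
    rw [div_le_div_iff₀ (by positivity) hp0]
    have hs : ∀ s s' : ZMod p, (∀ u ∈ t :: l, s' ≠ s + t.2 - u.2) →
        Z p r (fun x => Th (t :: l) (x + s) - Th (t :: l) (x + s')) ≤
          (CZ r (2 * l.length + 1) : ℝ) / p := by
      intro s s' h
      have := ih (t.1, t.2 + s) ((l.map fun u => (u.1, u.2 + s)) ++
        (t :: l).map fun u => (-u.1, u.2 + s')) ht ?_
      · have he : (fun x => Th (t :: l) (x + s) - Th (t :: l) (x + s')) =
            Th ((t.1, t.2 + s) :: ((l.map fun u => (u.1, u.2 + s)) ++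
              (t :: l).map fun u => (-u.1, u.2 + s'))) := by
          ext x
          simp only [Th, List.map_cons, List.sum_cons, List.map_append, List.sum_append, List.map_map]
          have e1 : (List.map ((fun t ↦ t.1 * (x + t.2)⁻¹) ∘ fun u : ZMod p × ZMod p ↦ (-u.1, u.2 + s')) l).sum
             = - (List.map (fun t ↦ t.1 * (x + s' + t.2)⁻¹) l).sum := by
            rw [← sum_map_neg']
            congr 1
            apply List.map_congr_left
            intro u _
            simp only [Function.comp]; rw [add_assoc, add_comm s']; ring
          have e2 : (List.map ((fun t ↦ t.1 * (x + t.2)⁻¹) ∘ fun u : ZMod p × ZMod p ↦ (u.1, u.2 + s)) l).sum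
             = (List.map (fun t ↦ t.1 * (x + s + t.2)⁻¹) l).sum := by
            congr 1
            apply List.map_congr_left
            intro u _
            simp only [Function.comp]; rw [add_assoc x s, add_comm s]
          rw [e1, e2, add_assoc x s, add_comm s, add_assoc x s' t.2, add_comm s' t.2]
          ring
        rw [he]
        convert this using 3
        congr 1
        simp; ring
      · intro u hu
        rw [List.mem_append, List.mem_map, List.mem_map] at hu
        rcases hu with ⟨w, hw, rfl⟩ | ⟨w, hw, rfl⟩
        · simpa using hl w hw
        · intro h2
          exact h w hw (by simp only at h2; linear_combination h2)
    have h1 : ∀ s : ZMod p, ∑ s', Z p r (fun x => Th (t :: l) (x + s) - Th (t :: l) (x + s')) ≤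
        (l.length + 1) + (CZ r (2 * l.length + 1) : ℝ) := by
      intro s
      classical
      rw [← sum_filter_add_sum_filter_not univ (fun s' => ∃ u ∈ t :: l, s' = s + t.2 - u.2)]
      apply add_le_add
      · refine (sum_le_sum fun s' _ => Z_le_one _ _).trans ?_
        rw [sum_const, nsmul_eq_mul, mul_one]
        have : ({s' | ∃ u ∈ t :: l, s' = s + t.2 - u.2} : Finset (ZMod p)) ⊆
            ((t :: l).map fun u => s + t.2 - u.2).toFinset := by
          intro y hy
          simp only [mem_filter, mem_univ, true_and] at hy
          obtain ⟨u, hu, rfl⟩ := hy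
          rw [List.mem_toFinset]
          exact List.mem_map.2 ⟨u, hu, rfl⟩
        have h3 := (card_le_card this).trans (List.toFinset_card_le _)
        rw [List.length_map, List.length_cons] at h3
        exact_mod_cast h3
      · refine (sum_le_sum (g := fun _ => (CZ r (2 * l.length + 1) : ℝ) / p) fun s' hs' => ?_).trans ?_
        · simp only [mem_filter, mem_univ, true_and] at hs'
          push Not at hs'
          exact hs s s' hs'
        · rw [sum_const, nsmul_eq_mul]
          rw [mul_div_assoc', div_le_iff₀ hp0]
          rw [mul_comm]
          gcongr
          refine (card_le_univ _).trans ?_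
          rw [ZMod.card]
    have h2 := sum_le_sum (s := univ) fun x _ => h1 x
    simp only [sum_const, card_univ, ZMod.card, nsmul_eq_mul] at h2
    push_cast
    nlinarith
lemma U_inv_le (r : ℕ) : U p r (fun x => ZMod.stdAddChar (x⁻¹ : ZMod p)) ≤ 2 * (CZ r 0 : ℝ) / p := by
  have hp0 : (0:ℝ) < p := by exact_mod_cast hp.out.pos
  have h1 := sum_U r (fun x : ZMod p => x⁻¹)
  have h2 : Z p r (fun x : ZMod p => x⁻¹) ≤ (CZ r 0 : ℝ) / p := by
    have := Z_le (p := p) r (1, 0) [] one_ne_zero (by simp)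
    have e : (Th [((1 : ZMod p), (0 : ZMod p))]) = fun x => x⁻¹ := by ext x; simp [Th]
    rwa [e] at this
  have h3 : ∀ h : ZMod p, h ≠ 0 → U p r (fun x => ZMod.stdAddChar (h * x⁻¹)) =
      U p r (fun x => ZMod.stdAddChar (x⁻¹ : ZMod p)) := by
    intro h hh
    rw [← U_scale r (fun x => ZMod.stdAddChar (h * x⁻¹)) hh]
    congr 1
    ext x
    rw [mul_inv, mul_inv_cancel_left₀ hh]
  have h4 : ((p:ℝ) - 1) * U p r (fun x => ZMod.stdAddChar (x⁻¹ : ZMod p)) ≤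
      ∑ h : ZMod p, U p r (fun x => ZMod.stdAddChar (h * x⁻¹)) := by
    classical
    rw [← Finset.add_sum_erase univ _ (mem_univ (0 : ZMod p))]
    rw [sum_congr rfl fun h hh => h3 h (ne_of_mem_erase hh)]
    rw [sum_const, card_erase_of_mem (mem_univ _), card_univ, ZMod.card, nsmul_eq_mul,
      Nat.cast_pred hp.out.pos]
    have := U_nonneg r (fun x : ZMod p => ZMod.stdAddChar ((0 : ZMod p) * x⁻¹))
    linarith
  rw [h1] at h4
  have h5 : (p:ℝ) * Z p r (fun x : ZMod p => x⁻¹) ≤ CZ r 0 := by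
    rw [le_div_iff₀ hp0] at h2; linarith
  have h6 : (2:ℝ) ≤ p := by exact_mod_cast hp.out.two_le
  rw [le_div_iff₀ hp0]
  have := U_nonneg r (fun x : ZMod p => ZMod.stdAddChar (x⁻¹ : ZMod p))
  nlinarith
lemma inner_le_sum_pow (I : ZMod p → ZMod p → ℂ) (m : ℕ) (hm : 0 < m) :
    (∑ s : ZMod p, ∑ s' : ZMod p, ‖I s s'‖) ^ m ≤
      ((p:ℝ) ^ 2) ^ (m - 1) * ∑ s : ZMod p, ∑ s' : ZMod p, ‖I s s'‖ ^ m := by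
  have hp0 : (0:ℝ) < p := by exact_mod_cast hp.out.pos
  have h := pow_sum_div_card_le_sum_pow (s := (univ : Finset (ZMod p × ZMod p)))
    (f := fun t => ‖I t.1 t.2‖) (fun t _ => norm_nonneg _) (m - 1)
  rw [Nat.sub_add_cancel hm, Fintype.sum_prod_type, Fintype.sum_prod_type, card_univ,
    Fintype.card_prod, ZMod.card] at h
  push_cast at h
  rw [← sq, div_le_iff₀ (by positivity)] at h
  linarith
lemma gcs (r : ℕ) (φ : ZMod p → ℂ) (a0 : ZMod p) (lam : Fin (r + 1) → ZMod p)
    (hlam : ∀ i, lam i ≠ 0) (H : Fin (r + 1) → (Fin (r + 1) → ZMod p) → ℂ)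
    (hH : ∀ i t, ‖H i t‖ ≤ 1) (hH2 : ∀ i t v, H i (Function.update t i v) = H i t) :
    ‖∑ t : Fin (r + 1) → ZMod p, φ (a0 + ∑ i, lam i * t i) * ∏ i, H i t‖ ^ (2 ^ (r + 1)) ≤
      ((p : ℝ) ^ (r + 1)) ^ (2 ^ (r + 1)) * U p r φ := by
  have hp0 : (0:ℝ) < p := by exact_mod_cast hp.out.pos
  induction r generalizing φ a0 with
  | zero =>
    simp only [U]
    have hc : ∀ t : Fin 1 → ZMod p, H 0 t = H 0 0 := by
      intro t
      rw [← hH2 0 t 0]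
      congr 1
      ext i
      have hi : i = 0 := Fin.fin_one_eq_zero i
      rw [hi]; simp
    have e1 : ∀ t : Fin 1 → ZMod p, ∑ i, lam i * t i = lam 0 * t 0 := fun t => Fin.sum_univ_one _
    have e2 : ∀ t : Fin 1 → ZMod p, ∏ i, H i t = H 0 t := fun t => Fin.prod_univ_one _
    simp only [zero_add, pow_one]
    change ‖∑ t : Fin 1 → ZMod p, φ (a0 + ∑ i, lam i * t i) * ∏ i, H i t‖ ^ 2 ≤ _
    simp only [e1, e2]
    have hsum : ∑ t : Fin 1 → ZMod p, φ (a0 + lam 0 * t 0) * H 0 t = (∑ x, φ x) * H 0 0 := by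
      rw [sum_mul]
      refine Fintype.sum_equiv ((Equiv.funUnique (Fin 1) (ZMod p)).trans
        ((Equiv.mulLeft₀ (lam 0) (hlam 0)).trans (Equiv.addLeft a0))) _ _ fun t => ?_
      rw [hc]; simp
    rw [hsum, norm_mul]
    have := hH 0 0
    have h2 : ((p:ℝ) ^ 2 * (‖∑ x, φ x‖ ^ 2 / (p:ℝ) ^ 2)) = ‖∑ x, φ x‖ ^ 2 := by field_simp
    rw [h2]
    gcongr
    exact mul_le_of_le_one_right (norm_nonneg _) this
  | succ r ih =>
    set m := 2 ^ (r + 1) with hm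
    have hm2 : 2 ^ (r + 1 + 1) = 2 * m := by rw [hm, pow_succ]; ring
    set P : ℝ := (p:ℝ) ^ (r + 1) with hP
    let I : ZMod p → ZMod p → ℂ := fun s s' =>
      ∑ t : Fin (r + 1) → ZMod p,
        (φ ((a0 + ∑ i : Fin (r + 1), lam i.succ * t i) + lam 0 * s) *
          conj (φ ((a0 + ∑ i : Fin (r + 1), lam i.succ * t i) + lam 0 * s'))) *
        ∏ i : Fin (r + 1), (H i.succ (Fin.cons s t) * conj (H i.succ (Fin.cons s' t)))
    have hI : ∀ s s', ‖I s s'‖ ^ m ≤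
        P ^ m * U p r (fun x => φ (x + lam 0 * s) * conj (φ (x + lam 0 * s'))) := by
      intro s s'
      refine ih (fun x => φ (x + lam 0 * s) * conj (φ (x + lam 0 * s'))) a0 (fun i => lam i.succ)
        (fun i => hlam _)
        (fun i t => H i.succ (Fin.cons s t) * conj (H i.succ (Fin.cons s' t))) ?_ ?_
      · intro i t
        rw [norm_mul, RCLike.norm_conj]
        exact mul_le_one₀ (hH _ _) (norm_nonneg _) (hH _ _)
      · intro i t v
        simp only [Fin.cons_update, hH2]
    let G : (Fin (r + 1) → ZMod p) → ℂ := fun t =>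
      ∑ s, φ ((a0 + ∑ i : Fin (r + 1), lam i.succ * t i) + lam 0 * s) * ∏ i : Fin (r + 1), H i.succ (Fin.cons s t)
    have hS : ∑ t : Fin (r + 1 + 1) → ZMod p, φ (a0 + ∑ i, lam i * t i) * ∏ i, H i t =
        ∑ t, H 0 (Fin.cons 0 t) * G t := by
      rw [← (Fin.consEquiv (fun _ : Fin (r + 1 + 1) => ZMod p)).sum_comp, Fintype.sum_prod_type, sum_comm]
      refine sum_congr rfl fun t _ => ?_
      rw [mul_sum]
      refine sum_congr rfl fun s _ => ?_
      have h0 : H 0 (Fin.cons s t) = H 0 (Fin.cons 0 t) := by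
        rw [← hH2 0 (Fin.cons s t) 0, Fin.update_cons_zero]
      simp only [Fin.consEquiv, Equiv.coe_fn_mk]
      rw [Fin.sum_univ_succ, Fin.prod_univ_succ, h0]
      simp only [Fin.cons_zero, Fin.cons_succ]
      rw [show a0 + (lam 0 * s + ∑ i : Fin (r + 1), lam i.succ * t i) =
        a0 + ∑ i : Fin (r + 1), lam i.succ * t i + lam 0 * s by ring]
      ring
    have hG : ∑ t, ‖G t‖ ^ 2 ≤ ∑ s, ∑ s', ‖I s s'‖ := by
      have h1 : ((∑ t, ‖G t‖ ^ 2 : ℝ) : ℂ) = ∑ s, ∑ s', I s s' := by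
        push_cast
        simp only [I]
        rw [show (∑ s, ∑ s', ∑ t : Fin (r + 1) → ZMod p, (φ ((a0 + ∑ i : Fin (r + 1), lam i.succ * t i) + lam 0 * s) *
          conj (φ ((a0 + ∑ i : Fin (r + 1), lam i.succ * t i) + lam 0 * s'))) *
          ∏ i : Fin (r + 1), (H i.succ (Fin.cons s t) * conj (H i.succ (Fin.cons s' t)))) =
          ∑ t : Fin (r + 1) → ZMod p, ∑ s, ∑ s', (φ ((a0 + ∑ i : Fin (r + 1), lam i.succ * t i) + lam 0 * s) *
          conj (φ ((a0 + ∑ i : Fin (r + 1), lam i.succ * t i) + lam 0 * s'))) *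
          ∏ i : Fin (r + 1), (H i.succ (Fin.cons s t) * conj (H i.succ (Fin.cons s' t))) from by
            conv_rhs => rw [sum_comm]
            refine sum_congr rfl fun s _ => ?_
            rw [sum_comm]]
        refine sum_congr rfl fun t _ => ?_
        rw [← Complex.mul_conj', map_sum, sum_mul_sum]
        refine sum_congr rfl fun s _ => sum_congr rfl fun s' _ => ?_
        rw [map_mul, map_prod, prod_mul_distrib]
        ring
      have h2 : ∑ t, ‖G t‖ ^ 2 = ‖((∑ t, ‖G t‖ ^ 2 : ℝ) : ℂ)‖ := by
        rw [Complex.norm_real, Real.norm_of_nonneg]; positivity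
      rw [h2, h1]
      exact (norm_sum_le _ _).trans (sum_le_sum fun s _ => norm_sum_le _ _)
    have hcard : (Fintype.card (Fin (r + 1) → ZMod p) : ℝ) = P := by
      rw [Fintype.card_fun, ZMod.card, Fintype.card_fin]; push_cast; rfl
    have hCS : ‖∑ t, H 0 (Fin.cons 0 t) * G t‖ ^ 2 ≤ P * ∑ t, ‖G t‖ ^ 2 := by
      have h1 : ‖∑ t, H 0 (Fin.cons 0 t) * G t‖ ≤ ∑ t, ‖G t‖ := by
        refine (norm_sum_le _ _).trans (sum_le_sum fun t _ => ?_)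
        rw [norm_mul]
        exact mul_le_of_le_one_left (norm_nonneg _) (hH _ _)
      refine (pow_le_pow_left₀ (norm_nonneg _) h1 2).trans ?_
      refine sq_sum_le_card_mul_sum_sq.trans ?_
      rw [card_univ, hcard]
    have hJ : (∑ s : ZMod p, ∑ s' : ZMod p, ‖I s s'‖) ^ m ≤
        ((p:ℝ) ^ 2) ^ m * P ^ m * U p (r + 1) φ := by
      have hU : ∑ s : ZMod p, ∑ s' : ZMod p,
          U p r (fun x => φ (x + lam 0 * s) * conj (φ (x + lam 0 * s'))) = (p:ℝ) ^ 2 * U p (r + 1) φ := by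
        simp only [U]
        rw [mul_div_cancel₀ _ (by positivity)]
        refine Fintype.sum_equiv (Equiv.mulLeft₀ _ (hlam 0)) _ _ fun s => ?_
        exact Fintype.sum_equiv (Equiv.mulLeft₀ _ (hlam 0)) _ _ fun s' => rfl
      have h1 := inner_le_sum_pow (p := p) I m (by positivity)
      refine h1.trans ?_
      have h2 : ∑ s : ZMod p, ∑ s' : ZMod p, ‖I s s'‖ ^ m ≤ P ^ m * ((p:ℝ) ^ 2 * U p (r + 1) φ) := by
        rw [← hU, mul_sum]
        refine sum_le_sum fun s _ => ?_
        rw [mul_sum]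
        exact sum_le_sum fun s' _ => hI s s'
      have hmpos : 0 < m := by positivity
      calc _ ≤ ((p:ℝ) ^ 2) ^ (m - 1) * (P ^ m * ((p:ℝ) ^ 2 * U p (r + 1) φ)) := by gcongr
        _ = ((p:ℝ) ^ 2) ^ (m - 1 + 1) * P ^ m * U p (r + 1) φ := by rw [pow_succ]; ring
        _ = _ := by rw [Nat.sub_add_cancel hmpos]
    rw [hS, hm2, pow_mul]
    calc (‖∑ t, H 0 (Fin.cons 0 t) * G t‖ ^ 2) ^ m ≤ (P * ∑ s, ∑ s', ‖I s s'‖) ^ m := by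
          gcongr
          exact hCS.trans (by gcongr)
      _ = P ^ m * (∑ s, ∑ s', ‖I s s'‖) ^ m := mul_pow _ _ _
      _ ≤ P ^ m * (((p:ℝ) ^ 2) ^ m * P ^ m * U p (r + 1) φ) := by gcongr
      _ = ((p:ℝ) ^ (r + 1 + 1)) ^ (2 * m) * U p (r + 1) φ := by
        rw [pow_succ _ (r + 1), ← hP, pow_mul]; ring
end GB

set_option linter.unusedSectionVars false
namespace GB
open Finset
open scoped ComplexConjugate
variable {p : ℕ} [hp : Fact p.Prime]
lemma sum_shift (f : ℤ → ℂ) (hf : ∀ t, ‖f t‖ ≤ 1) (T m : ℕ) :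
    ‖∑ t ∈ range T, f t - ∑ t ∈ range T, f (t + m)‖ ≤ 2 * m := by
  induction m with
  | zero => simp
  | succ m ih =>
    have h1 : ∑ t ∈ range T, f (t + m) - ∑ t ∈ range T, f (t + (m + 1 : ℕ)) = f m - f (T + m) := by
      have h2 := sum_range_succ (fun t : ℕ => f (t + m)) T
      rw [sum_range_succ'] at h2
      push_cast at h2 ⊢
      have h3 : ∑ t ∈ range T, f (t + 1 + m) = ∑ t ∈ range T, f (t + (m + 1)) :=
        sum_congr rfl fun t _ => by congr 1; ring
      rw [h3, zero_add] at h2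
      linear_combination -h2
    have h4 : ‖f m - f (T + m)‖ ≤ 2 := (norm_sub_le _ _).trans (by linarith [hf m, hf (T + m)])
    rw [← h1] at h4
    calc _ = ‖(∑ t ∈ range T, f t - ∑ t ∈ range T, f (t + m)) +
        (∑ t ∈ range T, f (t + m) - ∑ t ∈ range T, f (t + (m + 1 : ℕ)))‖ := by congr 1; ring
      _ ≤ 2 * m + 2 := (norm_add_le _ _).trans (add_le_add ih h4)
      _ = _ := by push_cast; ring
lemma norm_psi (x : ZMod p) : ‖(ZMod.stdAddChar x : ℂ)‖ = 1 := AddChar.norm_apply _ _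
lemma expsum (r : ℕ) (g : Fin (r + 1) → ℕ) (hg : ∀ i, (g i : ZMod p) ≠ 0) (G : ℕ)
    (hG : ∀ i, g i ≤ G) (H : Fin (r + 1) → ℤ → ℂ) (hH : ∀ i t, ‖H i t‖ ≤ 1)
    (hper : ∀ i t v, H i (t + g i * v) = H i t) (κ lam mu : ZMod p) (hκ : κ ≠ 0) (hlam : lam ≠ 0)
    (η : ℝ) (hη0 : 0 ≤ η) (hη : 2 * (CZ r 0 : ℝ) / p ≤ η ^ 2 ^ (r + 1)) (T : ℕ) :
    ‖∑ t ∈ range T, ZMod.stdAddChar (κ * (lam * (t : ZMod p) + mu)⁻¹) * ∏ i, H i (t : ℤ)‖ ≤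
      T * η + 2 * (r + 1) * p * G := by
  have hp0 : (0:ℝ) < p := by exact_mod_cast hp.out.pos
  set f : ℤ → ℂ := fun t => ZMod.stdAddChar (κ * (lam * (t : ZMod p) + mu)⁻¹) * ∏ i, H i t with hf
  have hf1 : ∀ t, ‖f t‖ ≤ 1 := by
    intro t
    rw [hf]
    simp only [norm_mul, norm_prod, norm_psi, one_mul]
    exact prod_le_one (fun i _ => norm_nonneg _) (fun i _ => hH i t)
  have hS : ∑ t ∈ range T, ZMod.stdAddChar (κ * (lam * (t : ZMod p) + mu)⁻¹) * ∏ i, H i (t : ℤ)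
      = ∑ t ∈ range T, f t := by
    refine sum_congr rfl fun t _ => ?_
    simp [hf]
  rw [hS]
  let m : (Fin (r + 1) → ZMod p) → ℕ := fun τ => ∑ i, g i * (τ i).val
  have hm : ∀ τ, (m τ : ℝ) ≤ (r + 1) * p * G := by
    intro τ
    have : m τ ≤ ∑ i : Fin (r + 1), G * p :=
      sum_le_sum fun i _ => Nat.mul_le_mul (hG i) (ZMod.val_lt _).le
    rw [sum_const, card_univ, Fintype.card_fin, smul_eq_mul] at this
    have h2 : (m τ : ℝ) ≤ ((r + 1) * (G * p) : ℕ) := by exact_mod_cast this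
    push_cast at h2
    linarith
  have hcard : (Fintype.card (Fin (r + 1) → ZMod p) : ℝ) = (p:ℝ) ^ (r + 1) := by
    rw [Fintype.card_fun, ZMod.card, Fintype.card_fin]; push_cast; rfl
  have hin : ∀ t : ℕ, ‖∑ τ, f (t + m τ)‖ ≤ (p:ℝ) ^ (r + 1) * η := by
    intro t
    have h1 := gcs r (fun x : ZMod p => (ZMod.stdAddChar (x⁻¹ : ZMod p) : ℂ))
      (κ⁻¹ * (lam * (t : ZMod p) + mu))
      (fun i => κ⁻¹ * lam * g i) (fun i => mul_ne_zero (mul_ne_zero (inv_ne_zero hκ) hlam) (hg i))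
      (fun i τ => H i (t + m τ)) (fun i τ => hH _ _) ?_
    · have h2 : ∀ τ : Fin (r + 1) → ZMod p, (ZMod.stdAddChar
          ((κ⁻¹ * (lam * (t : ZMod p) + mu) + ∑ i, κ⁻¹ * lam * g i * τ i)⁻¹) : ℂ) *
          ∏ i, H i (t + m τ) = f (t + m τ) := by
        intro τ
        simp only [hf]
        congr 2
        have h3 : ((↑(↑t + ↑(m τ) : ℤ)) : ZMod p) = t + ∑ i, g i * τ i := by
          push_cast
          congr 1
          simp only [m]
          push_cast
          exact sum_congr rfl fun i _ => by rw [ZMod.natCast_zmod_val]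
        rw [h3]
        have h4 : κ⁻¹ * (lam * (t : ZMod p) + mu) + ∑ i, κ⁻¹ * lam * g i * τ i =
          κ⁻¹ * (lam * (t + ∑ i, g i * τ i) + mu) := by
          have : ∑ i, κ⁻¹ * lam * g i * τ i = κ⁻¹ * lam * ∑ i, g i * τ i := by
            rw [mul_sum]; exact sum_congr rfl fun i _ => by ring
          rw [this]; ring
        rw [h4, mul_inv, inv_inv]
      simp_rw [h2] at h1
      have h5 : ‖∑ τ, f (t + m τ)‖ ^ 2 ^ (r + 1) ≤ ((p:ℝ) ^ (r + 1) * η) ^ 2 ^ (r + 1) := by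
        rw [mul_pow]
        exact h1.trans (mul_le_mul_of_nonneg_left ((U_inv_le r).trans hη) (by positivity))
      exact le_of_pow_le_pow_left₀ (by positivity) (by positivity) h5
    · intro i τ v
      have : (m (Function.update τ i v) : ℤ) = m τ + g i * ((v.val : ℤ) - (τ i).val) := by
        simp only [m]
        push_cast
        rw [← Finset.add_sum_erase univ _ (mem_univ i),
          ← Finset.add_sum_erase univ (fun k => (g k : ℤ) * (τ k).val) (mem_univ i)]
        rw [sum_congr rfl (fun k hk => by rw [Function.update_of_ne (ne_of_mem_erase hk)])]
        simp
        ring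
      simp only [this]
      rw [← add_assoc, hper]
  have hsh : ‖(p:ℝ) ^ (r + 1) * ∑ t ∈ range T, f t - ∑ τ, ∑ t ∈ range T, f (t + m τ)‖ ≤
      (p:ℝ) ^ (r + 1) * (2 * ((r + 1) * p * G)) := by
    have e : ((p:ℝ) ^ (r + 1) : ℂ) * ∑ t ∈ range T, f t =
        ∑ τ : Fin (r + 1) → ZMod p, ∑ t ∈ range T, f t := by
      rw [sum_const, card_univ, nsmul_eq_mul]
      congr 1
      exact_mod_cast hcard.symm
    rw [e, ← sum_sub_distrib]
    refine (norm_sum_le _ _).trans ?_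
    refine (sum_le_sum (g := fun _ => 2 * ((r + 1) * p * G : ℝ)) fun τ _ => ?_).trans ?_
    · exact (sum_shift f hf1 T (m τ)).trans (by linarith [hm τ])
    · rw [sum_const, card_univ, nsmul_eq_mul, hcard]
  have h6 : ‖∑ τ, ∑ t ∈ range T, f (t + m τ)‖ ≤ T * ((p:ℝ) ^ (r + 1) * η) := by
    rw [sum_comm]
    refine (norm_sum_le _ _).trans ((sum_le_sum fun t _ => hin t).trans ?_)
    simp
  have h7 : (p:ℝ) ^ (r + 1) * ‖∑ t ∈ range T, f t‖ ≤
      (p:ℝ) ^ (r + 1) * (T * η + 2 * (r + 1) * p * G) := by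
    calc _ = ‖(p:ℝ) ^ (r + 1) * ∑ t ∈ range T, f t‖ := by
          rw [norm_mul]; congr 1; simp
      _ ≤ ‖(p:ℝ) ^ (r + 1) * ∑ t ∈ range T, f t - ∑ τ, ∑ t ∈ range T, f (t + m τ)‖ +
          ‖∑ τ, ∑ t ∈ range T, f (t + m τ)‖ := by
          refine le_trans (le_of_eq ?_) (norm_add_le _ _); congr 1; ring
      _ ≤ _ := by linarith
  exact le_of_mul_le_mul_left h7 (by positivity)
noncomputable def Psi (p : ℕ) (L : ℕ) (y0 y : ZMod p) : ℝ :=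
  (∑ u ∈ range L, ∑ v ∈ range L, if y = y0 + u - v then (1:ℝ) else 0) / L
lemma Psi_nonneg (L : ℕ) (y0 y : ZMod p) : 0 ≤ Psi p L y0 y := by
  unfold Psi
  refine div_nonneg (sum_nonneg fun u _ => sum_nonneg fun v _ => ?_) (by positivity)
  split_ifs <;> norm_num
lemma natCast_inj {L u v : ℕ} (hL : L ≤ p) (hu : u < L) (hv : v < L)
    (h : (u : ZMod p) = v) : u = v := by
  have := (ZMod.natCast_eq_natCast_iff' _ _ _).1 h
  rwa [Nat.mod_eq_of_lt (by omega), Nat.mod_eq_of_lt (by omega)] at this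
lemma Psi_le_one (L : ℕ) (hL : L ≤ p) (y0 y : ZMod p) : Psi p L y0 y ≤ 1 := by
  unfold Psi
  rcases Nat.eq_zero_or_pos L with h0 | h0
  · simp [h0]
  rw [div_le_one (by exact_mod_cast h0)]
  calc _ ≤ ∑ u ∈ range L, (1:ℝ) := ?_
    _ = L := by simp
  refine sum_le_sum fun u _ => ?_
  rw [sum_boole]
  have : #{v ∈ range L | y = y0 + (u : ZMod p) - ((v : ℕ) : ZMod p)} ≤ 1 := by
    rw [card_le_one]
    intro v hv w hw
    simp only [mem_filter, mem_range] at hv hw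
    refine natCast_inj hL hv.1 hw.1 ?_
    have := hv.2.symm.trans hw.2
    linear_combination -this
  exact_mod_cast this
lemma Psi_pos (L : ℕ) (y0 y : ZMod p) (h : Psi p L y0 y ≠ 0) :
    ∃ u < L, ∃ v < L, y = y0 + (u : ℕ) - (v : ℕ) := by
  by_contra! hc
  apply h
  unfold Psi
  rw [sum_eq_zero, zero_div]
  intro u hu
  refine sum_eq_zero fun v hv => ?_
  rw [if_neg (hc u (mem_range.1 hu) v (mem_range.1 hv))]
lemma fourier (L : ℕ) (hL : L ≤ p) (hL1 : 1 ≤ L) (y0 : ZMod p) (X : ℕ → ZMod p) (T : ℕ) (E : ℝ)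
    (hE : ∀ h : ZMod p, h ≠ 0 → ‖∑ t ∈ range T, (ZMod.stdAddChar (h * X t) : ℂ)‖ ≤ E) :
    |∑ t ∈ range T, Psi p L y0 (X t) - T * L / p| ≤ E := by
  have hp0 : (0:ℝ) < p := by exact_mod_cast hp.out.pos
  have hpc : (p:ℂ) ≠ 0 := by exact_mod_cast hp0.ne'
  have hL0 : (0:ℝ) < L := by exact_mod_cast hL1
  have hLc : (L:ℂ) ≠ 0 := by exact_mod_cast hL0.ne'
  let K : ZMod p → ℂ := fun h => ∑ u ∈ range L, ZMod.stdAddChar (h * (u : ZMod p))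
  let S : ZMod p → ℂ := fun h => ∑ t ∈ range T, ZMod.stdAddChar (h * X t)
  have hite : ∀ a b : ZMod p, ((if a = b then (1:ℝ) else 0 : ℝ) : ℂ) =
      (∑ h : ZMod p, ZMod.stdAddChar (h * (a - b))) / p := by
    intro a b
    rw [AddChar.sum_mulShift _ (ZMod.isPrimitive_stdAddChar p)]
    simp only [sub_eq_zero, ZMod.card]
    split_ifs <;> simp [hpc]
  have hKK : ∀ h, K h * conj (K h) = ∑ u ∈ range L, ∑ v ∈ range L,
      ZMod.stdAddChar (h * ((u : ZMod p) - (v : ZMod p))) := by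
    intro h
    simp only [K]
    rw [map_sum, sum_mul_sum]
    refine sum_congr rfl fun u _ => sum_congr rfl fun v _ => ?_
    rw [mul_sub, sub_eq_add_neg, AddChar.map_add_eq_mul, AddChar.map_neg_eq_conj]
  have hmain : ((∑ t ∈ range T, Psi p L y0 (X t) : ℝ) : ℂ) =
      (∑ h, S h * ZMod.stdAddChar (-(h * y0)) * conj (K h * conj (K h))) / (p * L) := by
    have e1 : ∀ t, ((Psi p L y0 (X t) : ℝ) : ℂ) =
        (∑ h, ZMod.stdAddChar (h * X t) * ZMod.stdAddChar (-(h * y0)) *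
          conj (K h * conj (K h))) / (p * L) := by
      intro t
      unfold Psi
      rw [Complex.ofReal_div, Complex.ofReal_natCast, ← div_div]
      congr 1
      push_cast
      simp only [hite, hKK, map_sum, mul_sum]
      rw [eq_div_iff hpc, sum_mul, sum_comm]
      refine sum_congr rfl fun u _ => ?_
      rw [sum_mul, sum_comm]
      refine sum_congr rfl fun v _ => ?_
      rw [div_mul_cancel₀ _ hpc]
      refine sum_congr rfl fun h _ => ?_
      rw [← AddChar.map_neg_eq_conj, ← AddChar.map_add_eq_mul, ← AddChar.map_add_eq_mul]
      congr 1; ring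
    push_cast
    simp only [e1]
    rw [← sum_div, sum_comm]
    congr 1
    refine sum_congr rfl fun h _ => ?_
    rw [← sum_mul, ← sum_mul]
  have hpars : ∑ h, ‖K h‖ ^ 2 = p * L := by
    have : ((∑ h, ‖K h‖ ^ 2 : ℝ) : ℂ) = ((p * L : ℝ) : ℂ) := by
      push_cast
      simp_rw [← Complex.mul_conj', hKK]
      rw [sum_comm]
      have : ∀ u ∈ range L, ∑ h : ZMod p, ∑ v ∈ range L,
          (ZMod.stdAddChar (h * ((u : ZMod p) - (v : ZMod p))) : ℂ) = p := by
        intro u hu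
        rw [sum_comm]
        rw [sum_eq_single_of_mem u hu]
        · simp
        · intro v hv hne
          rw [AddChar.sum_mulShift _ (ZMod.isPrimitive_stdAddChar p), if_neg]
          · simp
          intro h0
          exact hne (natCast_inj hL (mem_range.1 hu) (mem_range.1 hv) (sub_eq_zero.1 h0)).symm
      rw [sum_congr rfl this]
      simp [mul_comm]
    exact_mod_cast this
  have h0 : S 0 * ZMod.stdAddChar (-((0 : ZMod p) * y0)) * conj (K 0 * conj (K 0)) = T * L ^ 2 := by
    simp only [S, K, zero_mul, neg_zero, AddChar.map_zero_eq_one, sum_const, card_range, nsmul_eq_mul, mul_one, map_mul, map_natCast]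
    ring
  have hdiff : ((∑ t ∈ range T, Psi p L y0 (X t) - T * L / p : ℝ) : ℂ) =
      (∑ h ∈ univ.erase (0 : ZMod p),
        S h * ZMod.stdAddChar (-(h * y0)) * conj (K h * conj (K h))) / (p * L) := by
    rw [Complex.ofReal_sub, hmain, ← Finset.add_sum_erase univ _ (mem_univ (0 : ZMod p)), h0]
    push_cast
    rw [add_div, add_sub_assoc, add_sub_left_comm]
    have : (T * L ^ 2 / (p * L) - T * L / p : ℂ) = 0 := by field_simp; ring
    rw [this, add_zero]
  rw [← Real.norm_eq_abs, ← Complex.norm_real, hdiff, norm_div]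
  have hden : ‖(p * L : ℂ)‖ = p * L := by simp
  rw [hden, div_le_iff₀ (by positivity)]
  refine (norm_sum_le _ _).trans ?_
  rw [← hpars, mul_sum]
  have hE0 : 0 ≤ E := (norm_nonneg _).trans (hE 1 one_ne_zero)
  refine (sum_le_sum (g := fun h => E * ‖K h‖ ^ 2) fun h hh => ?_).trans
    (sum_le_sum_of_subset_of_nonneg (subset_univ _) fun h _ _ => by positivity)
  rw [norm_mul, norm_mul, norm_psi, mul_one, RCLike.norm_conj, norm_mul, RCLike.norm_conj, ← sq]
  gcongr
  exact hE h (ne_of_mem_erase hh)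
lemma stdAddChar_sum {ι : Type*} (s : Finset ι) (f : ι → ZMod p) :
    (ZMod.stdAddChar (∑ i ∈ s, f i) : ℂ) = ∏ i ∈ s, ZMod.stdAddChar (f i) := by
  classical
  induction s using Finset.induction_on with
  | empty => simp
  | insert a s ha ih => rw [sum_insert ha, prod_insert ha, AddChar.map_add_eq_mul, ih]
theorem equi (r : ℕ) (g : Fin (r + 1) → ℕ) (hg : ∀ i, (g i : ZMod p) ≠ 0) (G : ℕ)
    (hG : ∀ i, g i ≤ G) (s : Fin (r + 1) → ℤ → ZMod p)
    (hper : ∀ i t v, s i (t + g i * v) = s i t) (κ lam mu : ZMod p) (hκ : κ ≠ 0) (hlam : lam ≠ 0)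
    (η : ℝ) (hη0 : 0 ≤ η) (hη : 2 * (CZ r 0 : ℝ) / p ≤ η ^ 2 ^ (r + 1))
    (L : ℕ) (hL : L ≤ p) (hL1 : 1 ≤ L) (y0 : ZMod p) (d : ℕ) (hd : (d : ZMod p) ≠ 0)
    (t0 : ℤ) (T : ℕ) :
    |∑ t ∈ range T, Psi p L y0 (κ * (lam * ((t0 + d * t : ℤ) : ZMod p) + mu)⁻¹ +
      ∑ i, s i (t0 + d * t)) - T * L / p| ≤ T * η + 2 * (r + 1) * p * G := by
  refine fourier L hL hL1 y0 _ T _ fun h hh => ?_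
  have := expsum r g hg G hG (fun i t => ZMod.stdAddChar (h * s i (t0 + d * t)))
    (fun i t => (norm_psi _).le) (fun i t v => by
      rw [show t0 + d * (t + g i * v) = t0 + d * t + g i * (d * v) by ring, hper])
    (h * κ) (lam * d) (lam * t0 + mu) (mul_ne_zero hh hκ) (mul_ne_zero hlam hd) η hη0 hη T
  convert this using 3 with t
  rw [mul_add, AddChar.map_add_eq_mul, mul_sum, stdAddChar_sum]
  congr 2
  push_cast
  rw [show lam * d * t + (lam * t0 + mu) = lam * ((t0 : ZMod p) + d * t) + mu by ring]
  ring
end GB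

set_option linter.unusedSectionVars false
namespace ME
open Finset Filter Topology Nat
lemma theta_le (n : ℕ) : ∑ p ∈ primesLE n, Real.log p ≤ 2 * n := by
  have := Chebyshev.theta_le_log4_mul_x (x := (n:ℝ)) (by positivity)
  rw [Chebyshev.theta_eq_sum_primesLE_log] at this
  have h4 : Real.log 4 ≤ 2 := by
    have : Real.log 4 = 2 * Real.log 2 := by
      rw [show (4:ℝ) = 2 ^ 2 by norm_num, Real.log_pow]; norm_num
    rw [this]; linarith [Real.log_two_lt_d9]
  exact this.trans (by gcongr)
lemma mertens_le (n : ℕ) (hn : 1 ≤ n) :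
    ∑ p ∈ primesLE n, Real.log p / p ≤ Real.log n + 2 := by
  have hn0 : (0:ℝ) < n := by exact_mod_cast hn
  have h1 : ∑ p ∈ primesLE n, ((n / p : ℕ) : ℝ) * Real.log p ≤ Real.log (n ! : ℕ) := by
    have hd : ∏ p ∈ primesLE n, p ^ (n / p) ∣ n ! := by
      refine Finset.prod_dvd_of_isRelPrime ?_ ?_
      · intro i hi j hj hij
        refine Nat.coprime_iff_isRelPrime.1 (Nat.Coprime.pow _ _
          ((Nat.coprime_primes (prime_of_mem_primesLE hi) (prime_of_mem_primesLE hj)).2 hij))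
      · intro p hp
        have hp' := prime_of_mem_primesLE hp
        have hfac := hp'.pow_dvd_factorial_iff (n := n) (r := n / p) (b := n + 1)
          (Nat.lt_succ_of_le (Nat.log_le_self _ _))
        rw [hfac]
        have : (1:ℕ) ∈ Finset.Ico 1 (n + 1) := by simp; omega
        calc n / p = n / p ^ 1 := by simp
          _ ≤ _ := Finset.single_le_sum (f := fun i => n / p ^ i) (fun i _ => Nat.zero_le _) this
    have hle := Nat.le_of_dvd (Nat.factorial_pos n) hd
    have h2 : Real.log ((∏ p ∈ primesLE n, p ^ (n / p) : ℕ) : ℝ) ≤ Real.log (n ! : ℕ) := by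
      apply Real.log_le_log
      · exact_mod_cast Finset.prod_pos fun p hp => pow_pos (prime_of_mem_primesLE hp).pos _
      · exact_mod_cast hle
    refine le_trans (le_of_eq ?_) h2
    rw [Nat.cast_prod, Real.log_prod]
    · refine sum_congr rfl fun p _ => ?_
      push_cast; rw [Real.log_pow]
    · intro p hp
      exact_mod_cast (pow_pos (prime_of_mem_primesLE hp).pos _).ne'
  have h3 : Real.log (n ! : ℕ) ≤ n * Real.log n := by
    rw [← Real.log_pow]
    apply Real.log_le_log (by exact_mod_cast Nat.factorial_pos n)
    exact_mod_cast Nat.factorial_le_pow n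
  have h4 : ∑ p ∈ primesLE n, (n * (Real.log p / p) - Real.log p) ≤
      ∑ p ∈ primesLE n, ((n / p : ℕ) : ℝ) * Real.log p := by
    refine sum_le_sum fun p hp => ?_
    have hp0 : (0:ℝ) < p := by exact_mod_cast (prime_of_mem_primesLE hp).pos
    have h5 : (n:ℝ) / p - 1 ≤ (n / p : ℕ) := by
      have := Nat.lt_div_mul_add (a := n) (prime_of_mem_primesLE hp).pos
      have h6 : (n:ℝ) < (n / p : ℕ) * p + p := by exact_mod_cast this
      rw [sub_le_iff_le_add, div_le_iff₀ hp0]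
      nlinarith
    have hl : 0 ≤ Real.log p := Real.log_natCast_nonneg p
    calc _ = ((n:ℝ) / p - 1) * Real.log p := by field_simp
      _ ≤ _ := by gcongr
  rw [sum_sub_distrib, ← mul_sum] at h4
  have h5 := theta_le n
  have : (n:ℝ) * ∑ p ∈ primesLE n, Real.log p / p ≤ n * (Real.log n + 2) := by nlinarith
  exact le_of_mul_le_mul_left this hn0
lemma E1_aux (a : ℕ → ℕ) (ha : ∀ p, p.Prime → a p ≤ 3) (A : ℝ → ℝ) (κ : ℝ) (hκ : 0 < κ)
    (hA : Tendsto (fun y => A y / y) atTop (𝓝 κ)) (C : ℝ) (hC : 0 ≤ C)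
    (hA0 : ∀ y, 0 ≤ A y) (hAC : ∀ y, 0 < y → A y ≤ C * y) (S : ℕ → ℝ)
    (hS1 : ∀ n : ℕ, 1 ≤ n → S n ≤ A n * Real.log n) (hS2 : ∀ n : ℕ, 1 ≤ n → A n * Real.log n - C * n ≤ S n)
    (hS3 : ∀ n : ℕ, 1 ≤ n → ∑ p ∈ primesLE n, a p * Real.log p * A (n / p) ≤ S n)
    (hS4 : ∀ n : ℕ, 1 ≤ n → S n ≤ ∑ p ∈ primesLE n, a p * Real.log p * A (n / p) + C * n) :
    Tendsto (fun n : ℕ => (∑ p ∈ primesLE n, a p * Real.log p / p) / Real.log n) atTop (𝓝 1) := by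
  have key : ∀ ε > 0, ∀ᶠ n : ℕ in atTop,
      |κ * (∑ p ∈ primesLE n, a p * Real.log p / p) - κ * Real.log n| ≤ ε * Real.log n := by
    intro ε hε
    set ε' := ε / 16 with hε'
    have hε'0 : 0 < ε' := by positivity
    have h1 := hA.eventually (Metric.closedBall_mem_nhds κ hε'0)
    obtain ⟨Y, hY⟩ := eventually_atTop.1 h1
    set Y' := max Y 1 with hY'
    have hY'1 : 1 ≤ Y' := le_max_right _ _
    have hlog : ∀ᶠ n : ℕ in atTop, (6 + 2 * C + 3 * (C + κ) * (2 * Y') / ε' ) ≤ Real.log n :=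
      (Real.tendsto_log_atTop.comp tendsto_natCast_atTop_atTop).eventually_ge_atTop _
    have hlog2 : ∀ᶠ n : ℕ in atTop, (2 * C + 3 * (C + κ) * (2 * Y')) / ε' ≤ Real.log n :=
      (Real.tendsto_log_atTop.comp tendsto_natCast_atTop_atTop).eventually_ge_atTop _
    have hAn := (hA.comp tendsto_natCast_atTop_atTop).eventually (Metric.closedBall_mem_nhds κ hε'0)
    filter_upwards [hlog, hlog2, hAn, eventually_ge_atTop 1] with n hl1 hl2 han hn
    have hn0 : (0:ℝ) < n := by exact_mod_cast hn
    have hl0 : 6 ≤ Real.log n := by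
      have : 0 ≤ 3 * (C + κ) * (2 * Y') / ε' := by positivity
      linarith
    simp only [Function.comp, Metric.mem_closedBall, Real.dist_eq] at han
    have hm := mertens_le n hn
    have hterm : ∀ p ∈ primesLE n, |a p * Real.log p * A (n / p) / n - κ * (a p * Real.log p / p)| ≤
        3 * ε' * (Real.log p / p) + 3 * (C + κ) * (Y' / n) * Real.log p := by
      intro p hp
      have hp0 : (0:ℝ) < p := by exact_mod_cast (prime_of_mem_primesLE hp).pos
      have hlp : 0 ≤ Real.log p := Real.log_natCast_nonneg p
      have hap : (a p : ℝ) ≤ 3 := by exact_mod_cast ha p (prime_of_mem_primesLE hp)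
      have e : a p * Real.log p * A (n / p) / n - κ * (a p * Real.log p / p) =
          a p * (Real.log p / p) * (A (n / p) / (n / p) - κ) := by field_simp
      rw [e, abs_mul, abs_of_nonneg (by positivity : 0 ≤ a p * (Real.log p / p))]
      by_cases hy : Y' ≤ n / p
      · have := hY (n / p) ((le_max_left _ _).trans hy)
        simp only [Metric.mem_closedBall, Real.dist_eq] at this
        calc a p * (Real.log p / p) * |A (n / p) / (n / p) - κ| ≤ 3 * (Real.log p / p) * ε' := by
              gcongr
          _ ≤ _ := by
            have : 0 ≤ 3 * (C + κ) * (Y' / n) * Real.log p := by positivity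
            linarith
      · push Not at hy
        have h2 : |A (n / p) / (n / p) - κ| ≤ C + κ := by
          have hq : (0:ℝ) < n / p := by positivity
          have h3 : A (n / p) / (n / p) ≤ C := by rw [div_le_iff₀ hq]; exact hAC _ hq
          have h4 : 0 ≤ A (n / p) / (n / p) := div_nonneg (hA0 _) hq.le
          rw [abs_le]; constructor <;> linarith
        have h5 : (1:ℝ) / p ≤ Y' / n := by
          rw [div_lt_iff₀ hp0] at hy
          rw [div_le_div_iff₀ hp0 hn0]; linarith
        calc a p * (Real.log p / p) * |A (n / p) / (n / p) - κ|
            ≤ 3 * (Real.log p * (Y' / n)) * (C + κ) := by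
              have : Real.log p / p ≤ Real.log p * (Y' / n) := by
                rw [div_eq_mul_one_div]; gcongr
              gcongr
          _ ≤ _ := by
            have : 0 ≤ 3 * ε' * (Real.log p / p) := by positivity
            linarith
    have hsum : |(∑ p ∈ primesLE n, a p * Real.log p * A (n / p)) / n -
        κ * ∑ p ∈ primesLE n, a p * Real.log p / p| ≤
        3 * ε' * (Real.log n + 2) + 3 * (C + κ) * (2 * Y') := by
      rw [sum_div, mul_sum, ← sum_sub_distrib]
      refine (abs_sum_le_sum_abs _ _).trans ((sum_le_sum hterm).trans ?_)
      rw [sum_add_distrib, ← mul_sum, ← mul_sum]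
      have h1 : 3 * (C + κ) * (Y' / n) * ∑ p ∈ primesLE n, Real.log p ≤
          3 * (C + κ) * (Y' / n) * (2 * n) := by
        have := theta_le n
        gcongr
      have h2 : 3 * (C + κ) * (Y' / n) * (2 * n) = 3 * (C + κ) * (2 * Y') := by field_simp
      have h3 : 3 * ε' * ∑ p ∈ primesLE n, Real.log p / p ≤ 3 * ε' * (Real.log n + 2) := by gcongr
      linarith
    set S1 := ∑ p ∈ primesLE n, a p * Real.log p / p
    set S2 := (∑ p ∈ primesLE n, a p * Real.log p * A (n / p)) with hs2
    have b1 := hS1 n hn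
    have b2 := hS2 n hn
    have b3 := hS3 n hn
    have b4 := hS4 n hn
    have c1 : S2 / n ≤ A n / n * Real.log n := by
      rw [div_mul_eq_mul_div]; gcongr; linarith
    have c2 : A n / n * Real.log n - 2 * C ≤ S2 / n := by
      rw [le_div_iff₀ hn0]
      have : (A n / n * Real.log n - 2 * C) * n = A n * Real.log n - 2 * C * n := by field_simp
      linarith
    have hl2' : 2 * C + 3 * (C + κ) * (2 * Y') ≤ ε' * Real.log n := by
      rw [div_le_iff₀ hε'0] at hl2; linarith
    rw [abs_le] at han hsum ⊢
    have d1 : A n / n * Real.log n ≤ (κ + ε') * Real.log n := by gcongr; linarith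
    have d2 : (κ - ε') * Real.log n ≤ A n / n * Real.log n := by gcongr; linarith
    have e1 : 0 ≤ 3 * (C + κ) * (2 * Y') := by positivity
    have e2 : ε' * 6 ≤ ε' * Real.log n := by gcongr
    have : ε * Real.log n = 16 * (ε' * Real.log n) := by rw [hε']; ring
    constructor <;> nlinarith
  rw [Metric.tendsto_nhds]
  intro ε hε
  filter_upwards [key (κ * (ε / 2)) (by positivity),
    (Real.tendsto_log_atTop.comp tendsto_natCast_atTop_atTop).eventually_ge_atTop 1] with n hn hl
  simp only [Function.comp] at hl
  rw [Real.dist_eq]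
  have hl0 : 0 < Real.log n := by linarith
  rw [← mul_sub, abs_mul, abs_of_pos hκ, mul_assoc] at hn
  have h2 := le_of_mul_le_mul_left hn hκ
  have e : (∑ p ∈ primesLE n, a p * Real.log p / p) / Real.log n - 1 =
    (∑ p ∈ primesLE n, a p * Real.log p / p - Real.log n) / Real.log n := by field_simp
  rw [e, abs_div, abs_of_pos hl0, div_lt_iff₀ hl0]
  nlinarith
end ME

set_option linter.unusedSectionVars false
namespace SV
open Finset
noncomputable def es (P : Finset ℕ) (x : ℕ → ℝ) (j : ℕ) : ℝ := ∑ S ∈ P.powersetCard j, ∏ l ∈ S, x l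
lemma es_zero (P : Finset ℕ) (x : ℕ → ℝ) : es P x 0 = 1 := by simp [es]
lemma es_nonneg (P : Finset ℕ) (x : ℕ → ℝ) (hx : ∀ l ∈ P, 0 ≤ x l) (j : ℕ) : 0 ≤ es P x j :=
  sum_nonneg fun S hS => prod_nonneg fun l hl => hx l ((mem_powersetCard.1 hS).1 hl)
lemma es_insert {P : Finset ℕ} {a : ℕ} (ha : a ∉ P) (x : ℕ → ℝ) (j : ℕ) :
    es (insert a P) x (j + 1) = es P x (j + 1) + x a * es P x j := by
  unfold es
  rw [powersetCard_succ_insert ha, sum_union, sum_image, mul_sum]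
  · congr 1
    refine sum_congr rfl fun S hS => ?_
    rw [prod_insert]
    exact fun h => ha ((mem_powersetCard.1 hS).1 h)
  · intro S hS S' hS' h
    have h1 : a ∉ S := fun h => ha ((mem_powersetCard.1 hS).1 h)
    have h2 : a ∉ S' := fun h => ha ((mem_powersetCard.1 hS').1 h)
    rw [← erase_insert h1, ← erase_insert h2, h]
  · rw [disjoint_left]
    intro S hS hS'
    obtain ⟨S', _, rfl⟩ := mem_image.1 hS'
    exact ha ((mem_powersetCard.1 hS).1 (mem_insert_self a S'))
noncomputable def Tr (P : Finset ℕ) (x : ℕ → ℝ) (k : ℕ) : ℝ := ∑ j ∈ range (k + 1), (-1) ^ j * es P x j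
lemma Tr_insert {P : Finset ℕ} {a : ℕ} (ha : a ∉ P) (x : ℕ → ℝ) (k : ℕ) :
    Tr (insert a P) x (k + 1) = Tr P x (k + 1) - x a * Tr P x k := by
  unfold Tr
  rw [sum_range_succ', sum_range_succ' (fun j => (-1) ^ j * es P x j) (k + 1), mul_sum]
  simp only [es_insert ha, es_zero]
  rw [add_sub_right_comm, ← sum_sub_distrib]
  congr 1
  refine sum_congr rfl fun j _ => ?_
  ring
lemma bonf (P : Finset ℕ) (x : ℕ → ℝ) (hx : ∀ l ∈ P, 0 ≤ x l ∧ x l ≤ 1) : ∀ k,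
    0 ≤ (-1) ^ k * (Tr P x k - ∏ l ∈ P, (1 - x l)) ∧
    (-1) ^ k * (Tr P x k - ∏ l ∈ P, (1 - x l)) ≤ es P x (k + 1) := by
  induction P using Finset.induction_on with
  | empty =>
    intro k
    have h0 : ∀ j, es ∅ x (j + 1) = 0 := by
      intro j; unfold es; rw [powersetCard_eq_empty.2 (by simp)]; simp
    have : Tr ∅ x k = 1 := by
      unfold Tr; rw [sum_range_succ']; simp [h0, es_zero]
    simp [this, h0]
  | insert a P ha ih =>
    intro k
    have ih' := ih fun l hl => hx l (mem_insert_of_mem hl)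
    have hxa := hx a (mem_insert_self _ _)
    rw [prod_insert ha, es_insert ha]
    have hP0 : 0 ≤ ∏ l ∈ P, (1 - x l) := prod_nonneg fun l hl => by
      linarith [(hx l (mem_insert_of_mem hl)).2]
    have hP1 : ∏ l ∈ P, (1 - x l) ≤ 1 := prod_le_one (fun l hl => by
      linarith [(hx l (mem_insert_of_mem hl)).2]) (fun l hl => by
      linarith [(hx l (mem_insert_of_mem hl)).1])
    cases k with
    | zero =>
      have h1 := ih' 0
      have e0 : ∀ Q, Tr Q x 0 = 1 := fun Q => by simp [Tr, es_zero]
      rw [e0, pow_zero, one_mul] at h1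
      rw [e0, pow_zero, one_mul, es_zero]
      constructor <;> nlinarith [h1.1, h1.2]
    | succ k =>
      have h1 := ih' (k + 1)
      have h2 := ih' k
      rw [Tr_insert ha]
      have e : (-1 : ℝ) ^ (k + 1) * (Tr P x (k + 1) - x a * Tr P x k - (1 - x a) * ∏ l ∈ P, (1 - x l)) =
        (-1) ^ (k + 1) * (Tr P x (k + 1) - ∏ l ∈ P, (1 - x l)) +
          x a * ((-1) ^ k * (Tr P x k - ∏ l ∈ P, (1 - x l))) := by ring
      rw [e]
      have h3 := mul_nonneg hxa.1 h2.1
      have h4 := mul_le_mul_of_nonneg_left h2.2 hxa.1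
      constructor <;> linarith [h1.1, h1.2]
noncomputable def lf (P : Finset ℕ) (m : ℕ) (c : Finset ℕ → ℝ) (x : ℕ → ℝ) : ℝ :=
  ∑ S ∈ P.powerset with #S ≤ m, c S * ∏ l ∈ S, x l
noncomputable def cU (k : ℕ) (S : Finset ℕ) : ℝ := if #S ≤ k then (-1) ^ #S else 0
noncomputable def cR (k : ℕ) (S : Finset ℕ) : ℝ := if #S = k + 1 then 1 else 0
lemma lf_U (P : Finset ℕ) (k : ℕ) (x : ℕ → ℝ) : lf P (k + 1) (cU k) x = Tr P x k := by
  unfold lf Tr es cU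
  simp only [ite_mul, zero_mul]
  rw [← sum_filter, filter_filter]
  have h : ∀ S ∈ {a ∈ P.powerset | #a ≤ k + 1 ∧ #a ≤ k}, #S ∈ range (k + 1) := by
    intro S hS; rw [mem_filter] at hS; rw [mem_range]; omega
  rw [← sum_fiberwise_of_maps_to h]
  refine sum_congr rfl fun j hj => ?_
  rw [mem_range] at hj
  rw [mul_sum, filter_filter]
  refine sum_congr ?_ fun S hS => ?_
  · ext S
    rw [mem_filter, mem_powerset, mem_powersetCard]
    constructor
    · rintro ⟨h1, _, h3⟩; exact ⟨h1, h3⟩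
    · rintro ⟨h1, h3⟩; exact ⟨h1, by omega, h3⟩
  · rw [(mem_powersetCard.1 hS).2]
lemma lf_R (P : Finset ℕ) (k : ℕ) (x : ℕ → ℝ) : lf P (k + 1) (cR k) x = es P x (k + 1) := by
  unfold lf es cR
  simp only [ite_mul, zero_mul, one_mul]
  rw [← sum_filter, filter_filter]
  refine sum_congr ?_ fun _ _ => rfl
  ext S
  rw [mem_filter, mem_powerset, mem_powersetCard]
  constructor
  · rintro ⟨h1, _, h3⟩; exact ⟨h1, h3⟩
  · rintro ⟨h1, h3⟩; exact ⟨h1, by omega, h3⟩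
section
variable {ι : Type*} (τ : Finset ι) (w : ι → ℝ) (χ : ℕ → ι → ℝ) (h : ℕ → ℝ) (X E : ℝ) {J : ℕ}
  (P : Fin J → Finset ℕ)
lemma level (m : Fin J → ℕ) (hlev : ∀ S : Fin J → Finset ℕ, (∀ j, S j ⊆ P j) →
      |∑ t ∈ τ, w t * ∏ j, ∏ l ∈ S j, χ l t - X * ∏ j, ∏ l ∈ S j, h l| ≤ E * ∏ j, 3 ^ #(S j))
    (c : Fin J → Finset ℕ → ℝ) (hc : ∀ j S, |c j S| ≤ 1) :
    |∑ t ∈ τ, w t * ∏ j, lf (P j) (m j) (c j) (fun l => χ l t) - X * ∏ j, lf (P j) (m j) (c j) h| ≤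
      E * ∏ j, ∑ S ∈ (P j).powerset with #S ≤ m j, (3:ℝ) ^ #S := by
  classical
  unfold lf
  simp only [prod_univ_sum, prod_mul_distrib, mul_sum]
  rw [sum_comm, ← sum_sub_distrib]
  refine (abs_sum_le_sum_abs _ _).trans (sum_le_sum fun S hS => ?_)
  rw [Fintype.mem_piFinset] at hS
  have h1 := hlev S fun j => mem_powerset.1 (mem_filter.1 (hS j)).1
  have e : ∑ t ∈ τ, w t * ((∏ j, c j (S j)) * ∏ j, ∏ l ∈ S j, χ l t) -
      X * ((∏ j, c j (S j)) * ∏ j, ∏ l ∈ S j, h l) = (∏ j, c j (S j)) *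
      (∑ t ∈ τ, w t * ∏ j, ∏ l ∈ S j, χ l t - X * ∏ j, ∏ l ∈ S j, h l) := by
    rw [mul_sub, mul_sum]
    congr 1
    · refine sum_congr rfl fun t _ => ?_
      ring
    · ring
  rw [e, abs_mul, abs_prod]
  have h2 : ∏ j, |c j (S j)| ≤ 1 := prod_le_one (fun _ _ => abs_nonneg _) (fun j _ => hc j _)
  have h3 : 0 ≤ ∏ j, |c j (S j)| := prod_nonneg fun _ _ => abs_nonneg _
  calc _ ≤ 1 * |∑ t ∈ τ, w t * ∏ j, ∏ l ∈ S j, χ l t - X * ∏ j, ∏ l ∈ S j, h l| := by gcongr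
    _ ≤ _ := by rw [one_mul]; exact h1
lemma prod_diff {s : Finset (Fin J)} (x y : Fin J → ℝ) (hx : ∀ j, 0 ≤ x j) (hxy : ∀ j, x j ≤ y j) :
    ∏ j ∈ s, y j - ∑ j ∈ s, (y j - x j) * ∏ i ∈ s.erase j, y i ≤ ∏ j ∈ s, x j := by
  classical
  induction s using Finset.induction_on with
  | empty => simp
  | insert a s ha ih =>
    rw [prod_insert ha, prod_insert ha, sum_insert ha, erase_insert ha]
    have h1 : ∑ j ∈ s, (y j - x j) * ∏ i ∈ (insert a s).erase j, y i =
        y a * ∑ j ∈ s, (y j - x j) * ∏ i ∈ s.erase j, y i := by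
      rw [mul_sum]
      refine sum_congr rfl fun j hj => ?_
      have hne : a ≠ j := fun h => ha (h ▸ hj)
      rw [erase_insert_of_ne hne, prod_insert (fun h => ha (mem_of_mem_erase h))]
      ring
    rw [h1]
    have hs : ∏ j ∈ s, x j ≤ ∏ j ∈ s, y j := prod_le_prod (fun j _ => hx j) (fun j _ => hxy j)
    have := mul_le_mul_of_nonneg_left ih ((hx a).trans (hxy a))
    nlinarith [hxy a, hx a]
lemma hooley (k : Fin J → ℕ) (hk : ∀ j, Even (k j)) (hw : ∀ t ∈ τ, 0 ≤ w t)
    (hχ : ∀ l t, 0 ≤ χ l t ∧ χ l t ≤ 1) (hX : 0 ≤ X)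
    (hlev : ∀ S : Fin J → Finset ℕ, (∀ j, S j ⊆ P j) →
      |∑ t ∈ τ, w t * ∏ j, ∏ l ∈ S j, χ l t - X * ∏ j, ∏ l ∈ S j, h l| ≤ E * ∏ j, 3 ^ #(S j))
    (hh : ∀ j, ∀ l ∈ P j, 0 ≤ h l ∧ h l ≤ 1) (hV : ∀ j, 0 < ∏ l ∈ P j, (1 - h l))
    (hR : ∑ j, es (P j) h (k j + 1) / ∏ l ∈ P j, (1 - h l) ≤ 1 / 2) :
    X / 2 * ∏ j, ∏ l ∈ P j, (1 - h l) -
      (J + 1) * (E * ∏ j, ∑ S ∈ (P j).powerset with #S ≤ k j + 1, (3:ℝ) ^ #S) ≤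
      ∑ t ∈ τ, w t * ∏ j, ∏ l ∈ P j, (1 - χ l t) := by
  classical
  set B := E * ∏ j, ∑ S ∈ (P j).powerset with #S ≤ k j + 1, (3:ℝ) ^ #S with hB
  let cj : Fin J → Fin J → Finset ℕ → ℝ := fun j i => if i = j then cR (k i) else cU (k i)
  have hcU : ∀ k S, |cU k S| ≤ 1 := by
    intro k S; unfold cU; split_ifs <;> simp
  have hcR : ∀ k S, |cR k S| ≤ 1 := by
    intro k S; unfold cR; split_ifs <;> simp
  have L0 := level τ w χ h X E P (fun j => k j + 1) hlev (fun i => cU (k i)) (fun j S => hcU _ _)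
  have L1 := fun j => level τ w χ h X E P (fun j => k j + 1) hlev (cj j) (fun i S => by
    simp only [cj]; split_ifs
    · exact hcR _ _
    · exact hcU _ _)
  simp only [lf_U] at L0
  have hprod : ∀ j (x : ℕ → ℝ), ∏ i, lf (P i) (k i + 1) (cj j i) x =
      es (P j) x (k j + 1) * ∏ i ∈ univ.erase j, Tr (P i) x (k i) := by
    intro j x
    rw [← mul_prod_erase univ _ (mem_univ j)]
    simp only [cj, if_true, lf_R]
    congr 1
    refine prod_congr rfl fun i hi => ?_
    rw [if_neg (ne_of_mem_erase hi), lf_U]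
  simp only [hprod] at L1
  have hb : ∀ j (x : ℕ → ℝ), (∀ l ∈ P j, 0 ≤ x l ∧ x l ≤ 1) → ∏ l ∈ P j, (1 - x l) ≤ Tr (P j) x (k j) ∧
      Tr (P j) x (k j) - ∏ l ∈ P j, (1 - x l) ≤ es (P j) x (k j + 1) := by
    intro j x hx
    have := bonf (P j) x hx (k j)
    rw [(hk j).neg_one_pow, one_mul] at this
    constructor <;> linarith [this.1, this.2]
  have pt : ∀ t ∈ τ, w t * ∏ j, Tr (P j) (fun l => χ l t) (k j) -
      ∑ j, w t * (es (P j) (fun l => χ l t) (k j + 1) * ∏ i ∈ univ.erase j, Tr (P i) (fun l => χ l t) (k i)) ≤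
      w t * ∏ j, ∏ l ∈ P j, (1 - χ l t) := by
    intro t ht
    have hx0 : ∀ j, 0 ≤ ∏ l ∈ P j, (1 - χ l t) := fun j => prod_nonneg fun l _ => by linarith [(hχ l t).2]
    have hbt := fun j => hb j (fun l => χ l t) (fun l _ => hχ l t)
    have h1 := prod_diff (s := univ) (fun j => ∏ l ∈ P j, (1 - χ l t)) (fun j => Tr (P j) (fun l => χ l t) (k j))
      hx0 (fun j => (hbt j).1)
    rw [← mul_sum, ← mul_sub]
    refine mul_le_mul_of_nonneg_left (le_trans ?_ h1) (hw t ht)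
    refine sub_le_sub_left (sum_le_sum fun j _ => ?_) _
    refine mul_le_mul_of_nonneg_right (hbt j).2 (prod_nonneg fun i _ => ?_)
    exact (hx0 i).trans (hbt i).1
  have h1 := sum_le_sum pt
  rw [sum_sub_distrib, sum_comm] at h1
  have h2 : ∑ j, ∑ t ∈ τ, w t * (es (P j) (fun l => χ l t) (k j + 1) * ∏ i ∈ univ.erase j, Tr (P i) (fun l => χ l t) (k i)) ≤
      ∑ j, (X * (es (P j) h (k j + 1) * ∏ i ∈ univ.erase j, Tr (P i) h (k i)) + B) :=
    sum_le_sum fun j _ => by have := (abs_le.1 (L1 j)).2; linarith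
  rw [sum_add_distrib, sum_const, card_univ, Fintype.card_fin, nsmul_eq_mul] at h2
  have h3 := (abs_le.1 L0).1
  have hbt := fun j => hb j h (hh j)
  set V := ∏ j, ∏ l ∈ P j, (1 - h l)
  set U := ∏ j, Tr (P j) h (k j) with hU
  have hVU : V ≤ U := prod_le_prod (fun j _ => (hV j).le) (fun j _ => (hbt j).1)
  have hU0 : 0 ≤ U := (prod_nonneg fun j _ => (hV j).le).trans hVU
  have h4 : ∑ j, X * (es (P j) h (k j + 1) * ∏ i ∈ univ.erase j, Tr (P i) h (k i)) ≤ X * U * (1 / 2) := by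
    refine le_trans (sum_le_sum (g := fun j => X * U * (es (P j) h (k j + 1) / ∏ l ∈ P j, (1 - h l))) fun j _ => ?_) ?_
    · have e : U = Tr (P j) h (k j) * ∏ i ∈ univ.erase j, Tr (P i) h (k i) :=
        (mul_prod_erase univ _ (mem_univ j)).symm
      rw [mul_assoc, e]
      refine mul_le_mul_of_nonneg_left ?_ hX
      rw [mul_div_assoc', le_div_iff₀ (hV j)]
      have p1 : 0 ≤ es (P j) h (k j + 1) := es_nonneg _ _ (fun l hl => (hh j l hl).1) _
      have p2 : 0 ≤ ∏ i ∈ univ.erase j, Tr (P i) h (k i) := prod_nonneg fun i _ => (hV i).le.trans (hbt i).1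
      have := mul_le_mul_of_nonneg_left (hbt j).1 (mul_nonneg p1 p2)
      linarith
    · rw [← mul_sum]
      exact mul_le_mul_of_nonneg_left hR (mul_nonneg hX hU0)
  have h5 := mul_le_mul_of_nonneg_left hVU hX
  linarith
end
lemma es_le (P : Finset ℕ) (x : ℕ → ℝ) (hx : ∀ l ∈ P, 0 ≤ x l) (s : ℝ) (hs : ∑ l ∈ P, x l ≤ s) (m : ℕ) :
    es P x m ≤ Real.exp (4 * s) / 4 ^ m := by
  rw [le_div_iff₀ (by positivity)]
  have h1 : es P x m * 4 ^ m ≤ ∏ l ∈ P, (1 + 4 * x l) := by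
    rw [prod_one_add]
    unfold es
    rw [sum_mul]
    refine le_trans (le_of_eq (sum_congr rfl fun S hS => ?_)) (sum_le_sum_of_subset_of_nonneg
      (s := P.powersetCard m) (f := fun S => ∏ l ∈ S, 4 * x l) ?_ ?_)
    · rw [prod_mul_distrib, prod_const, (mem_powersetCard.1 hS).2, mul_comm]
    · intro S hS; exact mem_powerset.2 (mem_powersetCard.1 hS).1
    · intro S hS _
      exact prod_nonneg fun l hl => mul_nonneg (by norm_num) (hx l (mem_powerset.1 hS hl))
  refine h1.trans ?_
  calc ∏ l ∈ P, (1 + 4 * x l) ≤ ∏ l ∈ P, Real.exp (4 * x l) :=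
        prod_le_prod (fun l hl => by have := hx l hl; positivity)
          (fun l _ => by linarith [Real.add_one_le_exp (4 * x l)])
    _ = Real.exp (4 * ∑ l ∈ P, x l) := by rw [← Real.exp_sum, mul_sum]
    _ ≤ _ := by gcongr
lemma V_ge (P : Finset ℕ) (x : ℕ → ℝ) (hx : ∀ l ∈ P, 0 ≤ x l ∧ x l ≤ 1 / 2) :
    Real.exp (-(2 * ∑ l ∈ P, x l)) ≤ ∏ l ∈ P, (1 - x l) := by
  rw [mul_sum, ← sum_neg_distrib, Real.exp_sum]
  refine prod_le_prod (fun l _ => (Real.exp_pos _).le) fun l hl => ?_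
  obtain ⟨h0, h1⟩ := hx l hl
  rw [Real.exp_neg, inv_le_comm₀ (Real.exp_pos _) (by linarith)]
  refine le_trans ?_ (Real.add_one_le_exp _)
  rw [inv_le_iff_one_le_mul₀ (by linarith)]
  nlinarith
lemma B_le (P : Finset ℕ) (m y : ℕ) (hP : 3 * #P + 1 ≤ y ^ 2) :
    ∑ S ∈ P.powerset with #S ≤ m, (3:ℝ) ^ #S ≤ (y:ℝ) ^ (2 * m) := by
  have h : ∀ S ∈ P.powerset.filter (fun S => #S ≤ m), #S ∈ range (m + 1) := by
    intro S hS; rw [mem_filter] at hS; rw [mem_range]; omega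
  rw [← sum_fiberwise_of_maps_to h]
  have h1 : ∀ j ∈ range (m + 1), ∑ S ∈ (P.powerset.filter (fun S => #S ≤ m)).filter (fun S => #S = j), (3:ℝ) ^ #S ≤
      m.choose j * (3 * #P : ℝ) ^ j := by
    intro j hj
    have e : ((P.powerset.filter (fun S => #S ≤ m)).filter (fun S => #S = j)) ⊆ P.powersetCard j := by
      intro S hS
      rw [mem_filter, mem_filter, mem_powerset] at hS
      exact mem_powersetCard.2 ⟨hS.1.1, hS.2⟩
    refine (sum_le_sum_of_subset_of_nonneg e (fun _ _ _ => by positivity)).trans ?_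
    rw [sum_congr rfl (g := fun _ => (3:ℝ) ^ j) (fun S hS => by rw [(mem_powersetCard.1 hS).2]), sum_const,
      card_powersetCard, nsmul_eq_mul, mul_pow, mul_comm]
    have h2 : ((#P).choose j : ℝ) ≤ (#P : ℝ) ^ j := by exact_mod_cast Nat.choose_le_pow _ _
    have h3 : (1:ℝ) ≤ m.choose j := by
      exact_mod_cast Nat.choose_pos (by rw [mem_range] at hj; omega)
    calc (3:ℝ) ^ j * (#P).choose j ≤ 3 ^ j * #P ^ j := by gcongr
      _ ≤ _ := le_mul_of_one_le_left (by positivity) h3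
  refine (sum_le_sum h1).trans ?_
  have h2 : ∑ j ∈ range (m + 1), (m.choose j : ℝ) * (3 * #P : ℝ) ^ j = (3 * #P + 1) ^ m := by
    rw [add_pow]
    refine sum_congr rfl fun j _ => ?_
    rw [one_pow]; ring
  rw [h2, pow_mul]
  gcongr
  exact_mod_cast hP
lemma expo_le (K0 : ℕ) : ∀ J, ∑ i ∈ range J, 2 ^ (i + 2) * (K0 + 1 + 2 * (J - 1 - i)) ≤ 2 ^ J * (4 * K0 + 12) := by
  have hg : ∀ J, ∑ i ∈ range J, 2 ^ (i + 2) ≤ 4 * 2 ^ J := by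
    intro J
    induction J with
    | zero => simp
    | succ J ih => rw [sum_range_succ]; have : 2 ^ (J + 2) = 4 * 2 ^ J := by ring
                   have : 2 ^ (J + 1) = 2 * 2 ^ J := by ring
                   omega
  intro J
  induction J with
  | zero => simp
  | succ J ih =>
    rw [sum_range_succ]
    have e : ∑ i ∈ range J, 2 ^ (i + 2) * (K0 + 1 + 2 * (J + 1 - 1 - i)) =
        ∑ i ∈ range J, 2 ^ (i + 2) * (K0 + 1 + 2 * (J - 1 - i)) + 2 * ∑ i ∈ range J, 2 ^ (i + 2) := by
      rw [mul_sum, ← sum_add_distrib]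
      refine sum_congr rfl fun i hi => ?_
      rw [mem_range] at hi
      obtain ⟨d, rfl⟩ : ∃ d, J = i + 1 + d := ⟨J - i - 1, by omega⟩
      rw [show i + 1 + d + 1 - 1 - i = d + 1 by omega, show i + 1 + d - 1 - i = d by omega]
      ring
    rw [e, show J + 1 - 1 - J = 0 by omega]
    have := hg J
    calc _ ≤ 2 ^ J * (4 * K0 + 12) + 2 * (4 * 2 ^ J) + 2 ^ (J + 2) * (K0 + 1 + 2 * 0) := by gcongr
      _ = _ := by ring
def pr (u v : ℕ) : Finset ℕ := {l ∈ Finset.Ioc u v | l.Prime}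
lemma mem_pr {u v l : ℕ} : l ∈ pr u v ↔ (u < l ∧ l ≤ v) ∧ l.Prime := by simp [pr]
lemma block_sum (y : ℕ) (hy : 8 ≤ y) : ∑ l ∈ pr y (y ^ 2), 1 / (l : ℝ) ≤ 4 := by
  have h1 := ME.mertens_le (y ^ 2) (Nat.one_le_pow _ _ (by omega))
  have hly : 2 ≤ Real.log y := by
    rw [Real.le_log_iff_exp_le (by positivity)]
    have : (8:ℝ) ≤ y := by exact_mod_cast hy
    have e := Real.exp_one_lt_d9
    have : Real.exp 2 = Real.exp 1 * Real.exp 1 := by rw [← Real.exp_add]; norm_num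
    nlinarith [Real.exp_pos 1]
  have h2 : ∑ l ∈ pr y (y ^ 2), Real.log y * (1 / (l:ℝ)) ≤ ∑ p ∈ Nat.primesLE (y ^ 2), Real.log p / p := by
    refine le_trans (sum_le_sum (g := fun l : ℕ => Real.log l / l) fun l hl => ?_)
      (sum_le_sum_of_subset_of_nonneg ?_ ?_)
    · rw [mem_pr] at hl
      rw [mul_one_div]
      gcongr
      exact hl.1.1.le
    · intro l hl
      rw [mem_pr] at hl
      exact Nat.mem_primesLE.2 ⟨hl.1.2, hl.2⟩
    · intro l _ _
      exact div_nonneg (Real.log_natCast_nonneg _) (by positivity)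
  rw [← mul_sum] at h2
  push_cast at h1
  rw [Real.log_pow] at h1
  push_cast at h1
  by_contra hc
  push Not at hc
  nlinarith
theorem sieve : ∃ κ : ℕ, ∀ (W J : ℕ), 8 ≤ W → ∀ (h : ℕ → ℝ),
    (∀ l, l.Prime → W < l → 0 ≤ h l ∧ h l ≤ 3 / l) →
    ∀ {ι : Type} (τ : Finset ι) (w : ι → ℝ) (χ : ℕ → ι → ℝ) (X E : ℝ), (∀ t ∈ τ, 0 ≤ w t) →
    (∀ l t, 0 ≤ χ l t ∧ χ l t ≤ 1) → 0 ≤ X → 0 ≤ E →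
    (∀ S ⊆ pr W (W ^ 2 ^ J), |∑ t ∈ τ, w t * ∏ l ∈ S, χ l t - X * ∏ l ∈ S, h l| ≤ E * 3 ^ #S) →
    X / 2 * ∏ l ∈ pr W (W ^ 2 ^ J), (1 - h l) - (J + 1) * (E * ((W ^ 2 ^ J : ℕ) : ℝ) ^ κ) ≤
      ∑ t ∈ τ, w t * ∏ l ∈ pr W (W ^ 2 ^ J), (1 - χ l t) := by
  obtain ⟨K1, hK1⟩ := pow_unbounded_of_one_lt (4 * Real.exp 72) (show (1:ℝ) < 4 by norm_num)
  set K0 := 2 * K1 with hK0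
  refine ⟨4 * K0 + 12, fun W J hW h hh ι τ w χ X E hw hχ hX hE hlev => ?_⟩
  let y : ℕ → ℕ := fun i => W ^ 2 ^ i
  have hy1 : ∀ i, y (i + 1) = y i ^ 2 := fun i => by simp only [y]; rw [← pow_mul, pow_succ]
  have hy8 : ∀ i, 8 ≤ y i := fun i => hW.trans (Nat.le_self_pow (by positivity) W)
  have hmono : Monotone y := fun i j hij => Nat.pow_le_pow_right (by omega) (Nat.pow_le_pow_right (by norm_num) hij)
  let P : Fin J → Finset ℕ := fun j => pr (y j) (y (j + 1))
  let k : Fin J → ℕ := fun j => K0 + 2 * (J - 1 - j)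
  have hdis : Set.PairwiseDisjoint (↑(univ : Finset (Fin J))) P := by
    intro i _ j _ hij
    rw [Function.onFun, disjoint_left]
    intro l hi hj
    rw [mem_pr] at hi hj
    rcases lt_or_gt_of_ne hij with h1 | h1
    · have := hmono (show (i:ℕ) + 1 ≤ j from h1); omega
    · have := hmono (show (j:ℕ) + 1 ≤ i from h1); omega
  have hunion : univ.biUnion P = pr W (W ^ 2 ^ J) := by
    ext l
    rw [mem_biUnion, mem_pr]
    constructor
    · rintro ⟨j, _, hj⟩
      rw [mem_pr] at hj
      refine ⟨⟨?_, hj.1.2.trans (hmono (show (j:ℕ) + 1 ≤ J from j.2))⟩, hj.2⟩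
      have : y 0 ≤ y j := hmono (Nat.zero_le _)
      simp only [y, pow_zero, pow_one] at this hj
      omega
    · rintro ⟨⟨h1, h2⟩, hp⟩
      have hex : ∃ i, l ≤ y i := ⟨J, h2⟩
      have hne : Nat.find hex ≠ 0 := by
        intro h0
        have := Nat.find_spec hex
        rw [h0] at this
        simp only [y, pow_zero, pow_one] at this
        omega
      obtain ⟨i, hi⟩ := Nat.exists_eq_succ_of_ne_zero hne
      have hiJ : i < J := by have := Nat.find_min' hex h2; omega
      refine ⟨⟨i, hiJ⟩, mem_univ _, mem_pr.2 ⟨⟨?_, ?_⟩, hp⟩⟩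
      · exact not_le.1 (Nat.find_min hex (m := i) (by omega))
      · have := Nat.find_spec hex; rwa [hi] at this
  have hprodU : ∀ g : ℕ → ℝ, ∏ l ∈ pr W (W ^ 2 ^ J), g l = ∏ j, ∏ l ∈ P j, g l := by
    intro g; rw [← hunion, prod_biUnion hdis]
  have hPsub : ∀ j, P j ⊆ pr W (W ^ 2 ^ J) := fun j => hunion ▸ subset_biUnion_of_mem P (mem_univ j)
  have hhP : ∀ j, ∀ l ∈ P j, 0 ≤ h l ∧ h l ≤ 1 / 2 ∧ h l ≤ 3 / l := by
    intro j l hl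
    have := mem_pr.1 (hPsub j hl)
    obtain ⟨h1, h2⟩ := hh l this.2 this.1.1
    refine ⟨h1, h2.trans ?_, h2⟩
    have : (8:ℝ) ≤ l := by exact_mod_cast (by omega : 8 ≤ l)
    rw [div_le_div_iff₀ (by positivity) (by norm_num)]; linarith
  have hs : ∀ j, ∑ l ∈ P j, h l ≤ 12 := by
    intro j
    have h1 := block_sum (y j) (hy8 j)
    rw [← hy1] at h1
    calc ∑ l ∈ P j, h l ≤ ∑ l ∈ P j, 3 * (1 / (l:ℝ)) := sum_le_sum fun l hl => by
          rw [mul_one_div]; exact (hhP j l hl).2.2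
      _ = 3 * ∑ l ∈ P j, 1 / (l:ℝ) := by rw [mul_sum]
      _ ≤ 3 * 4 := by gcongr
      _ = 12 := by norm_num
  have hVj : ∀ j, Real.exp (-24) ≤ ∏ l ∈ P j, (1 - h l) := by
    intro j
    refine le_trans ?_ (V_ge (P j) h fun l hl => ⟨(hhP j l hl).1, (hhP j l hl).2.1⟩)
    rw [Real.exp_le_exp]; linarith [hs j]
  have key := hooley τ w χ h X E P k (fun j => ⟨K1 + (J - 1 - j), by simp only [k]; omega⟩) hw hχ hX
    ?_ (fun j l hl => ⟨(hhP j l hl).1, (hhP j l hl).2.1.trans (by norm_num)⟩)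
    (fun j => (Real.exp_pos _).trans_le (hVj j)) ?_
  · simp only [← hprodU] at key
    refine le_trans (sub_le_sub_left ?_ _) key
    refine mul_le_mul_of_nonneg_left (mul_le_mul_of_nonneg_left ?_ hE) (by positivity)
    refine le_trans (prod_le_prod (g := fun j : Fin J => ((y (j + 1) : ℕ) : ℝ) ^ (2 * (k j + 1)))
      (fun j _ => by positivity) (fun j _ => B_le (P j) (k j + 1) (y (j + 1)) ?_)) ?_
    · have h1 : #(P j) ≤ y (j + 1) := by
        refine (card_filter_le _ _).trans ?_
        rw [Nat.card_Ioc]; omega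
      have := hy8 (j + 1)
      nlinarith
    · have e : ∏ j : Fin J, ((y (j + 1) : ℕ) : ℝ) ^ (2 * (k j + 1)) =
          (W:ℝ) ^ ∑ i ∈ range J, 2 ^ (i + 2) * (K0 + 1 + 2 * (J - 1 - i)) := by
        rw [← prod_pow_eq_pow_sum, ← Fin.prod_univ_eq_prod_range
          (fun i => (W:ℝ) ^ (2 ^ (i + 2) * (K0 + 1 + 2 * (J - 1 - i)))) J]
        refine prod_congr rfl fun j _ => ?_
        simp only [y, k]
        push_cast
        rw [← pow_mul]
        congr 1
        ring
      rw [e]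
      push_cast
      rw [← pow_mul]
      exact pow_le_pow_right₀ (by exact_mod_cast (by omega : 1 ≤ W)) (expo_le K0 J)
  · intro S hS
    have hd : Set.PairwiseDisjoint (↑(univ : Finset (Fin J))) S := by
      intro i hi j hj hij
      exact (hdis hi hj hij).mono (hS i) (hS j)
    have := hlev (univ.biUnion S) (by
      rw [← hunion]; exact biUnion_mono fun j _ => hS j)
    rw [card_biUnion (fun i hi j hj hij => hd hi hj hij), ← prod_pow_eq_pow_sum] at this
    simpa only [prod_biUnion hd] using this
  · have h1 : ∀ j, es (P j) h (k j + 1) / ∏ l ∈ P j, (1 - h l) ≤ Real.exp 72 / 4 ^ K0 * (1 / 4) * (1 / 4) ^ (2 * (J - 1 - j)) := by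
      intro j
      have h2 := es_le (P j) h (fun l hl => (hhP j l hl).1) 12 (hs j) (k j + 1)
      rw [div_le_iff₀ ((Real.exp_pos _).trans_le (hVj j))]
      have h3 : Real.exp 48 = Real.exp 72 * Real.exp (-24) := by rw [← Real.exp_add]; norm_num
      calc _ ≤ Real.exp (4 * 12) / 4 ^ (k j + 1) := h2
        _ = Real.exp 72 / 4 ^ K0 * (1 / 4) * (1 / 4) ^ (2 * (J - 1 - j)) * Real.exp (-24) := by
          simp only [k]
          rw [show (4:ℝ) * 12 = 48 by norm_num, h3, pow_add, pow_add, one_div_pow]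
          field_simp
        _ ≤ _ := by gcongr; exact hVj j
    refine (sum_le_sum fun j _ => h1 j).trans ?_
    rw [← mul_sum]
    have h2 : ∑ j : Fin J, (1 / 4 : ℝ) ^ (2 * (J - 1 - j)) ≤ 2 := by
      rw [Fin.sum_univ_eq_sum_range (fun i => (1 / 4 : ℝ) ^ (2 * (J - 1 - i))) J]
      rw [sum_range_reflect (fun i => (1 / 4 : ℝ) ^ (2 * i)) J]
      simp only [pow_mul]
      rw [geom_sum_eq (by norm_num)]
      have : (0:ℝ) < ((1 / 4) ^ 2) ^ J := by positivity
      rw [div_le_iff_of_neg (by norm_num)]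
      generalize ((1 / 4 : ℝ) ^ 2) ^ J = y at *
      linarith
    have h3 : Real.exp 72 / 4 ^ K0 ≤ 1 / 4 := by
      rw [div_le_div_iff₀ (by positivity) (by norm_num)]
      have : (4:ℝ) ^ K1 ≤ 4 ^ K0 := pow_le_pow_right₀ (by norm_num) (by omega)
      linarith
    calc _ ≤ (1 / 4) * (1 / 4) * (2:ℝ) := by gcongr
      _ ≤ _ := by norm_num
end SV

set_option linter.unusedSectionVars false
namespace ME
open Finset Filter Topology NumberField
open scoped nonZeroDivisors
variable (K : Type) [Field K] [NumberField K]
lemma fin_IS (n : ℕ) : {I : Ideal (𝓞 K) | I ≠ ⊥ ∧ Ideal.absNorm I ≤ n}.Finite :=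
  (Ideal.finite_setOfPred_absNorm_le n).subset (fun I h => h.2)
noncomputable def IS (n : ℕ) : Finset (Ideal (𝓞 K)) := (fin_IS K n).toFinset
variable {K}
lemma mem_IS {n : ℕ} {I : Ideal (𝓞 K)} : I ∈ IS K n ↔ I ≠ ⊥ ∧ Ideal.absNorm I ≤ n := by
  simp [IS]
lemma norm_pos {I : Ideal (𝓞 K)} (h : I ≠ ⊥) : 1 ≤ Ideal.absNorm I :=
  Nat.pos_of_ne_zero (fun h0 => h (Ideal.absNorm_eq_zero_iff.1 h0))
lemma norm_mono {I J : Ideal (𝓞 K)} (h : J ≠ ⊥) (hd : I ∣ J) : Ideal.absNorm I ≤ Ideal.absNorm J :=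
  Nat.le_of_dvd (norm_pos h) (map_dvd Ideal.absNorm hd)
lemma card_dvd (n : ℕ) (J : Ideal (𝓞 K)) (hJ : J ≠ ⊥) [DecidablePred (J ∣ ·)] :
    #{I ∈ IS K n | J ∣ I} = #(IS K (n / Ideal.absNorm J)) := by
  symm
  refine card_bij (fun I _ => J * I) ?_ ?_ ?_
  · intro I hI
    rw [mem_IS] at hI
    rw [mem_filter, mem_IS]
    refine ⟨⟨mul_ne_zero hJ hI.1, ?_⟩, dvd_mul_right _ _⟩
    rw [map_mul, mul_comm]
    exact (Nat.le_div_iff_mul_le (norm_pos hJ)).1 hI.2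
  · intro I _ I' _ h
    exact mul_left_cancel₀ hJ h
  · intro I hI
    rw [mem_filter, mem_IS] at hI
    obtain ⟨⟨h0, h1⟩, I', rfl⟩ := hI
    refine ⟨I', ?_, rfl⟩
    rw [mem_IS]
    refine ⟨right_ne_zero_of_mul h0, ?_⟩
    rw [Nat.le_div_iff_mul_le (norm_pos hJ), mul_comm, ← map_mul]
    exact h1
variable (K)
noncomputable def AA (y : ℝ) : ℝ := #(IS K ⌊y⌋₊)
lemma AA_nonneg (y : ℝ) : 0 ≤ AA K y := by unfold AA; positivity
lemma AA_mono {y y' : ℝ} (h : y ≤ y') : AA K y ≤ AA K y' := by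
  unfold AA
  have : IS K ⌊y⌋₊ ⊆ IS K ⌊y'⌋₊ := fun I hI => by
    rw [mem_IS] at hI ⊢
    exact ⟨hI.1, hI.2.trans (Nat.floor_le_floor h)⟩
  exact_mod_cast card_le_card this
lemma AA_tendsto : ∃ κ > 0, Tendsto (fun y => AA K y / y) atTop (𝓝 κ) := by
  refine ⟨_, ?_, (Ideal.tendsto_norm_le_div_atTop₀ K).congr' ?_⟩
  · have h1 := Units.regulator_pos K
    have h2 : (0:ℝ) < classNumber K := by exact_mod_cast classNumber_pos K
    have h3 : (0:ℝ) < Units.torsionOrder K := by exact_mod_cast Units.torsionOrder_pos K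
    have h4 : (0:ℝ) < |(discr K : ℤ)| := by exact_mod_cast abs_pos.2 (discr_ne_zero K)
    push_cast at h4
    positivity
  · filter_upwards [eventually_ge_atTop 0] with y hy
    congr 2
    rw [← Nat.card_eq_finsetCard]
    refine Nat.card_congr ⟨fun I => ⟨I.1.1, ?_⟩, fun I => ⟨⟨I.1, ?_⟩, ?_⟩, fun I => rfl, fun I => rfl⟩
    · rw [mem_IS]
      exact ⟨nonZeroDivisors.ne_zero I.1.2, Nat.le_floor I.2⟩
    · exact mem_nonZeroDivisors_of_ne_zero (mem_IS.1 I.2).1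
    · exact (Nat.le_floor_iff hy).1 (mem_IS.1 I.2).2
lemma AA_le : ∃ C > 0, ∀ y > 0, AA K y ≤ C * y := by
  obtain ⟨κ, hκ, h⟩ := AA_tendsto K
  obtain ⟨Y, hY⟩ := eventually_atTop.1 (h.eventually (gt_mem_nhds (show κ < κ + 1 by linarith)))
  refine ⟨κ + 1 + AA K Y, by have := AA_nonneg K Y; linarith, fun y hy => ?_⟩
  have hn := AA_nonneg K Y
  rcases le_total Y y with h1 | h1
  · have := hY y h1
    rw [div_lt_iff₀ hy] at this
    nlinarith
  · rcases lt_or_ge y 1 with h2 | h2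
    · have : AA K y = 0 := by
        unfold AA
        rw [Nat.floor_eq_zero.2 h2]
        simp only [Nat.cast_eq_zero, card_eq_zero]
        ext I
        simp only [mem_IS, notMem_empty, iff_false, not_and]
        intro h0 h3
        have := norm_pos h0
        omega
      rw [this]; positivity
    · have := AA_mono K h1
      nlinarith
variable {K}
lemma log_sum_dvd (n : ℕ) (I : Ideal (𝓞 K)) (hI : I ≠ ⊥) (T : Finset (Ideal (𝓞 K)))
    (hT : ∀ P ∈ T, Prime P ∧ P ∣ I) : ∑ P ∈ T, Real.log (Ideal.absNorm P) ≤
      Real.log (Ideal.absNorm I) := by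
  have h1 : ∏ P ∈ T, P ∣ I := by
    refine Finset.prod_primes_dvd I (fun P hP => (hT P hP).1) (fun P hP => (hT P hP).2)
  have h2 := norm_mono hI h1
  rw [map_prod] at h2
  rw [← Real.log_prod (fun P hP => ?_)]
  · apply Real.log_le_log
    · exact prod_pos fun P hP => by exact_mod_cast norm_pos (hT P hP).1.ne_zero
    · exact_mod_cast h2
  · have := norm_pos (hT P hP).1.ne_zero
    positivity
lemma dyadic (n : ℕ) (m : ℕ) (hm : 1 ≤ m) (hmn : m ≤ n) :
    Real.log n - Real.log m ≤ ∑ k ∈ range (n + 1), if m ≤ n / 2 ^ k then (1:ℝ) else 0 := by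
  set t := Nat.log 2 (n / m) with ht
  have hq : n / m ≠ 0 := (Nat.div_pos hmn hm).ne'
  have h1 : range (t + 1) ⊆ (range (n + 1)).filter (fun k => m ≤ n / 2 ^ k) := by
    intro k hk
    rw [mem_range] at hk
    rw [mem_filter, mem_range]
    have hk2 : 2 ^ k ≤ n / m := Nat.pow_le_of_le_log hq (by omega)
    refine ⟨?_, ?_⟩
    · have := Nat.div_le_self n m
      have := Nat.lt_two_pow_self (n := k)
      omega
    · rw [Nat.le_div_iff_mul_le (by positivity)]
      rw [Nat.le_div_iff_mul_le hm] at hk2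
      linarith [mul_comm m (2 ^ k)]
  rw [sum_boole]
  have h2 : (t + 1 : ℝ) ≤ #{k ∈ range (n + 1) | m ≤ n / 2 ^ k} := by
    have := card_le_card h1
    rw [card_range] at this
    exact_mod_cast this
  refine le_trans ?_ h2
  have h3 : n < 2 ^ (t + 1) * m := by
    have := Nat.lt_pow_succ_log_self (b := 2) (by norm_num) (n / m)
    exact (Nat.div_lt_iff_lt_mul hm).1 this
  have hm0 : (0:ℝ) < m := by exact_mod_cast hm
  have hn0 : (0:ℝ) < n := by exact_mod_cast hm.trans hmn
  rw [← Real.log_div hn0.ne' hm0.ne']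
  have h4 : (n:ℝ) / m ≤ 2 ^ (t + 1) := by
    rw [div_le_iff₀ hm0]; exact_mod_cast h3.le
  calc Real.log (n / m) ≤ Real.log (2 ^ (t + 1)) := Real.log_le_log (by positivity) h4
    _ = (t + 1) * Real.log 2 := by rw [Real.log_pow]; push_cast; ring
    _ ≤ (t + 1) * 1 := by gcongr; linarith [Real.log_two_lt_d9]
    _ = _ := by ring
noncomputable def SS (K : Type) [Field K] [NumberField K] (n : ℕ) : ℝ :=
  ∑ I ∈ IS K n, Real.log (Ideal.absNorm I)
lemma SS_le (n : ℕ) : SS K n ≤ AA K n * Real.log n := by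
  unfold SS AA
  rw [Nat.floor_natCast, ← nsmul_eq_mul]
  refine sum_le_card_nsmul _ _ _ fun I hI => ?_
  rw [mem_IS] at hI
  exact Real.log_le_log (by exact_mod_cast norm_pos hI.1) (by exact_mod_cast hI.2)
lemma SS_ge (C : ℝ) (hC : ∀ y > 0, AA K y ≤ C * y) (n : ℕ) (hn : 1 ≤ n) :
    AA K n * Real.log n - 2 * C * n ≤ SS K n := by
  have hn0 : (0:ℝ) < n := by exact_mod_cast hn
  have h1 : AA K n * Real.log n - SS K n ≤ ∑ k ∈ range (n + 1), AA K (n / 2 ^ k) := by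
    have e : AA K n * Real.log n - SS K n =
        ∑ I ∈ IS K n, (Real.log n - Real.log (Ideal.absNorm I)) := by
      unfold SS AA
      rw [sum_sub_distrib, Nat.floor_natCast, sum_const, nsmul_eq_mul]
    rw [e]
    refine (sum_le_sum fun I hI => dyadic n _ (norm_pos (mem_IS.1 hI).1) (mem_IS.1 hI).2).trans ?_
    rw [sum_comm]
    refine sum_le_sum fun k _ => ?_
    rw [sum_boole]
    unfold AA
    have : ⌊(n:ℝ) / 2 ^ k⌋₊ = n / 2 ^ k := by
      rw [← Nat.floor_div_eq_div (K := ℝ)]; push_cast; rfl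
    rw [this]
    have : {I ∈ IS K n | Ideal.absNorm I ≤ n / 2 ^ k} ⊆ IS K (n / 2 ^ k) := fun I hI => by
      rw [mem_filter, mem_IS] at hI
      rw [mem_IS]
      exact ⟨hI.1.1, hI.2⟩
    exact_mod_cast card_le_card this
  have hC0 : 0 ≤ C := by
    have := hC 1 one_pos
    linarith [AA_nonneg K 1]
  have h2 : ∑ k ∈ range (n + 1), AA K (n / 2 ^ k) ≤ ∑ k ∈ range (n + 1), C * n * (1 / 2) ^ k := by
    refine sum_le_sum fun k _ => (hC _ (by positivity)).trans (le_of_eq ?_)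
    rw [div_pow, one_pow]; ring
  rw [← mul_sum] at h2
  have h3 : ∑ k ∈ range (n + 1), (1 / 2 : ℝ) ^ k ≤ 2 := by
    rw [geom_sum_eq (by norm_num)]
    have : (0:ℝ) < (1 / 2) ^ (n + 1) := by positivity
    rw [div_le_iff_of_neg (by norm_num)]
    linarith
  have h4 : C * n * ∑ k ∈ range (n + 1), (1 / 2 : ℝ) ^ k ≤ C * n * 2 := by gcongr
  linarith
end ME

set_option linter.unusedSectionVars false
namespace ME
open Finset Filter Topology NumberField
open scoped nonZeroDivisors
variable {K : Type} [Field K] [NumberField K]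
noncomputable def pb (P : Ideal (𝓞 K)) : ℕ := (Ideal.absNorm P).minFac
lemma norm_span (p : ℕ) : Ideal.absNorm (Ideal.span {(p : 𝓞 K)}) = p ^ Module.finrank ℚ K := by
  rw [Ideal.absNorm_span_singleton]
  have : Algebra.norm ℤ (p : 𝓞 K) = (p : ℤ) ^ Module.finrank ℚ K := by
    rw [Algebra.norm_natCast ℤ p, RingOfIntegers.rank]
  rw [this]
  simp [Int.natAbs_pow]
lemma pb_spec (P : Ideal (𝓞 K)) (hP : Prime P) :
    (pb P).Prime ∧ (pb P : 𝓞 K) ∈ P ∧ ∃ f, 1 ≤ f ∧ Ideal.absNorm P = pb P ^ f := by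
  have hP' := Ideal.isPrime_of_prime hP
  have h1 : Ideal.absNorm P ≠ 1 := by
    rw [Ne, Ideal.absNorm_eq_one_iff]; exact hP'.ne_top
  have hpos := norm_pos hP.ne_zero
  have hmem : ((Ideal.absNorm P : ℕ) : 𝓞 K) ∈ P := Ideal.absNorm_mem P
  have h2 : ∃ p : ℕ, p.Prime ∧ (p : 𝓞 K) ∈ P := by
    have h3 := Nat.prod_primeFactorsList (n := Ideal.absNorm P) (by omega)
    rw [← h3] at hmem
    push_cast at hmem
    rw [← Multiset.prod_coe, hP'.multiset_prod_mem_iff_exists_mem] at hmem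
    obtain ⟨x, hx, hxP⟩ := hmem
    rw [Multiset.mem_coe, List.mem_map] at hx
    obtain ⟨p, hp, rfl⟩ := hx
    exact ⟨p, Nat.prime_of_mem_primeFactorsList hp, hxP⟩
  obtain ⟨p, hp, hpP⟩ := h2
  have h4 : Ideal.absNorm P ∣ p ^ Module.finrank ℚ K := by
    rw [← norm_span]
    exact map_dvd Ideal.absNorm (Ideal.dvd_span_singleton.2 hpP)
  obtain ⟨f, hf, hf2⟩ := (Nat.dvd_prime_pow hp).1 h4
  have hf0 : f ≠ 0 := by rintro rfl; simp at hf2; exact h1 (Ideal.absNorm_eq_one_iff.2 hf2)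
  have h5 : pb P = p := by rw [pb, hf2, hp.pow_minFac hf0]
  rw [h5]
  exact ⟨hp, hpP, f, by omega, hf2⟩
lemma card_over (p : ℕ) (hp : p.Prime) (T : Finset (Ideal (𝓞 K)))
    (hT : ∀ P ∈ T, Prime P ∧ (p : 𝓞 K) ∈ P) : #T ≤ Module.finrank ℚ K := by
  have h1 : ∏ P ∈ T, P ∣ Ideal.span {(p : 𝓞 K)} :=
    Finset.prod_primes_dvd _ (fun P hP => (hT P hP).1)
      (fun P hP => Ideal.dvd_span_singleton.2 (hT P hP).2)
  have hne : Ideal.span {(p : 𝓞 K)} ≠ ⊥ := by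
    rw [Ne, Ideal.span_singleton_eq_bot]; exact_mod_cast hp.ne_zero
  have h2 := norm_mono hne h1
  rw [norm_span, map_prod] at h2
  have h3 : p ^ #T ≤ ∏ P ∈ T, Ideal.absNorm P := by
    rw [← prod_const]
    refine prod_le_prod' fun P hP => ?_
    obtain ⟨h4, h5, f, hf, hf2⟩ := pb_spec P (hT P hP).1
    have h6 : Ideal.absNorm P ∣ p ^ Module.finrank ℚ K := by
      rw [← norm_span]
      exact map_dvd Ideal.absNorm (Ideal.dvd_span_singleton.2 (hT P hP).2)
    obtain ⟨f', hf', hf2'⟩ := (Nat.dvd_prime_pow hp).1 h6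
    rw [hf2']
    refine Nat.le_self_pow ?_ p
    rintro rfl
    rw [hf2'] at hf2
    have := Nat.one_lt_pow (n := f) (by omega) h4.one_lt
    simp at hf2; omega
  exact (Nat.pow_le_pow_iff_right hp.one_lt).1 (h3.trans h2)
noncomputable def aset (K : Type) [Field K] [NumberField K] (p : ℕ) : Finset (Ideal (𝓞 K)) :=
  {I ∈ IS K p | Ideal.absNorm I = p}
lemma mem_aset {p : ℕ} (hp : p.Prime) {I : Ideal (𝓞 K)} : I ∈ aset K p ↔ Ideal.absNorm I = p := by
  unfold aset
  rw [mem_filter, mem_IS]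
  refine ⟨fun h => h.2, fun h => ⟨⟨?_, h.le⟩, h⟩⟩
  rintro rfl
  simp at h
  exact hp.ne_zero h.symm
lemma prime_of_norm {p : ℕ} (hp : p.Prime) {I : Ideal (𝓞 K)} (h : Ideal.absNorm I = p) :
    Prime I := by
  have h0 : I ≠ ⊥ := by rintro rfl; simp at h; exact hp.ne_zero h.symm
  refine Ideal.prime_of_isPrime h0 ?_
  exact Ideal.isPrime_of_irreducible_absNorm (by rw [h]; exact hp)
lemma pb_norm {p : ℕ} (hp : p.Prime) {I : Ideal (𝓞 K)} (h : Ideal.absNorm I = p) : pb I = p := by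
  rw [pb, h, hp.minFac_eq]
noncomputable def aa (K : Type) [Field K] [NumberField K] (p : ℕ) : ℕ := #(aset K p)
lemma aa_le (p : ℕ) (hp : p.Prime) : aa K p ≤ Module.finrank ℚ K :=
  card_over p hp _ fun P hP => ⟨prime_of_norm hp ((mem_aset hp).1 hP), by
    have := (pb_spec P (prime_of_norm hp ((mem_aset hp).1 hP))).2.1
    rwa [pb_norm hp ((mem_aset hp).1 hP)] at this⟩
lemma AA_div (n p : ℕ) : AA K ((n:ℝ) / p) = #(IS K (n / p)) := by
  unfold AA; rw [Nat.floor_div_eq_div]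
lemma SS_ge2 (n : ℕ) : ∑ p ∈ Nat.primesLE n, aa K p * Real.log p * AA K (n / p) ≤ SS K n := by
  classical
  have h1 : ∀ p ∈ Nat.primesLE n, aa K p * Real.log p * AA K (n / p) =
      ∑ P ∈ aset K p, ∑ I ∈ IS K n, if P ∣ I then Real.log (Ideal.absNorm P) else 0 := by
    intro p hp
    have hp' := Nat.prime_of_mem_primesLE hp
    rw [AA_div, aa, mul_assoc, ← nsmul_eq_mul, ← sum_const]
    refine sum_congr rfl fun P hP => ?_
    have hN := (mem_aset hp').1 hP
    rw [← sum_filter, sum_const, card_dvd n P (prime_of_norm hp' hN).ne_zero, hN, nsmul_eq_mul,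
      mul_comm]
  rw [sum_congr rfl h1, ← sum_biUnion, sum_comm]
  · refine sum_le_sum fun I hI => ?_
    rw [← sum_filter]
    refine log_sum_dvd n I (mem_IS.1 hI).1 _ fun P hP => ?_
    rw [mem_filter, mem_biUnion] at hP
    obtain ⟨⟨p, hp, h⟩, h2⟩ := hP
    have hp' := Nat.prime_of_mem_primesLE hp
    exact ⟨prime_of_norm hp' ((mem_aset hp').1 h), h2⟩
  · intro p hp p' hp' hne
    rw [Function.onFun, disjoint_left]
    intro P hP hP'
    exact hne (((mem_aset (Nat.prime_of_mem_primesLE hp)).1 hP).symm.trans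
      ((mem_aset (Nat.prime_of_mem_primesLE hp')).1 hP'))
lemma log_le_sum (n : ℕ) (I : Ideal (𝓞 K)) (hI : I ∈ IS K n) [DecidablePred (fun P : Ideal (𝓞 K) => Prime P)]
    [DecidableRel (fun P J : Ideal (𝓞 K) => P ∣ J)] :
    Real.log (Ideal.absNorm I) ≤ ∑ P ∈ (IS K n).filter (fun P => Prime P),
      ∑ j ∈ Icc 1 n, if P ^ j ∣ I then Real.log (Ideal.absNorm P) else 0 := by
  classical
  obtain ⟨h0, hn⟩ := mem_IS.1 hI
  have h1 : I = (UniqueFactorizationMonoid.normalizedFactors I).prod :=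
    (associated_iff_eq.1 (UniqueFactorizationMonoid.prod_normalizedFactors h0)).symm
  set m := UniqueFactorizationMonoid.normalizedFactors I with hm
  have hP : ∀ P ∈ m.toFinset, Prime P ∧ P ∣ I := fun P h => by
    rw [Multiset.mem_toFinset] at h
    exact ⟨UniqueFactorizationMonoid.prime_of_normalized_factor P h,
      UniqueFactorizationMonoid.dvd_of_mem_normalizedFactors h⟩
  have h2 : Real.log (Ideal.absNorm I) = ∑ P ∈ m.toFinset, m.count P * Real.log (Ideal.absNorm P) := by
    conv_lhs => rw [h1, Finset.prod_multiset_count, map_prod, Nat.cast_prod]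
    rw [Real.log_prod]
    · refine sum_congr rfl fun P _ => ?_
      rw [map_pow, Nat.cast_pow, Real.log_pow]
    · intro P h
      rw [map_pow]
      have := norm_pos (hP P h).1.ne_zero
      positivity
  rw [h2]
  refine (sum_le_sum (g := fun P => ∑ j ∈ Icc 1 n, if P ^ j ∣ I then Real.log (Ideal.absNorm P) else 0)
    fun P h => ?_).trans (sum_le_sum_of_subset_of_nonneg ?_ ?_)
  · rw [← sum_filter, sum_const, nsmul_eq_mul]
    have hl : 0 ≤ Real.log (Ideal.absNorm P) := Real.log_natCast_nonneg _
    refine mul_le_mul_of_nonneg_right ?_ hl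
    have : Icc 1 (m.count P) ⊆ {j ∈ Icc 1 n | P ^ j ∣ I} := by
      intro j hj
      rw [mem_Icc] at hj
      have hd : P ^ j ∣ I := by
        rw [h1]
        refine (pow_dvd_pow P hj.2).trans ?_
        rw [← Multiset.prod_replicate]
        exact Multiset.prod_dvd_prod_of_le (Multiset.le_count_iff_replicate_le.1 le_rfl)
      rw [mem_filter, mem_Icc]
      refine ⟨⟨hj.1, ?_⟩, hd⟩
      have h3 := norm_mono h0 hd
      rw [map_pow] at h3
      have h4 : 2 ≤ Ideal.absNorm P := by
        obtain ⟨h5, _, f, hf, hf2⟩ := pb_spec P (hP P h).1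
        rw [hf2]; exact Nat.one_lt_pow (by omega) h5.one_lt
      have h5 : 2 ^ j ≤ Ideal.absNorm P ^ j := Nat.pow_le_pow_left h4 j
      have := Nat.lt_two_pow_self (n := j)
      omega
    have := card_le_card this
    simp only [Nat.card_Icc, add_tsub_cancel_right] at this
    exact_mod_cast this
  · intro P h
    rw [mem_filter, mem_IS]
    exact ⟨⟨(hP P h).1.ne_zero, (norm_mono h0 (hP P h).2).trans hn⟩, (hP P h).1⟩
  · intro P _ _
    refine sum_nonneg fun j _ => ?_
    split_ifs
    · exact Real.log_natCast_nonneg _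
    · exact le_rfl
lemma log_div_le (t : ℝ) (ht : 1 ≤ t) (p : ℝ) (hp : 1 ≤ p) (h : p ^ 2 ≤ t) :
    Real.log t / t ≤ 4 * p ^ (-(3/2) : ℝ) := by
  have ht0 : 0 < t := by linarith
  have hp0 : 0 < p := by linarith
  have h1 : Real.log t ≤ 4 * t ^ (1/4 : ℝ) := by
    have := Real.log_le_rpow_div ht0.le (show (0:ℝ) < 1/4 by norm_num)
    linarith
  calc Real.log t / t ≤ 4 * t ^ (1/4 : ℝ) / t := by gcongr
    _ = 4 * t ^ (-(3/4) : ℝ) := by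
      rw [mul_div_assoc]; congr 1
      rw [div_eq_iff ht0.ne']
      nth_rewrite 3 [← Real.rpow_one t]
      rw [← Real.rpow_add ht0]; norm_num
    _ ≤ 4 * (p ^ 2) ^ (-(3/4) : ℝ) := by
      gcongr ?_ * ?_
      exact Real.rpow_le_rpow_of_nonpos (by positivity) h (by norm_num)
    _ = _ := by
      rw [← Real.rpow_natCast, ← Real.rpow_mul hp0.le]; norm_num
end ME

set_option linter.unusedSectionVars false
namespace ME
open Finset Filter Topology NumberField
variable {K : Type} [Field K] [NumberField K]
lemma geom_tail (t : ℝ) (ht : 2 ≤ t) (m n : ℕ) (hm : 1 ≤ m) (Q : ℕ → Prop) [DecidablePred Q]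
    (hQ : ∀ j, Q j → m ≤ j) :
    ∑ j ∈ Icc 1 n, (if Q j then (1 / t ^ j : ℝ) else 0) ≤ 2 / t ^ m := by
  have h1 : ∑ j ∈ Icc 1 n, (if Q j then (1 / t ^ j : ℝ) else 0) ≤
      ∑ j ∈ Ico m (m + (n + 1)), (1 / t ^ j : ℝ) := by
    rw [← sum_filter]
    refine sum_le_sum_of_subset_of_nonneg ?_ (fun _ _ _ => by positivity)
    intro j hj
    rw [mem_filter, mem_Icc] at hj
    rw [mem_Ico]
    have := hQ j hj.2
    omega
  refine h1.trans ?_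
  rw [sum_Ico_eq_sum_range]
  have h2 : ∀ i ∈ range (m + (n + 1) - m), (1 / t ^ (m + i) : ℝ) ≤ 1 / t ^ m * (1 / 2) ^ i := by
    intro i _
    rw [pow_add, ← one_div_mul_one_div]
    gcongr
    rw [one_div_pow]
    exact one_div_le_one_div_of_le (by positivity) (by gcongr)
  refine (sum_le_sum h2).trans ?_
  rw [← mul_sum, div_eq_mul_one_div 2, mul_comm 2]
  gcongr
  rw [geom_sum_eq (by norm_num)]
  have : (0:ℝ) < (1 / 2) ^ (m + (n + 1) - m) := by positivity
  rw [div_le_iff_of_neg (by norm_num)]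
  linarith
lemma rest_le (C : ℝ) (hC : ∀ y > 0, AA K y ≤ C * y) (n : ℕ) (hn : 1 ≤ n) (P : Ideal (𝓞 K)) (hP : Prime P) :
    ∑ j ∈ Icc 1 n, (if ¬ (j = 1 ∧ (Ideal.absNorm P).Prime) then
      Real.log (Ideal.absNorm P) * AA K (n / (Ideal.absNorm P : ℝ) ^ j) else 0) ≤
      8 * C * n * (pb P : ℝ) ^ (-(3/2) : ℝ) := by
  have hC0 : 0 ≤ C := by
    have := hC 1 one_pos
    linarith [AA_nonneg K 1]
  obtain ⟨hp, -, f, hf, hN⟩ := pb_spec P hP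
  set t := Ideal.absNorm P with ht
  have ht2 : 2 ≤ t := by rw [hN]; exact Nat.one_lt_pow (by omega) hp.one_lt
  have ht2' : (2:ℝ) ≤ t := by exact_mod_cast ht2
  have hl : 0 ≤ Real.log t := Real.log_natCast_nonneg _
  have hp2 : (2:ℝ) ≤ pb P := by exact_mod_cast hp.two_le
  have hn0 : (0:ℝ) < n := by exact_mod_cast hn
  have h1 : ∑ j ∈ Icc 1 n, (if ¬ (j = 1 ∧ t.Prime) then
      Real.log t * AA K (n / (t : ℝ) ^ j) else 0) ≤ C * n * (Real.log t * ∑ j ∈ Icc 1 n,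
        (if ¬ (j = 1 ∧ t.Prime) then (1 / (t:ℝ) ^ j : ℝ) else 0)) := by
    rw [mul_sum, mul_sum]
    refine sum_le_sum fun j _ => ?_
    split_ifs
    · simp
    · have := hC (n / (t:ℝ) ^ j) (by positivity)
      calc Real.log t * AA K (n / (t : ℝ) ^ j) ≤ Real.log t * (C * (n / (t:ℝ) ^ j)) := by gcongr
        _ = _ := by ring
  refine h1.trans ?_
  have h2 : Real.log t * ∑ j ∈ Icc 1 n,
        (if ¬ (j = 1 ∧ t.Prime) then (1 / (t:ℝ) ^ j : ℝ) else 0) ≤ 8 * (pb P : ℝ) ^ (-(3/2) : ℝ) := by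
    by_cases htp : t.Prime
    · have h3 := geom_tail t ht2' 2 n (by norm_num) (fun j => 1 ≤ j ∧ ¬ (j = 1 ∧ t.Prime))
        (fun j hj => by
          have := hj.2
          rw [not_and] at this
          by_contra h
          exact this (by omega) htp)
      have h4 : ∑ j ∈ Icc 1 n, (if ¬ (j = 1 ∧ t.Prime) then (1 / (t:ℝ) ^ j : ℝ) else 0) ≤ 2 / (t:ℝ)^2 := by
        refine le_trans (le_of_eq (sum_congr rfl fun j hj => ?_)) h3
        rw [mem_Icc] at hj
        simp [hj.1]
      have hpt : pb P = t := by rw [pb, ← ht, htp.minFac_eq]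
      have h5 := log_div_le ((t:ℝ)^2) (by nlinarith) t (by linarith) le_rfl
      rw [Real.log_pow] at h5
      rw [hpt]
      calc _ ≤ Real.log t * (2 / (t:ℝ)^2) := by gcongr
        _ = ((2:ℕ):ℝ) * Real.log t / (t:ℝ)^2 := by push_cast; ring
        _ ≤ _ := h5
        _ ≤ _ := by gcongr; norm_num
    · have h3 := geom_tail t ht2' 1 n (by norm_num) (fun j => 1 ≤ j) (fun j hj => hj)
      have h4 : ∑ j ∈ Icc 1 n, (if ¬ (j = 1 ∧ t.Prime) then (1 / (t:ℝ) ^ j : ℝ) else 0) ≤ 2 / (t:ℝ)^1 := by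
        refine le_trans (le_of_eq (sum_congr rfl fun j hj => ?_)) h3
        rw [mem_Icc] at hj
        simp [hj.1, htp]
      have hf2 : 2 ≤ f := by
        rcases hf.lt_or_eq with h | h
        · omega
        · rw [← h, pow_one] at hN
          rw [hN] at htp; exact absurd hp htp
      have h5 := log_div_le t (by linarith) (pb P) (by linarith)
        (by exact_mod_cast (hN ▸ Nat.pow_le_pow_right hp.pos hf2 : pb P ^ 2 ≤ t))
      calc _ ≤ Real.log t * (2 / (t:ℝ)^1) := by gcongr
        _ = 2 * (Real.log t / t) := by rw [pow_one]; ring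
        _ ≤ 2 * (4 * (pb P : ℝ) ^ (-(3/2) : ℝ)) := by gcongr
        _ = _ := by ring
  calc _ ≤ C * n * (8 * (pb P : ℝ) ^ (-(3/2) : ℝ)) := by gcongr
    _ = _ := by ring
lemma SS_le2 : ∃ C : ℝ, 0 ≤ C ∧ ∀ n : ℕ, 1 ≤ n →
    SS K n ≤ ∑ p ∈ Nat.primesLE n, aa K p * Real.log p * AA K (n / p) + C * n := by
  classical
  obtain ⟨C, hC0, hC⟩ := AA_le K
  have hsum : Summable (fun p : ℕ => (p : ℝ) ^ (-(3/2) : ℝ)) :=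
    Real.summable_nat_rpow.2 (by norm_num)
  have hT0 : 0 ≤ ∑' p : ℕ, (p : ℝ) ^ (-(3/2) : ℝ) := tsum_nonneg fun p => by positivity
  refine ⟨8 * C * (Module.finrank ℚ K * ∑' p : ℕ, (p : ℝ) ^ (-(3/2) : ℝ)), by positivity, fun n hn => ?_⟩
  set PP := (IS K n).filter (fun P => Prime P) with hPP
  have h1 : SS K n ≤ ∑ P ∈ PP, ∑ j ∈ Icc 1 n, Real.log (Ideal.absNorm P) * AA K (n / (Ideal.absNorm P : ℝ) ^ j) := by
    unfold SS
    refine (sum_le_sum fun I hI => log_le_sum n I hI).trans (le_of_eq ?_)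
    rw [sum_comm]
    refine sum_congr rfl fun P hP => ?_
    rw [sum_comm]
    refine sum_congr rfl fun j _ => ?_
    have hP' := (mem_filter.1 hP).2
    rw [← sum_filter, sum_const, card_dvd n _ (pow_ne_zero _ hP'.ne_zero), map_pow, nsmul_eq_mul, mul_comm]
    have := AA_div (K := K) n (Ideal.absNorm P ^ j)
    push_cast at this
    rw [this]
  have h2 : ∀ P ∈ PP, ∑ j ∈ Icc 1 n, Real.log (Ideal.absNorm P) * AA K (n / (Ideal.absNorm P : ℝ) ^ j) ≤
      (if (Ideal.absNorm P).Prime then Real.log (Ideal.absNorm P) * AA K (n / (Ideal.absNorm P : ℝ)) else 0) +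
      8 * C * n * (pb P : ℝ) ^ (-(3/2) : ℝ) := by
    intro P hP
    have hP' := (mem_filter.1 hP).2
    have h3 := rest_le C hC n hn P hP'
    have h4 : ∑ j ∈ Icc 1 n, (if (j = 1 ∧ (Ideal.absNorm P).Prime) then
      Real.log (Ideal.absNorm P) * AA K (n / (Ideal.absNorm P : ℝ) ^ j) else 0) =
      (if (Ideal.absNorm P).Prime then Real.log (Ideal.absNorm P) * AA K (n / (Ideal.absNorm P : ℝ)) else 0) := by
      rw [sum_eq_single_of_mem 1 (by simp [hn])]
      · simp
      · intro j _ hj; simp [hj]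
    rw [← h4]
    refine le_trans (le_of_eq ?_) (add_le_add_right h3 _)
    rw [← sum_add_distrib]
    refine sum_congr rfl fun j _ => ?_
    by_cases h : (j = 1 ∧ (Ideal.absNorm P).Prime) <;> simp [h]
  refine h1.trans ((sum_le_sum h2).trans ?_)
  rw [sum_add_distrib]
  refine add_le_add ?_ ?_
  · have h1 : ∀ p ∈ Nat.primesLE n, aa K p * Real.log p * AA K (n / p) =
      ∑ P ∈ aset K p, Real.log (Ideal.absNorm P) * AA K (n / (Ideal.absNorm P : ℝ)) := by
      intro p hp
      have hp' := Nat.prime_of_mem_primesLE hp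
      rw [aa, mul_assoc, ← nsmul_eq_mul, ← sum_const]
      refine sum_congr rfl fun P hP => ?_
      rw [(mem_aset hp').1 hP]
    rw [sum_congr rfl h1, ← sum_biUnion, ← sum_filter]
    · refine sum_le_sum_of_subset_of_nonneg ?_ ?_
      · intro P hP
        rw [mem_filter, hPP, mem_filter, mem_IS] at hP
        rw [mem_biUnion]
        exact ⟨_, Nat.mem_primesLE.2 ⟨hP.1.1.2, hP.2⟩, (mem_aset hP.2).2 rfl⟩
      · intro P _ _
        exact mul_nonneg (Real.log_natCast_nonneg _) (AA_nonneg K _)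
    · intro p hp p' hp' hne
      rw [Function.onFun, disjoint_left]
      intro P hP hP'
      exact hne (((mem_aset (Nat.prime_of_mem_primesLE hp)).1 hP).symm.trans
        ((mem_aset (Nat.prime_of_mem_primesLE hp')).1 hP'))
  · rw [← mul_sum]
    have h5 : ∑ P ∈ PP, (pb P : ℝ) ^ (-(3/2) : ℝ) ≤ Module.finrank ℚ K * ∑' p : ℕ, (p : ℝ) ^ (-(3/2) : ℝ) := by
      have h6 : ∀ P ∈ PP, pb P ∈ Nat.primesLE n := by
        intro P hP
        rw [hPP, mem_filter, mem_IS] at hP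
        obtain ⟨hp, -, f, hf, hN⟩ := pb_spec P hP.2
        rw [Nat.mem_primesLE]
        exact ⟨(Nat.minFac_le (norm_pos hP.1.1)).trans hP.1.2, hp⟩
      rw [← sum_fiberwise_of_maps_to h6]
      refine le_trans (sum_le_sum (g := fun p : ℕ => Module.finrank ℚ K * (p : ℝ) ^ (-(3/2) : ℝ)) fun p hp => ?_) ?_
      · rw [sum_congr rfl (g := fun _ => (p : ℝ) ^ (-(3/2) : ℝ)) (fun P hP => by rw [(mem_filter.1 hP).2])]
        rw [sum_const, nsmul_eq_mul]
        gcongr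
        refine card_over p (Nat.prime_of_mem_primesLE hp) _ fun P hP => ?_
        rw [mem_filter, hPP, mem_filter] at hP
        refine ⟨hP.1.2, ?_⟩
        rw [← hP.2]
        exact (pb_spec P hP.1.2).2.1
      · rw [← mul_sum]
        gcongr
        exact hsum.sum_le_tsum _ (fun p _ => by positivity)
    calc _ ≤ 8 * C * n * (Module.finrank ℚ K * ∑' p : ℕ, (p : ℝ) ^ (-(3/2) : ℝ)) := by gcongr
      _ = _ := by ring
lemma E1 (h3 : Module.finrank ℚ K ≤ 3) : Tendsto (fun n : ℕ =>
    (∑ p ∈ Nat.primesLE n, aa K p * Real.log p / p) / Real.log n) atTop (𝓝 1) := by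
  obtain ⟨κ, hκ, hA⟩ := AA_tendsto K
  obtain ⟨C, hC0, hC⟩ := AA_le K
  obtain ⟨C2, hC20, hC2⟩ := SS_le2 (K := K)
  have := E1_aux (aa K) (fun p hp => (aa_le p hp).trans h3) (AA K) κ hκ hA (2 * C + C2) (by positivity)
    (AA_nonneg K) (fun y hy => (hC y hy).trans (by nlinarith)) (SS K) (fun n _ => SS_le n)
  refine this (fun n hn => ?_) (fun n hn => SS_ge2 n) (fun n hn => (hC2 n hn).trans ?_)
  · have := SS_ge C hC n hn
    have : 0 ≤ C2 * n := by positivity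
    nlinarith
  · gcongr; linarith
end ME

set_option linter.unusedSectionVars false
namespace ME
open Finset Filter Topology NumberField Polynomial
variable {K : Type} [Field K] [NumberField K]
section
variable {θ : 𝓞 K} {p : ℕ} [Fact p.Prime]
lemma hom_exists (hp : ¬ p ∣ RingOfIntegers.exponent θ) (t : ZMod p)
    (ht : ((minpoly ℤ θ).map (Int.castRingHom (ZMod p))).eval t = 0) :
    ∃ φ : 𝓞 K →+* ZMod p, φ θ = t := by
  let e := RingOfIntegers.ZModXQuotSpanEquivQuotSpan hp
  let ev : (ZMod p)[X] ⧸ Ideal.span {map (Int.castRingHom (ZMod p)) (minpoly ℤ θ)} →+* ZMod p :=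
    Ideal.Quotient.lift _ (evalRingHom t) (by
      intro a ha
      obtain ⟨b, rfl⟩ := Ideal.mem_span_singleton.1 ha
      simp [ht])
  refine ⟨ev.comp (e.symm.toRingHom.comp (Ideal.Quotient.mk _)), ?_⟩
  have h1 := RingOfIntegers.ZModXQuotSpanEquivQuotSpan_mk_apply hp X
  rw [aeval_X] at h1
  have h2 : e.symm (Ideal.Quotient.mk _ θ) = Ideal.Quotient.mk _ (map (Int.castRingHom (ZMod p)) X) := by
    rw [← h1]; exact e.symm_apply_apply _
  simp only [RingHom.comp_apply, RingEquiv.toRingHom_eq_coe, RingHom.coe_coe]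
  rw [h2]
  simp [ev]
lemma hom_unique (hp : ¬ p ∣ RingOfIntegers.exponent θ) (φ ψ : 𝓞 K →+* ZMod p) (h : φ θ = ψ θ) :
    φ = ψ := by
  ext x
  let e := RingOfIntegers.ZModXQuotSpanEquivQuotSpan hp
  obtain ⟨y, hy⟩ := e.surjective (Ideal.Quotient.mk _ x)
  obtain ⟨Q, rfl⟩ := Ideal.Quotient.mk_surjective y
  obtain ⟨S, rfl⟩ := (map_surjective _ (ZMod.ringHom_surjective (Int.castRingHom (ZMod p)))) Q
  have h1 := RingOfIntegers.ZModXQuotSpanEquivQuotSpan_mk_apply hp S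
  have h2 : Ideal.Quotient.mk (Ideal.span {(p : 𝓞 K)}) x = Ideal.Quotient.mk _ (aeval θ S) :=
    hy.symm.trans h1
  rw [Ideal.Quotient.eq, Ideal.mem_span_singleton] at h2
  obtain ⟨z, hz⟩ := h2
  have hx : x = aeval θ S + p * z := by rw [← hz]; ring
  have key : ∀ χ : 𝓞 K →+* ZMod p, χ x = S.eval₂ (Int.castRingHom (ZMod p)) (χ θ) := by
    intro χ
    rw [hx, map_add, map_mul, map_natCast, CharP.cast_eq_zero, zero_mul, add_zero, aeval_def, hom_eval₂]
    congr 1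
    exact RingHom.ext_int _ _
  rw [key φ, key ψ, h]
end
def rho (k : Cub) (D : ℕ) : ℕ := #{t ∈ range D | (D : ℤ) ∣ k.f ((t : ℕ) : ℤ)}
lemma aa_eq (k : Cub) {θ : 𝓞 K} (hθ : minpoly ℤ θ = X ^ 3 + C k.c2 * X ^ 2 + C k.c1 * X + C k.c0)
    {p : ℕ} (hpp : p.Prime) (hp : ¬ p ∣ RingOfIntegers.exponent θ) : aa K p = rho k p := by
  haveI := Fact.mk hpp
  have hev : ∀ t : ZMod p, ((minpoly ℤ θ).map (Int.castRingHom (ZMod p))).eval t =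
      t ^ 3 + k.c2 * t ^ 2 + k.c1 * t + k.c0 := by
    intro t; rw [hθ]; simp
  have hf : ∀ t : ℕ, (p : ℤ) ∣ k.f t ↔ ((minpoly ℤ θ).map (Int.castRingHom (ZMod p))).eval (t : ZMod p) = 0 := by
    intro t
    rw [hev, ← ZMod.intCast_zmod_eq_zero_iff_dvd]
    simp [Cub.f]
  unfold aa rho
  symm
  have ex : ∀ t : ℕ, (p : ℤ) ∣ k.f t → ∃ φ : 𝓞 K →+* ZMod p, φ θ = t :=
    fun t ht => hom_exists hp _ ((hf t).1 ht)
  refine card_bij (fun t ht => RingHom.ker (ex t (mem_filter.1 ht).2).choose) ?_ ?_ ?_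
  · intro t ht
    rw [mem_aset hpp]
    set φ := (ex t (mem_filter.1 ht).2).choose
    have e := RingHom.quotientKerEquivOfSurjective (ZMod.ringHom_surjective φ)
    rw [Ideal.absNorm_apply, Submodule.cardQuot_apply]
    exact (Nat.card_congr e.toEquiv).trans (Nat.card_zmod p)
  · intro t ht t' ht' h
    have h1 := (ex t (mem_filter.1 ht).2).choose_spec
    have h2 := (ex t' (mem_filter.1 ht').2).choose_spec
    set φ := (ex t (mem_filter.1 ht).2).choose
    set ψ := (ex t' (mem_filter.1 ht').2).choose
    have h3 : θ - (t : 𝓞 K) ∈ RingHom.ker φ := by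
      rw [RingHom.mem_ker, map_sub, map_natCast, h1, sub_self]
    rw [h, RingHom.mem_ker, map_sub, map_natCast, h2, sub_eq_zero, ZMod.natCast_eq_natCast_iff',
      Nat.mod_eq_of_lt (mem_range.1 (mem_filter.1 ht').1),
      Nat.mod_eq_of_lt (mem_range.1 (mem_filter.1 ht).1)] at h3
    exact h3.symm
  · intro I hI
    rw [mem_aset hpp] at hI
    have hc : Nat.card (𝓞 K ⧸ I) = p := by
      rw [Ideal.absNorm_apply, Submodule.cardQuot_apply] at hI; exact hI
    haveI : Finite (𝓞 K ⧸ I) := Nat.finite_of_card_ne_zero (by rw [hc]; exact hpp.ne_zero)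
    letI := Fintype.ofFinite (𝓞 K ⧸ I)
    have e := ZMod.ringEquivOfPrime (𝓞 K ⧸ I) hpp (by rw [← Nat.card_eq_fintype_card, hc])
    let ψ : 𝓞 K →+* ZMod p := e.symm.toRingHom.comp (Ideal.Quotient.mk I)
    have hker : RingHom.ker ψ = I := by
      ext x
      rw [RingHom.mem_ker]
      simp [ψ, Ideal.Quotient.eq_zero_iff_mem]
    have hroot : ((minpoly ℤ θ).map (Int.castRingHom (ZMod p))).eval (ψ θ) = 0 := by
      have h := congrArg ψ (minpoly.aeval ℤ θ)
      rw [aeval_def, hom_eval₂, map_zero] at h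
      rw [eval_map, ← h]
      congr 1
      exact RingHom.ext_int _ _
    refine ⟨(ψ θ).val, ?_, ?_⟩
    · rw [mem_filter, mem_range]
      refine ⟨ZMod.val_lt _, ?_⟩
      rw [hf, ZMod.natCast_zmod_val]; exact hroot
    · rw [← hker]
      congr 1
      refine hom_unique hp _ _ ?_
      have hd : (p : ℤ) ∣ k.f ((ψ θ).val : ℕ) := by
        rw [hf, ZMod.natCast_zmod_val]; exact hroot
      rw [(ex _ hd).choose_spec, ZMod.natCast_zmod_val]
lemma field_exists (k : Cub) (hf : Irreducible (X ^ 3 + C k.c2 * X ^ 2 + C k.c1 * X + C k.c0 : ℤ[X])) :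
    ∃ (K : Type) (_ : Field K) (_ : NumberField K) (θ : 𝓞 K), Module.finrank ℚ K ≤ 3 ∧
      minpoly ℤ θ = X ^ 3 + C k.c2 * X ^ 2 + C k.c1 * X + C k.c0 ∧ RingOfIntegers.exponent θ ≠ 0 := by
  set P := (X ^ 3 + C k.c2 * X ^ 2 + C k.c1 * X + C k.c0 : ℤ[X]) with hP
  have hm : P.Monic := by rw [hP]; monicity!
  have hd : P.natDegree = 3 := by rw [hP]; compute_degree!
  have hq := (Polynomial.IsPrimitive.Int.irreducible_iff_irreducible_map_cast hm.isPrimitive).1 hf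
  set Pq := P.map (Int.castRingHom ℚ) with hPq
  haveI : Fact (Irreducible Pq) := ⟨hq⟩
  have hmq : Pq.Monic := hm.map _
  have hdq : Pq.natDegree = 3 := by rw [hPq, hm.natDegree_map, hd]
  let pbs := AdjoinRoot.powerBasis hq.ne_zero
  haveI : FiniteDimensional ℚ (AdjoinRoot Pq) := pbs.finite
  haveI : CharZero (AdjoinRoot Pq) := algebraRat.charZero _
  haveI : NumberField (AdjoinRoot Pq) := ⟨⟩
  have hroot : aeval (AdjoinRoot.root Pq) P = 0 := by
    have := AdjoinRoot.eval₂_root Pq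
    rw [hPq, eval₂_map] at this
    rw [aeval_def, ← this]
    congr 1
  have hint : IsIntegral ℤ (AdjoinRoot.root Pq) := ⟨P, hm, by rw [← aeval_def]; exact hroot⟩
  let θ : 𝓞 (AdjoinRoot Pq) := ⟨AdjoinRoot.root Pq, hint⟩
  have hmin : minpoly ℤ θ = P := by
    have h0 : aeval θ P = 0 := by
      apply RingOfIntegers.coe_injective
      have := aeval_algebraMap_apply (AdjoinRoot Pq) θ P
      rw [map_zero]
      exact this.symm.trans hroot
    obtain ⟨S, hS⟩ := minpoly.isIntegrallyClosed_dvd (R := ℤ) θ.isIntegral h0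
    refine eq_of_monic_of_associated (minpoly.monic θ.isIntegral) hm ?_
    rcases hf.isUnit_or_isUnit hS with h | h
    · exact absurd h (minpoly.not_isUnit ℤ θ)
    · exact ⟨h.unit, hS.symm⟩
  refine ⟨AdjoinRoot Pq, inferInstance, inferInstance, θ, ?_, hmin, ?_⟩
  · rw [pbs.finrank, AdjoinRoot.powerBasis_dim, hdq]
  · have hadj : Algebra.adjoin ℚ {algebraMap (𝓞 (AdjoinRoot Pq)) (AdjoinRoot Pq) θ} = ⊤ :=
      AdjoinRoot.adjoinRoot_eq_top
    have h1 := conductor_mul_differentIdeal ℤ ℚ (AdjoinRoot Pq) θ hadj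
    have h2 : aeval θ (derivative (minpoly ℤ θ)) ≠ 0 := by
      intro h
      have h3 := minpoly.isIntegrallyClosed_dvd (R := ℤ) θ.isIntegral h
      have h4 : derivative (minpoly ℤ θ) ≠ 0 := by
        intro h0
        have := natDegree_eq_zero_of_derivative_eq_zero h0
        rw [hmin, hd] at this; omega
      have h5 := natDegree_le_of_dvd h3 h4
      have h6 := natDegree_derivative_lt (p := minpoly ℤ θ) (by rw [hmin, hd]; norm_num)
      omega
    have h3 : conductor ℤ θ ≠ ⊥ := by
      intro h0
      rw [h0, Ideal.bot_mul, eq_comm, Ideal.span_singleton_eq_bot] at h1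
      exact h2 h1
    unfold RingOfIntegers.exponent
    rw [Ne, Ideal.absNorm_eq_zero_iff]
    exact Ideal.IsIntegral.comap_ne_bot (R := ℤ) h3
end ME

set_option linter.unusedSectionVars false
namespace ME
open Finset Filter Topology NumberField
variable {K : Type} [Field K] [NumberField K]
lemma zeta_le : ∃ C : ℝ, 1 ≤ C ∧ ∀ u : ℝ, 0 < u → u ≤ 1 → ∀ M : ℕ,
    ∑ I ∈ IS K M, (Ideal.absNorm I : ℝ) ^ (-(1 + u)) ≤ C / u := by
  obtain ⟨C, hC0, hC⟩ := AA_le K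
  refine ⟨4 * C + 1, by linarith, fun u hu hu1 M => ?_⟩
  have hmap : ∀ I ∈ IS K M, Nat.log 2 (Ideal.absNorm I) ∈ range (M + 1) := by
    intro I hI
    rw [mem_range]
    have h1 := (mem_IS.1 hI).2
    have h2 := Nat.log_le_self 2 (Ideal.absNorm I)
    omega
  rw [← sum_fiberwise_of_maps_to hmap]
  have hr : (2:ℝ) ^ (-u) ≤ 1 - u / 2 := by
    have h := convexOn_exp.2 (Set.mem_univ (0:ℝ)) (Set.mem_univ (-Real.log 2))
      (show 0 ≤ 1 - u by linarith) hu.le (by ring)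
    rw [smul_eq_mul, smul_eq_mul, smul_eq_mul, smul_eq_mul, mul_zero, zero_add, Real.exp_zero, Real.exp_neg,
      Real.exp_log (by norm_num)] at h
    rw [Real.rpow_def_of_pos (by norm_num)]
    rw [show Real.log 2 * -u = u * -Real.log 2 by ring]
    linarith
  have hr0 : (0:ℝ) < 2 ^ (-u) := by positivity
  have hfib : ∀ j ∈ range (M + 1), ∑ I ∈ IS K M with Nat.log 2 (Ideal.absNorm I) = j,
      (Ideal.absNorm I : ℝ) ^ (-(1 + u)) ≤ 2 * C * ((2:ℝ) ^ (-u)) ^ j := by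
    intro j _
    have h1 : ∀ I ∈ (IS K M).filter (fun I => Nat.log 2 (Ideal.absNorm I) = j),
        (Ideal.absNorm I : ℝ) ^ (-(1 + u)) ≤ ((2:ℝ) ^ j) ^ (-(1 + u)) := by
      intro I hI
      rw [mem_filter, mem_IS] at hI
      refine Real.rpow_le_rpow_of_nonpos (by positivity) ?_ (by linarith)
      have := Nat.pow_log_le_self 2 (x := Ideal.absNorm I) (by have := norm_pos hI.1.1; omega)
      rw [hI.2] at this
      exact_mod_cast this
    refine (sum_le_card_nsmul _ _ _ h1).trans ?_
    rw [nsmul_eq_mul]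
    have h2 : (#((IS K M).filter (fun I => Nat.log 2 (Ideal.absNorm I) = j)) : ℝ) ≤ C * 2 ^ (j + 1) := by
      refine le_trans ?_ (hC _ (by positivity))
      unfold AA
      have : ⌊(2:ℝ) ^ (j + 1)⌋₊ = 2 ^ (j + 1) := by
        rw [← Nat.floor_natCast (R := ℝ) (2 ^ (j + 1))]; push_cast; rfl
      rw [this]
      have : (IS K M).filter (fun I => Nat.log 2 (Ideal.absNorm I) = j) ⊆ IS K (2 ^ (j + 1)) := by
        intro I hI
        rw [mem_filter, mem_IS] at hI
        rw [mem_IS]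
        refine ⟨hI.1.1, ?_⟩
        have := Nat.lt_pow_succ_log_self (b := 2) (by norm_num) (Ideal.absNorm I)
        rw [hI.2] at this
        exact this.le
      exact_mod_cast card_le_card this
    calc _ ≤ C * 2 ^ (j + 1) * ((2:ℝ) ^ j) ^ (-(1 + u)) := by gcongr
      _ = _ := by
        have e1 : ((2:ℝ) ^ j) ^ (-(1 + u)) = ((2:ℝ) ^ j)⁻¹ * ((2:ℝ) ^ (-u)) ^ j := by
          rw [neg_add, Real.rpow_add (by positivity), Real.rpow_neg_one]
          congr 1
          rw [← Real.rpow_natCast, ← Real.rpow_natCast, ← Real.rpow_mul (by norm_num), ← Real.rpow_mul (by norm_num), mul_comm]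
        rw [e1, pow_succ]
        field_simp
  refine (sum_le_sum hfib).trans ?_
  rw [← mul_sum]
  have hg : ∑ j ∈ range (M + 1), ((2:ℝ) ^ (-u)) ^ j ≤ 2 / u := by
    rw [geom_sum_eq (by linarith)]
    rw [div_le_iff_of_neg (by linarith), div_mul_eq_mul_div, div_le_iff₀ hu]
    have : (0:ℝ) < (2 ^ (-u)) ^ (M + 1) := by positivity
    nlinarith
  calc _ ≤ 2 * C * (2 / u) := by gcongr
    _ = 4 * C / u := by ring
    _ ≤ _ := by gcongr; linarith
lemma prod_le (S : Finset (Ideal (𝓞 K))) (hS : ∀ P ∈ S, Prime P) (s : ℝ) :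
    ∃ M : ℕ, ∏ P ∈ S, (1 + (Ideal.absNorm P : ℝ) ^ (-s)) ≤ ∑ I ∈ IS K M, (Ideal.absNorm I : ℝ) ^ (-s) := by
  classical
  refine ⟨Ideal.absNorm (∏ P ∈ S, P), ?_⟩
  rw [Finset.prod_one_add]
  have h1 : ∀ T ∈ S.powerset, ∏ P ∈ T, (Ideal.absNorm P : ℝ) ^ (-s) =
      (Ideal.absNorm (∏ P ∈ T, P) : ℝ) ^ (-s) := by
    intro T _
    rw [map_prod, Nat.cast_prod, Real.finsetProd_rpow _ _ (fun _ _ => by positivity)]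
  rw [sum_congr rfl h1]
  have hne : ∏ P ∈ S, P ≠ ⊥ := by
    rw [← Ideal.zero_eq_bot, prod_ne_zero_iff]; exact fun P hP => (hS P hP).ne_zero
  have hinj : Set.InjOn (fun T : Finset (Ideal (𝓞 K)) => ∏ P ∈ T, P) S.powerset := by
    have key : ∀ T ⊆ S, ∀ P ∈ S, P ∣ ∏ Q ∈ T, Q ↔ P ∈ T := by
      intro T hT P hP
      refine ⟨fun h => ?_, fun h => dvd_prod_of_mem _ h⟩
      obtain ⟨Q, hQ, hd⟩ := (hS P hP).exists_mem_finset_dvd h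
      have := associated_iff_eq.1 ((hS P hP).associated_of_dvd (hS Q (hT hQ)) hd)
      rwa [this]
    intro T hT T' hT' h
    simp only [coe_powerset, Set.mem_preimage, Set.mem_powerset_iff, coe_subset] at hT hT' h
    ext P
    constructor
    · intro hP
      rw [← key T' hT' P (hT hP), ← h]; exact dvd_prod_of_mem _ hP
    · intro hP
      rw [← key T hT P (hT' hP), h]; exact dvd_prod_of_mem _ hP
  rw [← sum_image (f := fun I : Ideal (𝓞 K) => (Ideal.absNorm I : ℝ) ^ (-s)) hinj]
  refine sum_le_sum_of_subset_of_nonneg ?_ (fun _ _ _ => by positivity)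
  intro I hI
  obtain ⟨T, hT, rfl⟩ := mem_image.1 hI
  rw [mem_powerset] at hT
  rw [mem_IS]
  refine ⟨?_, norm_mono hne (prod_dvd_prod_of_subset _ _ _ hT)⟩
  rw [← Ideal.zero_eq_bot, prod_ne_zero_iff]; exact fun P hP => (hS P (hT hP)).ne_zero
lemma E2_aux (h3 : Module.finrank ℚ K ≤ 3) : ∃ C : ℝ, ∀ n : ℕ, 3 ≤ n →
    ∑ p ∈ Nat.primesLE n, (aa K p : ℝ) / p ≤ Real.log (Real.log n) + C := by
  classical
  obtain ⟨C, hC1, hC⟩ := zeta_le (K := K)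
  have hsum : Summable (fun p : ℕ => 1 / (p : ℝ) ^ 2) := Real.summable_one_div_nat_pow.2 (by norm_num)
  refine ⟨Real.log C + 3 * ∑' p : ℕ, 1 / (p : ℝ) ^ 2 + 9, fun n hn => ?_⟩
  have hn0 : (0:ℝ) < n := by positivity
  have hL : 1 ≤ Real.log n := by
    rw [Real.le_log_iff_exp_le hn0]
    have : (3:ℝ) ≤ n := by exact_mod_cast hn
    linarith [Real.exp_one_lt_d9]
  set L := Real.log n with hLdef
  set u := 1 / L with hu
  have hu0 : 0 < u := by positivity
  have hu1 : u ≤ 1 := by rw [hu, div_le_one (by linarith)]; exact hL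
  set S := (Nat.primesLE n).biUnion (aset K) with hSdef
  have hdis : Set.PairwiseDisjoint (↑(Nat.primesLE n)) (aset K) := by
    intro p hp p' hp' hne
    rw [Function.onFun, disjoint_left]
    intro P hP hP'
    exact hne (((mem_aset (Nat.prime_of_mem_primesLE hp)).1 hP).symm.trans
      ((mem_aset (Nat.prime_of_mem_primesLE hp')).1 hP'))
  have hS : ∀ P ∈ S, Prime P := by
    intro P hP
    obtain ⟨p, hp, h⟩ := mem_biUnion.1 hP
    have hp' := Nat.prime_of_mem_primesLE hp
    exact prime_of_norm hp' ((mem_aset hp').1 h)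
  have hgroup : ∀ g : ℕ → ℝ, ∑ P ∈ S, g (Ideal.absNorm P) = ∑ p ∈ Nat.primesLE n, aa K p * g p := by
    intro g
    rw [hSdef, sum_biUnion hdis]
    refine sum_congr rfl fun p hp => ?_
    rw [sum_congr rfl (g := fun _ => g p) (fun P hP => by
      rw [(mem_aset (Nat.prime_of_mem_primesLE hp)).1 hP]), sum_const, nsmul_eq_mul, aa]
  obtain ⟨M, hM⟩ := prod_le S hS (1 + u)
  have h1 := hM.trans (hC u hu0 hu1 M)
  have hpos : ∀ P ∈ S, (0:ℝ) < 1 + (Ideal.absNorm P : ℝ) ^ (-(1 + u)) := fun P _ => by positivity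
  have h2 := Real.log_le_log (prod_pos hpos) h1
  rw [Real.log_prod (fun P hP => (hpos P hP).ne')] at h2
  have h3' : Real.log (C / u) = Real.log C + Real.log L := by
    rw [hu, div_div_eq_mul_div, div_one, Real.log_mul (by positivity) (by positivity)]
  rw [h3', hgroup (fun m => Real.log (1 + (m:ℝ) ^ (-(1 + u))))] at h2
  have h4 : ∀ p ∈ Nat.primesLE n, (aa K p : ℝ) / p - 3 * (Real.log p / p / L) - 3 * (1 / (p:ℝ) ^ 2) ≤
      aa K p * Real.log (1 + (p:ℝ) ^ (-(1 + u))) := by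
    intro p hp
    have hp' := Nat.prime_of_mem_primesLE hp
    have hp2 : (2:ℝ) ≤ p := by exact_mod_cast hp'.two_le
    have ha : (aa K p : ℝ) ≤ 3 := by exact_mod_cast (aa_le p hp').trans h3
    have ha0 : (0:ℝ) ≤ aa K p := by positivity
    set v := (p:ℝ) ^ (-(1 + u)) with hv
    have hv0 : 0 < v := by positivity
    have hvp : v = 1 / p * Real.exp (-(Real.log p / L)) := by
      rw [hv, neg_add, Real.rpow_add (by positivity), Real.rpow_neg_one, one_div,
        Real.rpow_def_of_pos (by positivity)]
      congr 2
      rw [hu]; ring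
    have hlp : 0 ≤ Real.log p := Real.log_natCast_nonneg _
    have hv1 : v ≤ 1 / p := by
      rw [hvp]
      refine mul_le_of_le_one_right (by positivity) ?_
      rw [Real.exp_le_one_iff]
      have : 0 ≤ Real.log p / L := by positivity
      linarith
    have hv2 : 1 / p - Real.log p / p / L ≤ v := by
      rw [hvp]
      have := Real.add_one_le_exp (-(Real.log p / L))
      calc 1 / p - Real.log p / p / L = 1 / p * (-(Real.log p / L) + 1) := by ring
        _ ≤ _ := by gcongr
    have hlog : v - v ^ 2 ≤ Real.log (1 + v) := by
      have := Real.one_sub_inv_le_log_of_pos (show 0 < 1 + v by linarith)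
      refine le_trans ?_ this
      have e : 1 - (1 + v)⁻¹ = v / (1 + v) := by field_simp; ring
      rw [e, le_div_iff₀ (by linarith)]
      nlinarith [pow_pos hv0 3]
    have hv3 : v ^ 2 ≤ 1 / (p:ℝ) ^ 2 := by
      rw [← one_div_pow]; gcongr
    have hlast : 1 / (p:ℝ) - Real.log p / p / L - 1 / (p:ℝ)^2 ≤ Real.log (1 + v) := by linarith
    have hx : 0 ≤ Real.log p / p / L := by positivity
    have hy : 0 ≤ 1 / (p:ℝ)^2 := by positivity
    calc _ ≤ aa K p * (1 / (p:ℝ) - Real.log p / p / L - 1 / (p:ℝ)^2) := by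
          have t1 := mul_le_mul_of_nonneg_right ha hx
          have t2 := mul_le_mul_of_nonneg_right ha hy
          have t3 : (aa K p : ℝ) / p = aa K p * (1 / p) := by ring
          rw [mul_sub, mul_sub, t3]
          linarith
      _ ≤ _ := by gcongr
  have h5 := (sum_le_sum h4).trans h2
  rw [sum_sub_distrib, sum_sub_distrib, ← mul_sum, ← mul_sum, ← sum_div] at h5
  have h6 := mertens_le n (by omega)
  have h7 : (∑ p ∈ Nat.primesLE n, Real.log p / p) / L ≤ 3 := by
    rw [div_le_iff₀ (by linarith)]; linarith
  have h8 : ∑ p ∈ Nat.primesLE n, 1 / (p:ℝ) ^ 2 ≤ ∑' p : ℕ, 1 / (p : ℝ) ^ 2 :=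
    hsum.sum_le_tsum _ (fun p _ => by positivity)
  linarith
open Polynomial in
lemma rho_le (k : Cub) {p : ℕ} (hp : p.Prime) : rho k p ≤ 3 := by
  have : Fact p.Prime := ⟨hp⟩
  set P := (X ^ 3 + C (k.c2 : ZMod p) * X ^ 2 + C (k.c1 : ZMod p) * X + C (k.c0 : ZMod p) : (ZMod p)[X]) with hP
  have hm : P.Monic := by rw [hP]; monicity!
  have hd : P.natDegree = 3 := by rw [hP]; compute_degree!
  have h1 : #P.roots.toFinset ≤ 3 := (Multiset.toFinset_card_le _).trans (hd ▸ P.card_roots')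
  refine le_trans ?_ h1
  refine card_le_card_of_injOn (fun t : ℕ => (t : ZMod p)) ?_ ?_
  · intro t ht
    rw [mem_coe, mem_filter] at ht
    simp only [mem_coe, Multiset.mem_toFinset]
    rw [mem_roots hm.ne_zero, IsRoot.def]
    have h := (ZMod.intCast_zmod_eq_zero_iff_dvd _ _).2 ht.2
    rw [Cub.f] at h
    push_cast at h
    rw [hP]; simpa using h
  · intro t ht t' ht' h
    rw [mem_coe, mem_filter, mem_range] at ht ht'
    have := (ZMod.natCast_eq_natCast_iff' _ _ _).1 h
    rwa [Nat.mod_eq_of_lt ht.1, Nat.mod_eq_of_lt ht'.1] at this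
open Polynomial in
lemma rho_main (k : Cub) (hf : Irreducible (X ^ 3 + C k.c2 * X ^ 2 + C k.c1 * X + C k.c0 : ℤ[X])) :
    Tendsto (fun n : ℕ => (∑ p ∈ Nat.primesLE n, rho k p * Real.log p / p) / Real.log n) atTop (𝓝 1) ∧
    ∃ C : ℝ, ∀ n : ℕ, 3 ≤ n →
      ∑ p ∈ Nat.primesLE n, (rho k p : ℝ) / p ≤ Real.log (Real.log n) + C := by
  obtain ⟨K, _, _, θ, h3, hθ, he⟩ := field_exists k hf
  have hdiff : ∀ p, p.Prime → |(rho k p : ℝ) - aa K p| ≤ if p ∣ RingOfIntegers.exponent θ then 3 else 0 := by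
    intro p hp
    split_ifs with h
    · have h1 : (rho k p : ℝ) ≤ 3 := by exact_mod_cast rho_le k hp
      have h2 : (aa K p : ℝ) ≤ 3 := by exact_mod_cast (aa_le p hp).trans h3
      rw [abs_le]
      constructor <;> linarith [(Nat.cast_nonneg (rho k p) : (0:ℝ) ≤ _), (Nat.cast_nonneg (aa K p) : (0:ℝ) ≤ _)]
    · rw [aa_eq k hθ hp h, sub_self, abs_zero]
  have hgen : ∀ (g : ℕ → ℝ), (∀ p, 0 ≤ g p) → ∀ n, |∑ p ∈ Nat.primesLE n, rho k p * g p -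
      ∑ p ∈ Nat.primesLE n, aa K p * g p| ≤ ∑ p ∈ (RingOfIntegers.exponent θ).divisors, 3 * g p := by
    intro g hg n
    rw [← sum_sub_distrib]
    refine (abs_sum_le_sum_abs _ _).trans ?_
    refine le_trans (sum_le_sum (g := fun p => if p ∣ RingOfIntegers.exponent θ then 3 * g p else 0) fun p hp => ?_) ?_
    · rw [← sub_mul, abs_mul, abs_of_nonneg (hg p)]
      have := hdiff p (Nat.prime_of_mem_primesLE hp)
      split_ifs at this ⊢
      · exact mul_le_mul_of_nonneg_right this (hg p)
      · exact (mul_le_mul_of_nonneg_right this (hg p)).trans (by simp)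
    · rw [← sum_filter]
      refine sum_le_sum_of_subset_of_nonneg ?_ (fun p _ _ => by have := hg p; positivity)
      intro p hp
      rw [Nat.mem_divisors]
      exact ⟨(mem_filter.1 hp).2, he⟩
  constructor
  · have h1 := E1 (K := K) h3
    set Dc := ∑ p ∈ (RingOfIntegers.exponent θ).divisors, 3 * (Real.log p / p)
    have h2 : Tendsto (fun n : ℕ => (∑ p ∈ Nat.primesLE n, rho k p * Real.log p / p) / Real.log n -
        (∑ p ∈ Nat.primesLE n, aa K p * Real.log p / p) / Real.log n) atTop (𝓝 0) := by
      have h4 : Tendsto (fun n : ℕ => Dc / Real.log n) atTop (𝓝 0) :=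
        (Real.tendsto_log_atTop.comp tendsto_natCast_atTop_atTop).const_div_atTop Dc
      refine squeeze_zero_norm (fun n => ?_) h4
      rw [← sub_div, Real.norm_eq_abs, abs_div, abs_of_nonneg (Real.log_natCast_nonneg n)]
      have := hgen (fun p => Real.log p / p) (fun p => div_nonneg (Real.log_natCast_nonneg p) (by positivity)) n
      simp only [← mul_div_assoc] at this
      have hl := Real.log_natCast_nonneg n
      simp only [Dc, ← mul_div_assoc]
      gcongr
    simpa using h2.add h1
  · obtain ⟨C, hC⟩ := E2_aux (K := K) h3
    refine ⟨C + ∑ p ∈ (RingOfIntegers.exponent θ).divisors, 3 * (1 / (p:ℝ)), fun n hn => ?_⟩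
    have h1 := hC n hn
    have h2 := (abs_le.1 (hgen (fun p => 1 / (p:ℝ)) (fun p => by positivity) n)).2
    simp only [mul_one_div] at h2 ⊢
    linarith
end ME

set_option linter.unusedSectionVars false
namespace LV
open Finset
lemma geo (D : ℕ) [NeZero D] (h : ZMod D) (h0 : h ≠ 0) (T : ℕ) :
    ‖∑ b ∈ range T, (ZMod.stdAddChar (h * (b : ZMod D)) : ℂ)‖ ≤ D / (2 * |(h.valMinAbs : ℝ)|) := by
  have hD : (0:ℝ) < D := by exact_mod_cast NeZero.pos D
  set m : ℤ := h.valMinAbs with hm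
  have hm0 : m ≠ 0 := by rw [hm, Ne, ZMod.valMinAbs_eq_zero]; exact h0
  have hm1 : (0:ℝ) < |(m:ℝ)| := by positivity
  have hle : |(m:ℝ)| ≤ D / 2 := by
    have := ZMod.natAbs_valMinAbs_le h
    rw [← hm] at this
    have h2 : (2:ℝ) * (m.natAbs : ℝ) ≤ D := by exact_mod_cast (by omega : 2 * m.natAbs ≤ D)
    rw [Nat.cast_natAbs, Int.cast_abs] at h2
    linarith
  set z : ℂ := ZMod.stdAddChar h with hz
  have e1 : ∀ b : ℕ, (ZMod.stdAddChar (h * (b : ZMod D)) : ℂ) = z ^ b := by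
    intro b
    rw [hz, ← AddChar.map_nsmul_eq_pow, nsmul_eq_mul, mul_comm]
  simp only [e1]
  have hze : z = Complex.exp (Complex.I * ((2 * Real.pi * m / D : ℝ) : ℂ)) := by
    have : h = ((m : ℤ) : ZMod D) := by rw [hm, ZMod.coe_valMinAbs]
    rw [hz, this, ZMod.stdAddChar_coe]
    congr 1; push_cast; ring
  have hn : 4 * |(m:ℝ)| / D ≤ ‖z - 1‖ := by
    rw [hze, Complex.norm_exp_I_mul_ofReal_sub_one]
    rw [show 2 * Real.pi * m / D / 2 = Real.pi * m / D by ring, norm_mul, Real.norm_eq_abs, Real.norm_eq_abs]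
    have e : |Real.pi * m / D| = Real.pi * |(m:ℝ)| / D := by
      rw [abs_div, abs_mul, abs_of_pos Real.pi_pos, abs_of_pos hD]
    have h3 := Real.mul_abs_le_abs_sin (x := Real.pi * m / D) (by
      rw [e, div_le_div_iff₀ hD (by norm_num)]; nlinarith [Real.pi_pos])
    rw [e] at h3
    have h4 : 2 / Real.pi * (Real.pi * |(m:ℝ)| / D) = 2 * |(m:ℝ)| / D := by
      field_simp
    rw [h4] at h3
    rw [abs_two, show 4 * |(m:ℝ)| / D = 2 * (2 * |(m:ℝ)| / D) by ring]
    linarith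
  have hz1 : z ≠ 1 := by
    intro h; rw [h, sub_self, norm_zero] at hn
    have : 0 < 4 * |(m:ℝ)| / D := by positivity
    linarith
  have hzn : ‖z‖ = 1 := AddChar.norm_apply _ _
  rw [geom_sum_eq hz1, norm_div]
  have h5 : ‖z ^ T - 1‖ ≤ 2 := by
    calc _ ≤ ‖z ^ T‖ + ‖(1:ℂ)‖ := norm_sub_le _ _
      _ = 2 := by rw [norm_pow, hzn]; norm_num
  calc _ ≤ 2 / (4 * |(m:ℝ)| / D) := by gcongr
    _ = _ := by field_simp; norm_num
lemma lat1 (D : ℕ) [NeZero D] (u A : ZMod D) (T : ℕ) :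
    |((#{x ∈ range T ×ˢ range T | (x.1 : ZMod D) = u * (x.2 : ZMod D) + A} : ℕ) : ℝ) - (T:ℝ) ^ 2 / D| ≤
      (∑ h ∈ (univ : Finset (ZMod D)).erase 0, ‖∑ b ∈ range T, (ZMod.stdAddChar (h * (b : ZMod D)) : ℂ)‖ *
        ‖∑ b ∈ range T, (ZMod.stdAddChar (-(h * u) * (b : ZMod D)) : ℂ)‖) / D := by
  have hD : (0:ℝ) < D := by exact_mod_cast NeZero.pos D
  have hDc : (D:ℂ) ≠ 0 := by exact_mod_cast hD.ne'
  have h1 : ∀ y : ZMod D, (if y = 0 then (1:ℂ) else 0) = (∑ h : ZMod D, (ZMod.stdAddChar (h * y) : ℂ)) / D := by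
    intro y
    rw [AddChar.sum_mulShift y (ZMod.isPrimitive_stdAddChar D), ZMod.card]
    split_ifs <;> simp [hDc]
  have h2 : ((#{x ∈ range T ×ˢ range T | (x.1 : ZMod D) = u * (x.2 : ZMod D) + A} : ℕ) : ℂ) =
      (∑ h : ZMod D, ZMod.stdAddChar (-(h * A)) * ((∑ b ∈ range T, (ZMod.stdAddChar (h * (b : ZMod D)) : ℂ)) *
        (∑ b ∈ range T, (ZMod.stdAddChar (-(h * u) * (b : ZMod D)) : ℂ)))) / D := by
    rw [card_filter]
    push_cast
    have : ∀ x ∈ range T ×ˢ range T, (if (x.1 : ZMod D) = u * (x.2 : ZMod D) + A then (1:ℂ) else 0) =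
        (∑ h : ZMod D, (ZMod.stdAddChar (h * ((x.1 : ZMod D) - (u * (x.2 : ZMod D) + A))) : ℂ)) / D := by
      intro x _
      rw [← h1]; simp only [sub_eq_zero]
    rw [sum_congr rfl this, ← sum_div, sum_comm]
    congr 1
    refine sum_congr rfl fun h _ => ?_
    rw [sum_mul_sum, mul_sum, sum_product]
    refine sum_congr rfl fun b _ => ?_
    rw [mul_sum]
    refine sum_congr rfl fun c _ => ?_
    rw [← AddChar.map_add_eq_mul, ← AddChar.map_add_eq_mul]
    congr 1; ring
  rw [← Real.norm_eq_abs, ← Complex.norm_real]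
  push_cast
  rw [h2, ← add_sum_erase _ _ (mem_univ (0 : ZMod D))]
  simp only [zero_mul, neg_zero, AddChar.map_zero_eq_one, sum_const, card_range, nsmul_eq_mul, mul_one, one_mul]
  rw [show ∀ S : ℂ, ((T:ℂ) * T + S) / D - T ^ 2 / D = S / D by intro S; ring, norm_div, Complex.norm_natCast]
  gcongr
  refine (norm_sum_le _ _).trans (le_of_eq (sum_congr rfl fun h _ => ?_))
  rw [norm_mul, norm_mul, AddChar.norm_apply, one_mul]
noncomputable def PP (Q : ℕ) : Finset (ℤ × ℤ) := ((Icc (-(Q:ℤ)) Q).erase 0) ×ˢ ((Icc (-(Q:ℤ)) Q).erase 0)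
lemma lat2 (D : ℕ) [NeZero D] (k : ℤ) (A : ZMod D) (T Q : ℕ) (hDQ : D ≤ Q) (hu : IsUnit (k : ZMod D)) :
    |((#{x ∈ range T ×ˢ range T | (x.1 : ZMod D) = (k : ZMod D) * (x.2 : ZMod D) + A} : ℕ) : ℝ) - (T:ℝ) ^ 2 / D| ≤
      ∑ x ∈ PP Q, if (D:ℤ) ∣ x.2 + x.1 * k then (Q:ℝ) / (4 * |(x.1:ℝ)| * |(x.2:ℝ)|) else 0 := by
  have hD : (0:ℝ) < D := by exact_mod_cast NeZero.pos D
  refine (lat1 D _ A T).trans ?_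
  set φ : ZMod D → ℤ × ℤ := fun h => (h.valMinAbs, (-(h * (k:ZMod D))).valMinAbs) with hφ
  have hne : ∀ h : ZMod D, h ≠ 0 → -(h * (k:ZMod D)) ≠ 0 := by
    intro h h0 h1
    rw [neg_eq_zero] at h1
    exact h0 (hu.mul_left_eq_zero.1 h1)
  have hb : ∀ h : ZMod D, h ≠ 0 → h.valMinAbs ∈ (Icc (-(Q:ℤ)) Q).erase 0 := by
    intro h h0
    rw [mem_erase, mem_Icc, Ne, ZMod.valMinAbs_eq_zero]
    have := ZMod.natAbs_valMinAbs_le h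
    exact ⟨h0, by omega, by omega⟩
  rw [← sum_filter]
  have hinj : Set.InjOn φ ((univ : Finset (ZMod D)).erase 0) := by
    intro h _ h' _ he
    exact ZMod.injective_valMinAbs (congrArg Prod.fst he)
  have hsub : ((univ : Finset (ZMod D)).erase 0).image φ ⊆ (PP Q).filter (fun x => (D:ℤ) ∣ x.2 + x.1 * k) := by
    intro x hx
    rw [mem_image] at hx
    obtain ⟨h, hh, rfl⟩ := hx
    have h0 := (mem_erase.1 hh).1
    rw [mem_filter]
    refine ⟨mem_product.2 ⟨hb h h0, hb _ (hne h h0)⟩, ?_⟩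
    rw [← ZMod.intCast_zmod_eq_zero_iff_dvd]
    simp only [hφ]
    push_cast
    ring
  refine le_trans ?_ (sum_le_sum_of_subset_of_nonneg hsub (fun _ _ _ => by positivity))
  rw [sum_image hinj, sum_div]
  refine sum_le_sum fun h hh => ?_
  have h0 := (mem_erase.1 hh).1
  have p1 : (0:ℝ) < |(h.valMinAbs : ℝ)| := by
    have : h.valMinAbs ≠ 0 := by rwa [Ne, ZMod.valMinAbs_eq_zero]
    positivity
  have p2 : (0:ℝ) < |((-(h * (k:ZMod D))).valMinAbs : ℝ)| := by
    have : (-(h * (k:ZMod D))).valMinAbs ≠ 0 := by rw [Ne, ZMod.valMinAbs_eq_zero]; exact hne h h0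
    positivity
  calc _ ≤ (D / (2 * |(h.valMinAbs : ℝ)|)) * (D / (2 * |((-(h * (k:ZMod D))).valMinAbs : ℝ)|)) / D := by
        gcongr
        · exact geo D h h0 T
        · exact geo D _ (hne h h0) T
    _ = D / (4 * |(h.valMinAbs : ℝ)| * |((-(h * (k:ZMod D))).valMinAbs : ℝ)|) := by
        field_simp; ring
    _ ≤ _ := by
        simp only [hφ]
        gcongr
lemma harm (Q : ℕ) : ∑ h ∈ (Icc (-(Q:ℤ)) Q).erase 0, 1 / |(h:ℝ)| ≤ 2 * (1 + Real.log Q) := by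
  have : (Icc (-(Q:ℤ)) Q).erase 0 ⊆ (Icc 1 Q).image (fun n : ℕ => (n:ℤ)) ∪ (Icc 1 Q).image (fun n : ℕ => -(n:ℤ)) := by
    intro h hh
    rw [mem_erase, mem_Icc] at hh
    rw [mem_union, mem_image, mem_image]
    rcases lt_or_ge h 0 with h0 | h0
    · right; exact ⟨h.natAbs, by rw [mem_Icc]; omega, by omega⟩
    · left; exact ⟨h.natAbs, by rw [mem_Icc]; omega, by omega⟩
  refine (sum_le_sum_of_subset_of_nonneg this (fun _ _ _ => by positivity)).trans ?_
  have h1 : ∑ n ∈ Icc 1 Q, 1 / (n:ℝ) ≤ 1 + Real.log Q := by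
    have := harmonic_le_one_add_log Q
    rw [harmonic_eq_sum_Icc] at this
    push_cast at this
    simpa using this
  have h2 := sum_union_inter (s₁ := (Icc 1 Q).image (fun n : ℕ => (n:ℤ))) (s₂ := (Icc 1 Q).image (fun n : ℕ => -(n:ℤ)))
    (f := fun h : ℤ => 1 / |(h:ℝ)|)
  have h3 : 0 ≤ ∑ h ∈ (Icc 1 Q).image (fun n : ℕ => (n:ℤ)) ∩ (Icc 1 Q).image (fun n : ℕ => -(n:ℤ)), 1 / |(h:ℝ)| :=
    sum_nonneg fun _ _ => by positivity
  rw [sum_image (fun a _ b _ h => by simpa using h), sum_image (fun a _ b _ h => by simpa using h)] at h2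
  simp only [Int.cast_neg, Int.cast_natCast, abs_neg, Nat.abs_cast] at h2
  linarith
theorem level {ι : Type*} (I : Finset ι) (D : ι → ℕ) (k : ι → ℤ) (A : ∀ i, ZMod (D i)) (T Q : ℕ) (Mu : ℝ)
    (hD0 : ∀ i ∈ I, D i ≠ 0) (hDQ : ∀ i ∈ I, D i ≤ Q) (hu : ∀ i ∈ I, IsUnit (k i : ZMod (D i)))
    (hMu : ∀ h h' : ℤ, h ≠ 0 → h' ≠ 0 → |h| ≤ Q → |h'| ≤ Q → ((#{i ∈ I | (D i : ℤ) ∣ h' + h * k i} : ℕ) : ℝ) ≤ Mu) :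
    ∑ i ∈ I, |((#{x ∈ range T ×ˢ range T | (x.1 : ZMod (D i)) = (k i : ZMod (D i)) * (x.2 : ZMod (D i)) + A i} : ℕ) : ℝ)
      - (T:ℝ) ^ 2 / D i| ≤ Q * Mu * (1 + Real.log Q) ^ 2 := by
  have h1 : ∀ i ∈ I, _ := fun i hi => by
    haveI : NeZero (D i) := ⟨hD0 i hi⟩
    exact lat2 (D i) (k i) (A i) T Q (hDQ i hi) (hu i hi)
  refine (sum_le_sum h1).trans ?_
  rw [sum_comm]
  have h2 : ∀ x ∈ PP Q, ∑ i ∈ I, (if (D i:ℤ) ∣ x.2 + x.1 * k i then (Q:ℝ) / (4 * |(x.1:ℝ)| * |(x.2:ℝ)|) else 0) ≤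
      (Q * Mu / 4) * ((1 / |(x.1:ℝ)|) * (1 / |(x.2:ℝ)|)) := by
    intro x hx
    simp only [PP, mem_product, mem_erase, mem_Icc] at hx
    obtain ⟨⟨a1, a2⟩, a3, a4⟩ := hx
    rw [← sum_filter, sum_const, nsmul_eq_mul]
    have := hMu x.1 x.2 a1 a3 (abs_le.2 a2) (abs_le.2 a4)
    calc _ ≤ Mu * ((Q:ℝ) / (4 * |(x.1:ℝ)| * |(x.2:ℝ)|)) := by gcongr
      _ = _ := by field_simp
  refine (sum_le_sum h2).trans ?_
  rw [← mul_sum, PP, sum_product]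
  simp only [← mul_sum]
  rw [← sum_mul]
  rcases Nat.eq_zero_or_pos Q with h0 | h0
  · simp [h0]
  have hMu0 : 0 ≤ Mu := le_trans (Nat.cast_nonneg _) (hMu 1 1 one_ne_zero one_ne_zero (by simp; omega) (by simp; omega))
  have hl : 0 ≤ Real.log Q := Real.log_natCast_nonneg Q
  have hs : 0 ≤ ∑ h ∈ (Icc (-(Q:ℤ)) Q).erase 0, 1 / |(h:ℝ)| := sum_nonneg fun _ _ => by positivity
  have hh := harm Q
  calc _ ≤ Q * Mu / 4 * ((2 * (1 + Real.log Q)) * (2 * (1 + Real.log Q))) := by gcongr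
    _ = _ := by ring
def Adm (k : Cub) (W : ℕ) {m : ℕ} (v : Fin m → ℕ × ℕ) : Prop :=
  (∀ j, (v j).1.Prime ∧ W < (v j).1 ∧ (v j).2 < (v j).1 ∧ ((v j).1 : ℤ) ∣ k.f ((v j).2 : ℕ)) ∧
    Function.Injective (fun j => (v j).1)
def DD {m : ℕ} (v : Fin m → ℕ × ℕ) : ℕ := ∏ j, (v j).1
def Hit {m : ℕ} (v : Fin m → ℕ × ℕ) (b c : ℤ) : Prop := ∀ j, ((v j).1 : ℤ) ∣ b - (v j).2 * c
lemma f_congr (k : Cub) {l x y : ℤ} (h : l ∣ x - y) : l ∣ k.f x - k.f y := by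
  have : k.f x - k.f y = (x - y) * (x ^ 2 + x * y + y ^ 2 + k.c2 * (x + y) + k.c1) := by
    simp only [Cub.f]; ring
  rw [this]; exact h.mul_right _
lemma F_of_root (k : Cub) {l κ b c : ℤ} (h : l ∣ k.f κ) (hb : l ∣ b - κ * c) : l ∣ k.F b c := by
  have : k.F b c = c ^ 3 * k.f κ + (b - κ * c) * (b ^ 2 + b * (κ * c) + (κ * c) ^ 2
      + k.c2 * c * (b + κ * c) + k.c1 * c ^ 2) := by
    simp only [Cub.f, Cub.F]; ring
  rw [this]
  exact dvd_add (h.mul_left _) (hb.mul_right _)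
lemma dd_dvd {m : ℕ} {v : Fin m → ℕ × ℕ} (hp : ∀ j, (v j).1.Prime) (hi : Function.Injective (fun j => (v j).1))
    (x : ℤ) : ((DD v : ℕ) : ℤ) ∣ x ↔ ∀ j, ((v j).1 : ℤ) ∣ x := by
  constructor
  · intro h j
    refine dvd_trans ?_ h
    exact_mod_cast dvd_prod_of_mem (fun j => (v j).1) (mem_univ j)
  · intro h
    rw [DD]; push_cast
    refine Finset.prod_dvd_of_coprime (t := univ) (s := fun j => ((v j).1 : ℤ)) ?_ (fun j _ => h j)
    intro i _ j _ hij
    exact Nat.isCoprime_iff_coprime.2 ((Nat.coprime_primes (hp i) (hp j)).2 fun h => hij (hi h))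
lemma crt {m : ℕ} {v : Fin m → ℕ × ℕ} (hp : ∀ j, (v j).1.Prime) (hi : Function.Injective (fun j => (v j).1)) :
    ∃ κ : ℤ, ∀ j, ((v j).1 : ℤ) ∣ κ - (v j).2 := by
  obtain ⟨κ, hκ⟩ := Nat.chineseRemainderOfFinset (fun j => (v j).2) (fun j => (v j).1) univ
    (fun j _ => (hp j).ne_zero) (by
      intro i _ j _ hij
      exact (Nat.coprime_primes (hp i) (hp j)).2 fun h => hij (hi h))
  exact ⟨κ, fun j => Nat.modEq_iff_dvd.1 (hκ j (mem_univ j)).symm⟩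
lemma card_pf {n : ℕ} (hn : n ≠ 0) : #n.primeFactors ≤ Nat.log 2 n := by
  refine Nat.le_log_of_pow_le (by norm_num) ?_
  calc 2 ^ #n.primeFactors ≤ ∏ p ∈ n.primeFactors, p := by
        rw [← prod_const]
        exact prod_le_prod' fun p hp => (Nat.prime_of_mem_primeFactors hp).two_le
    _ ≤ n := Nat.le_of_dvd (Nat.pos_of_ne_zero hn) (Nat.prod_primeFactors_dvd n)
def SS (k : Cub) : ℕ := 1 + k.c0.natAbs + k.c1.natAbs + k.c2.natAbs
lemma F_bd (k : Cub) {b c Q : ℤ} (hb : |b| ≤ Q) (hc : |c| ≤ Q) : |k.F b c| ≤ SS k * Q ^ 3 := by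
  have hQ : 0 ≤ Q := (abs_nonneg _).trans hb
  unfold Cub.F SS
  push_cast
  calc _ ≤ |b| ^ 3 + |k.c2| * |b| ^ 2 * |c| + |k.c1| * |b| * |c| ^ 2 + |k.c0| * |c| ^ 3 := by
        refine (abs_add_le _ _).trans (add_le_add ((abs_add_le _ _).trans (add_le_add ((abs_add_le _ _).trans (add_le_add ?_ ?_)) ?_)) ?_) <;>
        simp [abs_mul, abs_pow]
    _ ≤ Q ^ 3 + |k.c2| * Q ^ 2 * Q + |k.c1| * Q * Q ^ 2 + |k.c0| * Q ^ 3 := by gcongr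
    _ = _ := by ring
def ZZ (k : Cub) (n : ℕ) : Finset (ℕ × ℕ) :=
  n.primeFactors.biUnion fun l => ((range l).filter fun t : ℕ => (l:ℤ) ∣ k.f ((t:ℕ):ℤ)).image (fun t => (l, t))
lemma card_ZZ (k : Cub) {n : ℕ} (hn : n ≠ 0) : #(ZZ k n) ≤ 3 * Nat.log 2 n := by
  refine card_biUnion_le.trans ?_
  calc _ ≤ ∑ l ∈ n.primeFactors, 3 := by
        refine sum_le_sum fun l hl => card_image_le.trans ?_
        exact ME.rho_le k (Nat.prime_of_mem_primeFactors hl)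
    _ = 3 * #n.primeFactors := by rw [sum_const, smul_eq_mul, mul_comm]
    _ ≤ _ := Nat.mul_le_mul_left _ (card_pf hn)
lemma mult (k : Cub) (hk : k.Good) {m : ℕ} (I : Finset (Fin m → ℕ × ℕ)) (W : ℕ) (hI : ∀ v ∈ I, Adm k W v)
    {Q b c : ℤ} (hb : |b| ≤ Q) (hc : |c| ≤ Q) (h0 : b ≠ 0 ∨ c ≠ 0) :
    #(I.filter fun v => ∀ j, ((v j).1 : ℤ) ∣ b - (v j).2 * c) ≤ (3 * Nat.log 2 (SS k * Q.natAbs ^ 3)) ^ m := by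
  have hF : k.F b c ≠ 0 := fun h => by obtain ⟨h1, h2⟩ := hk _ _ h; tauto
  have hn : (k.F b c).natAbs ≠ 0 := by simpa using hF
  have hle : (k.F b c).natAbs ≤ SS k * Q.natAbs ^ 3 := by
    have := F_bd k hb hc
    zify; rwa [abs_of_nonneg ((abs_nonneg _).trans hb)]
  have hsub : (I.filter fun v => ∀ j, ((v j).1 : ℤ) ∣ b - (v j).2 * c) ⊆
      Fintype.piFinset (fun _ => ZZ k (k.F b c).natAbs) := by
    intro v hv
    rw [mem_filter] at hv
    rw [Fintype.mem_piFinset]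
    intro j
    obtain ⟨h1, h2, h3, h4⟩ := (hI v hv.1).1 j
    rw [ZZ, mem_biUnion]
    refine ⟨(v j).1, Nat.mem_primeFactors.2 ⟨h1, ?_, hn⟩, ?_⟩
    · rw [← Int.natCast_dvd]; exact F_of_root k h4 (hv.2 j)
    · rw [mem_image]; exact ⟨(v j).2, by rw [mem_filter, mem_range]; exact ⟨h3, h4⟩, rfl⟩
  refine (card_le_card hsub).trans ?_
  rw [Fintype.card_piFinset_const]
  exact Nat.pow_le_pow_left ((card_ZZ k hn).trans (Nat.mul_le_mul_left _ (Nat.log_mono_right hle))) _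
open Classical in
theorem level2 (k : Cub) (hk : k.Good) (W M : ℕ) (hW : k.c0.natAbs ≤ W)
    (hM : ∀ l : ℕ, l.Prime → W < l → ¬ l ∣ M) {m : ℕ} (I : Finset (Fin m → ℕ × ℕ))
    (hI : ∀ v ∈ I, Adm k W v) (Q T : ℕ) (hQ : ∀ v ∈ I, DD v ≤ Q) (β : ℤ) :
    ∑ v ∈ I, |((#{x ∈ range T ×ˢ range T | Hit v (1 + M * (β + (x.1 : ℕ))) (M * (1 + (x.2 : ℕ)))} : ℕ) : ℝ)
      - (T:ℝ) ^ 2 / DD v| ≤ Q * ((3 * Nat.log 2 (SS k * Q ^ 3)) ^ m : ℕ) * (1 + Real.log Q) ^ 2 := by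
  have hcc : ∀ v : Fin m → ℕ × ℕ, ∃ κ : ℤ, v ∈ I → ∀ j, ((v j).1 : ℤ) ∣ κ - (v j).2 := by
    intro v
    by_cases h : v ∈ I
    · obtain ⟨κ, hκ⟩ := crt (fun j => ((hI v h).1 j).1) (hI v h).2
      exact ⟨κ, fun _ => hκ⟩
    · exact ⟨0, fun h' => absurd h' h⟩
  choose κ hκ using hcc
  have hc0 : k.c0 ≠ 0 := fun h => by
    have := hk 0 1 (by simp [Cub.F, h]); simp at this
  have hpr : ∀ v ∈ I, ∀ j, (v j).1.Prime := fun v h j => ((hI v h).1 j).1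
  have hfk : ∀ v ∈ I, ∀ j, ((v j).1 : ℤ) ∣ k.f (κ v) := by
    intro v h j
    have h1 := f_congr k (hκ v h j)
    have := dvd_add h1 ((hI v h).1 j).2.2.2
    simpa using this
  have hun : ∀ v ∈ I, ∀ x : ℤ, (∀ j, ¬ ((v j).1 : ℤ) ∣ x) → IsUnit ((x : ℤ) : ZMod (DD v)) := by
    intro v h x hx
    rw [ZMod.coe_int_isUnit_iff_isCoprime]
    rw [DD]; push_cast
    refine IsCoprime.prod_left fun j _ => ?_
    exact (Prime.coprime_iff_not_dvd (Nat.prime_iff_prime_int.1 (hpr v h j))).2 (hx j)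
  have hMu : ∀ v ∈ I, IsUnit (((M:ℤ) : ℤ) : ZMod (DD v)) := by
    intro v h
    refine hun v h _ fun j hj => hM _ (hpr v h j) ((hI v h).1 j).2.1 (by exact_mod_cast hj)
  have hku : ∀ v ∈ I, IsUnit ((κ v : ℤ) : ZMod (DD v)) := by
    intro v h
    refine hun v h _ fun j hj => ?_
    have h1 : ((v j).1 : ℤ) ∣ k.c0 := by
      have e : k.c0 = k.f (κ v) - κ v * (κ v ^ 2 + k.c2 * κ v + k.c1) := by simp only [Cub.f]; ring
      rw [e]; exact dvd_sub (hfk v h j) (hj.mul_right _)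
    have h2 := Nat.le_of_dvd (by omega) (Int.natCast_dvd.1 h1)
    have := ((hI v h).1 j).2.1
    omega
  have main := level I (fun v => DD v) κ (fun v => (((κ v * M - 1 - M * β : ℤ)) : ZMod (DD v)) * ((M : ℤ) : ZMod (DD v))⁻¹)
    T Q ((3 * Nat.log 2 (SS k * Q ^ 3)) ^ m : ℕ) (fun v h => prod_ne_zero_iff.2 fun j _ => (hpr v h j).ne_zero) hQ hku ?_
  · refine le_trans (le_of_eq (sum_congr rfl fun v h => ?_)) main
    congr 4
    apply filter_congr
    intro x _
    have e1 : Hit v (1 + M * (β + (x.1 : ℕ))) (M * (1 + (x.2 : ℕ))) ↔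
        ((DD v : ℕ) : ℤ) ∣ (1 + M * (β + (x.1 : ℕ))) - κ v * (M * (1 + (x.2 : ℕ))) := by
      rw [dd_dvd (hpr v h) (hI v h).2]
      unfold Hit
      refine forall_congr' fun j => ?_
      have h2 := (hκ v h j).mul_right (M * (1 + ((x.2 : ℕ):ℤ)))
      constructor <;> intro h3
      · have := dvd_sub h3 h2
        rwa [show ∀ A κ l y : ℤ, A - l * y - (κ - l) * y = A - κ * y by intros; ring] at this
      · have := dvd_add h3 h2
        rwa [show ∀ A κ l y : ℤ, A - κ * y + (κ - l) * y = A - l * y by intros; ring] at this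
    rw [e1, ← ZMod.intCast_zmod_eq_zero_iff_dvd]
    have hu := hMu v h
    have e2 : ((M:ℤ) : ZMod (DD v)) * ((M:ℤ) : ZMod (DD v))⁻¹ = 1 := ZMod.mul_inv_of_unit _ hu
    rw [← sub_eq_zero (a := (x.1 : ZMod (DD v))), ← hu.mul_right_eq_zero (b := (x.1 : ZMod (DD v)) - _)]
    push_cast at e2 ⊢
    have e3 : (M : ZMod (DD v)) * ((x.1 : ZMod (DD v)) - ((κ v : ZMod (DD v)) * (x.2 : ZMod (DD v)) +
       ((κ v : ZMod (DD v)) * M - 1 - M * β) * (M : ZMod (DD v))⁻¹)) =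
       M * x.1 - M * κ v * x.2 - (M * (M : ZMod (DD v))⁻¹) * ((κ v : ZMod (DD v)) * M - 1 - M * β) := by ring
    rw [e3, e2]
    constructor <;> intro h' <;> rw [← h'] <;> ring
  · intro h h' h0 h0' hh hh'
    have := mult k hk I W hI (Q := Q) (b := h') (c := -h) hh' (by rwa [abs_neg]) (Or.inl h0')
    rw [Int.natAbs_natCast] at this
    refine le_trans ?_ (Nat.cast_le.2 this)
    refine Nat.cast_le.2 (card_le_card fun v hv => ?_)
    rw [mem_filter] at hv ⊢
    refine ⟨hv.1, fun j => ?_⟩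
    have h1 := (dd_dvd (hpr v hv.1) (hI v hv.1).2 _).1 hv.2 j
    have h2 := (hκ v hv.1 j).mul_right h
    have := dvd_sub h1 h2
    rw [show h' - ((v j).2 : ℤ) * -h = h' + h * κ v - (κ v - ((v j).2 : ℤ)) * h by ring]; exact this
end LV

set_option linter.unusedSectionVars false
namespace LV
open Finset
def prs (k : Cub) (u v : ℕ) : Finset (ℕ × ℕ) :=
  (SV.pr u v).biUnion fun l => ((range l).filter fun t : ℕ => (l:ℤ) ∣ k.f ((t:ℕ):ℤ)).image (fun t => (l, t))
lemma mem_prs {k : Cub} {u v : ℕ} {y : ℕ × ℕ} : y ∈ prs k u v ↔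
    ((u < y.1 ∧ y.1 ≤ v) ∧ y.1.Prime) ∧ y.2 < y.1 ∧ (y.1:ℤ) ∣ k.f ((y.2:ℕ):ℤ) := by
  unfold prs
  simp only [mem_biUnion, SV.mem_pr, mem_image, mem_filter, mem_range]
  constructor
  · rintro ⟨l, hl, t, ht, rfl⟩; exact ⟨hl, ht⟩
  · rintro ⟨h1, h2⟩; exact ⟨y.1, h1, y.2, h2, rfl⟩
lemma sum_prs (k : Cub) (u v : ℕ) (φ : ℕ → ℝ) :
    ∑ y ∈ prs k u v, φ y.1 = ∑ l ∈ SV.pr u v, ME.rho k l * φ l := by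
  unfold prs
  rw [sum_biUnion]
  · refine sum_congr rfl fun l _ => ?_
    rw [sum_image (fun a _ b _ h => by simpa using h)]
    dsimp only
    rw [sum_const, nsmul_eq_mul]; rfl
  · intro l _ l' _ hll
    rw [Function.onFun, disjoint_left]
    rintro y h1 h2
    rw [mem_image] at h1 h2
    obtain ⟨t, _, rfl⟩ := h1
    obtain ⟨t', _, h⟩ := h2
    exact hll (congrArg Prod.fst h).symm
lemma root_mult (k : Cub) {l : ℕ} (hl : l.Prime) (b c : ℤ) :
    (l:ℤ) ^ #{t ∈ range l | (l:ℤ) ∣ k.f ((t:ℕ):ℤ) ∧ (l:ℤ) ∣ b - (t:ℕ) * c} ∣ k.F b c := by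
  set s := (range l).filter (fun t : ℕ => (l:ℤ) ∣ k.f ((t:ℕ):ℤ) ∧ (l:ℤ) ∣ b - (t:ℕ) * c) with hs
  have hl' := Nat.prime_iff_prime_int.1 hl
  rcases le_or_gt #s 1 with h | h
  · rcases Nat.le_one_iff_eq_zero_or_eq_one.1 h with h | h
    · rw [h]; simp
    · rw [h, pow_one]
      obtain ⟨t, ht⟩ := card_eq_one.1 h
      have : t ∈ s := by rw [ht]; simp
      rw [hs, mem_filter] at this
      exact F_of_root k this.2.1 this.2.2
  · obtain ⟨t, ht, t', ht', hne⟩ := one_lt_card.1 h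
    rw [hs, mem_filter, mem_range] at ht ht'
    have h1 : (l:ℤ) ∣ ((t':ℤ) - t) * c := by
      have := dvd_sub ht.2.2 ht'.2.2
      rwa [show b - (t:ℤ) * c - (b - (t':ℤ) * c) = ((t':ℤ) - t) * c by ring] at this
    have hc : (l:ℤ) ∣ c := by
      rcases hl'.dvd_or_dvd h1 with h2 | h2
      · exfalso
        obtain ⟨w, hw⟩ := h2
        have hlt : |(t':ℤ) - t| < l := by rw [abs_lt]; omega
        rw [hw, abs_mul, Nat.abs_cast] at hlt
        have hl0 : (0:ℤ) < l := by exact_mod_cast hl.pos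
        have : |w| < 1 := by nlinarith
        have : w = 0 := Int.abs_lt_one_iff.1 this
        rw [this] at hw; omega
      · exact h2
    have hb : (l:ℤ) ∣ b := by
      have := dvd_add ht.2.2 (hc.mul_left (t:ℤ))
      simpa using this
    have h3 : #s ≤ 3 := by
      refine le_trans (card_le_card ?_) (ME.rho_le k hl)
      intro t ht
      rw [hs, mem_filter] at ht
      exact mem_filter.2 ⟨ht.1, ht.2.1⟩
    refine (pow_dvd_pow _ h3).trans ?_
    obtain ⟨b', rfl⟩ := hb
    obtain ⟨c', rfl⟩ := hc
    exact ⟨k.F b' c', by simp only [Cub.F]; ring⟩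
lemma logF_ge (k : Cub) (b c : ℤ) (n : ℕ) (hn : n = (k.F b c).natAbs) (hn0 : n ≠ 0) (A : Finset ℕ)
    (hA : ∀ l ∈ A, l ∈ n.primeFactors) (L Y W : ℕ) (hLY : L ≤ Y) (hAY : ∀ l ∈ A, l ≤ Y) :
    ∑ l ∈ A, Real.log l + ∑ y ∈ (prs k W L).filter (fun y => y.1 ∉ A ∧ (y.1:ℤ) ∣ b - (y.2:ℕ) * c), Real.log y.1
      + ∑ l ∈ n.primeFactors.filter (fun l => Y < l), Real.log l ≤ Real.log n := by
  classical
  set R := (prs k W L).filter (fun y => y.1 ∉ A ∧ (y.1:ℤ) ∣ b - (y.2:ℕ) * c) with hR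
  set B := R.image Prod.fst with hB
  have hRn : ∀ y ∈ R, y.1 ∈ n.primeFactors := by
    intro y hy
    rw [hR, mem_filter, mem_prs] at hy
    refine Nat.mem_primeFactors.2 ⟨hy.1.1.2, ?_, hn0⟩
    rw [hn, ← Int.natCast_dvd]
    exact F_of_root k hy.1.2.2 hy.2.2
  have hBn : ∀ l ∈ B, l ∈ n.primeFactors := by
    intro l hl
    obtain ⟨y, hy, rfl⟩ := mem_image.1 hl
    exact hRn y hy
  have hlog : Real.log n = ∑ l ∈ n.primeFactors, (n.factorization l : ℝ) * Real.log l := by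
    conv_lhs => rw [← Nat.prod_factorization_pow_eq_self hn0]
    rw [Finsupp.prod, Nat.support_factorization]
    push_cast
    rw [Real.log_prod (fun l hl => pow_ne_zero _ (by exact_mod_cast (Nat.prime_of_mem_primeFactors hl).ne_zero))]
    exact sum_congr rfl fun l _ => Real.log_pow _ _
  have h1 : ∀ l ∈ n.primeFactors, Real.log l ≤ (n.factorization l : ℝ) * Real.log l := by
    intro l hl
    have : 1 ≤ n.factorization l := (Nat.prime_of_mem_primeFactors hl).factorization_pos_of_dvd hn0 (Nat.dvd_of_mem_primeFactors hl)
    have h2 : (1:ℝ) ≤ n.factorization l := by exact_mod_cast this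
    nlinarith [Real.log_natCast_nonneg l]
  have h2 : ∑ y ∈ R, Real.log y.1 ≤ ∑ l ∈ B, (n.factorization l : ℝ) * Real.log l := by
    rw [← sum_fiberwise_of_maps_to (fun y hy => mem_image_of_mem Prod.fst hy) (t := B)]
    refine sum_le_sum fun l hl => ?_
    rw [sum_congr rfl (g := fun _ => Real.log l) (fun y hy => by rw [(mem_filter.1 hy).2]), sum_const, nsmul_eq_mul]
    refine mul_le_mul_of_nonneg_right ?_ (Real.log_natCast_nonneg l)
    have hlp := Nat.prime_of_mem_primeFactors (hBn l hl)
    have h3 : l ^ #(R.filter (fun y => y.1 = l)) ∣ n := by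
      refine dvd_trans (b := l ^ #{t ∈ range l | (l:ℤ) ∣ k.f ((t:ℕ):ℤ) ∧ (l:ℤ) ∣ b - (t:ℕ) * c}) (pow_dvd_pow _ ?_) ?_
      · refine card_le_card_of_injOn Prod.snd ?_ ?_
        · intro y hy
          have hy := mem_filter.1 (mem_coe.1 hy)
          obtain ⟨hy1, hy2⟩ := hy
          rw [hR, mem_filter, mem_prs, hy2] at hy1
          exact mem_coe.2 (mem_filter.2 ⟨mem_range.2 hy1.1.2.1, hy1.1.2.2, hy1.2.2⟩)
        · intro y hy y' hy' h
          have a1 := (mem_filter.1 (mem_coe.1 hy)).2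
          have a2 := (mem_filter.1 (mem_coe.1 hy')).2
          exact Prod.ext (a1.trans a2.symm) h
      · have := root_mult k hlp b c
        rw [hn, ← Int.natCast_dvd]; push_cast; exact this
    exact_mod_cast (hlp.pow_dvd_iff_le_factorization hn0).1 h3
  have hdAB : Disjoint A B := by
    rw [disjoint_left]; intro l h3 h4
    obtain ⟨y, hy, rfl⟩ := mem_image.1 h4
    rw [hR, mem_filter] at hy
    exact hy.2.1 h3
  have hdC : Disjoint (A ∪ B) (n.primeFactors.filter (fun l => Y < l)) := by
    rw [disjoint_left]; intro l h3 h4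
    have h5 := (mem_filter.1 h4).2
    rcases mem_union.1 h3 with h3 | h3
    · have := hAY l h3; omega
    · obtain ⟨y, hy, rfl⟩ := mem_image.1 h3
      rw [hR, mem_filter, mem_prs] at hy
      omega
  rw [hlog]
  calc _ ≤ ∑ l ∈ A, (n.factorization l : ℝ) * Real.log l + ∑ l ∈ B, (n.factorization l : ℝ) * Real.log l
        + ∑ l ∈ n.primeFactors.filter (fun l => Y < l), (n.factorization l : ℝ) * Real.log l := by
        refine add_le_add (add_le_add (sum_le_sum fun l hl => h1 l (hA l hl)) h2)
          (sum_le_sum fun l hl => h1 l (mem_filter.1 hl).1)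
    _ = ∑ l ∈ (A ∪ B) ∪ n.primeFactors.filter (fun l => Y < l), (n.factorization l : ℝ) * Real.log l := by
        rw [sum_union hdC, sum_union hdAB]
    _ ≤ _ := by
        refine sum_le_sum_of_subset_of_nonneg ?_ fun l _ _ => mul_nonneg (by positivity) (Real.log_natCast_nonneg l)
        intro l hl
        rcases mem_union.1 hl with hl | hl
        · rcases mem_union.1 hl with hl | hl
          · exact hA l hl
          · exact hBn l hl
        · exact (mem_filter.1 hl).1
lemma mult_x (k : Cub) (u v m n : ℕ) (hu : 1 ≤ u) (hn0 : n ≠ 0) (hn : n < u ^ (m + 1)) :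
    #((prs k u v).filter fun y => y.1 ∣ n) ≤ 3 * m := by
  have h1 : #((SV.pr u v).filter fun l => l ∣ n) ≤ m := by
    by_contra! h
    have h2 : u ^ (m + 1) ≤ ∏ l ∈ (SV.pr u v).filter (fun l => l ∣ n), l := by
      calc u ^ (m + 1) ≤ u ^ #((SV.pr u v).filter fun l => l ∣ n) := Nat.pow_le_pow_right hu h
        _ = ∏ l ∈ (SV.pr u v).filter (fun l => l ∣ n), u := by rw [prod_const]
        _ ≤ _ := prod_le_prod' fun l hl => (SV.mem_pr.1 (mem_filter.1 hl).1).1.1.le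
    have h3 : ∏ l ∈ (SV.pr u v).filter (fun l => l ∣ n), l ∣ n := by
      refine prod_primes_dvd _ (fun l hl => (SV.mem_pr.1 (mem_filter.1 hl).1).2.prime) fun l hl => (mem_filter.1 hl).2
    have := Nat.le_of_dvd (Nat.pos_of_ne_zero hn0) h3
    omega
  have h2 : (prs k u v).filter (fun y => y.1 ∣ n) ⊆ ((SV.pr u v).filter fun l => l ∣ n).biUnion
      fun l => ((range l).filter fun t : ℕ => (l:ℤ) ∣ k.f ((t:ℕ):ℤ)).image (fun t => (l, t)) := by
    intro y hy
    rw [mem_filter, mem_prs] at hy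
    rw [mem_biUnion]
    refine ⟨y.1, mem_filter.2 ⟨SV.mem_pr.2 hy.1.1, hy.2⟩, ?_⟩
    exact mem_image.2 ⟨y.2, mem_filter.2 ⟨mem_range.2 hy.1.2.1, hy.1.2.2⟩, rfl⟩
  refine (card_le_card h2).trans (card_biUnion_le.trans ?_)
  calc _ ≤ ∑ l ∈ (SV.pr u v).filter (fun l => l ∣ n), 3 := by
        refine sum_le_sum fun l hl => card_image_le.trans ?_
        exact ME.rho_le k (SV.mem_pr.1 (mem_filter.1 hl).1).2
    _ = 3 * #((SV.pr u v).filter fun l => l ∣ n) := by rw [sum_const, smul_eq_mul, mul_comm]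
    _ ≤ _ := by omega
end LV

set_option linter.unusedSectionVars false
namespace LV
open Finset
set_option maxHeartbeats 1000000 in
lemma Gabs {X P : Type} (box : Finset X) (ind : P → X → ℝ) (hi : ∀ y x, 0 ≤ ind y x)
    (S0 S1 S2 SP : Finset P) (R : P → P → P → Finset P) (d lg : P → ℝ) (Λ vv : X → ℝ)
    (lT B E ε T2 K0 : ℝ) (hd : ∀ y, 0 ≤ d y) (hlT : 0 < lT) (hT2 : 0 < T2) (hE0 : 0 ≤ E) (hε : 0 < ε) (hε1 : ε ≤ 1 / 10 ^ 7) (hK0 : 0 ≤ K0)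
    (hv : ∀ x, 0 ≤ vv x ∧ vv x ≤ 1)
    (ha : ∀ y0 ∈ S0, ∀ y1 ∈ S1, ∀ y2 ∈ S2, ∀ x ∈ box, ind y0 x * ind y1 x * ind y2 x * Λ x ≤
      ind y0 x * ind y1 x * ind y2 x * (B - lg y0 - lg y1 - lg y2) - ∑ y ∈ R y0 y1 y2, lg y * (ind y0 x * ind y1 x * ind y2 x * ind y x))
    (hB : ∀ y0 ∈ S0, ∀ y1 ∈ S1, ∀ y2 ∈ S2, |B - lg y0 - lg y1 - lg y2| ≤ 4 * lT)
    (hR : ∀ y0 ∈ S0, ∀ y1 ∈ S1, ∀ y2 ∈ S2, ∀ y ∈ R y0 y1 y2, 0 ≤ lg y ∧ lg y ≤ 2 * lT)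
    (hc : ∀ y0 ∈ S0, ∀ y1 ∈ S1, ∀ y2 ∈ S2, B - lg y0 - lg y1 - lg y2 - ∑ y ∈ R y0 y1 y2, lg y * d y ≤ (1 + ε / 8) * lT)
    (he : ∀ x ∈ box, (1 + ε) * lT ≤ Λ x + 2 * ε * lT * (∑ z ∈ SP, ind z x) + 2 * lT * vv x)
    (hm0 : ∀ x ∈ box, ∑ y ∈ S0, ind y x ≤ K0) (hm1 : ∀ x ∈ box, ∑ y ∈ S1, ind y x ≤ 21)
    (hm2 : ∀ x ∈ box, ∑ y ∈ S2, ind y x ≤ 21)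
    (l2 : ∑ y ∈ S0, ∑ z ∈ SP, |∑ x ∈ box, ind y x * ind z x - T2 * (d y * d z)| ≤ E)
    (l3 : ∑ y0 ∈ S0, ∑ y1 ∈ S1, ∑ y2 ∈ S2, |∑ x ∈ box, ind y0 x * ind y1 x * ind y2 x - T2 * (d y0 * d y1 * d y2)| ≤ E)
    (l4 : ∑ y0 ∈ S0, ∑ y1 ∈ S1, ∑ y2 ∈ S2, ∑ y ∈ R y0 y1 y2,
      |∑ x ∈ box, ind y0 x * ind y1 x * ind y2 x * ind y x - T2 * (d y0 * d y1 * d y2 * d y)| ≤ E)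
    (h0 : 1 / 10 ≤ ∑ y ∈ S0, d y) (h1 : 1 / 10 ≤ ∑ y ∈ S1, d y) (h2 : 1 / 10 ≤ ∑ y ∈ S2, d y)
    (hP : ∑ y ∈ SP, d y ≤ 5 * ε) (hE : E ≤ ε / 10 ^ 6 * T2) :
    4 / 10 ^ 4 * ε * T2 ≤ K0 * 441 * ∑ x ∈ box, vv x * (if 0 < ∑ y ∈ S0, ind y x then 1 else 0) := by
  set m0 : X → ℝ := fun x => ∑ y ∈ S0, ind y x with hm0'
  set m1 : X → ℝ := fun x => ∑ y ∈ S1, ind y x with hm1'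
  set m2 : X → ℝ := fun x => ∑ y ∈ S2, ind y x with hm2'
  set mP : X → ℝ := fun x => ∑ y ∈ SP, ind y x with hmP'
  have p0 : ∀ x, 0 ≤ m0 x := fun x => sum_nonneg fun _ _ => hi _ _
  have p1 : ∀ x, 0 ≤ m1 x := fun x => sum_nonneg fun _ _ => hi _ _
  have p2 : ∀ x, 0 ≤ m2 x := fun x => sum_nonneg fun _ _ => hi _ _
  have pP : ∀ x, 0 ≤ mP x := fun x => sum_nonneg fun _ _ => hi _ _
  set s0 := ∑ y ∈ S0, d y
  set s1 := ∑ y ∈ S1, d y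
  set s2 := ∑ y ∈ S2, d y
  set sP := ∑ y ∈ SP, d y
  have e3 : ∀ φ : X → ℝ, ∑ y0 ∈ S0, ∑ y1 ∈ S1, ∑ y2 ∈ S2, ∑ x ∈ box, ind y0 x * ind y1 x * ind y2 x * φ x =
      ∑ x ∈ box, m0 x * m1 x * m2 x * φ x := by
    intro φ
    have a : ∀ x ∈ box, m0 x * m1 x * m2 x * φ x = ∑ y0 ∈ S0, ∑ y1 ∈ S1, ∑ y2 ∈ S2, ind y0 x * ind y1 x * ind y2 x * φ x := by
      intro x _
      simp only [hm0', hm1', hm2', ← sum_mul, ← mul_sum]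
    rw [sum_congr rfl a]
    symm
    rw [sum_comm]
    refine sum_congr rfl fun y0 _ => ?_
    rw [sum_comm]
    refine sum_congr rfl fun y1 _ => ?_
    rw [sum_comm]
  have hs3 : ∑ y0 ∈ S0, ∑ y1 ∈ S1, ∑ y2 ∈ S2, T2 * (d y0 * d y1 * d y2) = T2 * (s0 * s1 * s2) := by
    simp only [s0, s1, s2, ← sum_mul, ← mul_sum]
  set S := T2 * (s0 * s1 * s2) with hS
  have hσ : 1 / 1000 ≤ s0 * s1 * s2 := by
    have : (1/10 : ℝ) * (1 / 10) * (1 / 10) ≤ s0 * s1 * s2 := by gcongr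
    linarith
  have hST : T2 ≤ 1000 * S := by rw [hS]; nlinarith
  have hSpos : 0 < S := by linarith
  have hES : E ≤ ε / 1000 * S := by nlinarith
  have k2 : S - E ≤ ∑ x ∈ box, m0 x * m1 x * m2 x * 1 := by
    rw [← e3, ← hs3, sub_le_comm, ← sum_sub_distrib]
    refine le_trans (sum_le_sum fun y0 _ => ?_) l3
    rw [← sum_sub_distrib]
    refine sum_le_sum fun y1 _ => ?_
    rw [← sum_sub_distrib]
    refine sum_le_sum fun y2 _ => ?_
    simp only [mul_one]
    rw [abs_sub_comm]
    exact le_abs_self _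
  have k1 : ∑ x ∈ box, m0 x * m1 x * m2 x * Λ x ≤ (1 + ε / 8) * lT * S + 6 * lT * E := by
    rw [← e3]
    have a : ∀ y0 ∈ S0, ∀ y1 ∈ S1, ∀ y2 ∈ S2, ∑ x ∈ box, ind y0 x * ind y1 x * ind y2 x * Λ x ≤
        (1 + ε / 8) * lT * (T2 * (d y0 * d y1 * d y2))
        + 4 * lT * |∑ x ∈ box, ind y0 x * ind y1 x * ind y2 x - T2 * (d y0 * d y1 * d y2)|
        + 2 * lT * ∑ y ∈ R y0 y1 y2, |∑ x ∈ box, ind y0 x * ind y1 x * ind y2 x * ind y x - T2 * (d y0 * d y1 * d y2 * d y)| := by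
      intro y0 g0 y1 g1 y2 g2
      refine (sum_le_sum fun x hx => ha y0 g0 y1 g1 y2 g2 x hx).trans ?_
      rw [sum_sub_distrib, ← sum_mul, sum_comm]
      simp only [← mul_sum]
      set c3 := ∑ x ∈ box, ind y0 x * ind y1 x * ind y2 x
      have b1 : c3 * (B - lg y0 - lg y1 - lg y2) ≤ T2 * (d y0 * d y1 * d y2) * (B - lg y0 - lg y1 - lg y2)
          + 4 * lT * |c3 - T2 * (d y0 * d y1 * d y2)| := by
        have := (le_abs_self ((c3 - T2 * (d y0 * d y1 * d y2)) * (B - lg y0 - lg y1 - lg y2)))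
        rw [abs_mul] at this
        have q := mul_le_mul_of_nonneg_left (hB y0 g0 y1 g1 y2 g2) (abs_nonneg (c3 - T2 * (d y0 * d y1 * d y2)))
        linarith
      have b2 : T2 * (d y0 * d y1 * d y2) * ∑ y ∈ R y0 y1 y2, lg y * d y - 2 * lT * ∑ y ∈ R y0 y1 y2, |∑ x ∈ box, ind y0 x * ind y1 x * ind y2 x * ind y x - T2 * (d y0 * d y1 * d y2 * d y)|
          ≤ ∑ y ∈ R y0 y1 y2, lg y * ∑ x ∈ box, ind y0 x * ind y1 x * ind y2 x * ind y x := by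
        rw [mul_sum, mul_sum, ← sum_sub_distrib]
        refine sum_le_sum fun y hy => ?_
        obtain ⟨r1, r2⟩ := hR y0 g0 y1 g1 y2 g2 y hy
        set c4 := ∑ x ∈ box, ind y0 x * ind y1 x * ind y2 x * ind y x
        have t1 := neg_abs_le (c4 - T2 * (d y0 * d y1 * d y2 * d y))
        have t2 := abs_nonneg (c4 - T2 * (d y0 * d y1 * d y2 * d y))
        nlinarith
      have b3 := mul_le_mul_of_nonneg_left (hc y0 g0 y1 g1 y2 g2) (show 0 ≤ T2 * (d y0 * d y1 * d y2) by
        have := hd y0; have := hd y1; have := hd y2; positivity)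
      linarith
    refine (sum_le_sum fun y0 g0 => sum_le_sum fun y1 g1 => sum_le_sum fun y2 g2 => a y0 g0 y1 g1 y2 g2).trans ?_
    simp only [sum_add_distrib]
    have hz : ∀ (c : ℝ) (φ : P → P → P → ℝ), ∑ y0 ∈ S0, ∑ y1 ∈ S1, ∑ y2 ∈ S2, c * φ y0 y1 y2 = c * ∑ y0 ∈ S0, ∑ y1 ∈ S1, ∑ y2 ∈ S2, φ y0 y1 y2 := by
      intro c φ; simp only [mul_sum]
    rw [hz, hs3, hz, hz]
    have l3' := mul_le_mul_of_nonneg_left l3 (show 0 ≤ 4 * lT by linarith)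
    have l4' := mul_le_mul_of_nonneg_left l4 (show 0 ≤ 2 * lT by linarith)
    linarith
  have k4 : ∑ x ∈ box, m0 x * m1 x * m2 x * mP x ≤ 441 * (501 * ε * S) := by
    have a : ∑ x ∈ box, m0 x * m1 x * m2 x * mP x ≤ 441 * ∑ x ∈ box, m0 x * mP x := by
      rw [mul_sum]
      refine sum_le_sum fun x hx => ?_
      have : m1 x * m2 x ≤ 21 * 21 := mul_le_mul (hm1 x hx) (hm2 x hx) (p2 x) (by norm_num)
      have q := mul_nonneg (p0 x) (pP x)
      nlinarith
    have b : ∑ x ∈ box, m0 x * mP x ≤ T2 * (s0 * sP) + E := by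
      have e : ∑ x ∈ box, m0 x * mP x = ∑ y ∈ S0, ∑ z ∈ SP, ∑ x ∈ box, ind y x * ind z x := by
        have : ∀ x ∈ box, m0 x * mP x = ∑ y ∈ S0, ∑ z ∈ SP, ind y x * ind z x := by
          intro x _; simp only [hm0', hmP', sum_mul_sum]
        rw [sum_congr rfl this, sum_comm]
        refine sum_congr rfl fun y0 _ => ?_
        rw [sum_comm]
      have e' : T2 * (s0 * sP) = ∑ y ∈ S0, ∑ z ∈ SP, T2 * (d y * d z) := by
        simp only [s0, sP, ← sum_mul, ← mul_sum]
      rw [e, e', ← sub_le_iff_le_add', ← sum_sub_distrib]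
      refine le_trans (sum_le_sum fun y0 _ => ?_) l2
      rw [← sum_sub_distrib]
      exact sum_le_sum fun y1 _ => le_abs_self _
    have c : T2 * (s0 * sP) ≤ 500 * ε * S := by
      have q1 : s0 ≤ 100 * (s0 * s1 * s2) := by
        have : (1/10:ℝ) * (1 / 10) ≤ s1 * s2 := by gcongr
        nlinarith
      have : s0 * sP ≤ (100 * (s0 * s1 * s2)) * (5 * ε) := by
        refine mul_le_mul q1 hP (sum_nonneg fun _ _ => hd _) (by positivity)
      rw [hS]
      nlinarith
    have : E ≤ ε * S := by nlinarith
    nlinarith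
  have k3 : (1 + ε) * lT * (∑ x ∈ box, m0 x * m1 x * m2 x * 1) ≤ ∑ x ∈ box, m0 x * m1 x * m2 x * Λ x
      + 2 * ε * lT * (∑ x ∈ box, m0 x * m1 x * m2 x * mP x) + 2 * lT * ∑ x ∈ box, m0 x * m1 x * m2 x * vv x := by
    rw [mul_sum, mul_sum, mul_sum, ← sum_add_distrib, ← sum_add_distrib]
    refine sum_le_sum fun x hx => ?_
    have := mul_le_mul_of_nonneg_left (he x hx) (mul_nonneg (mul_nonneg (p0 x) (p1 x)) (p2 x))
    simp only [hmP']
    linarith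
  have k6 : ∑ x ∈ box, m0 x * m1 x * m2 x * vv x ≤ K0 * 441 * ∑ x ∈ box, vv x * (if 0 < m0 x then 1 else 0) := by
    rw [mul_sum]
    refine sum_le_sum fun x hx => ?_
    split_ifs with h
    · have q1 : m0 x * m1 x ≤ K0 * 21 := mul_le_mul (hm0 x hx) (hm1 x hx) (p1 x) hK0
      have q2 : m0 x * m1 x * m2 x ≤ K0 * 21 * 21 := mul_le_mul q1 (hm2 x hx) (p2 x) (by positivity)
      have := mul_le_mul_of_nonneg_right q2 (hv x).1
      linarith
    · have : m0 x = 0 := le_antisymm (not_lt.1 h) (p0 x)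
      rw [this]; simp
  set V := ∑ x ∈ box, m0 x * m1 x * m2 x * vv x
  have k7 : 8 / 10 * ε * S ≤ 2 * V := by
    have w1 : (1 + ε) * lT * (S - E) ≤ (1 + ε) * lT * (∑ x ∈ box, m0 x * m1 x * m2 x * 1) := by gcongr
    have w2 : 2 * ε * lT * (∑ x ∈ box, m0 x * m1 x * m2 x * mP x) ≤ 2 * ε * lT * (441 * (501 * ε * S)) := by gcongr
    have w3 : lT * ((1 + ε) * (S - E)) ≤ lT * ((1 + ε / 8) * S + 6 * E + 2 * ε * (441 * (501 * ε * S)) + 2 * V) := by linarith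
    have w4 := le_of_mul_le_mul_left w3 hlT
    have w5 : ε * (ε * S) ≤ 1 / 10 ^ 7 * (ε * S) := by gcongr
    have w6 : ε * E ≤ E := mul_le_of_le_one_left hE0 (by linarith)
    linarith
  have : ε * T2 ≤ ε * (1000 * S) := mul_le_mul_of_nonneg_left hST hε.le
  linarith
end LV

set_option linter.unusedSectionVars false
namespace LV
open Finset Filter Topology
noncomputable def fl (T : ℕ) (β : ℝ) : ℕ := ⌊(T:ℝ) ^ β⌋₊
noncomputable def RR (k : Cub) (n : ℕ) : ℝ := ∑ p ∈ Nat.primesLE n, ME.rho k p * Real.log p / p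
lemma fl_lt {T l : ℕ} {β : ℝ} : fl T β < l ↔ (T:ℝ) ^ β < l := Nat.floor_lt (by positivity)
lemma le_fl {T l : ℕ} {β : ℝ} : l ≤ fl T β ↔ (l:ℝ) ≤ (T:ℝ) ^ β := Nat.le_floor_iff (by positivity)
lemma fl_le {T : ℕ} {β : ℝ} : (fl T β : ℝ) ≤ (T:ℝ) ^ β := Nat.floor_le (by positivity)
lemma fl_ge {T : ℕ} {β : ℝ} (h : (1:ℝ) ≤ (T:ℝ) ^ β) : (T:ℝ) ^ β / 2 ≤ fl T β := by
  have h1 : (1:ℝ) ≤ fl T β := by exact_mod_cast le_fl.2 (by simpa using h)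
  have h2 := Nat.lt_floor_add_one ((T:ℝ) ^ β)
  unfold fl at *
  linarith
lemma log_nat : Tendsto (fun T : ℕ => Real.log T) atTop atTop :=
  Real.tendsto_log_atTop.comp tendsto_natCast_atTop_atTop
lemma rpow_nat {β : ℝ} (hβ : 0 < β) : Tendsto (fun T : ℕ => (T:ℝ) ^ β) atTop atTop :=
  (tendsto_rpow_atTop hβ).comp tendsto_natCast_atTop_atTop
lemma fl_tendsto {β : ℝ} (hβ : 0 < β) : Tendsto (fun T => fl T β) atTop atTop :=
  tendsto_nat_floor_atTop.comp (rpow_nat hβ)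
lemma fl_log {β : ℝ} (hβ : 0 < β) : Tendsto (fun T : ℕ => Real.log (fl T β) / Real.log T) atTop (𝓝 β) := by
  have h1 : Tendsto (fun T : ℕ => β - Real.log 2 / Real.log T) atTop (𝓝 β) := by
    have := (tendsto_const_nhds (x := Real.log 2)).div_atTop log_nat
    simpa using (tendsto_const_nhds (x := β)).sub this
  refine tendsto_of_tendsto_of_tendsto_of_le_of_le' h1 tendsto_const_nhds ?_ ?_
  · filter_upwards [log_nat.eventually_gt_atTop 0, (rpow_nat hβ).eventually_ge_atTop 1, eventually_ge_atTop 1] with T a b c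
    have hT : (0:ℝ) < T := by exact_mod_cast c
    rw [le_div_iff₀ a, sub_mul, div_mul_cancel₀ _ a.ne', ← Real.log_rpow hT, ← Real.log_div (by positivity) (by norm_num)]
    exact Real.log_le_log (by positivity) (fl_ge b)
  · filter_upwards [log_nat.eventually_gt_atTop 0, (rpow_nat hβ).eventually_ge_atTop 1, eventually_ge_atTop 1] with T a b c
    have hT : (0:ℝ) < T := by exact_mod_cast c
    rw [div_le_iff₀ a, ← Real.log_rpow hT]
    refine Real.log_le_log ?_ fl_le
    have := fl_ge b; linarith
variable (k : Cub)
lemma RR_fl (hR : Tendsto (fun n : ℕ => RR k n / Real.log n) atTop (𝓝 1)) {β : ℝ} (hβ : 0 < β) : Tendsto (fun T : ℕ => RR k (fl T β) / Real.log T) atTop (𝓝 β) := by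
  have h := (hR.comp (fl_tendsto hβ)).mul (fl_log hβ)
  rw [one_mul] at h
  refine h.congr' ?_
  filter_upwards [(log_nat.comp (fl_tendsto hβ)).eventually_gt_atTop 0] with T a
  simp only [Function.comp] at a ⊢
  field_simp
lemma RR_diff {u v : ℕ} (h : u ≤ v) : ∑ l ∈ SV.pr u v, ME.rho k l * (Real.log l / l) = RR k v - RR k u := by
  unfold RR
  rw [eq_sub_iff_add_eq, sum_congr rfl fun l _ => (mul_div_assoc _ _ _).symm, ← sum_union]
  · refine sum_congr ?_ fun _ _ => rfl
    ext l; simp only [mem_union, SV.mem_pr, Nat.mem_primesLE]; grind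
  · rw [disjoint_left]; intro l; simp only [SV.mem_pr, Nat.mem_primesLE]; grind
lemma RR_nonneg (n : ℕ) : 0 ≤ RR k n := sum_nonneg fun p _ => by
  have := Real.log_natCast_nonneg p; positivity
lemma RR_ge (hR : Tendsto (fun n : ℕ => RR k n / Real.log n) atTop (𝓝 1)) (δ : ℝ) (hδ : 0 < δ) :
    ∃ C, 0 ≤ C ∧ ∀ n : ℕ, 1 ≤ n → (1 - δ) * Real.log n - C ≤ RR k n := by
  obtain ⟨N, hN⟩ := eventually_atTop.1 ((hR.eventually_const_lt (show 1 - δ < 1 by linarith)).and (log_nat.eventually_gt_atTop 0))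
  refine ⟨Real.log N, Real.log_natCast_nonneg N, fun n hn => ?_⟩
  rcases le_or_gt N n with h | h
  · obtain ⟨a, b⟩ := hN n h
    rw [lt_div_iff₀ b] at a
    have := Real.log_natCast_nonneg N
    linarith
  · have := RR_nonneg k n
    have h1 : Real.log n ≤ Real.log N := Real.log_le_log (by exact_mod_cast hn) (by exact_mod_cast h.le)
    have h2 := Real.log_natCast_nonneg n
    nlinarith
lemma S_ge (hR : Tendsto (fun n : ℕ => RR k n / Real.log n) atTop (𝓝 1)) {α β s : ℝ} (hα : 0 < α) (hβ : α < β)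
    (hs : s < (β - α) / β) : ∀ᶠ T : ℕ in atTop, s ≤ ∑ y ∈ prs k (fl T α) (fl T β), 1 / (y.1:ℝ) := by
  have hb : 0 < β := hα.trans hβ
  have h := (((RR_fl k hR hb).sub (RR_fl k hR hα)).div_const β).eventually_const_lt hs
  filter_upwards [h, log_nat.eventually_gt_atTop 0, eventually_ge_atTop 1] with T a b c
  have hT : (1:ℝ) ≤ T := by exact_mod_cast c
  have huv : fl T α ≤ fl T β := Nat.floor_le_floor (Real.rpow_le_rpow_of_exponent_le hT hβ.le)
  rw [sum_prs k _ _ (fun l => 1 / (l:ℝ))]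
  refine a.le.trans ?_
  rw [← sub_div, ← RR_diff k huv, div_div, div_le_iff₀ (by positivity), sum_mul]
  refine sum_le_sum fun l hl => ?_
  rw [SV.mem_pr] at hl
  have h1 := Real.log_le_log (by exact_mod_cast hl.2.pos) (le_fl.1 hl.1.2)
  rw [Real.log_rpow (by linarith)] at h1
  have : Real.log l / l ≤ 1 / l * (Real.log T * β) := by
    rw [div_mul_eq_mul_div, one_mul]; gcongr; linarith
  rw [mul_assoc]
  gcongr
lemma S_le (hR : Tendsto (fun n : ℕ => RR k n / Real.log n) atTop (𝓝 1)) {α β s : ℝ} (hα : 0 < α) (hβ : α < β)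
    (hs : (β - α) / α < s) : ∀ᶠ T : ℕ in atTop, ∑ y ∈ prs k (fl T α) (fl T β), 1 / (y.1:ℝ) ≤ s := by
  have hb : 0 < β := hα.trans hβ
  have h := (((RR_fl k hR hb).sub (RR_fl k hR hα)).div_const α).eventually_lt_const hs
  filter_upwards [h, log_nat.eventually_gt_atTop 0, eventually_ge_atTop 1] with T a b c
  have hT : (1:ℝ) ≤ T := by exact_mod_cast c
  have huv : fl T α ≤ fl T β := Nat.floor_le_floor (Real.rpow_le_rpow_of_exponent_le hT hβ.le)
  rw [sum_prs k _ _ (fun l => 1 / (l:ℝ))]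
  refine le_trans ?_ a.le
  rw [← sub_div, ← RR_diff k huv, div_div, le_div_iff₀ (by positivity), sum_mul]
  refine sum_le_sum fun l hl => ?_
  rw [SV.mem_pr] at hl
  have h1 := Real.log_le_log (by positivity) (fl_lt.1 hl.1.1).le
  rw [Real.log_rpow (by linarith)] at h1
  have : 1 / l * (Real.log T * α) ≤ Real.log l / l := by
    rw [div_mul_eq_mul_div, one_mul]; gcongr; linarith
  rw [mul_assoc]
  gcongr
lemma polylog (C1 C2 η : ℝ) (m : ℕ) (hη : 0 < η) (A : ℝ) :
    ∀ᶠ T : ℕ in atTop, A * (C1 + C2 * Real.log T) ^ m ≤ (T:ℝ) ^ η := by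
  have h1 : (fun T : ℕ => A * (C1 + C2 * Real.log T) ^ m) =o[atTop] fun T : ℕ => (T:ℝ) ^ η := by
    have h2 : (fun t : ℝ => (C1 + C2 * t) ^ m) =O[atTop] fun t : ℝ => t ^ m := by
      refine Asymptotics.IsBigO.pow ?_ m
      refine Asymptotics.IsBigO.add ?_ (Asymptotics.isBigO_const_mul_self _ _ _)
      exact (Asymptotics.isLittleO_const_id_atTop C1).isBigO
    have h3 : (fun x : ℝ => Real.log x ^ m) =o[atTop] fun x : ℝ => x ^ η := by
      simpa using isLittleO_log_rpow_rpow_atTop (s := η) (m:ℝ) hη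
    have h4 := (h2.comp_tendsto Real.tendsto_log_atTop).trans_isLittleO h3
    exact (h4.const_mul_left A).comp_tendsto tendsto_natCast_atTop_atTop
  filter_upwards [h1.def one_pos] with T hT
  rw [one_mul, Real.norm_of_nonneg (by positivity : (0:ℝ) ≤ (T:ℝ) ^ η)] at hT
  exact (le_abs_self _).trans hT
lemma lev_err (ε2 A : ℝ) (h0 : 0 < ε2) (h2 : ε2 < 2) (hA : 0 < A) (m : ℕ) : ∀ᶠ T : ℕ in atTop,
    (fl T (2 - ε2) : ℝ) * ((3 * Nat.log 2 (SS k * (fl T (2 - ε2)) ^ 3)) ^ m : ℕ) * (1 + Real.log (fl T (2 - ε2))) ^ 2 ≤ A * (T:ℝ) ^ 2 := by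
  filter_upwards [polylog (1 + 5 * Real.log (SS k)) 30 ε2 (m + 2) h0 A⁻¹, eventually_ge_atTop 1] with T hT h1
  have hT1 : (1:ℝ) ≤ T := by exact_mod_cast h1
  set Q := fl T (2 - ε2)
  have hQ1 : 1 ≤ Q := le_fl.2 (by simpa using Real.one_le_rpow hT1 (by linarith))
  have hlQ : Real.log Q ≤ 2 * Real.log T := by
    have := Real.log_le_log (by exact_mod_cast hQ1) (fl_le (T := T) (β := 2 - ε2))
    rw [Real.log_rpow (by linarith)] at this
    nlinarith [Real.log_nonneg hT1]
  have hlQ0 : 0 ≤ Real.log Q := Real.log_natCast_nonneg _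
  have hS0 : 0 ≤ Real.log (SS k) := Real.log_natCast_nonneg _
  have hn : ((3 * Nat.log 2 (SS k * Q ^ 3) : ℕ) : ℝ) ≤ (1 + 5 * Real.log (SS k)) + 30 * Real.log T := by
    have a : Real.logb 2 ((SS k * Q ^ 3 : ℕ):ℝ) = (Real.log (SS k) + 3 * Real.log Q) / Real.log 2 := by
      rw [Real.logb]; push_cast
      rw [Real.log_mul (by unfold SS; positivity) (by positivity), Real.log_pow]; norm_num
    have b := Real.natLog_le_logb (SS k * Q ^ 3) 2
    push_cast at b a ⊢
    rw [a] at b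
    have c : (Real.log (SS k) + 3 * Real.log Q) / Real.log 2 ≤ (Real.log (SS k) + 3 * Real.log Q) * (5 / 3) := by
      rw [div_le_iff₀ (by positivity)]
      nlinarith [Real.log_two_gt_d9]
    linarith
  have hn2 : 1 + Real.log Q ≤ (1 + 5 * Real.log (SS k)) + 30 * Real.log T := by linarith
  set Z := (1 + 5 * Real.log (SS k)) + 30 * Real.log T
  have hZ : 0 ≤ Z := by linarith
  have : (T:ℝ) ^ (2 - ε2) * (T:ℝ) ^ ε2 = (T:ℝ) ^ 2 := by
    rw [← Real.rpow_add (by linarith)]; norm_num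
  calc _ ≤ (T:ℝ) ^ (2 - ε2) * Z ^ m * Z ^ 2 := by
        rw [Nat.cast_pow]
        gcongr
        exact fl_le
    _ = (T:ℝ) ^ (2 - ε2) * (A * (A⁻¹ * Z ^ (m + 2))) := by field_simp; ring
    _ ≤ (T:ℝ) ^ (2 - ε2) * (A * (T:ℝ) ^ ε2) := by gcongr
    _ = _ := by rw [← this]; ring
end LV

set_option linter.unusedSectionVars false
namespace LV
open Finset Filter Topology
def bb (M : ℕ) (β : ℤ) (x : ℕ × ℕ) : ℤ := 1 + M * (β + (x.1 : ℕ))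
def cc (M : ℕ) (x : ℕ × ℕ) : ℤ := M * (1 + (x.2 : ℕ))
noncomputable def ind (M : ℕ) (β : ℤ) (y x : ℕ × ℕ) : ℝ := if (y.1:ℤ) ∣ bb M β x - (y.2:ℕ) * cc M x then 1 else 0
def bx (T : ℕ) : Finset (ℕ × ℕ) := range T ×ˢ range T
lemma lev_gen (k : Cub) (hk : k.Good) (W M : ℕ) (hW : k.c0.natAbs ≤ W)
    (hM : ∀ l : ℕ, l.Prime → W < l → ¬ l ∣ M) {m : ℕ} {ι : Type} (J : Finset ι) (φ : ι → Fin m → ℕ × ℕ)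
    (hφ : Set.InjOn φ J) (hI : ∀ i ∈ J, Adm k W (φ i)) (Q T : ℕ) (hQ : ∀ i ∈ J, DD (φ i) ≤ Q) (β : ℤ) (E : ℝ)
    (hE : (Q:ℝ) * ((3 * Nat.log 2 (SS k * Q ^ 3)) ^ m : ℕ) * (1 + Real.log Q) ^ 2 ≤ E) :
    ∑ i ∈ J, |∑ x ∈ bx T, ∏ j, ind M β (φ i j) x - (T:ℝ) ^ 2 * ∏ j, (1 / ((φ i j).1:ℝ))| ≤ E := by
  classical
  have h := level2 k hk W M hW hM (J.image φ) (by simpa using hI) Q T (by simpa using hQ) β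
  refine le_trans (le_of_eq ?_) (h.trans hE)
  rw [sum_image hφ]
  refine sum_congr rfl fun i _ => ?_
  have a : ∑ x ∈ bx T, ∏ j, ind M β (φ i j) x = ((#{x ∈ range T ×ˢ range T | Hit (φ i) (1 + M * (β + (x.1 : ℕ))) (M * (1 + (x.2 : ℕ)))} : ℕ) : ℝ) := by
    rw [card_filter]
    push_cast
    refine sum_congr rfl fun x _ => ?_
    unfold ind Hit bb cc
    rw [prod_ite_zero]
    simp
  rw [a, DD]
  congr 2
  simp [div_eq_mul_inv]
variable {k : Cub} {W : ℕ}
def PA (k : Cub) (W : ℕ) (y : ℕ × ℕ) : Prop := y.1.Prime ∧ W < y.1 ∧ y.2 < y.1 ∧ (y.1 : ℤ) ∣ k.f (y.2 : ℕ)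
lemma adm2 {y z : ℕ × ℕ} (h1 : PA k W y) (h2 : PA k W z) (h : y.1 ≠ z.1) : Adm k W ![y, z] := by
  refine ⟨fun j => ?_, fun i j hij => ?_⟩
  · fin_cases j; exacts [h1, h2]
  · fin_cases i <;> fin_cases j <;> simp_all
lemma adm3 {y z w : ℕ × ℕ} (h1 : PA k W y) (h2 : PA k W z) (h3 : PA k W w) (h : y.1 ≠ z.1) (h' : y.1 ≠ w.1) (h'' : z.1 ≠ w.1) :
    Adm k W ![y, z, w] := by
  refine ⟨fun j => ?_, fun i j hij => ?_⟩
  · fin_cases j; exacts [h1, h2, h3]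
  · fin_cases i <;> fin_cases j <;> simp_all
lemma adm4 {y z w u : ℕ × ℕ} (h1 : PA k W y) (h2 : PA k W z) (h3 : PA k W w) (h4 : PA k W u)
    (h : y.1 ≠ z.1) (h' : y.1 ≠ w.1) (h'' : z.1 ≠ w.1) (g : u.1 ≠ y.1) (g' : u.1 ≠ z.1) (g'' : u.1 ≠ w.1) :
    Adm k W ![y, z, w, u] := by
  refine ⟨fun j => ?_, fun i j hij => ?_⟩
  · fin_cases j; exacts [h1, h2, h3, h4]
  · fin_cases i <;> fin_cases j <;> simp_all <;> omega
lemma lev_all (k : Cub) (hk : k.Good) (W M : ℕ) (hW : k.c0.natAbs ≤ W)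
    (hM : ∀ l : ℕ, l.Prime → W < l → ¬ l ∣ M) (Q T : ℕ) (β : ℤ) (E : ℝ)
    (hE : ∀ m, m ≤ 4 → (Q:ℝ) * ((3 * Nat.log 2 (SS k * Q ^ 3)) ^ m : ℕ) * (1 + Real.log Q) ^ 2 ≤ E)
    (S0 S1 S2 SP : Finset (ℕ × ℕ)) (R : ℕ × ℕ → ℕ × ℕ → ℕ × ℕ → Finset (ℕ × ℕ))
    (H0 : ∀ y ∈ S0, PA k W y) (H1 : ∀ y ∈ S1, PA k W y) (H2 : ∀ y ∈ S2, PA k W y) (HP : ∀ y ∈ SP, PA k W y)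
    (H01 : ∀ y ∈ S0, ∀ z ∈ S1, y.1 ≠ z.1) (H02 : ∀ y ∈ S0, ∀ z ∈ S2, y.1 ≠ z.1) (H12 : ∀ y ∈ S1, ∀ z ∈ S2, y.1 ≠ z.1)
    (H0P : ∀ y ∈ S0, ∀ z ∈ SP, y.1 ≠ z.1 ∧ y.1 * z.1 ≤ Q)
    (H3 : ∀ y0 ∈ S0, ∀ y1 ∈ S1, ∀ y2 ∈ S2, y0.1 * y1.1 * y2.1 ≤ Q)
    (HR : ∀ y0 ∈ S0, ∀ y1 ∈ S1, ∀ y2 ∈ S2, ∀ y ∈ R y0 y1 y2, PA k W y ∧ y.1 ≠ y0.1 ∧ y.1 ≠ y1.1 ∧ y.1 ≠ y2.1 ∧ y0.1 * y1.1 * y2.1 * y.1 ≤ Q) :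
    (∑ y ∈ S0, ∑ z ∈ SP, |∑ x ∈ bx T, ind M β y x * ind M β z x - (T:ℝ) ^ 2 * (1 / (y.1:ℝ) * (1 / (z.1:ℝ)))| ≤ E) ∧
    (∑ y0 ∈ S0, ∑ y1 ∈ S1, ∑ y2 ∈ S2, |∑ x ∈ bx T, ind M β y0 x * ind M β y1 x * ind M β y2 x - (T:ℝ) ^ 2 * (1 / (y0.1:ℝ) * (1 / (y1.1:ℝ)) * (1 / (y2.1:ℝ)))| ≤ E) ∧
    (∑ y0 ∈ S0, ∑ y1 ∈ S1, ∑ y2 ∈ S2, ∑ y ∈ R y0 y1 y2,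
      |∑ x ∈ bx T, ind M β y0 x * ind M β y1 x * ind M β y2 x * ind M β y x - (T:ℝ) ^ 2 * (1 / (y0.1:ℝ) * (1 / (y1.1:ℝ)) * (1 / (y2.1:ℝ)) * (1 / (y.1:ℝ)))| ≤ E) := by
  refine ⟨?_, ?_, ?_⟩
  · have := lev_gen k hk W M hW hM (m := 2) (S0 ×ˢ SP) (fun i => ![i.1, i.2]) (by
      intro i _ j _ h; simpa [Prod.ext_iff, funext_iff, Fin.forall_fin_succ] using h) (fun i hi => by
      rw [mem_product] at hi
      exact adm2 (H0 _ hi.1) (HP _ hi.2) (H0P _ hi.1 _ hi.2).1) Q T (fun i hi => by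
      rw [mem_product] at hi
      simpa [DD, Fin.prod_univ_succ] using (H0P _ hi.1 _ hi.2).2) β E (hE 2 (by norm_num))
    rw [sum_product] at this
    simpa only [Fin.prod_univ_two, Matrix.cons_val_zero, Matrix.cons_val_one] using this
  · have := lev_gen k hk W M hW hM (m := 3) (S0 ×ˢ (S1 ×ˢ S2)) (fun i => ![i.1, i.2.1, i.2.2]) (by
      intro i _ j _ h; simpa [Prod.ext_iff, funext_iff, Fin.forall_fin_succ] using h) (fun i hi => by
      rw [mem_product, mem_product] at hi
      exact adm3 (H0 _ hi.1) (H1 _ hi.2.1) (H2 _ hi.2.2) (H01 _ hi.1 _ hi.2.1) (H02 _ hi.1 _ hi.2.2) (H12 _ hi.2.1 _ hi.2.2)) Q T (fun i hi => by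
      rw [mem_product, mem_product] at hi
      simpa [DD, Fin.prod_univ_succ, mul_assoc] using (H3 _ hi.1 _ hi.2.1 _ hi.2.2)) β E (hE 3 (by norm_num))
    simp only [sum_product] at this
    simpa only [Fin.prod_univ_three, Matrix.cons_val_zero, Matrix.cons_val_one, Matrix.cons_val_two, Matrix.tail_cons, Matrix.head_cons, Matrix.cons_val] using this
  · have := lev_gen k hk W M hW hM (m := 4) ((S0 ×ˢ (S1 ×ˢ S2)).sigma (fun i => R i.1 i.2.1 i.2.2)) (fun i => ![i.1.1, i.1.2.1, i.1.2.2, i.2]) (by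
      rintro ⟨i, i'⟩ _ ⟨j, j'⟩ _ h
      simp [Prod.ext_iff, funext_iff, Fin.forall_fin_succ] at h
      have h1 : i = j := by simp only [Prod.ext_iff]; tauto
      subst h1
      have h2 : i' = j' := by simp only [Prod.ext_iff]; tauto
      rw [h2]) (fun i hi => by
      rw [mem_sigma, mem_product, mem_product] at hi
      obtain ⟨⟨a, b, c⟩, d⟩ := hi
      obtain ⟨e1, e2, e3, e4, e5⟩ := HR _ a _ b _ c _ d
      exact adm4 (H0 _ a) (H1 _ b) (H2 _ c) e1 (H01 _ a _ b) (H02 _ a _ c) (H12 _ b _ c) e2 e3 e4) Q T (fun i hi => by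
      rw [mem_sigma, mem_product, mem_product] at hi
      obtain ⟨⟨a, b, c⟩, d⟩ := hi
      obtain ⟨e1, e2, e3, e4, e5⟩ := HR _ a _ b _ c _ d
      simpa [DD, Fin.prod_univ_succ, mul_assoc] using e5) β E (hE 4 (by norm_num))
    rw [sum_sigma] at this
    simp only [sum_product] at this
    simpa only [Fin.prod_univ_four, Matrix.cons_val_zero, Matrix.cons_val_one, Matrix.cons_val_two, Matrix.tail_cons, Matrix.head_cons, Matrix.cons_val] using this
end LV

set_option linter.unusedSectionVars false
namespace LV
open Finset Filter Topology
lemma RR_diff' (k : Cub) (u v : ℕ) : RR k v - RR k u ≤ ∑ l ∈ SV.pr u v, ME.rho k l * (Real.log l / l) := by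
  rcases le_total u v with h | h
  · rw [RR_diff k h]
  · have : RR k v ≤ RR k u := by
      unfold RR
      refine sum_le_sum_of_subset_of_nonneg ?_ fun p _ _ => ?_
      · intro p; simp only [Nat.mem_primesLE]; grind
      · have := Real.log_natCast_nonneg p; positivity
    have h2 : 0 ≤ ∑ l ∈ SV.pr u v, ME.rho k l * (Real.log l / l) := sum_nonneg fun p _ => by
      have := Real.log_natCast_nonneg p; positivity
    linarith
lemma lg_mem {k : Cub} {T : ℕ} {α β : ℝ} {y : ℕ × ℕ} (hT : 1 ≤ T) (h : y ∈ prs k (fl T α) (fl T β)) :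
    α * Real.log T ≤ Real.log y.1 ∧ Real.log y.1 ≤ β * Real.log T := by
  have hT1 : (0:ℝ) < T := by exact_mod_cast hT
  obtain ⟨⟨⟨a, b⟩, c⟩, -⟩ := mem_prs.1 h
  rw [← Real.log_rpow hT1, ← Real.log_rpow hT1]
  exact ⟨Real.log_le_log (by positivity) (fl_lt.1 a).le, Real.log_le_log (by exact_mod_cast c.pos) (le_fl.1 b)⟩
lemma sumR_ge (k : Cub) (W L : ℕ) (A : Finset ℕ) (hA : #A ≤ 3) :
    RR k L - RR k W - 9 ≤ ∑ y ∈ (prs k W L).filter (fun y => y.1 ∉ A), Real.log y.1 * (1 / (y.1:ℝ)) := by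
  rw [sum_filter, sum_prs k W L (fun l => if l ∉ A then Real.log l * (1 / (l:ℝ)) else 0)]
  have h := RR_diff' k W L
  have h3 : ∑ l ∈ SV.pr W L, ((ME.rho k l:ℝ) * (Real.log l / l) - ME.rho k l * (if l ∉ A then Real.log l * (1 / (l:ℝ)) else 0)) ≤ 9 := by
    calc _ ≤ ∑ l ∈ SV.pr W L, (if l ∈ A then (3:ℝ) else 0) := by
          refine sum_le_sum fun l hl => ?_
          have hp := (SV.mem_pr.1 hl).2
          by_cases h : l ∈ A
          · simp only [h, not_true, if_false, if_true, mul_zero, sub_zero]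
            have h1 : (ME.rho k l : ℝ) ≤ 3 := by exact_mod_cast ME.rho_le k hp
            have h2 : Real.log l / l ≤ 1 := by
              rw [div_le_one (by exact_mod_cast hp.pos)]
              exact Real.log_le_self (by positivity)
            have : 0 ≤ Real.log l / l := div_nonneg (Real.log_natCast_nonneg _) (by positivity)
            nlinarith
          · simp only [h, not_false_eq_true, if_true, if_false]
            apply le_of_eq; ring
      _ = 3 * #(SV.pr W L ∩ A) := by rw [← sum_filter, filter_mem_eq_inter]; simp [mul_comm]
      _ ≤ 9 := by
          have : (#(SV.pr W L ∩ A) : ℝ) ≤ 3 := by exact_mod_cast (card_le_card inter_subset_right).trans hA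
          linarith
  rw [sum_sub_distrib] at h3
  linarith
lemma pow_big {α : ℝ} (m : ℕ) (hα : 0 < α) (h : 3 < α * (m + 1)) (C : ℝ) :
    ∀ᶠ T : ℕ in atTop, C * (T:ℝ) ^ 3 < (fl T α : ℝ) ^ (m + 1) := by
  have h1 := (rpow_nat (show 0 < α * (m + 1) - 3 by linarith)).eventually_gt_atTop (C * 2 ^ (m + 1))
  filter_upwards [h1, eventually_ge_atTop 1] with T a b
  have hT1 : (1:ℝ) ≤ T := by exact_mod_cast b
  have h2 : ((T:ℝ) ^ α / 2) ^ (m + 1) ≤ (fl T α : ℝ) ^ (m + 1) :=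
    pow_le_pow_left₀ (by positivity) (fl_ge (Real.one_le_rpow hT1 hα.le)) _
  refine lt_of_lt_of_le ?_ h2
  rw [div_pow, lt_div_iff₀ (by positivity), ← Real.rpow_natCast ((T:ℝ) ^ α), ← Real.rpow_mul (by linarith)]
  have : (T:ℝ) ^ (α * ((m + 1 : ℕ):ℝ)) = (T:ℝ) ^ (α * (m + 1) - 3) * (T:ℝ) ^ 3 := by
    rw [← Real.rpow_natCast _ 3, ← Real.rpow_add (by linarith)]; push_cast; ring_nf
  rw [this]
  have : C * (T:ℝ) ^ 3 * 2 ^ (m + 1) = (C * 2 ^ (m + 1)) * (T:ℝ) ^ 3 := by ring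
  rw [this]
  have : (0:ℝ) < (T:ℝ) ^ 3 := by positivity
  gcongr
lemma root_exists (k : Cub) {P : ℕ} (hP : P.Prime) {b c : ℤ} (hd : (P:ℤ) ∣ k.F b c) (hbc : IsCoprime b c) :
    ∃ κ : ℕ, κ < P ∧ (P:ℤ) ∣ k.f (κ:ℕ) ∧ (P:ℤ) ∣ b - (κ:ℕ) * c := by
  have hPi : Prime (P:ℤ) := Nat.prime_iff_prime_int.1 hP
  have hc : ¬ (P:ℤ) ∣ c := by
    intro h
    have : (P:ℤ) ∣ b ^ 3 := by
      have e : b ^ 3 = k.F b c - c * (k.c2 * b ^ 2 + k.c1 * b * c + k.c0 * c ^ 2) := by simp only [Cub.F]; ring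
      rw [e]; exact dvd_sub hd (h.mul_right _)
    exact hPi.not_unit (hbc.isUnit_of_dvd' (hPi.dvd_of_dvd_pow this) h)
  obtain ⟨u, v, huv⟩ := (hPi.coprime_iff_not_dvd.2 hc)
  have hP0 : (P:ℤ) ≠ 0 := by exact_mod_cast hP.ne_zero
  refine ⟨((b * v) % P).toNat, ?_, ?_, ?_⟩
  · have := Int.emod_lt_of_pos (b * v) (show (0:ℤ) < P by exact_mod_cast hP.pos)
    have := Int.emod_nonneg (b * v) hP0
    omega
  all_goals rw [Int.toNat_of_nonneg (Int.emod_nonneg _ hP0)]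
  · have h3 : (P:ℤ) ∣ k.f (b * v % P) - k.f (b * v) := f_congr k (by
      exact (Int.mod_modEq _ _).symm.dvd)
    have h4 : (P:ℤ) ∣ c ^ 3 * k.f (b * v) := by
      have : c ^ 3 * k.f (b * v) = k.F (b * v * c) c := by simp only [Cub.f, Cub.F]; ring
      rw [this]
      have e : b * v * c = b - P * (u * b) := by linear_combination b * huv
      have : k.F (b * v * c) c = k.F b c + P * (-(u * b)) * ((b * v * c) ^ 2 + (b * v * c) * b + b ^ 2 + k.c2 * c * (b * v * c + b) + k.c1 * c ^ 2) := by
        simp only [Cub.F, e]; ring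
      rw [this]
      exact dvd_add hd ((Dvd.intro _ rfl).mul_right _)
    have h5 := (hPi.dvd_or_dvd h4).resolve_left (fun h => hc (hPi.dvd_of_dvd_pow h))
    exact (dvd_sub_left h5).1 h3 |> fun h => h
  · have : b - b * v % P * c = (P:ℤ) * (u * b + b * v / P * c) := by
      have := Int.emod_add_mul_ediv (b * v) P
      linear_combination b * (-huv) + (-c) * this
    rw [this]; exact Dvd.intro _ rfl
end LV

set_option linter.unusedSectionVars false
namespace LV
open Finset Filter Topology
lemma bc_bd (M K1 T : ℕ) (hT : 1 ≤ T) {x : ℕ × ℕ} (hx : x ∈ bx T) :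
    |bb M ((K1 * T : ℕ):ℤ) x| ≤ ((1 + M * (K1 + 1)) * T : ℕ) ∧ |cc M x| ≤ ((1 + M * (K1 + 1)) * T : ℕ) := by
  unfold bx at hx
  rw [mem_product, mem_range, mem_range] at hx
  unfold bb cc
  constructor
  · rw [abs_of_nonneg (by positivity)]
    norm_cast
    have : M * x.1 ≤ M * T := Nat.mul_le_mul_left _ hx.1.le
    nlinarith
  · rw [abs_of_nonneg (by positivity)]
    norm_cast
    exact (Nat.mul_le_mul_left _ (by omega)).trans (Nat.mul_le_mul_right T (show M ≤ 1 + M * (K1 + 1) by nlinarith))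
open Classical in
set_option maxHeartbeats 2000000 in
theorem G1 (k : Cub) (hk : k.Good) (hRt : Tendsto (fun n : ℕ => RR k n / Real.log n) atTop (𝓝 1))
    (W M K1 : ℕ) (hM0 : 1 ≤ M) (hW : k.c0.natAbs ≤ W) (hM : ∀ l : ℕ, l.Prime → W < l → ¬ l ∣ M)
    (ε : ℝ) (hε : 0 < ε) (hε1 : ε ≤ 1 / 10 ^ 7) (m0 : ℕ) (hm0 : 3 < ε / 4 * (m0 + 1)) :
    ∀ᶠ T : ℕ in atTop, 4 / 10 ^ 4 * ε * (T:ℝ) ^ 2 ≤ (3 * m0 : ℕ) * 441 *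
      (#((bx T).filter fun x => ((∀ p : ℕ, p.Prime → (p:ℤ) ∣ k.F (bb M ((K1 * T : ℕ):ℤ) x) (cc M x) → p ≤ fl T (1 - ε)) ∨
          ¬ IsCoprime (bb M ((K1 * T : ℕ):ℤ) x) (cc M x)) ∧ ∃ p : ℕ, (fl T (ε / 4) < p ∧ p ≤ fl T (ε / 2)) ∧ p.Prime ∧
          (p:ℤ) ∣ k.F (bb M ((K1 * T : ℕ):ℤ) x) (cc M x)) : ℝ) := by
  set C' : ℕ := SS k * (1 + M * (K1 + 1)) ^ 3 with hC'
  obtain ⟨CR, hCR0, hCR⟩ := RR_ge k hRt (ε / 64) (by positivity)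
  have hC'1 : 1 ≤ C' := by
    rw [hC']; exact Nat.mul_pos (by unfold SS; omega) (by positivity)
  set C1 : ℝ := Real.log C' with hC1
  have hC10 : 0 ≤ C1 := Real.log_natCast_nonneg _
  have e1 : ∀ᶠ T : ℕ in atTop, ∀ m, m ≤ 4 → ((fl T (2 - ε/16):ℕ):ℝ) * ((3 * Nat.log 2 (SS k * (fl T (2 - ε/16)) ^ 3)) ^ m : ℕ) * (1 + Real.log (fl T (2 - ε/16))) ^ 2 ≤ ε / 10 ^ 6 * (T:ℝ) ^ 2 := by
    have : ∀ᶠ T : ℕ in atTop, ∀ m ∈ range 5, ((fl T (2 - ε/16):ℕ):ℝ) * ((3 * Nat.log 2 (SS k * (fl T (2 - ε/16)) ^ 3)) ^ m : ℕ) * (1 + Real.log (fl T (2 - ε/16))) ^ 2 ≤ ε / 10 ^ 6 * (T:ℝ) ^ 2 := by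
      rw [eventually_all_finset]
      intro m _
      exact lev_err k (ε / 16) (ε / 10 ^ 6) (by positivity) (by linarith) (by positivity) m
    filter_upwards [this] with T h m hm
    exact h m (by rw [mem_range]; omega)
  filter_upwards [e1, S_ge k hRt (α := ε / 4) (β := ε / 2) (s := 1 / 10) (by positivity) (by linarith) (by rw [lt_div_iff₀ (by positivity)]; linarith),
    S_ge k hRt (α := 0.5) (β := 0.6) (s := 1 / 10) (by norm_num) (by norm_num) (by norm_num),
    S_ge k hRt (α := 0.6) (β := 0.7) (s := 1 / 10) (by norm_num) (by norm_num) (by norm_num),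
    S_le k hRt (α := 1 - ε) (β := 1 + ε) (s := 5 * ε) (by linarith) (by linarith) (by rw [div_lt_iff₀ (by linarith)]; nlinarith),
    pow_big m0 (α := ε / 4) (by positivity) hm0 C', pow_big 7 (α := 0.5) (by norm_num) (by norm_num) C',
    pow_big 7 (α := 0.6) (by norm_num) (by norm_num) C',
    log_nat.eventually_ge_atTop (1 + C1 + 64 / ε * (C1 + CR + RR k W + 10)), eventually_ge_atTop 1,
    (fl_tendsto (show 0 < ε / 4 by positivity)).eventually_ge_atTop (W + 1)] with T f1 f2 f3 f4 f5 f6 f7 f8 f9 hT f10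
  have hT1 : (1:ℝ) ≤ T := by exact_mod_cast hT
  have hT0 : (0:ℝ) < T := by linarith
  set lT := Real.log T with hlT
  have hbig : 64 / ε * (C1 + CR + RR k W + 10) ≤ lT ∧ C1 + 1 ≤ lT := by
    have := RR_nonneg k W
    have : 0 ≤ 64 / ε * (C1 + CR + RR k W + 10) := by positivity
    constructor <;> linarith
  have hlT0 : 0 < lT := by linarith
  have hel : ε * lT ≤ 1 / 10 ^ 7 * lT := by gcongr
  have hel0 : 0 < ε * lT := by positivity
  have hmono : ∀ {u v : ℝ}, u ≤ v → fl T u ≤ fl T v := fun h =>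
    Nat.floor_le_floor (Real.rpow_le_rpow_of_exponent_le hT1 h)
  set Q := fl T (2 - ε / 16) with hQ
  set Y := fl T (1 - ε) with hY
  have prodQ : ∀ {a : ℕ} (s : ℝ), 0 < a → Real.log a ≤ s * lT → s ≤ 2 - ε / 16 → a ≤ Q := by
    intro a s h0 h1 h2
    rw [hQ, le_fl]
    rw [← Real.log_le_log_iff (by exact_mod_cast h0) (by positivity), Real.log_rpow hT0]
    exact h1.trans (by gcongr)
  set S0 := prs k (fl T (ε / 4)) (fl T (ε / 2)) with hS0
  set S1 := prs k (fl T 0.5) (fl T 0.6) with hS1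
  set S2 := prs k (fl T 0.6) (fl T 0.7) with hS2
  set SP := prs k Y (fl T (1 + ε)) with hSP
  have hPA : ∀ {α β : ℝ}, ε / 4 ≤ α → ∀ y ∈ prs k (fl T α) (fl T β), PA k W y := by
    intro α β h y hy
    obtain ⟨⟨⟨a, b⟩, c⟩, d, e⟩ := mem_prs.1 hy
    refine ⟨c, ?_, d, e⟩
    have := hmono h
    omega
  have hdis : ∀ {α β α' β' : ℝ}, β ≤ α' → ∀ y ∈ prs k (fl T α) (fl T β), ∀ z ∈ prs k (fl T α') (fl T β'), y.1 ≠ z.1 := by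
    intro α β α' β' h y hy z hz
    have h1 := (mem_prs.1 hy).1.1.2
    have h2 := (mem_prs.1 hz).1.1.1
    have := hmono h
    omega
  have hpos : ∀ {u v : ℕ} {y : ℕ × ℕ}, y ∈ prs k u v → (0:ℝ) < y.1 := fun hy => by exact_mod_cast (mem_prs.1 hy).1.2.pos
  set R : ℕ × ℕ → ℕ × ℕ → ℕ × ℕ → Finset (ℕ × ℕ) := fun y0 y1 y2 =>
    (prs k W (Q / (y0.1 * y1.1 * y2.1))).filter (fun y => y.1 ∉ ({y0.1, y1.1, y2.1} : Finset ℕ)) with hR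
  have hlog3 : ∀ y0 ∈ S0, ∀ y1 ∈ S1, ∀ y2 ∈ S2, Real.log ((y0.1 * y1.1 * y2.1 : ℕ):ℝ) = Real.log y0.1 + Real.log y1.1 + Real.log y2.1 := by
    intro y0 g0 y1 g1 y2 g2
    have := hpos g0; have := hpos g1; have := hpos g2
    push_cast
    rw [Real.log_mul (by positivity) (by positivity), Real.log_mul (by positivity) (by positivity)]
  have hlgs : ∀ y0 ∈ S0, ∀ y1 ∈ S1, ∀ y2 ∈ S2, 1.1 * lT ≤ Real.log y0.1 + Real.log y1.1 + Real.log y2.1 ∧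
      Real.log y0.1 + Real.log y1.1 + Real.log y2.1 ≤ 1.4 * lT := by
    intro y0 g0 y1 g1 y2 g2
    have a0 := lg_mem hT g0; have a1 := lg_mem hT g1; have a2 := lg_mem hT g2
    constructor <;> linarith
  have h3Q : ∀ y0 ∈ S0, ∀ y1 ∈ S1, ∀ y2 ∈ S2, y0.1 * y1.1 * y2.1 ≤ Q := by
    intro y0 g0 y1 g1 y2 g2
    have := hpos g0; have := hpos g1; have := hpos g2
    refine prodQ 1.4 (by have : (0:ℝ) < (y0.1 * y1.1 * y2.1 : ℕ) := by push_cast; positivity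
                         exact_mod_cast this) ?_ (by linarith)
    rw [hlog3 _ g0 _ g1 _ g2]
    exact (hlgs _ g0 _ g1 _ g2).2
  have hLY : ∀ y0 ∈ S0, ∀ y1 ∈ S1, ∀ y2 ∈ S2, Q / (y0.1 * y1.1 * y2.1) ≤ Y := by
    intro y0 g0 y1 g1 y2 g2
    rw [hY, le_fl]
    have p0 := hpos g0; have p1 := hpos g1; have p2 := hpos g2
    have pp : (0:ℝ) < (y0.1 * y1.1 * y2.1 : ℕ) := by push_cast; positivity
    refine (Nat.cast_div_le).trans ?_
    rw [div_le_iff₀ pp]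
    refine (fl_le).trans ?_
    rw [← Real.log_le_log_iff (by positivity) (by positivity), Real.log_mul (by positivity) pp.ne', Real.log_rpow hT0, Real.log_rpow hT0,
      hlog3 _ g0 _ g1 _ g2]
    have := (hlgs _ g0 _ g1 _ g2).1
    linarith
  set β : ℤ := ((K1 * T : ℕ):ℤ) with hβ
  set n : ℕ × ℕ → ℕ := fun x => (k.F (bb M β x) (cc M x)).natAbs with hn
  have hn0 : ∀ x, n x ≠ 0 := by
    intro x h
    have := (hk _ _ (Int.natAbs_eq_zero.1 h)).2
    unfold cc at this
    have : (0:ℤ) < M * (1 + (x.2:ℕ)) := by positivity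
    omega
  have hnb : ∀ x ∈ bx T, n x ≤ C' * T ^ 3 := by
    intro x hx
    obtain ⟨h1, h2⟩ := bc_bd M K1 T hT hx
    have := F_bd k h1 h2
    have : ((n x : ℕ):ℤ) ≤ (C' * T ^ 3 : ℕ) := by
      rw [hn]; simp only [Int.natCast_natAbs]
      refine this.trans (le_of_eq ?_)
      rw [hC']; push_cast; ring
    exact_mod_cast this
  have hlogn : ∀ x ∈ bx T, Real.log (n x) ≤ 3 * lT + C1 := by
    intro x hx
    have h1 : (n x : ℝ) ≤ C' * T ^ 3 := by exact_mod_cast hnb x hx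
    have h2 := Real.log_le_log (by exact_mod_cast Nat.pos_of_ne_zero (hn0 x)) h1
    rw [Real.log_mul (by positivity) (by positivity), Real.log_pow] at h2
    push_cast at h2
    linarith
  have hind : ∀ {y x}, ind M β y x = 1 ∨ ind M β y x = 0 := by
    intro y x; unfold ind; split_ifs <;> simp
  have hindn : ∀ {u v : ℕ} {y : ℕ × ℕ} {x}, y ∈ prs k u v → ind M β y x ≠ 0 → y.1 ∣ n x := by
    intro u v y x hy h
    have : (y.1:ℤ) ∣ bb M β x - (y.2:ℕ) * cc M x := by
      by_contra h'; exact h (by unfold ind; rw [if_neg h'])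
    have := F_of_root k (mem_prs.1 hy).2.2 this
    exact Int.natCast_dvd.1 this
  have hmult : ∀ (u v m : ℕ) (x), x ∈ bx T → 1 ≤ u → (C':ℝ) * T ^ 3 < (u:ℝ) ^ (m + 1) → ∑ y ∈ prs k u v, ind M β y x ≤ (3 * m : ℕ) := by
    intro u v m x hx hu h
    have h1 : n x < u ^ (m + 1) := by
      have : (n x : ℝ) ≤ C' * T ^ 3 := by exact_mod_cast hnb x hx
      exact_mod_cast this.trans_lt h
    have h2 := mult_x k u v m (n x) hu (hn0 x) h1
    refine le_trans ?_ (Nat.cast_le.2 h2)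
    rw [card_filter]
    push_cast
    refine sum_le_sum fun y hy => ?_
    split_ifs with hd
    · rcases hind (y := y) (x := x) with h | h <;> rw [h] <;> norm_num
    · by_contra hh
      exact hd (hindn hy (fun h => hh (by rw [h])))
  obtain ⟨l2, l3, l4⟩ := lev_all k hk W M hW hM Q T β (ε / 10 ^ 6 * (T:ℝ) ^ 2) f1 S0 S1 S2 SP R (hPA le_rfl) (hPA (by linarith))
    (hPA (by linarith)) (hPA (by linarith)) (hdis (by linarith)) (hdis (by linarith)) (hdis (by linarith))
    (fun y hy z hz => by
      refine ⟨hdis (by linarith) y hy z hz, ?_⟩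
      have a := lg_mem hT hy; have b := lg_mem hT hz
      have p0 := hpos hy; have p1 := hpos hz
      refine prodQ 1.2 (by have : (0:ℝ) < (y.1 * z.1 : ℕ) := by push_cast; positivity
                           exact_mod_cast this) ?_ (by linarith)
      push_cast
      rw [Real.log_mul p0.ne' p1.ne']
      linarith) h3Q (fun y0 g0 y1 g1 y2 g2 y hy => by
      rw [hR] at hy
      simp only [mem_filter, mem_insert, mem_singleton, not_or] at hy
      obtain ⟨⟨⟨⟨a, b⟩, c⟩, d, e⟩, f, g, h⟩ := (⟨mem_prs.1 hy.1, hy.2⟩ : _ ∧ _)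
      refine ⟨⟨c, a, d, e⟩, f, g, h, ?_⟩
      have := (Nat.le_div_iff_mul_le (by
        have p0 := hpos g0; have p1 := hpos g1; have p2 := hpos g2
        have pp : (0:ℝ) < (y0.1 * y1.1 * y2.1 : ℕ) := by push_cast; positivity
        exact_mod_cast pp)).1 b
      linarith)
  have key := Gabs (bx T) (ind M β) (fun y x => by rcases hind (y := y) (x := x) with h | h <;> rw [h] <;> norm_num)
    S0 S1 S2 SP R (fun y => 1 / (y.1:ℝ)) (fun y => Real.log y.1)
    (fun x => ∑ l ∈ (n x).primeFactors.filter (fun l => Y < l), Real.log l)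
    (fun x => if ((∀ p : ℕ, p.Prime → (p:ℤ) ∣ k.F (bb M β x) (cc M x) → p ≤ Y) ∨ ¬ IsCoprime (bb M β x) (cc M x)) then 1 else 0)
    lT (3 * lT + C1) (ε / 10 ^ 6 * (T:ℝ) ^ 2) ε ((T:ℝ) ^ 2) ((3 * m0 : ℕ):ℝ) (fun y => by positivity) hlT0 (by positivity) (by positivity) hε hε1
    (by positivity) (fun x => by split_ifs <;> norm_num) ?_ ?_ ?_ ?_ ?_ (fun x hx => hmult _ _ _ x hx (by omega) f6)
    (fun x hx => by simpa using hmult _ _ 7 x hx (by have := hmono (show ε / 4 ≤ 0.5 by linarith); omega) f7)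
    (fun x hx => by simpa using hmult _ _ 7 x hx (by have := hmono (show ε / 4 ≤ 0.6 by linarith); omega) f8)
    l2 l3 l4 f2 f3 f4 f5 le_rfl
  · refine key.trans ?_
    rw [card_filter]
    push_cast
    refine mul_le_mul_of_nonneg_left (sum_le_sum fun x hx => ?_) (by positivity)
    by_cases h1 : 0 < ∑ y ∈ S0, ind M β y x
    · obtain ⟨y, hy, h2⟩ := exists_ne_zero_of_sum_ne_zero h1.ne'
      have h3 := hindn hy h2
      have h4 := (mem_prs.1 hy).1
      rw [if_pos h1, mul_one]
      refine le_of_eq (if_congr ?_ rfl rfl)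
      refine ⟨fun h => ⟨h, y.1, h4.1, h4.2, Int.natCast_dvd.2 h3⟩, fun h => h.1⟩
    · rw [if_neg h1, mul_zero]
      split_ifs <;> norm_num
  · intro y0 g0 y1 g1 y2 g2 x hx
    rcases hind (y := y0) (x := x) with i0 | i0 <;> rcases hind (y := y1) (x := x) with i1 | i1 <;>
      rcases hind (y := y2) (x := x) with i2 | i2 <;> rw [i0, i1, i2] <;> simp only [zero_mul, mul_zero, one_mul, sum_const_zero, sub_zero, le_refl]
    have d01 := hdis (by linarith) y0 g0 y1 g1
    have d02 := hdis (by linarith) y0 g0 y2 g2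
    have d12 := hdis (by linarith) y1 g1 y2 g2
    have := logF_ge k (bb M β x) (cc M x) (n x) rfl (hn0 x) {y0.1, y1.1, y2.1} (by
      intro l hl
      simp only [mem_insert, mem_singleton] at hl
      rcases hl with rfl | rfl | rfl
      · exact Nat.mem_primeFactors.2 ⟨(mem_prs.1 g0).1.2, hindn g0 (by rw [i0]; norm_num), hn0 x⟩
      · exact Nat.mem_primeFactors.2 ⟨(mem_prs.1 g1).1.2, hindn g1 (by rw [i1]; norm_num), hn0 x⟩
      · exact Nat.mem_primeFactors.2 ⟨(mem_prs.1 g2).1.2, hindn g2 (by rw [i2]; norm_num), hn0 x⟩) (Q / (y0.1 * y1.1 * y2.1)) Y W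
      (hLY _ g0 _ g1 _ g2) (by
      intro l hl
      simp only [mem_insert, mem_singleton] at hl
      rcases hl with rfl | rfl | rfl
      · exact (mem_prs.1 g0).1.1.2.trans (hmono (by linarith))
      · exact (mem_prs.1 g1).1.1.2.trans (hmono (by linarith))
      · exact (mem_prs.1 g2).1.1.2.trans (hmono (by linarith)))
    rw [sum_insert (by simp [d01, d02]), sum_insert (by simp [d12]), sum_singleton] at this
    have hs : ∑ y ∈ R y0 y1 y2, Real.log y.1 * ind M β y x = ∑ y ∈ (prs k W (Q / (y0.1 * y1.1 * y2.1))).filter (fun y => y.1 ∉ ({y0.1, y1.1, y2.1} : Finset ℕ) ∧ (y.1:ℤ) ∣ bb M β x - (y.2:ℕ) * cc M x), Real.log y.1 := by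
      conv_rhs => rw [← filter_filter, sum_filter]
      refine sum_congr rfl fun y _ => ?_
      unfold ind; split_ifs <;> simp
    rw [hs]
    have := hlogn x hx
    linarith
  · intro y0 g0 y1 g1 y2 g2
    have := hlgs _ g0 _ g1 _ g2
    rw [abs_le]
    constructor <;> linarith
  · intro y0 g0 y1 g1 y2 g2 y hy
    rw [hR, mem_filter] at hy
    have h1 := (mem_prs.1 hy.1).1
    refine ⟨Real.log_natCast_nonneg _, ?_⟩
    have h2 : (y.1:ℝ) ≤ (T:ℝ) ^ (1 - ε) := le_fl.1 (h1.1.2.trans (hLY _ g0 _ g1 _ g2))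
    have h3 := Real.log_le_log (by exact_mod_cast h1.2.pos) h2
    rw [Real.log_rpow hT0] at h3
    linarith
  · intro y0 g0 y1 g1 y2 g2
    have h1 := sumR_ge k W (Q / (y0.1 * y1.1 * y2.1)) {y0.1, y1.1, y2.1} card_le_three
    have p0 := hpos g0; have p1 := hpos g1; have p2 := hpos g2
    have pp : (0:ℝ) < (y0.1 * y1.1 * y2.1 : ℕ) := by push_cast; positivity
    have ppn : 0 < y0.1 * y1.1 * y2.1 := by exact_mod_cast pp
    set L := Q / (y0.1 * y1.1 * y2.1) with hL
    have hL1 : 1 ≤ L := (Nat.one_le_div_iff ppn).2 (h3Q _ g0 _ g1 _ g2)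
    have h2 := hCR L hL1
    have h3 : (T:ℝ) ^ (2 - ε / 16) ≤ 3 * (L * (y0.1 * y1.1 * y2.1 : ℕ)) := by
      have a : (Q:ℝ) ≤ (L + 1) * (y0.1 * y1.1 * y2.1 : ℕ) := by
        have := Nat.lt_mul_div_succ Q ppn
        rw [← hL] at this
        have : Q ≤ (L + 1) * (y0.1 * y1.1 * y2.1) := by linarith
        exact_mod_cast this
      have b : (T:ℝ) ^ (2 - ε / 16) ≤ Q + 1 := (Nat.lt_floor_add_one _).le
      have c : (1:ℝ) ≤ L := by exact_mod_cast hL1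
      have c' : (1:ℝ) ≤ (y0.1 * y1.1 * y2.1 : ℕ) := by exact_mod_cast ppn
      linarith [mul_nonneg (sub_nonneg.2 c) (sub_nonneg.2 c')]
    have hLp : (0:ℝ) < L := by exact_mod_cast hL1
    have h4 := Real.log_le_log (by positivity) h3
    rw [Real.log_rpow hT0, Real.log_mul (by norm_num) (by positivity), Real.log_mul (by positivity) (by positivity), hlog3 _ g0 _ g1 _ g2] at h4
    have h5 : Real.log 3 ≤ 2 := by
      have := Real.log_le_sub_one_of_pos (show (0:ℝ) < 3 by norm_num); linarith
    have h6 : Real.log L ≤ 2 * lT := by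
      have a : (L:ℝ) ≤ (T:ℝ) ^ (1 - ε) := le_fl.1 (hLY _ g0 _ g1 _ g2)
      have := Real.log_le_log hLp a
      rw [Real.log_rpow hT0] at this
      linarith
    have h7 : ε / 64 * Real.log L ≤ ε / 64 * (2 * lT) := by gcongr
    have h8 : C1 + CR + RR k W + 10 ≤ ε / 64 * lT := by
      have := hbig.1
      rw [div_mul_eq_mul_div, div_le_iff₀ hε] at this
      linarith
    change RR k L - RR k W - 9 ≤ ∑ y ∈ R y0 y1 y2, _ at h1
    have := RR_nonneg k W
    beta_reduce
    linarith
  · intro x hx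
    have hL0 : 0 ≤ ∑ l ∈ (n x).primeFactors.filter (fun l => Y < l), Real.log l := sum_nonneg fun _ _ => Real.log_natCast_nonneg _
    have hi0 : ∀ y, 0 ≤ ind M β y x := fun y => by rcases hind (y := y) (x := x) with h | h <;> rw [h] <;> norm_num
    have hP0 : 0 ≤ ∑ z ∈ SP, ind M β z x := sum_nonneg fun _ _ => hi0 _
    have hP1 : 0 ≤ 2 * ε * lT * ∑ z ∈ SP, ind M β z x := by positivity
    split_ifs with hv
    · linarith
    · push_neg at hv
      obtain ⟨⟨P, hP, hPd, hPY⟩, hco⟩ := hv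
      have hmem : P ∈ (n x).primeFactors.filter (fun l => Y < l) := mem_filter.2 ⟨Nat.mem_primeFactors.2 ⟨hP, Int.natCast_dvd.1 hPd, hn0 x⟩, hPY⟩
      have hLP : Real.log P ≤ ∑ l ∈ (n x).primeFactors.filter (fun l => Y < l), Real.log l :=
        single_le_sum (f := fun l : ℕ => Real.log l) (fun _ _ => Real.log_natCast_nonneg _) hmem
      rcases le_or_gt P (fl T (1 + ε)) with hle | hgt
      · obtain ⟨κ, a, b, c⟩ := root_exists k hP hPd hco
        have hz : (P, κ) ∈ SP := mem_prs.2 ⟨⟨⟨hPY, hle⟩, hP⟩, a, b⟩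
        have h1 : 1 ≤ ∑ z ∈ SP, ind M β z x := by
          refine le_trans (le_of_eq ?_) (single_le_sum (fun y _ => hi0 y) hz)
          unfold ind; rw [if_pos c]
        have h2 := (lg_mem hT hz).1
        have : 2 * ε * lT * 1 ≤ 2 * ε * lT * ∑ z ∈ SP, ind M β z x := by gcongr
        simp only at h2
        linarith
      · have h1 := Real.log_le_log (by positivity) (fl_lt.1 hgt).le
        rw [Real.log_rpow hT0] at h1
        linarith
end LV

set_option linter.unusedSectionVars false
namespace LV
open Finset Filter Topology
open Polynomial in
lemma sep (k : Cub) (hf : Irreducible (X^3 + C k.c2 * X^2 + C k.c1 * X + C k.c0 : ℤ[X])) :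
    ∃ D : ℕ, D ≠ 0 ∧ ∀ n : ℤ, ∀ l : ℕ, (l:ℤ) ∣ k.f n → (l:ℤ) ∣ 3 * n ^ 2 + 2 * k.c2 * n + k.c1 → l ∣ D := by
  have hm : (X ^ 3 + C k.c2 * X ^ 2 + C k.c1 * X + C k.c0 : ℤ[X]).Monic := by monicity!
  have hq := (Polynomial.IsPrimitive.Int.irreducible_iff_irreducible_map_cast hm.isPrimitive).1 hf
  obtain ⟨a, b, hab⟩ := hq.separable
  obtain ⟨u, hu, hu'⟩ := IsLocalization.integerNormalization_spec (nonZeroDivisors ℤ) a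
  obtain ⟨v, hv, hv'⟩ := IsLocalization.integerNormalization_spec (nonZeroDivisors ℤ) b
  generalize IsLocalization.integerNormalization (nonZeroDivisors ℤ) a = a' at hu'
  generalize IsLocalization.integerNormalization (nonZeroDivisors ℤ) b = b' at hv'
  have h0 : u * v ≠ 0 := mul_ne_zero (nonZeroDivisors.ne_zero hu) (nonZeroDivisors.ne_zero hv)
  have key : C v * a' * (X ^ 3 + C k.c2 * X ^ 2 + C k.c1 * X + C k.c0) + C u * b' * derivative (X ^ 3 + C k.c2 * X ^ 2 + C k.c1 * X + C k.c0) = C (u * v) := by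
    apply Polynomial.map_injective (algebraMap ℤ ℚ) (algebraMap ℤ ℚ).injective_int
    rw [Polynomial.map_add, Polynomial.map_mul, Polynomial.map_mul, hu', Polynomial.map_mul, Polynomial.map_mul, hv', ← Polynomial.derivative_map]
    have e : Int.castRingHom ℚ = algebraMap ℤ ℚ := rfl
    rw [e] at hab
    rw [← mul_one (Polynomial.map (algebraMap ℤ ℚ) (C (u * v))), ← hab, Polynomial.map_C, Polynomial.map_C, Polynomial.map_C, map_mul, map_mul, zsmul_eq_mul, zsmul_eq_mul]
    simp only [eq_intCast, map_intCast]
    ring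
  refine ⟨(u * v).natAbs, by simpa using h0, fun n l h1 h2 => ?_⟩
  rw [← Int.natCast_dvd]
  have := congrArg (eval n) key
  simp only [eval_add, eval_mul, eval_C, eval_pow, eval_X, derivative_add, derivative_mul, derivative_C, derivative_X_pow, derivative_X] at this
  rw [← this]
  refine dvd_add (Dvd.dvd.mul_left (by simpa [Cub.f] using h1) _) (Dvd.dvd.mul_left ?_ _)
  refine h2.trans (dvd_of_eq ?_)
  simp
  ring
lemma rho_pow (k : Cub) {l e : ℕ} (hl : l.Prime) (he : 1 ≤ e)
    (h : e = 1 ∨ ∀ n : ℤ, (l:ℤ) ∣ k.f n → ¬ (l:ℤ) ∣ 3 * n ^ 2 + 2 * k.c2 * n + k.c1) : ME.rho k (l ^ e) ≤ ME.rho k l := by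
  rcases h with rfl | h
  · simp
  have hd : (l:ℤ) ∣ ((l ^ e : ℕ) : ℤ) := by exact_mod_cast dvd_pow_self l (by omega)
  refine card_le_card_of_injOn (fun t => t % l) (fun t ht => ?_) (fun u hu v hv huv => ?_)
  · simp only [coe_filter, mem_range, Set.mem_setOf_eq] at ht ⊢
    refine ⟨Nat.mod_lt _ hl.pos, ?_⟩
    have := f_congr k (l := l) (x := t) (y := ((t % l : ℕ):ℤ)) (by
      exact ((Nat.modEq_iff_dvd.1 (Nat.mod_modEq t l)) ))
    exact (dvd_sub_right (hd.trans ht.2)).1 this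
  · simp only [coe_filter, mem_range, Set.mem_setOf_eq] at hu hv huv
    have h1 : (l:ℤ) ∣ (u:ℤ) - v := Nat.modEq_iff_dvd.1 (show v ≡ u [MOD l] from huv.symm)
    have h2 : ((l ^ e : ℕ):ℤ) ∣ ((u:ℤ) - v) * ((u:ℤ)^2 + u * v + v ^2 + k.c2 * (u + v) + k.c1) := by
      refine (dvd_sub hu.2 hv.2).trans (dvd_of_eq ?_)
      simp only [Cub.f]; ring
    have h3 : IsCoprime ((l ^ e : ℕ):ℤ) ((u:ℤ)^2 + u * v + v ^2 + k.c2 * (u + v) + k.c1) := by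
      push_cast
      refine IsCoprime.pow_left ((Prime.coprime_iff_not_dvd (Nat.prime_iff_prime_int.1 hl)).2 fun h4 => ?_)
      refine h u (hd.trans hu.2) ?_
      exact (dvd_add h4 (h1.mul_right (2 * u + v + k.c2))).trans (dvd_of_eq (by ring))
    have h4 := h3.dvd_of_dvd_mul_right h2
    have h5 : v ≡ u [MOD l ^ e] := Nat.modEq_iff_dvd.2 h4
    exact (Nat.ModEq.eq_of_lt_of_lt h5 hv.1 hu.1).symm
lemma cnt (k : Cub) {D : ℕ} (hD : D ≠ 0) (s M : ℤ) (hM : IsCoprime M (D:ℤ)) (T : ℕ) :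
    #{t ∈ range T | (D:ℤ) ∣ k.f (s + M * (t:ℕ))} ≤ ((T - 1) / D + 1) * ME.rho k D := by
  rw [ME.rho, ← card_range ((T - 1) / D + 1), ← card_product]
  have hD' : (0:ℤ) < D := by positivity
  have hn : ∀ t : ℕ, (((s + M * t) % D).toNat : ℤ) = (s + M * t) % D := fun t => Int.toNat_of_nonneg (Int.emod_nonneg _ hD'.ne')
  refine card_le_card_of_injOn (fun t => (t / D, ((s + M * t) % D).toNat)) (fun t ht => ?_) (fun u hu v hv huv => ?_)
  · simp only [coe_filter, mem_range, Set.mem_setOf_eq, coe_product, Set.mem_prod, mem_coe, mem_filter] at ht ⊢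
    refine ⟨Nat.lt_succ_of_le (Nat.div_le_div_right (Nat.le_sub_one_of_lt ht.1)), ?_, ?_⟩
    · zify; rw [hn]; exact Int.emod_lt_of_pos _ hD'
    · rw [hn]
      have := f_congr k (l := D) (x := s + M * t) (y := (s + M * t) % D) (Int.dvd_self_sub_emod)
      exact (dvd_sub_right ht.2).1 this
  · simp only [Prod.mk.injEq] at huv
    have h1 : (s + M * u) % D = (s + M * v) % D := by rw [← hn u, ← hn v, huv.2]
    have h2 : (D:ℤ) ∣ M * ((u:ℤ) - v) := by
      have := Int.ModEq.dvd (show (s + M * v) ≡ s + M * u [ZMOD D] from h1.symm)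
      exact this.trans (dvd_of_eq (by ring))
    have h3 := hM.symm.dvd_of_dvd_mul_left h2
    have h5 : v ≡ u [MOD D] := Nat.modEq_iff_dvd.2 h3
    rw [← Nat.div_add_mod u D, ← Nat.div_add_mod v D, huv.1, h5]
end LV

set_option linter.unusedSectionVars false
namespace LV
open Finset Filter Topology
lemma cnt1 {D : ℕ} (s M : ℤ) (hM : IsCoprime M (D:ℤ)) (T : ℕ) :
    #{t ∈ range T | (D:ℤ) ∣ s + M * (t:ℕ)} ≤ T / D + 1 := by
  rw [← card_range (T / D + 1)]
  refine card_le_card_of_injOn (fun t => t / D) (fun t ht => ?_) (fun u hu v hv huv => ?_)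
  · simp only [coe_filter, mem_range, Set.mem_setOf_eq, mem_coe] at ht ⊢
    exact Nat.lt_succ_of_le (Nat.div_le_div_right ht.1.le)
  · simp only [coe_filter, mem_range, Set.mem_setOf_eq] at huv hu hv
    have h2 : (D:ℤ) ∣ M * ((u:ℤ) - v) := (dvd_sub hu.2 hv.2).trans (dvd_of_eq (by ring))
    have h3 := hM.symm.dvd_of_dvd_mul_left h2
    have h5 : v ≡ u [MOD D] := Nat.modEq_iff_dvd.2 h3
    rw [← Nat.div_add_mod u D, ← Nat.div_add_mod v D, huv, h5]
lemma gW (k : Cub) {M l : ℕ} (hl : l.Prime) {β : ℤ} {x : ℕ × ℕ} (h : (l:ℤ) ∣ k.F (bb M β x) (cc M x)) : ¬ l ∣ M := by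
  intro hM
  have hM' : (l:ℤ) ∣ M := by exact_mod_cast hM
  have : (M:ℤ) ∣ k.F (bb M β x) (cc M x) - 1 := by
    refine Dvd.intro ((β + x.1) * (3 + 3 * (M * (β + x.1)) + (M * (β + x.1)) ^ 2) + k.c2 * bb M β x ^ 2 * (1 + x.2) + k.c1 * bb M β x * (1 + x.2) * cc M x + k.c0 * (1 + x.2) * cc M x ^ 2) ?_
    unfold bb cc Cub.F; ring
  have h1 := (dvd_sub_right h).1 (hM'.trans this)
  exact (Nat.prime_iff_prime_int.1 hl).not_dvd_one h1
open Classical in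
lemma cntF (k : Cub) {M l e : ℕ} (hl : l.Prime) (he : 1 ≤ e) (hM : ¬ l ∣ M) (β : ℤ) (T : ℕ)
    (h : e = 1 ∨ ∀ n : ℤ, (l:ℤ) ∣ k.f n → ¬ (l:ℤ) ∣ 3 * n ^ 2 + 2 * k.c2 * n + k.c1) :
    #((bx T).filter fun x => IsCoprime (bb M β x) (cc M x) ∧ ((l ^ e : ℕ):ℤ) ∣ k.F (bb M β x) (cc M x)) ≤ T * ((T / l ^ e + 1) * 3) := by
  have hlp := Nat.prime_iff_prime_int.1 hl
  have hd : (l:ℤ) ∣ ((l ^ e : ℕ) : ℤ) := by exact_mod_cast dvd_pow_self l (by omega)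
  rw [card_filter, bx, sum_product_right]
  refine (sum_le_card_nsmul _ _ ((T / l ^ e + 1) * 3) fun y _ => ?_).trans (by simp)
  rw [← card_filter]
  by_cases hy : (l:ℤ) ∣ cc M (0, y)
  · rw [filter_eq_empty_iff.2]
    · simp
    rintro x _ ⟨h1, h2⟩
    have h3 : (l:ℤ) ∣ cc M (x, y) := hy
    have h4 : (l:ℤ) ∣ bb M β (x, y) ^ 3 := by
      have : k.F (bb M β (x, y)) (cc M (x, y)) = bb M β (x, y) ^ 3 + cc M (x, y) * (k.c2 * bb M β (x, y) ^ 2 + k.c1 * bb M β (x, y) * cc M (x, y) + k.c0 * cc M (x, y) ^ 2) := by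
        unfold Cub.F; ring
      rw [this] at h2
      exact (dvd_add_left (h3.mul_right _)).1 (hd.trans h2)
    exact hlp.not_unit (h1.isUnit_of_dvd' (hlp.dvd_of_dvd_pow h4) h3)
  · obtain ⟨u, v, huv⟩ : IsCoprime (cc M (0, y)) ((l ^ e : ℕ):ℤ) := by
      push_cast
      exact (((Prime.coprime_iff_not_dvd hlp).2 hy).symm).pow_right
    have hu : IsCoprime u ((l ^ e : ℕ):ℤ) := ⟨cc M (0, y), v, by linarith⟩
    have hMl : IsCoprime (M:ℤ) ((l ^ e : ℕ):ℤ) := Nat.isCoprime_iff_coprime.2 (((Nat.Prime.coprime_iff_not_dvd hl).2 hM).symm.pow_right e)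
    refine (card_le_card ?_).trans ((cnt k (pow_ne_zero e hl.ne_zero) (u * (1 + M * β)) (u * M) (hu.mul_left hMl) T).trans
      (Nat.mul_le_mul (Nat.succ_le_succ (Nat.div_le_div_right (Nat.sub_le _ _))) ((rho_pow k hl he h).trans (ME.rho_le k hl))))
    intro x hx
    rw [mem_filter] at hx ⊢
    refine ⟨hx.1, ?_⟩
    have e1 : u * (1 + M * β) + u * M * x = u * bb M β (x, y) := by unfold bb; ring
    rw [e1]
    have e2 : cc M (x, y) = cc M (0, y) := rfl
    have h1 := hx.2.2
    rw [e2] at h1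
    set D : ℤ := ((l ^ e : ℕ):ℤ)
    have h6 : D ∣ u * cc M (0, y) - 1 := ⟨-v, by linarith⟩
    have h7 : k.f (u * bb M β (x, y)) = u ^ 3 * k.F (bb M β (x, y)) (cc M (0, y)) - (u * cc M (0, y) - 1) * (k.c2 * (u * bb M β (x, y)) ^ 2 + k.c1 * (u * bb M β (x, y)) * (u * cc M (0, y) + 1) + k.c0 * ((u * cc M (0, y)) ^ 2 + u * cc M (0, y) + 1)) := by
      unfold Cub.f Cub.F; ring
    rw [h7]
    exact dvd_sub (h1.mul_left _) (h6.mul_right _)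
def OK (k : Cub) (W M K1 T : ℕ) (ε : ℝ) (x : ℕ × ℕ) : Prop :=
  IsCoprime (bb M ((K1 * T : ℕ):ℤ) x) (cc M x) ∧
  (∃ p : ℕ, (fl T (ε / 4) < p ∧ p ≤ fl T (ε / 2)) ∧ p.Prime ∧ (p:ℤ) ∣ k.F (bb M ((K1 * T : ℕ):ℤ) x) (cc M x) ∧
    ¬ ((p ^ 2 : ℕ):ℤ) ∣ k.F (bb M ((K1 * T : ℕ):ℤ) x) (cc M x)) ∧
  (∀ l e : ℕ, l.Prime → 1 ≤ e → ((l ^ e : ℕ):ℤ) ∣ k.F (bb M ((K1 * T : ℕ):ℤ) x) (cc M x) → l ^ e ≤ fl T (1 - ε)) ∧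
  ∑ l ∈ (SV.pr W T).filter (fun l : ℕ => (l:ℤ) ∣ k.F (bb M ((K1 * T : ℕ):ℤ) x) (cc M x)), (1:ℝ) / l ≤ 1
lemma inv2 {W T : ℕ} (hW : W ≠ 0) : ∑ l ∈ SV.pr W T, (1:ℝ) / (l:ℝ) ^ 2 ≤ 1 / W := by
  rcases le_total W T with h | h
  · refine (sum_le_sum_of_subset_of_nonneg (t := Ioc W T) (fun l hl => ?_) fun _ _ _ => by positivity).trans ?_
    · rw [mem_Ioc]; exact (SV.mem_pr.1 hl).1
    · have := sum_Ioc_inv_sq_le_sub (α := ℝ) hW h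
      simp only [one_div]
      exact this.trans (by simp)
  · rw [sum_eq_zero]
    · positivity
    · intro l hl
      have := (SV.mem_pr.1 hl).1
      omega
lemma dvb {T l : ℕ} (hl : 0 < l) (h : l ≤ T) : ((T / l + 1 : ℕ):ℝ) ≤ 2 * T / l := by
  have h1 : ((T / l : ℕ):ℝ) ≤ (T:ℝ) / l := Nat.cast_div_le
  have h2 : (1:ℝ) ≤ (T:ℝ) / l := by
    rw [le_div_iff₀ (by exact_mod_cast hl)]; simpa using (by exact_mod_cast h : (l:ℝ) ≤ T)
  push_cast
  rw [mul_div_assoc]; linarith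
open Classical in
set_option maxHeartbeats 1000000 in
theorem G2 (k : Cub) (hk : k.Good) (hRt : Tendsto (fun n : ℕ => RR k n / Real.log n) atTop (𝓝 1))
    (D : ℕ) (hD : ∀ n : ℤ, ∀ l : ℕ, (l:ℤ) ∣ k.f n → (l:ℤ) ∣ 3 * n ^ 2 + 2 * k.c2 * n + k.c1 → l ∣ D) (hD0 : D ≠ 0)
    (W M K1 : ℕ) (hM0 : 1 ≤ M) (hW : k.c0.natAbs ≤ W) (hWD : D ≤ W) (hM : ∀ l : ℕ, l.Prime → W < l → ¬ l ∣ M)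
    (hM2 : ∀ l : ℕ, l.Prime → l ≤ W → l ∣ M)
    (ε : ℝ) (hε : 0 < ε) (hε1 : ε ≤ 1 / 10 ^ 7) (m0 : ℕ) (hm0 : 3 < ε / 4 * (m0 + 1)) (κ : ℝ) (hκ : 0 < κ)
    (hκ' : κ * ((3 * m0 : ℕ) * 441) ≤ 4 / 10 ^ 4 * ε) (hWκ : 40 / κ ≤ W) :
    ∀ᶠ T : ℕ in atTop, κ / 2 * (T:ℝ) ^ 2 ≤ (#((bx T).filter fun x => OK k W M K1 T ε x) : ℝ) := by
  have hW0 : 0 < W := by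
    have : (0:ℝ) < W := lt_of_lt_of_le (by positivity) hWκ
    exact_mod_cast this
  filter_upwards [G1 k hk hRt W M K1 hM0 hW hM ε hε hε1 m0 hm0, polylog 1 1 (ε/4) 1 (by positivity) (48 / κ), (rpow_nat hε).eventually_ge_atTop (24 / κ), eventually_ge_atTop 1] with T hG hpl hTε hT1
  have hTr : (1:ℝ) ≤ T := by exact_mod_cast hT1
  set β : ℤ := ((K1 * T : ℕ):ℤ) with hβ
  set z := fl T (ε / 4) with hz
  set Y := fl T (1 - ε) with hY
  have hz1 : (1:ℝ) ≤ (T:ℝ) ^ (ε / 4) := Real.one_le_rpow hTr (by positivity)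
  have hz2 := fl_ge hz1
  rw [← hz] at hz2
  have hz0 : 0 < z := by
    have : (0:ℝ) < z := by linarith
    exact_mod_cast this
  have hYT : Y ≤ T := by
    have : (Y:ℝ) ≤ T := fl_le.trans (by simpa using Real.rpow_le_rpow_of_exponent_le hTr (by linarith : 1 - ε ≤ 1))
    exact_mod_cast this
  have hex : ∀ l : ℕ, l.Prime → ∃ e, 2 ≤ e ∧ z ^ 2 < l ^ e := fun l hl => ⟨z ^ 2 + 2, by omega, (Nat.lt_pow_self hl.one_lt).trans_le (Nat.pow_le_pow_right hl.pos (by omega))⟩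
  let ee : ℕ → ℕ := fun l => if h : l.Prime then Nat.find (hex l h) else 0
  have hee : ∀ l, l.Prime → (2 ≤ ee l ∧ z ^ 2 < l ^ ee l) ∧ ∀ e, 2 ≤ e → z ^ 2 < l ^ e → ee l ≤ e := fun l hl => by
    simp only [ee, dif_pos hl]
    exact ⟨Nat.find_spec (hex l hl), fun e h1 h2 => Nat.find_min' _ ⟨h1, h2⟩⟩
  let B1 := (SV.pr W T).biUnion fun l => (bx T).filter fun x => (l:ℤ) ∣ bb M β x ∧ (l:ℤ) ∣ cc M x
  let B2 := (bx T).filter fun x => IsCoprime (bb M β x) (cc M x) ∧ 1 < ∑ l ∈ (SV.pr W T).filter (fun l : ℕ => (l:ℤ) ∣ k.F (bb M β x) (cc M x)), (1:ℝ) / l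
  let B3 := (SV.pr W Y).biUnion fun l => (bx T).filter fun x => IsCoprime (bb M β x) (cc M x) ∧ ((l ^ ee l : ℕ):ℤ) ∣ k.F (bb M β x) (cc M x)
  have hi2 := inv2 (W := W) (T := T) hW0.ne'
  have hWk : (1:ℝ) / W ≤ κ / 40 := by
    rw [div_le_div_iff₀ (by positivity) (by positivity)]
    rw [div_le_iff₀ hκ] at hWκ; linarith
  have b1 : (#B1 : ℝ) ≤ 4 * (T:ℝ) ^ 2 * (κ / 40) := by
    calc (#B1:ℝ) ≤ ∑ l ∈ SV.pr W T, (#((bx T).filter fun x => (l:ℤ) ∣ bb M β x ∧ (l:ℤ) ∣ cc M x):ℝ) := by exact_mod_cast card_biUnion_le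
      _ ≤ ∑ l ∈ SV.pr W T, 4 * (T:ℝ) ^ 2 * (1 / (l:ℝ) ^ 2) := by
        refine sum_le_sum fun l hl => ?_
        rw [SV.mem_pr] at hl
        have hMl : IsCoprime (M:ℤ) (l:ℤ) := Nat.isCoprime_iff_coprime.2 (((Nat.Prime.coprime_iff_not_dvd hl.2).2 (hM l hl.2 hl.1.1)).symm)
        have e1 := cnt1 (1 + M * β) M hMl T
        have e2 := cnt1 M M hMl T
        have e3 : #((bx T).filter fun x => (l:ℤ) ∣ bb M β x ∧ (l:ℤ) ∣ cc M x) ≤ (T / l + 1) * (T / l + 1) := by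
          refine le_trans (le_trans (card_le_card ?_) (card_product _ _).le) (Nat.mul_le_mul e1 e2)
          intro x hx
          rw [mem_filter, bx, mem_product] at hx
          rw [mem_product, mem_filter, mem_filter]
          refine ⟨⟨hx.1.1, ?_⟩, hx.1.2, ?_⟩
          · exact hx.2.1.trans (dvd_of_eq (by unfold bb; ring))
          · exact hx.2.2.trans (dvd_of_eq (by unfold cc; ring))
        have e4 := dvb hl.2.pos hl.1.2
        calc _ ≤ ((T / l + 1 : ℕ):ℝ) * ((T / l + 1 : ℕ):ℝ) := by exact_mod_cast e3
          _ ≤ (2 * T / l) * (2 * T / l) := by gcongr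
          _ = _ := by ring
      _ ≤ _ := by rw [← mul_sum]; gcongr; exact hi2.trans hWk
  have cF := fun (l e : ℕ) (hl : l.Prime) (hWl : W < l) (he : 1 ≤ e) => cntF k (e := e) hl he (hM l hl hWl) β T
    (Or.inr fun n h1 h2 => absurd (Nat.le_of_dvd (Nat.pos_of_ne_zero hD0) (hD n l h1 h2)) (by omega))
  have b2 : (#B2 : ℝ) ≤ 6 * (T:ℝ) ^ 2 * (κ / 40) := by
    calc (#B2:ℝ) ≤ ∑ x ∈ B2, ∑ l ∈ (SV.pr W T).filter (fun l : ℕ => (l:ℤ) ∣ k.F (bb M β x) (cc M x)), (1:ℝ) / l := by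
          rw [card_eq_sum_ones]; push_cast
          exact sum_le_sum fun x hx => (mem_filter.1 hx).2.2.le
      _ = ∑ l ∈ SV.pr W T, (#(B2.filter fun x => (l:ℤ) ∣ k.F (bb M β x) (cc M x)):ℝ) * ((1:ℝ) / l) := by
        simp only [sum_filter]
        rw [sum_comm]
        refine sum_congr rfl fun l _ => ?_
        rw [← sum_filter, sum_const, nsmul_eq_mul]
      _ ≤ ∑ l ∈ SV.pr W T, 6 * (T:ℝ) ^ 2 * (1 / (l:ℝ) ^ 2) := by
        refine sum_le_sum fun l hl => ?_
        rw [SV.mem_pr] at hl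
        have e1 := cF l 1 hl.2 hl.1.1 le_rfl
        have e4 := dvb hl.2.pos hl.1.2
        rw [pow_one] at e1
        have e5 : #(B2.filter fun x => (l:ℤ) ∣ k.F (bb M β x) (cc M x)) ≤ T * ((T / l + 1) * 3) := by
          refine le_trans (card_le_card fun x hx => ?_) e1
          rw [mem_filter] at hx ⊢
          have h2 := mem_filter.1 hx.1
          exact ⟨h2.1, h2.2.1, hx.2⟩
        calc _ ≤ ((T:ℝ) * ((T / l + 1 : ℕ) * 3)) * (1 / l) := by gcongr; exact_mod_cast e5
          _ ≤ ((T:ℝ) * ((2 * T / l) * 3)) * (1 / l) := by gcongr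
          _ = _ := by ring
      _ ≤ _ := by rw [← mul_sum]; gcongr; exact hi2.trans hWk
  have b3 : (#B3 : ℝ) ≤ κ / 4 * (T:ℝ) ^ 2 := by
    have hsub : SV.pr W Y ⊆ Icc 1 T := fun l hl => by
      rw [SV.mem_pr] at hl; rw [mem_Icc]; exact ⟨hl.2.pos, hl.1.2.trans hYT⟩
    calc (#B3:ℝ) ≤ ∑ l ∈ SV.pr W Y, (#((bx T).filter fun x => IsCoprime (bb M β x) (cc M x) ∧ ((l ^ ee l : ℕ):ℤ) ∣ k.F (bb M β x) (cc M x)):ℝ) := by exact_mod_cast card_biUnion_le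
      _ ≤ ∑ l ∈ SV.pr W Y, (3 * (T:ℝ) ^ 2 / z * (l:ℝ)⁻¹ + 3 * T) := by
        refine sum_le_sum fun l hl => ?_
        rw [SV.mem_pr] at hl
        obtain ⟨⟨h1, h2⟩, h3⟩ := hee l hl.2
        have e1 := cF l (ee l) hl.2 hl.1.1 (by omega)
        have e2 : z * l ≤ l ^ ee l := by
          rcases le_total l z with h | h
          · nlinarith
          · calc z * l ≤ l ^ 2 := by nlinarith
              _ ≤ _ := Nat.pow_le_pow_right hl.2.pos h1
        have e3 : ((T / l ^ ee l : ℕ):ℝ) ≤ (T:ℝ) / (z * l) := by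
          refine Nat.cast_div_le.trans ?_
          have := hl.2.pos
          gcongr
          exact_mod_cast e2
        calc _ ≤ (T:ℝ) * (((T / l ^ ee l : ℕ) + 1) * 3) := by exact_mod_cast e1
          _ ≤ (T:ℝ) * (((T:ℝ) / (z * l) + 1) * 3) := by gcongr
          _ = _ := by field_simp
      _ ≤ 3 * (T:ℝ) ^ 2 / z * (1 + Real.log T) + 3 * T * Y := by
        rw [sum_add_distrib, ← mul_sum, sum_const, nsmul_eq_mul]
        have h1 : ∑ l ∈ SV.pr W Y, (l:ℝ)⁻¹ ≤ 1 + Real.log T := by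
          refine (sum_le_sum_of_subset_of_nonneg hsub fun _ _ _ => by positivity).trans ?_
          have := harmonic_le_one_add_log T
          rw [harmonic_eq_sum_Icc] at this
          push_cast at this
          exact this
        have h2 : (#(SV.pr W Y):ℝ) ≤ Y := by
          have : #(SV.pr W Y) ≤ #(Icc 1 Y) := card_le_card fun l hl => by
            rw [SV.mem_pr] at hl; rw [mem_Icc]; exact ⟨hl.2.pos, hl.1.2⟩
          simpa using this
        have h3 : (#(SV.pr W Y):ℝ) * (3 * T) ≤ 3 * T * Y := by nlinarith
        gcongr
      _ ≤ _ := by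
        have hzr : (0:ℝ) < z := by exact_mod_cast hz0
        have h1 : (1 + Real.log T) / z ≤ κ / 24 := by
          rw [div_le_iff₀ hzr]
          have : 48 / κ * (1 + Real.log T) ≤ 2 * z := by simpa using hpl.trans (by linarith)
          rw [div_mul_eq_mul_div, div_le_iff₀ hκ] at this
          linarith
        have h2 : (Y:ℝ) ≤ κ / 24 * T := by
          refine fl_le.trans ?_
          rw [Real.rpow_sub (by linarith), Real.rpow_one, div_le_iff₀ (by positivity)]
          rw [div_le_iff₀ hκ] at hTε
          nlinarith
        calc _ = 3 * (T:ℝ) ^ 2 * ((1 + Real.log T) / z) + 3 * T * Y := by ring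
          _ ≤ 3 * (T:ℝ) ^ 2 * (κ / 24) + 3 * T * (κ / 24 * T) := by gcongr
          _ = _ := by ring
  have hcov : ((bx T).filter fun x => ((∀ p : ℕ, p.Prime → (p:ℤ) ∣ k.F (bb M β x) (cc M x) → p ≤ Y) ∨
          ¬ IsCoprime (bb M β x) (cc M x)) ∧ ∃ p : ℕ, (z < p ∧ p ≤ fl T (ε / 2)) ∧ p.Prime ∧
          (p:ℤ) ∣ k.F (bb M β x) (cc M x)) ⊆ ((bx T).filter fun x => OK k W M K1 T ε x) ∪ (B1 ∪ (B2 ∪ B3)) := by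
    intro x hx
    rw [mem_filter] at hx
    obtain ⟨hx1, hx2, p, hp1, hp, hpg⟩ := hx
    rw [mem_union, mem_union, mem_union]
    by_contra! hn
    obtain ⟨n0, n1, n2, n3⟩ := hn
    have hcop : IsCoprime (bb M β x) (cc M x) := by
      by_contra hc
      rw [Int.isCoprime_iff_gcd_eq_one] at hc
      obtain ⟨l, hl, hlg⟩ := Nat.exists_prime_and_dvd hc
      have h1 : (l:ℤ) ∣ bb M β x := (Int.natCast_dvd_natCast.2 hlg).trans (Int.gcd_dvd_left _ _)
      have h2 : (l:ℤ) ∣ cc M x := (Int.natCast_dvd_natCast.2 hlg).trans (Int.gcd_dvd_right _ _)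
      have h3 : ¬ l ∣ M := by
        intro h
        have h' : (l:ℤ) ∣ M := by exact_mod_cast h
        exact (Nat.prime_iff_prime_int.1 hl).not_dvd_one ((dvd_add_left (h'.mul_right _)).1 h1)
      have h4 : l ∣ 1 + x.2 := by
        have h5 : (l:ℤ) ∣ ((M * (1 + x.2) : ℕ):ℤ) := by push_cast; exact h2
        exact (hl.dvd_mul.1 (Int.natCast_dvd_natCast.1 h5)).resolve_left h3
      refine n1 (mem_biUnion.2 ⟨l, SV.mem_pr.2 ⟨⟨by_contra fun h => h3 (hM2 l hl (by omega)), ?_⟩, hl⟩, mem_filter.2 ⟨hx1, h1, h2⟩⟩)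
      have := Nat.le_of_dvd (by omega) h4
      rw [bx, mem_product, mem_range, mem_range] at hx1
      omega
    have hYp := hx2.resolve_right (not_not.2 hcop)
    have hlW : ∀ l : ℕ, l.Prime → (l:ℤ) ∣ k.F (bb M β x) (cc M x) → W < l := fun l hl h => by
      by_contra h'
      exact gW k hl h (hM2 l hl (by omega))
    have hpow : ∀ l e : ℕ, l.Prime → 2 ≤ e → ((l ^ e : ℕ):ℤ) ∣ k.F (bb M β x) (cc M x) → l ^ e ≤ z ^ 2 := by
      intro l e hl he h
      by_contra! h'
      have hd : (l:ℤ) ∣ k.F (bb M β x) (cc M x) := (Int.natCast_dvd_natCast.2 (dvd_pow_self l (by omega))).trans h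
      refine n3 (mem_biUnion.2 ⟨l, SV.mem_pr.2 ⟨⟨hlW l hl hd, hYp l hl hd⟩, hl⟩, mem_filter.2 ⟨hx1, hcop, ?_⟩⟩)
      exact (Int.natCast_dvd_natCast.2 (pow_dvd_pow l ((hee l hl).2 e he h'))).trans h
    refine n0 (mem_filter.2 ⟨hx1, hcop, ⟨p, hp1, hp, hpg, fun h => ?_⟩, ?_, ?_⟩)
    · have := hpow p 2 hp le_rfl h
      have h2 : z ^ 2 < p ^ 2 := Nat.pow_lt_pow_left hp1.1 (by omega)
      omega
    · intro l e hl he h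
      rcases he.eq_or_lt with rfl | he
      · rw [pow_one] at h ⊢; exact hYp l hl h
      · refine (hpow l e hl he h).trans ?_
        rw [le_fl]
        push_cast
        calc (z:ℝ) ^ 2 ≤ ((T:ℝ) ^ (ε / 4)) ^ 2 := by gcongr; exact fl_le
          _ = (T:ℝ) ^ (ε / 4 * 2) := by rw [Real.rpow_mul (by linarith)]; simp
          _ ≤ _ := Real.rpow_le_rpow_of_exponent_le hTr (by linarith)
    · by_contra! h
      exact n2 (mem_filter.2 ⟨hx1, hcop, h⟩)
  have hc := (card_le_card hcov).trans ((card_union_le _ _).trans (Nat.add_le_add_left ((card_union_le _ _).trans (Nat.add_le_add_left (card_union_le _ _) _)) _))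
  have hc' : (#((bx T).filter fun x => ((∀ p : ℕ, p.Prime → (p:ℤ) ∣ k.F (bb M β x) (cc M x) → p ≤ Y) ∨
          ¬ IsCoprime (bb M β x) (cc M x)) ∧ ∃ p : ℕ, (z < p ∧ p ≤ fl T (ε / 2)) ∧ p.Prime ∧
          (p:ℤ) ∣ k.F (bb M β x) (cc M x)):ℝ) ≤ #((bx T).filter fun x => OK k W M K1 T ε x) + (#B1 + (#B2 + #B3)) := by exact_mod_cast hc
  have hm : 0 < m0 := by
    rcases Nat.eq_zero_or_pos m0 with h | h
    · subst h; norm_num at hm0; linarith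
    · exact h
  have hm' : (0:ℝ) < (3 * m0 : ℕ) * 441 := by positivity
  have hfin : κ * (T:ℝ) ^ 2 ≤ (#((bx T).filter fun x => ((∀ p : ℕ, p.Prime → (p:ℤ) ∣ k.F (bb M β x) (cc M x) → p ≤ Y) ∨
          ¬ IsCoprime (bb M β x) (cc M x)) ∧ ∃ p : ℕ, (z < p ∧ p ≤ fl T (ε / 2)) ∧ p.Prime ∧
          (p:ℤ) ∣ k.F (bb M β x) (cc M x)):ℝ) := by
    refine le_of_mul_le_mul_left ?_ hm'
    refine le_trans ?_ hG
    calc _ = (κ * ((3 * m0 : ℕ) * 441)) * (T:ℝ) ^ 2 := by ring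
      _ ≤ _ := by gcongr
  linarith
end LV

set_option linter.unusedSectionVars false
namespace LV
open Finset Filter Topology
lemma group {G Y r : ℕ} (hG : G ≠ 0) (hY : 1 ≤ Y) (hpp : ∀ l e : ℕ, l.Prime → 1 ≤ e → l ^ e ∣ G → l ^ e ≤ Y)
    (hr : G ^ 2 < Y ^ (r + 1)) : ∃ g : Fin (r + 1) → ℕ, ∏ i, g i = G ∧ (∀ i, 1 ≤ g i ∧ g i ≤ Y) ∧
      ∀ i j, i ≠ j → (g i).Coprime (g j) := by
  classical
  let P : Finset ℕ → Prop := fun A => ∏ a ∈ A, a = G ∧ (∀ a ∈ A, a ≤ Y) ∧ ∀ a ∈ A, ∀ b ∈ A, a ≠ b → a.Coprime b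
  have hex : ∃ n, ∃ A, P A ∧ #A = n := by
    have hinj : Set.InjOn (fun l => l ^ G.factorization l) (G.primeFactors : Set ℕ) := by
      intro l hl l' hl' h
      simp only [mem_coe, Nat.mem_primeFactors] at hl hl' h
      exact ((Nat.prime_dvd_prime_iff_eq hl.1 hl'.1).1 (hl.1.dvd_of_dvd_pow (h ▸ dvd_pow_self l (hl.1.factorization_pos_of_dvd hG hl.2.1).ne')))
    refine ⟨_, G.primeFactors.image (fun l => l ^ G.factorization l), ⟨?_, ?_, ?_⟩, rfl⟩
    · rw [prod_image hinj]
      exact Nat.prod_factorization_pow_eq_self hG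
    · intro a ha
      obtain ⟨l, hl, rfl⟩ := mem_image.1 ha
      rw [Nat.mem_primeFactors] at hl
      exact hpp l _ hl.1 (hl.1.factorization_pos_of_dvd hG hl.2.1) (Nat.ordProj_dvd G l)
    · intro a ha b hb hab
      obtain ⟨l, hl, rfl⟩ := mem_image.1 ha
      obtain ⟨l', hl', rfl⟩ := mem_image.1 hb
      rw [Nat.mem_primeFactors] at hl hl'
      exact Nat.Coprime.pow _ _ ((Nat.coprime_primes hl.1 hl'.1).2 fun h => hab (by rw [h]))
  obtain ⟨A, ⟨hA1, hA2, hA3⟩, hA4⟩ := Nat.find_spec hex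
  have hmin := fun m => Nat.find_min hex (m := m)
  rw [← hA4] at hmin
  have hpos : ∀ a ∈ A, 1 ≤ a := fun a ha => Nat.pos_of_ne_zero fun h => hG (hA1 ▸ prod_eq_zero ha h)
  have hmul : ∀ a ∈ A, ∀ b ∈ A, a ≠ b → Y < a * b := by
    intro a ha b hb hab
    by_contra! h
    have hb' : b ∈ A.erase a := mem_erase.2 ⟨hab.symm, hb⟩
    have hc : ∀ c ∈ (A.erase a).erase b, (a * b).Coprime c := fun c hc => by
      rw [mem_erase, mem_erase] at hc
      exact Nat.Coprime.mul_left (hA3 a ha c hc.2.2 hc.2.1.symm) (hA3 b hb c hc.2.2 hc.1.symm)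
    by_cases hm : a * b ∈ (A.erase a).erase b
    · have h1 := hc _ hm
      rw [Nat.coprime_self] at h1
      exact hab ((Nat.eq_one_of_mul_eq_one_right h1).trans (Nat.eq_one_of_mul_eq_one_left h1).symm)
    · refine hmin ( #(insert (a * b) ((A.erase a).erase b))) ?_ ⟨_, ⟨?_, ?_, ?_⟩, rfl⟩
      · rw [card_insert_of_notMem hm, card_erase_of_mem hb', card_erase_of_mem ha]
        have := card_pos.2 ⟨b, hb'⟩
        rw [card_erase_of_mem ha] at this
        omega
      · rw [prod_insert hm, mul_assoc, mul_prod_erase _ (fun a => a) hb', mul_prod_erase _ (fun a => a) ha, hA1]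
      · intro c hc
        rcases mem_insert.1 hc with rfl | hc
        · exact h
        · exact hA2 c (mem_of_mem_erase (mem_of_mem_erase hc))
      · intro c h1 d h2 h3
        rcases mem_insert.1 h1 with rfl | h1 <;> rcases mem_insert.1 h2 with rfl | h2
        · exact absurd rfl h3
        · exact hc d h2
        · exact (hc c h1).symm
        · exact hA3 c (mem_of_mem_erase (mem_of_mem_erase h1)) d (mem_of_mem_erase (mem_of_mem_erase h2)) h3
  have hcard : #A ≤ r + 1 := by
    set S := A.filter fun a => a ^ 2 < Y
    have h1 : #S ≤ 1 := by
      rw [card_le_one]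
      intro a ha b hb
      rw [mem_filter] at ha hb
      by_contra hab
      have := hmul a ha.1 b hb.1 hab
      nlinarith [Nat.mul_self_le_mul_self (show a * b ≥ Y by omega)]
    have h2 : Y ^ #(A \ S) ≤ G ^ 2 := by
      rw [← hA1, ← prod_pow, ← prod_sdiff (filter_subset (fun a => a ^ 2 < Y) A)]
      refine (Nat.le_mul_of_pos_right _ (prod_pos fun a ha => pow_pos (hpos a (mem_filter.1 ha).1) 2)).trans' ?_
      rw [← prod_const]
      refine prod_le_prod' fun a ha => ?_
      rw [Finset.mem_sdiff, mem_filter] at ha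
      by_contra! h
      exact ha.2 ⟨ha.1, h⟩
    have h4 : #(A \ S) < r + 1 := by
      by_contra! h
      exact absurd (hr.trans_le (Nat.pow_le_pow_right hY h)) (by omega)
    have : #(A \ S) + #S = #A := card_sdiff_add_card_eq_card (filter_subset (fun a => a ^ 2 < Y) A)
    omega
  obtain ⟨φ⟩ : Nonempty (A ↪ Fin (r + 1)) := Function.Embedding.nonempty_of_card_le (by simpa using hcard)
  refine ⟨fun i => ∏ a ∈ univ.filter (fun a => φ a = i), (a:ℕ), ?_, fun i => ⟨?_, ?_⟩, fun i j hij => ?_⟩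
  · rw [prod_fiberwise, ← hA1]
    exact prod_coe_sort A fun a => a
  · exact Nat.pos_of_ne_zero (prod_ne_zero_iff.2 fun (a : A) _ => (Nat.one_le_iff_ne_zero.1 (hpos a a.2)))
  · by_cases h : ∃ a, φ a = i
    · obtain ⟨a, rfl⟩ := h
      have : univ.filter (fun b => φ b = φ a) = {a} := by ext b; simp [φ.injective.eq_iff]
      beta_reduce; rw [this, prod_singleton]
      exact hA2 a a.2
    · push Not at h
      beta_reduce; rw [filter_eq_empty_iff.2 fun a _ => h a, prod_empty]
      exact hY
  · refine Nat.Coprime.prod_left fun (a : A) ha => Nat.Coprime.prod_right fun (b : A) hb => hA3 a a.2 b b.2 fun h => hij ?_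
    rw [mem_filter] at ha hb
    rw [← ha.2, ← hb.2, Subtype.ext h]
end LV

set_option linter.unusedSectionVars false
namespace LV
open Finset Filter Topology
noncomputable def rr {r : ℕ} (p : ℕ) (g : Fin (r + 1) → ℕ) (c C : ℤ) (i : Fin (r + 1)) : ℕ :=
  (-(c:ZMod (g i)) ^ 2 * ((p * ∏ j ∈ univ.erase i, g j : ℕ) : ZMod (g i))⁻¹ * (C : ZMod (g i))⁻¹).val
lemma crtR {r p : ℕ} (hp : p.Prime) (g : Fin (r + 1) → ℕ) (hg1 : ∀ i, 1 ≤ g i) (hgp : ∀ i, p.Coprime (g i))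
    (hgg : ∀ i j, i ≠ j → (g i).Coprime (g j)) (c C : ℤ) (hC : IsCoprime C ((p * ∏ i, g i : ℕ):ℤ)) (y : ℤ)
    (hy : (y : ZMod p) = -(c:ZMod p) ^ 2 * ((∏ i, g i : ℕ) : ZMod p)⁻¹ * (C : ZMod p)⁻¹ + ∑ i, ((p * rr p g c C i / g i : ℕ) : ZMod p)) :
    ∃ R : ℤ, ((p * ∏ i, g i : ℕ):ℤ) ∣ R * C + c ^ 2 ∧ (y:ℝ) / p ≤ R / (p * ∏ i, g i : ℕ) ∧
      (R:ℝ) / (p * ∏ i, g i : ℕ) ≤ (y + r + 1) / p := by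
  have : Fact p.Prime := ⟨hp⟩
  obtain ⟨s, hs⟩ : ∃ s : Fin (r + 1) → ℕ, s = fun i => p * rr p g c C i / g i := ⟨_, rfl⟩
  have hs' : ∀ i, p * rr p g c C i / g i = s i := fun i => by rw [hs]
  simp only [hs'] at hy
  set J : ℤ := y - ∑ i, (s i : ℤ) with hJ
  set G := ∏ i, g i with hG
  have hGi : ∀ i, g i * ∏ j ∈ univ.erase i, g j = G := fun i => mul_prod_erase _ _ (mem_univ i)
  have hJp : (J : ZMod p) = -(c:ZMod p) ^ 2 * (G : ZMod p)⁻¹ * (C : ZMod p)⁻¹ := by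
    rw [hJ]; push_cast; rw [hy]; ring
  have key : ∀ {m : ℕ} {x : ℤ}, IsCoprime (m:ℤ) x → (x : ZMod m) * (x : ZMod m)⁻¹ = 1 := fun {m x} h =>
    ZMod.mul_inv_of_unit _ ((ZMod.coe_int_isUnit_iff_isCoprime _ _).2 h)
  have hCm : ∀ m : ℕ, m ∣ p * G → IsCoprime (m:ℤ) C := fun m hm => (hC.of_isCoprime_of_dvd_right (Int.natCast_dvd_natCast.2 hm)).symm
  obtain ⟨h, hh⟩ : ∃ h : Fin (r + 1) → ℕ, h = fun i => p * ∏ j ∈ univ.erase i, g j := ⟨_, rfl⟩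
  have hh' : ∀ i, p * ∏ j ∈ univ.erase i, g j = h i := fun i => by rw [hh]
  have hhg : ∀ i, g i * h i = p * G := fun i => by rw [← hh', ← hGi i]; ring
  have hpG : p.Coprime G := Nat.Coprime.prod_right fun i _ => hgp i
  have hgh : ∀ i j, i ≠ j → g i ∣ h j := fun i j hij => by
    rw [← hh']; exact (dvd_prod_of_mem g (mem_erase.2 ⟨hij, mem_univ i⟩)).mul_left _
  refine ⟨J * G + ∑ i, (rr p g c C i : ℤ) * (h i : ℕ), ?_, ?_⟩
  · have h1 : (p:ℤ) ∣ (J * G + ∑ i, (rr p g c C i : ℤ) * (h i : ℕ)) * C + c ^ 2 := by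
      rw [← ZMod.intCast_zmod_eq_zero_iff_dvd]
      push_cast
      have e1 := key (m := p) (x := (G:ℤ)) (Nat.isCoprime_iff_coprime.2 hpG)
      have e2 := key (hCm p (dvd_mul_right _ _))
      push_cast at e1
      rw [sum_eq_zero fun i _ => by rw [← hh']; simp, hJp]
      linear_combination (-(c:ZMod p) ^ 2) * ((G:ZMod p) * (G:ZMod p)⁻¹) * e2 - (c:ZMod p) ^ 2 * e1
    have h2 : ∀ i, (g i:ℤ) ∣ (J * G + ∑ i, (rr p g c C i : ℤ) * (h i : ℕ)) * C + c ^ 2 := by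
      intro i
      rw [← ZMod.intCast_zmod_eq_zero_iff_dvd]
      have : NeZero (g i) := ⟨by have := hg1 i; omega⟩
      push_cast
      have e0 : (G : ZMod (g i)) = 0 := (ZMod.natCast_eq_zero_iff _ _).2 (Dvd.intro _ (hGi i))
      have e1 := key (m := g i) (x := (h i:ℤ)) (Nat.isCoprime_iff_coprime.2 (by
        rw [← hh']; exact Nat.Coprime.mul_right (hgp i).symm (Nat.Coprime.prod_right fun j hj => hgg i j (mem_erase.1 hj).1.symm)))
      have e2 := key (hCm (g i) (Dvd.intro _ (hhg i)))
      push_cast at e1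
      rw [e0, sum_eq_single i (fun j _ hj => by rw [(ZMod.natCast_eq_zero_iff _ _).2 (hgh i j hj.symm), mul_zero]) (by simp), rr, ZMod.natCast_zmod_val, hh']
      linear_combination (-(c:ZMod (g i)) ^ 2) * ((h i:ZMod (g i)) * (h i:ZMod (g i))⁻¹) * e2 - (c:ZMod (g i)) ^ 2 * e1
    push_cast
    refine IsCoprime.mul_dvd (by exact_mod_cast Nat.isCoprime_iff_coprime.2 hpG) h1 ?_
    refine (dvd_of_eq (by rw [hG]; push_cast; rfl : (G:ℤ) = ∏ i, (g i:ℤ))).trans ?_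
    exact Finset.prod_dvd_of_coprime (fun i _ j _ hij => Nat.isCoprime_iff_coprime.2 (hgg i j hij)) fun i _ => h2 i
  · have hp0 : (0:ℝ) < p := by exact_mod_cast hp.pos
    have hg0 : ∀ i, (0:ℝ) < g i := fun i => by exact_mod_cast hg1 i
    have hG0 : (0:ℝ) < G := by
      rw [hG]; push_cast; exact prod_pos fun i _ => hg0 i
    have e : (((J * G + ∑ i, (rr p g c C i : ℤ) * (h i : ℕ) : ℤ)):ℝ) / ((p * G : ℕ):ℝ) = y / p + ∑ i, ((rr p g c C i:ℝ) / g i - s i / p) := by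
      rw [sum_sub_distrib, ← sum_div, hJ]
      push_cast
      rw [add_div, sum_div]
      have : ∀ i, (rr p g c C i : ℝ) * (h i:ℝ) / (p * G) = (rr p g c C i : ℝ) / g i := fun i => by
        have h3 : (g i : ℝ) * h i = p * G := by exact_mod_cast hhg i
        have := hg0 i
        rw [div_eq_div_iff (by positivity) (by positivity), ← h3]; ring
      simp only [this]
      field_simp
      ring
    have lo : ∀ i, 0 ≤ (rr p g c C i:ℝ) / g i - s i / p ∧ (rr p g c C i:ℝ) / g i - s i / p ≤ 1 / p := fun i => by
      have h3 : s i * g i ≤ p * rr p g c C i := by rw [← hs']; exact Nat.div_mul_le_self _ _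
      have h4 : p * rr p g c C i < g i * (s i + 1) := by rw [← hs']; exact Nat.lt_mul_div_succ _ (hg1 i)
      have h3' : (s i:ℝ) * g i ≤ p * rr p g c C i := by exact_mod_cast h3
      have h4' : (p:ℝ) * rr p g c C i < g i * (s i + 1) := by exact_mod_cast h4
      have := hg0 i
      constructor
      · rw [sub_nonneg, div_le_div_iff₀ hp0 this]; linarith
      · rw [sub_le_iff_le_add, ← add_div, div_le_div_iff₀ this hp0]; linarith
    rw [e]
    constructor
    · linarith [sum_nonneg fun i (_ : i ∈ univ) => (lo i).1]
    · have := sum_le_card_nsmul univ _ _ fun i (_ : i ∈ univ) => (lo i).2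
      simp only [card_univ, Fintype.card_fin, nsmul_eq_mul] at this
      push_cast at this
      rw [add_assoc, add_div, div_eq_mul_one_div ((r:ℝ) + 1)]
      linarith
end LV

set_option linter.unusedSectionVars false
namespace LV
open Finset Filter Topology
lemma split {l : ℕ} (hl : 1 ≤ l) (T : ℕ) (φ : ℕ → ℝ) :
    ∑ t ∈ range T, φ t = ∑ j ∈ range l, ∑ s ∈ range ((T + l - 1 - j) / l), φ (j + l * s) := by
  rw [sum_sigma']
  refine sum_nbij' (fun t => (⟨t % l, t / l⟩ : Σ _ : ℕ, ℕ)) (fun x => x.1 + l * x.2) ?_ ?_ ?_ ?_ ?_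
  · intro t ht
    simp only [mem_sigma, mem_range] at ht ⊢
    refine ⟨Nat.mod_lt _ hl, Nat.succ_le_iff.1 ((Nat.le_div_iff_mul_le hl).2 ?_)⟩
    have := Nat.mod_add_div t l
    have := Nat.mod_lt t hl
    rw [Nat.succ_mul, Nat.mul_comm]; omega
  · rintro ⟨j, s⟩ h
    simp only [mem_sigma, mem_range] at h ⊢
    have h2 := (Nat.le_div_iff_mul_le hl).1 (Nat.succ_le_iff.2 h.2)
    rw [Nat.succ_mul, Nat.mul_comm] at h2; omega
  · intro t _; exact Nat.mod_add_div t l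
  · rintro ⟨j, s⟩ h
    simp only [mem_sigma, mem_range] at h
    have h1 : (j + l * s) % l = j := by rw [Nat.add_mul_mod_self_left, Nat.mod_eq_of_lt h.1]
    have h2 : (j + l * s) / l = s := by rw [Nat.add_mul_div_left _ _ hl, Nat.div_eq_of_lt h.1, zero_add]
    simp only [h1, h2]
  · intro t _; simp only [Nat.mod_add_div]
open Classical in
lemma cnt_lin {l : ℕ} (hl : l.Prime) {χ : ℤ → Prop} (hχ : ∀ t v, χ (t + l * v) ↔ χ t) {d : ℕ} (hd : ¬ l ∣ d) (t0 : ℤ) :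
    #{j ∈ range l | χ (t0 + d * (j:ℕ))} = #{j ∈ range l | χ ((j:ℕ):ℤ)} := by
  have hl0 : (0:ℤ) < l := by exact_mod_cast hl.pos
  have hn : ∀ t : ℕ, (((t0 + d * t) % l).toNat : ℤ) = (t0 + d * t) % l := fun t => Int.toNat_of_nonneg (Int.emod_nonneg _ hl0.ne')
  have hi : Set.InjOn (fun j : ℕ => ((t0 + d * j) % l).toNat) (range l : Set ℕ) := by
    intro u hu v hv huv
    simp only [coe_range, Set.mem_Iio] at hu hv huv
    have h1 : (t0 + d * u) % l = (t0 + d * v) % l := by rw [← hn u, ← hn v, huv]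
    have h2 : (l:ℤ) ∣ d * ((u:ℤ) - v) :=
      (Int.ModEq.dvd (show (t0 + d * v) ≡ t0 + d * u [ZMOD l] from h1.symm)).trans (dvd_of_eq (by ring))
    have h3 := ((Nat.prime_iff_prime_int.1 hl).dvd_mul.1 h2).resolve_left (by exact_mod_cast hd)
    exact (Nat.ModEq.eq_of_lt_of_lt (Nat.modEq_iff_dvd.2 h3) hv hu).symm
  have him : (range l).image (fun j : ℕ => ((t0 + d * j) % l).toNat) = range l := by
    refine eq_of_subset_of_card_le (fun t ht => ?_) (card_image_of_injOn hi).ge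
    obtain ⟨j, _, rfl⟩ := mem_image.1 ht
    rw [mem_range]; zify; rw [hn]; exact Int.emod_lt_of_pos _ hl0
  conv_rhs => rw [← him, filter_image, card_image_of_injOn (hi.mono (filter_subset _ _))]
  congr 1
  refine filter_congr fun j _ => ?_
  rw [hn, ← hχ ((t0 + d * j) % l) ((t0 + d * j) / l), Int.emod_add_mul_ediv]
open Classical in
lemma prog (w : ℤ → ℝ) {p : ℕ} (hp : p.Prime) {ρ η E0 : ℝ} (hρ0 : 0 ≤ ρ) (hρ1 : ρ ≤ 1) (hη : 0 ≤ η) (hE : 0 ≤ E0)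
    (H : ∀ d : ℕ, ¬ p ∣ d → ∀ (t0 : ℤ) (T : ℕ), |∑ t ∈ range T, w (t0 + d * t) - T * ρ| ≤ T * η + E0)
    (χ : ℕ → ℤ → Prop) (ν : ℕ → ℕ) (S : Finset ℕ) (hS : ∀ l ∈ S, l.Prime ∧ l ≠ p ∧ (∀ t v, χ l (t + l * v) ↔ χ l t) ∧
      #{j ∈ range l | χ l ((j:ℕ):ℤ)} = ν l ∧ ν l ≤ 3) :
    ∀ d : ℕ, ¬ p ∣ d → (∀ l ∈ S, ¬ l ∣ d) → ∀ (t0 : ℤ) (T : ℕ),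
      |∑ t ∈ range T, w (t0 + d * t) * ∏ l ∈ S, (if χ l (t0 + d * t) then (1:ℝ) else 0) - T * ρ * ∏ l ∈ S, ((ν l:ℝ) / l)| ≤
        3 ^ #S * (T * η + E0 + 2) - 2 := by
  induction S using Finset.induction_on with
  | empty =>
    intro d hd _ t0 T
    simpa using H d hd t0 T
  | insert l S hlS ih =>
    intro d hd hdS t0 T
    obtain ⟨hl, hlp, hper, hν, hν3⟩ := hS l (mem_insert_self _ _)
    have ih' := ih (fun m hm => hS m (mem_insert_of_mem hm)) (d * l) (fun h => (hp.dvd_mul.1 h).elim hd fun h => hlp ((Nat.prime_dvd_prime_iff_eq hp hl).1 h).symm)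
      (fun m hm h => (((hS m (mem_insert_of_mem hm)).1).dvd_mul.1 h).elim (hdS m (mem_insert_of_mem hm)) fun h => hlS (((Nat.prime_dvd_prime_iff_eq (hS m (mem_insert_of_mem hm)).1 hl).1 h) ▸ hm))
    set A := {j ∈ range l | χ l (t0 + d * (j:ℕ))} with hA
    have hAc : #A = ν l := (cnt_lin hl hper (hdS l (mem_insert_self _ _)) t0).trans hν
    set P := ∏ m ∈ S, ((ν m:ℝ) / m) with hP
    have hP0 : 0 ≤ P := prod_nonneg fun m _ => by positivity
    have hP1 : P ≤ 1 := by
      refine prod_le_one (fun m _ => by positivity) fun m hm => ?_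
      obtain ⟨h1, -, -, h2, -⟩ := hS m (mem_insert_of_mem hm)
      refine div_le_one_of_le₀ ?_ (by positivity)
      rw [← h2]; exact_mod_cast (card_filter_le _ _).trans (card_range m).le
    have hl0 : (0:ℝ) < l := by exact_mod_cast hl.pos
    let T' : ℕ → ℕ := fun j => (T + l - 1 - j) / l
    have e1 : ∑ t ∈ range T, w (t0 + d * t) * ∏ m ∈ insert l S, (if χ m (t0 + d * t) then (1:ℝ) else 0) =
        ∑ j ∈ A, ∑ s ∈ range (T' j), w ((t0 + d * j) + (d * l : ℕ) * s) * ∏ m ∈ S, (if χ m ((t0 + d * j) + (d * l : ℕ) * s) then (1:ℝ) else 0) := by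
      rw [split hl.one_le, hA, sum_filter]
      refine sum_congr rfl fun j _ => ?_
      have e0 : ∀ s : ℕ, (t0 + d * ((j + l * s : ℕ):ℤ)) = (t0 + d * j) + (d * l : ℕ) * s := fun s => by push_cast; ring
      simp only [e0]
      have e2 : ∀ s : ℕ, χ l ((t0 + d * j) + (d * l : ℕ) * s) ↔ χ l (t0 + d * j) := fun s => by
        rw [← hper (t0 + d * j) (d * s)]; push_cast; rw [mul_comm (d:ℤ) l, mul_assoc]
      simp only [prod_insert hlS, e2]
      split_ifs with h
      · simp [T']
      · simp
    have hT' : ∀ j ∈ A, (T' j ≤ T) ∧ |(T' j : ℝ) - T / l| ≤ 1 := by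
      intro j hj
      have hj' : j < l := mem_range.1 (mem_filter.1 hj).1
      have h1 : l * T' j ≤ T + l - 1 - j := Nat.mul_div_le _ _
      have h2 : T + l - 1 - j < l * (T' j + 1) := Nat.lt_mul_div_succ _ hl.pos
      have h1' : l * T' j ≤ T + l := by omega
      have h2' : T ≤ l * T' j + l := by rw [Nat.mul_add] at h2; omega
      constructor
      · rcases Nat.eq_zero_or_pos (T' j) with h | h
        · omega
        · by_contra! h3
          have : l * (T + 1) ≤ l * T' j := Nat.mul_le_mul_left _ h3
          have h5 := Nat.mul_le_mul_right T hl.one_le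
          rw [Nat.mul_add] at this; omega
      · have h1r : (l:ℝ) * T' j ≤ T + l := by exact_mod_cast h1'
        have h2r : (T:ℝ) ≤ l * T' j + l := by exact_mod_cast h2'
        rw [abs_le]
        constructor
        · rw [le_sub_iff_add_le, neg_add_eq_sub, sub_le_iff_le_add, div_le_iff₀ hl0]; linarith
        · rw [sub_le_iff_le_add, ← sub_le_iff_le_add', le_div_iff₀ hl0]; linarith
    have e3 : (T:ℝ) * ρ * ∏ m ∈ insert l S, ((ν m:ℝ) / m) = ∑ j ∈ A, (T / l * ρ * P) := by
      rw [prod_insert hlS, sum_const, hAc, nsmul_eq_mul]; ring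
    rw [e1, e3, ← sum_sub_distrib]
    have e4 : ∀ j ∈ A, |∑ s ∈ range (T' j), w ((t0 + d * j) + (d * l : ℕ) * s) * ∏ m ∈ S, (if χ m ((t0 + d * j) + (d * l : ℕ) * s) then (1:ℝ) else 0) - T / l * ρ * P| ≤
        3 ^ #S * (T * η + E0 + 2) - 1 := by
      intro j hj
      have h1 := ih' (t0 + d * j) (T' j)
      obtain ⟨h2, h3⟩ := hT' j hj
      have h4 : |(T' j:ℝ) * ρ * P - T / l * ρ * P| ≤ 1 := by
        rw [show (T' j:ℝ) * ρ * P - T / l * ρ * P = ((T' j : ℝ) - T / l) * (ρ * P) by ring, abs_mul, abs_of_nonneg (mul_nonneg hρ0 hP0)]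
        exact mul_le_one₀ h3 (mul_nonneg hρ0 hP0) (mul_le_one₀ hρ1 hP0 hP1)
      have h5 : (3:ℝ) ^ #S * (T' j * η + E0 + 2) ≤ 3 ^ #S * (T * η + E0 + 2) := by
        have : (T' j:ℝ) ≤ T := by exact_mod_cast h2
        gcongr
      have := abs_sub_le (∑ s ∈ range (T' j), w ((t0 + d * j) + (d * l : ℕ) * s) * ∏ m ∈ S, (if χ m ((t0 + d * j) + (d * l : ℕ) * s) then (1:ℝ) else 0)) ((T' j:ℝ) * ρ * P) (T / l * ρ * P)
      linarith
    refine (abs_sum_le_sum_abs _ _).trans ((sum_le_card_nsmul _ _ _ e4).trans ?_)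
    rw [nsmul_eq_mul, hAc, card_insert_of_notMem hlS, pow_succ]
    have h6 : (1:ℝ) ≤ 3 ^ #S := one_le_pow₀ (by norm_num)
    have h7 : (0:ℝ) ≤ T * η + E0 := by positivity
    have h8 : 0 ≤ (3:ℝ) ^ #S * (T * η + E0 + 2) - 1 := by nlinarith
    have h9 : (ν l:ℝ) ≤ 3 := by exact_mod_cast hν3
    nlinarith
end LV

set_option linter.unusedSectionVars false
namespace LV
open Finset Filter Topology
def nu (k : Cub) (M : ℕ) (b c : ℤ) (l : ℕ) : ℕ := #{j ∈ range l | (l:ℤ) ∣ k.q (M * (j:ℕ)) b c}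
lemma nu_le3 (k : Cub) {M l : ℕ} (hl : l.Prime) (hM : ¬ l ∣ M) (b c : ℤ) : nu k M b c l ≤ 3 := by
  let k' : Cub := ⟨k.q 0 b c, b ^ 2 * k.c1 + 3 * b * c * k.c0 + b * c * k.c1 * k.c2 + c ^ 2 * k.c0 * k.c2
    + c ^ 2 * k.c1 ^ 2, -b * k.c2 - 2 * c * k.c1⟩
  have hk : ∀ a, k.q a b c = k'.f a := fun a => by simp only [Cub.q, Cub.f, k']; ring
  have := cnt k' hl.ne_zero 0 M (Nat.isCoprime_iff_coprime.2 ((Nat.Prime.coprime_iff_not_dvd hl).2 hM).symm) l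
  rw [Nat.div_eq_of_lt (Nat.sub_lt hl.pos one_pos), zero_add, one_mul] at this
  refine le_trans (le_of_eq ?_) (this.trans (ME.rho_le k' hl))
  unfold nu; simp only [hk, zero_add]
lemma nu_rho (k : Cub) {M l : ℕ} (hl : l.Prime) (hM : ¬ l ∣ M) {b c : ℤ} (hF : ¬ (l:ℤ) ∣ k.F b c) : nu k M b c l ≤ ME.rho k l := by
  have : Fact l.Prime := ⟨hl⟩
  have hF' : ((k.F b c : ℤ) : ZMod l) ≠ 0 := fun h => hF ((ZMod.intCast_zmod_eq_zero_iff_dvd _ _).1 h)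
  have hM' : (M : ZMod l) ≠ 0 := fun h => hM ((ZMod.natCast_eq_zero_iff _ _).1 h)
  have hC : ∀ a, (l:ℤ) ∣ k.q a b c → ((k.Cc a b c : ℤ) : ZMod l) ≠ 0 := fun a ha h => by
    have h1 := congrArg (Int.cast : ℤ → ZMod l) (k.Fq_eq a b c)
    have h2 := congrArg (Int.cast : ℤ → ZMod l) (k.F_eq a b c)
    rw [Int.cast_mul, (ZMod.intCast_zmod_eq_zero_iff_dvd _ _).2 ha, mul_zero, Cub.F] at h1
    push_cast at h1 h2
    rw [h] at h1 h2
    have h3 : ((k.B a b c : ℤ) : ZMod l) = 0 := by simpa using h1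
    rw [h3] at h2; exact hF' (by simpa using h2)
  refine card_le_card_of_injOn (fun j => ((k.B (M * j) b c : ZMod l) * (k.Cc (M * j) b c : ZMod l)⁻¹).val) (fun j hj => ?_) (fun u hu v hv huv => ?_)
  · simp only [coe_filter, mem_range, Set.mem_setOf_eq] at hj ⊢
    refine ⟨ZMod.val_lt _, (ZMod.intCast_zmod_eq_zero_iff_dvd _ _).1 ?_⟩
    have h0 := hC _ hj.2
    have h1 := congrArg (Int.cast : ℤ → ZMod l) (k.Fq_eq (M * j) b c)
    rw [Int.cast_mul, (ZMod.intCast_zmod_eq_zero_iff_dvd _ _).2 hj.2, mul_zero, Cub.F] at h1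
    unfold Cub.f
    push_cast [ZMod.natCast_zmod_val] at h1 ⊢
    field_simp
    linear_combination h1
  · simp only [coe_filter, mem_range, Set.mem_setOf_eq] at hu hv
    have h1 := ZMod.val_injective l huv
    have h2 := hC _ hu.2
    have h3 := hC _ hv.2
    have h4 : (k.B (M * u) b c : ZMod l) * (k.Cc (M * v) b c : ZMod l) = (k.B (M * v) b c : ZMod l) * (k.Cc (M * u) b c : ZMod l) := by
      field_simp at h1; linear_combination h1
    have h5 : k.B (M * u) b c * k.Cc (M * v) b c - k.B (M * v) b c * k.Cc (M * u) b c = M * (v - u) * k.F b c := by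
      unfold Cub.B Cub.Cc Cub.F; ring
    have h6 := congrArg (Int.cast : ℤ → ZMod l) h5
    push_cast at h6
    rw [h4, sub_self] at h6
    have h7 : ((v:ℕ):ZMod l) = ((u:ℕ): ZMod l) := by
      rcases mul_eq_zero.1 h6.symm with h | h
      · exact sub_eq_zero.1 ((mul_eq_zero.1 h).resolve_left hM')
      · exact absurd h hF'
    exact (Nat.ModEq.eq_of_lt_of_lt ((ZMod.natCast_eq_natCast_iff _ _ _).1 h7) hv.1 hu.1).symm
noncomputable def ww (k : Cub) (M : ℕ) (b c : ℤ) (p : ℕ) {r : ℕ} (g : Fin (r + 1) → ℕ) (L : ℕ) (y0 : ℤ) (t : ℤ) : ℝ :=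
  GB.Psi p L (y0 : ZMod p) (-(c:ZMod p) ^ 2 * ((∏ i, g i : ℕ) : ZMod p)⁻¹ * (k.Cc (M * t) b c : ZMod p)⁻¹ +
    ∑ i, ((p * rr p g c (k.Cc (M * t) b c) i / g i : ℕ) : ZMod p))
lemma eqd (k : Cub) {M p : ℕ} (hp : p.Prime) {b c : ℤ} (hc : ¬ (p:ℤ) ∣ c) (hM : ¬ p ∣ M) {r : ℕ} (g : Fin (r + 1) → ℕ)
    (hgp : ∀ i, p.Coprime (g i)) {Y : ℕ} (hY : ∀ i, g i ≤ Y) {L : ℕ} (hL : L ≤ p) (hL1 : 1 ≤ L) (y0 : ℤ)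
    {η : ℝ} (hη0 : 0 ≤ η) (hη : 2 * (GB.CZ r 0 : ℝ) / p ≤ η ^ 2 ^ (r + 1)) (d : ℕ) (hd : ¬ p ∣ d) (t0 : ℤ) (T : ℕ) :
    |∑ t ∈ range T, ww k M b c p g L y0 (t0 + d * t) - T * ((L:ℝ) / p)| ≤ T * η + 2 * (r + 1) * p * Y := by
  have : Fact p.Prime := ⟨hp⟩
  have hg : ∀ i, (g i : ZMod p) ≠ 0 := fun i h => (Nat.Prime.coprime_iff_not_dvd hp).1 (hgp i) ((ZMod.natCast_eq_zero_iff _ _).1 h)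
  have hc' : (c : ZMod p) ≠ 0 := fun h => hc ((ZMod.intCast_zmod_eq_zero_iff_dvd _ _).1 h)
  have hM' : (M : ZMod p) ≠ 0 := fun h => hM ((ZMod.natCast_eq_zero_iff _ _).1 h)
  have hd' : (d : ZMod p) ≠ 0 := fun h => hd ((ZMod.natCast_eq_zero_iff _ _).1 h)
  have hP : ((∏ i, g i : ℕ) : ZMod p) ≠ 0 := by push_cast; exact prod_ne_zero_iff.2 fun i _ => hg i
  have := GB.equi r g hg Y hY (fun i t => ((p * rr p g c (k.Cc (M * t) b c) i / g i : ℕ) : ZMod p)) (fun i t v => by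
      have : ((k.Cc (M * (t + g i * v)) b c : ℤ) : ZMod (g i)) = (k.Cc (M * t) b c : ZMod (g i)) := by
        unfold Cub.Cc; push_cast; simp
      unfold rr; rw [this]) (-(c:ZMod p) ^ 2 * ((∏ i, g i : ℕ) : ZMod p)⁻¹) (-(M * c)) (k.Cc 0 b c)
    (mul_ne_zero (by simpa using hc') (inv_ne_zero hP)) (by simpa using ⟨hM', hc'⟩) η hη0 hη L hL hL1 y0 d hd' t0 T
  convert this using 3
  · refine sum_congr rfl fun t _ => ?_
    unfold ww
    congr 4
    unfold Cub.Cc; push_cast; ring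
  · ring
end LV

set_option linter.unusedSectionVars false
namespace LV
open Finset Filter Topology
open Classical in
noncomputable def GS (k : Cub) (M : ℕ) (b c : ℤ) (W z : ℕ) (θ : ℝ) (t0 : ℤ) (T : ℕ) : Finset ℕ :=
  (range T).filter fun t => (∀ l : ℕ, l.Prime → W < l → l ≤ z → ¬ (l:ℤ) ∣ k.q (M * (t0 + t)) b c) ∧
    IsCoprime (k.Cc (M * (t0 + t)) b c) (k.F b c) ∧ ∃ R : ℤ, k.F b c ∣ R * k.Cc (M * (t0 + t)) b c + c ^ 2 ∧
      1.34 * θ ≤ (R:ℝ) / k.F b c ∧ (R:ℝ) / k.F b c ≤ 1.46 * θ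
lemma dvd_c (k : Cub) {l b c : ℤ} (hl : Prime l) (hbc : IsCoprime b c) (h : l ∣ k.F b c) : ¬ l ∣ c := fun h1 => by
  have : l ∣ b ^ 3 := by
    have h2 : b ^ 3 = k.F b c - c * (k.c2 * b ^ 2 + k.c1 * b * c + k.c0 * c ^ 2) := by unfold Cub.F; ring
    rw [h2]; exact dvd_sub h (h1.mul_right _)
  exact hl.not_unit (hbc.isUnit_of_dvd' (hl.dvd_of_dvd_pow this) h1)
lemma dvd_q (k : Cub) {l a b c : ℤ} (hl : Prime l) (hbc : IsCoprime b c) (h : l ∣ k.F b c) (hC : l ∣ k.Cc a b c) : l ∣ k.q a b c := by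
  have hc := dvd_c k hl hbc h
  rw [k.F_eq a b c, dvd_sub_right (hC.mul_left _)] at h
  have hB := (hl.dvd_mul.1 h).resolve_left hc
  have h1 : l ∣ c ^ 2 * k.q a b c := by
    rw [k.c2q_eq]
    exact dvd_add (dvd_add ((dvd_pow hC two_ne_zero).mul_left _) (hC.mul_left _)) ((dvd_pow hB two_ne_zero).mul_left _)
  exact (hl.dvd_mul.1 h1).resolve_left fun h2 => hc (hl.dvd_of_dvd_pow h2)
open Classical in
lemma pert : ∃ κ : ℕ, ∀ (k : Cub) (W J M : ℕ) (b c : ℤ) (p r Y : ℕ) (θ η : ℝ) (t0 : ℤ) (T : ℕ), 8 ≤ W →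
    (∀ l : ℕ, l.Prime → W < l → ¬ l ∣ M) → (∀ l : ℕ, l.Prime → (l:ℤ) ∣ k.F b c → W < l) → 0 < k.F b c → IsCoprime b c →
    p.Prime → (p:ℤ) ∣ k.F b c → ¬ ((p ^ 2 : ℕ):ℤ) ∣ k.F b c → 1 ≤ Y →
    (∀ l e : ℕ, l.Prime → 1 ≤ e → ((l ^ e : ℕ):ℤ) ∣ k.F b c → l ^ e ≤ Y) → (k.F b c) ^ 2 < (Y:ℤ) ^ (r + 1) → W ^ 2 ^ J < p →
    θ ≤ 1 → ((r:ℝ) + 1) / p ≤ θ / 100 → 0 ≤ η → 2 * (GB.CZ r 0 : ℝ) / p ≤ η ^ 2 ^ (r + 1) →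
    T * (θ / 50) * ∏ l ∈ SV.pr W (W ^ 2 ^ J), (1 - (nu k M b c l : ℝ) / l)
      - (J + 1) * ((T * η + 2 * (r + 1) * p * Y + 2) * ((W ^ 2 ^ J : ℕ) : ℝ) ^ κ)
      - Nat.log 2 (k.F b c).natAbs * (T / (W ^ 2 ^ J : ℕ) + 1) ≤ #(GS k M b c W (W ^ 2 ^ J) θ t0 T) := by
  obtain ⟨κ, hκ⟩ := SV.sieve
  refine ⟨κ, fun k W J M b c p r Y θ η t0 T hW hM hFW hF0 hbc hp hpF hpF2 hY hpp hr hzp hθ1 hθ hη0 hη => ?_⟩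
  have : Fact p.Prime := ⟨hp⟩
  set z := W ^ 2 ^ J with hz
  obtain ⟨G0, hG0⟩ := Int.eq_ofNat_of_zero_le hF0.le
  obtain ⟨G, rfl⟩ : p ∣ G0 := by rw [hG0] at hpF; exact_mod_cast hpF
  have hp0 : (0:ℝ) < p := by exact_mod_cast hp.pos
  have hG : G ≠ 0 := by rintro rfl; simp at hG0; omega
  have hpG : ¬ p ∣ G := fun h => hpF2 (by rw [hG0, sq]; exact_mod_cast mul_dvd_mul_left p h)
  obtain ⟨g, hg1, hg2, hg3⟩ := group (r := r) hG hY (fun l e hl he h => hpp l e hl he (by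
      rw [hG0]; exact_mod_cast h.mul_left p)) (by
      have : (G:ℤ) ^ 2 ≤ k.F b c ^ 2 := by
        rw [hG0]; push_cast
        have : (1:ℤ) ≤ p := by exact_mod_cast hp.one_le
        exact pow_le_pow_left₀ (by positivity) (le_mul_of_one_le_left (by positivity) this) 2
      exact_mod_cast this.trans_lt hr)
  have hgp : ∀ i, p.Coprime (g i) := fun i => (Nat.Prime.coprime_iff_not_dvd hp).2 fun h => hpG (by
    rw [← hg1]; exact h.trans (dvd_prod_of_mem _ (mem_univ i)))
  have hpc := dvd_c k (Nat.prime_iff_prime_int.1 hp) hbc hpF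
  have hpM := hM p hp (hFW p hp hpF)
  have hpθ : (100:ℝ) * (r + 1) ≤ p * θ := by rw [div_le_iff₀ hp0] at hθ; linarith
  have hr0 : (0:ℝ) ≤ r := Nat.cast_nonneg _
  have hθ0 : 0 < θ := by by_contra! h; nlinarith
  set L := ⌊p * θ / 20⌋₊ with hL
  set y0 := ⌊1.4 * (p * θ)⌋ with hy0
  have hL1 : 1 ≤ L := Nat.le_floor (by push_cast; linarith)
  have hLu : (L:ℝ) ≤ p * θ / 20 := Nat.floor_le (by positivity)
  have hLl : p * θ / 20 - 1 < L := by have := Nat.lt_floor_add_one (p * θ / 20); linarith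
  have hLp : L ≤ p := by
    have : (L:ℝ) ≤ p := by nlinarith
    exact_mod_cast this
  have hy1 : (y0:ℝ) ≤ 1.4 * (p * θ) := Int.floor_le _
  have hy2 : 1.4 * (p * θ) - 1 < y0 := by have := Int.lt_floor_add_one (1.4 * (p * θ)); rw [← hy0] at this; linarith
  have key := hκ W J hW (fun l => (nu k M b c l : ℝ) / l) (fun l hl hWl => ⟨by positivity, by
      gcongr; exact_mod_cast nu_le3 k hl (hM l hl hWl) b c⟩) (range T) (fun t => ww k M b c p g L y0 (t0 + t))
      (fun l t => if (l:ℤ) ∣ k.q (M * (t0 + t)) b c then 1 else 0) (T * (L / p)) (T * η + 2 * (r + 1) * p * Y + 2)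
      (fun t _ => GB.Psi_nonneg _ _ _) (fun l t => by split_ifs <;> norm_num) (by positivity) (by positivity) (fun S hS => by
    have h1 := prog (ww k M b c p g L y0) hp (ρ := (L:ℝ) / p) (η := η) (E0 := 2 * (r + 1) * p * Y) (by positivity) (div_le_one_of_le₀ (by exact_mod_cast hLp) hp0.le) hη0 (by positivity)
      (fun d hd t0 T => eqd k hp hpc hpM g hgp (fun i => (hg2 i).2) hLp hL1 y0 hη0 hη d hd t0 T)
      (fun l t => (l:ℤ) ∣ k.q (M * t) b c) (nu k M b c) S (fun l hl => by
        obtain ⟨⟨h1, h2⟩, h3⟩ := SV.mem_pr.1 (hS hl)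
        refine ⟨h3, by omega, fun t v => ?_, ?_, nu_le3 k h3 (hM l h3 h1) b c⟩
        · rw [← ZMod.intCast_zmod_eq_zero_iff_dvd, ← ZMod.intCast_zmod_eq_zero_iff_dvd]
          unfold Cub.q; push_cast; simp
        · unfold nu; congr!) 1 hp.not_dvd_one (fun l hl => (SV.mem_pr.1 (hS hl)).2.not_dvd_one) t0 T
    push_cast at h1
    simp only [one_mul] at h1
    have h2 : (0:ℝ) ≤ 3 ^ #S := by positivity
    refine le_trans ?_ (h1.trans ?_)
    · refine le_of_eq ?_; congr!
    · linarith)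
  have hpt : ∀ t ∈ range T, ww k M b c p g L y0 (t0 + t) * ∏ l ∈ SV.pr W z, (1 - (if (l:ℤ) ∣ k.q (M * (t0 + t)) b c then (1:ℝ) else 0)) ≤
      (if t ∈ GS k M b c W z θ t0 T then 1 else 0) +
        ∑ l ∈ (p * G).primeFactors.filter (z < ·), (if (l:ℤ) ∣ k.Cc (M * (t0 + t)) b c then (1:ℝ) else 0) := by
    intro t ht
    have hw0 : 0 ≤ ww k M b c p g L y0 (t0 + t) := GB.Psi_nonneg _ _ _
    have hw1 : ww k M b c p g L y0 (t0 + t) ≤ 1 := GB.Psi_le_one _ hLp _ _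
    have hs0 : 0 ≤ ∑ l ∈ (p * G).primeFactors.filter (z < ·), (if (l:ℤ) ∣ k.Cc (M * (t0 + t)) b c then (1:ℝ) else 0) :=
      sum_nonneg fun l _ => by split_ifs <;> norm_num
    have hi0 : (0:ℝ) ≤ if t ∈ GS k M b c W z θ t0 T then 1 else 0 := by split_ifs <;> norm_num
    have hP1 : ∏ l ∈ SV.pr W z, (1 - (if (l:ℤ) ∣ k.q (M * (t0 + t)) b c then (1:ℝ) else 0)) ≤ 1 :=
      prod_le_one (fun l _ => by split_ifs <;> norm_num) fun l _ => by split_ifs <;> norm_num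
    have hP0 : 0 ≤ ∏ l ∈ SV.pr W z, (1 - (if (l:ℤ) ∣ k.q (M * (t0 + t)) b c then (1:ℝ) else 0)) :=
      prod_nonneg (fun l _ => by split_ifs <;> norm_num)
    by_cases h1 : ∃ l ∈ (p * G).primeFactors.filter (z < ·), (l:ℤ) ∣ k.Cc (M * (t0 + t)) b c
    · obtain ⟨l, hl, hlC⟩ := h1
      have := single_le_sum (f := fun l : ℕ => if (l:ℤ) ∣ k.Cc (M * (t0 + t)) b c then (1:ℝ) else 0) (fun l _ => by split_ifs <;> norm_num) hl
      simp only [hlC, if_true] at this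
      nlinarith
    by_cases h2 : ∃ l ∈ SV.pr W z, (l:ℤ) ∣ k.q (M * (t0 + t)) b c
    · obtain ⟨l, hl, hlq⟩ := h2
      rw [prod_eq_zero hl (by simp [hlq]), mul_zero]; positivity
    by_cases h3 : ww k M b c p g L y0 (t0 + t) = 0
    · rw [h3, zero_mul]; positivity
    push Not at h1 h2
    have hcop : IsCoprime (k.Cc (M * (t0 + t)) b c) (k.F b c) := by
      rw [Int.isCoprime_iff_gcd_eq_one]
      by_contra hne
      obtain ⟨l, hl, hlg⟩ := Nat.exists_prime_and_dvd hne
      have h4 : (l:ℤ) ∣ k.Cc (M * (t0 + t)) b c := (Int.natCast_dvd_natCast.2 hlg).trans (Int.gcd_dvd_left ..)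
      have h5 : (l:ℤ) ∣ k.F b c := (Int.natCast_dvd_natCast.2 hlg).trans (Int.gcd_dvd_right ..)
      rcases le_or_gt l z with h | h
      · exact h2 l (SV.mem_pr.2 ⟨⟨hFW l hl h5, h⟩, hl⟩) (dvd_q k (Nat.prime_iff_prime_int.1 hl) hbc h5 h4)
      · refine h1 l (mem_filter.2 ⟨Nat.mem_primeFactors.2 ⟨hl, ?_, mul_ne_zero hp.ne_zero hG⟩, h⟩) h4
        rw [hG0] at h5; exact_mod_cast h5
    have hmem : t ∈ GS k M b c W z θ t0 T := by
      refine mem_filter.2 ⟨ht, fun l hl hl1 hl2 => h2 l (SV.mem_pr.2 ⟨⟨hl1, hl2⟩, hl⟩), hcop, ?_⟩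
      obtain ⟨u, hu, v, hv, huv⟩ := GB.Psi_pos _ _ _ h3
      have hF1 : k.F b c = ((p * ∏ i, g i : ℕ):ℤ) := by rw [hG0, hg1]
      obtain ⟨R, hR1, hR2, hR3⟩ := crtR hp g (fun i => (hg2 i).1) hgp hg3 c (k.Cc (M * (t0 + t)) b c) (by rwa [hF1] at hcop) (y0 + u - v) (by
        push_cast; rw [← huv]; push_cast; rfl)
      have hF2 : ((k.F b c : ℤ) : ℝ) = ((p * ∏ i, g i : ℕ):ℝ) := by rw [hF1]; norm_cast
      refine ⟨R, by rw [hF1]; exact hR1, ?_, ?_⟩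
      · rw [hF2]; refine le_trans ?_ hR2
        have : (v:ℝ) ≤ L := by exact_mod_cast hv.le
        rw [le_div_iff₀ hp0]; push_cast; linarith [(Nat.cast_nonneg u : (0:ℝ) ≤ u)]
      · rw [hF2]; refine hR3.trans ?_
        have : (u:ℝ) ≤ L := by exact_mod_cast hu.le
        rw [div_le_iff₀ hp0]; push_cast; linarith [(Nat.cast_nonneg v : (0:ℝ) ≤ v)]
    rw [if_pos hmem]
    nlinarith
  have hsum := sum_le_sum hpt
  rw [sum_add_distrib, sum_comm] at hsum
  have e1 : ∑ t ∈ range T, (if t ∈ GS k M b c W z θ t0 T then (1:ℝ) else 0) = #(GS k M b c W z θ t0 T) := by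
    rw [← sum_filter, filter_mem_eq_inter, inter_eq_right.2 (by unfold GS; exact filter_subset _ _)]; simp
  have e2 : ∑ l ∈ (p * G).primeFactors.filter (z < ·), ∑ t ∈ range T, (if (l:ℤ) ∣ k.Cc (M * (t0 + t)) b c then (1:ℝ) else 0) ≤
      Nat.log 2 (k.F b c).natAbs * (T / z + 1) := by
    have : ∀ l ∈ (p * G).primeFactors.filter (z < ·), ∑ t ∈ range T, (if (l:ℤ) ∣ k.Cc (M * (t0 + t)) b c then (1:ℝ) else 0) ≤ T / z + 1 := by
      intro l hl
      obtain ⟨hl1, hl2⟩ := mem_filter.1 hl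
      have hlp := Nat.prime_of_mem_primeFactors hl1
      have hlF : (l:ℤ) ∣ k.F b c := by rw [hG0]; exact_mod_cast Nat.dvd_of_mem_primeFactors hl1
      have hlc := dvd_c k (Nat.prime_iff_prime_int.1 hlp) hbc hlF
      have hlM := hM l hlp (hFW l hlp hlF)
      have hco : IsCoprime (-(M * c):ℤ) (l:ℤ) := by
        refine (IsCoprime.neg_left_iff _ _).2 (((Prime.coprime_iff_not_dvd (Nat.prime_iff_prime_int.1 hlp)).2 fun h => ?_).symm)
        exact ((Nat.prime_iff_prime_int.1 hlp).dvd_mul.1 h).elim (fun h => hlM (by exact_mod_cast h)) hlc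
      have h1 := cnt1 (k.Cc (M * t0) b c) (-(M * c)) hco T
      have h2 : ∀ t : ℕ, k.Cc (M * (t0 + t)) b c = k.Cc (M * t0) b c + -(M * c) * t := fun t => by unfold Cub.Cc; ring
      simp only [h2]
      rw [← sum_filter, sum_const, nsmul_eq_mul, mul_one]
      have h3 : ((T / l + 1 : ℕ):ℝ) ≤ T / z + 1 := by
        push_cast
        have h4 : ((T / l : ℕ):ℝ) ≤ T / l := Nat.cast_div_le
        have hz0 : (0:ℝ) < z := by rw [hz]; positivity
        have h5 : (T:ℝ) / l ≤ T / z := by gcongr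
        linarith
      refine le_trans ?_ h3
      exact_mod_cast h1
    refine (sum_le_card_nsmul _ _ _ this).trans ?_
    rw [nsmul_eq_mul]
    have h1 : #((p * G).primeFactors.filter (z < ·)) ≤ Nat.log 2 (k.F b c).natAbs := by
      refine (card_filter_le _ _).trans ?_
      rw [hG0]; exact card_pf (mul_ne_zero hp.ne_zero hG)
    gcongr
  have hP0 : 0 ≤ ∏ l ∈ SV.pr W z, (1 - (nu k M b c l:ℝ) / l) := prod_nonneg fun l hl => by
    obtain ⟨⟨h1, h2⟩, h3⟩ := SV.mem_pr.1 hl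
    have : nu k M b c l ≤ l := (card_filter_le _ _).trans (card_range l).le
    rw [sub_nonneg]; exact div_le_one_of_le₀ (by exact_mod_cast this) (by positivity)
  have e3 : T * (θ / 50) ≤ T * ((L:ℝ) / p) / 2 := by
    rw [mul_div_assoc]; refine mul_le_mul_of_nonneg_left ?_ (Nat.cast_nonneg _)
    rw [div_div, le_div_iff₀ (by positivity)]; linarith
  have e4 := mul_le_mul_of_nonneg_right e3 hP0
  linarith
end LV

set_option linter.unusedSectionVars false
namespace LV
open Finset Filter Topology
lemma Vlow (k : Cub) {C0 : ℝ} (hC0 : ∀ n : ℕ, 3 ≤ n → ∑ p ∈ Nat.primesLE n, (ME.rho k p : ℝ) / p ≤ Real.log (Real.log n) + C0)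
    {W M z : ℕ} (hW : 8 ≤ W) (hz : W ≤ z) (hM : ∀ l : ℕ, l.Prime → W < l → ¬ l ∣ M) {b c : ℤ}
    (hF : ∑ l ∈ (SV.pr W z).filter (fun l : ℕ => (l:ℤ) ∣ k.F b c), (1:ℝ) / l ≤ 1) :
    Real.exp (-(C0 + 12)) / Real.log z ≤ ∏ l ∈ SV.pr W z, (1 - (nu k M b c l : ℝ) / l) := by
  have hlz : 0 < Real.log z := Real.log_pos (by exact_mod_cast (by omega : 1 < z))
  have hh : ∀ l ∈ SV.pr W z, (nu k M b c l : ℝ) / l ≤ 3 / l ∧ (3:ℝ) / l ≤ 1 / 2 := fun l hl => by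
    obtain ⟨⟨h1, h2⟩, h3⟩ := SV.mem_pr.1 hl
    have : (8:ℝ) ≤ l := by exact_mod_cast (by omega : 8 ≤ l)
    refine ⟨by gcongr; exact_mod_cast nu_le3 k h3 (hM l h3 h1) b c, ?_⟩
    rw [div_le_div_iff₀ (by linarith) two_pos]; linarith
  have e1 : Real.exp (-∑ l ∈ SV.pr W z, ((nu k M b c l : ℝ) / l + 2 * (3 / (l:ℝ)) ^ 2)) ≤ ∏ l ∈ SV.pr W z, (1 - (nu k M b c l : ℝ) / l) := by
    rw [← sum_neg_distrib, Real.exp_sum]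
    refine prod_le_prod (fun l _ => (Real.exp_pos _).le) fun l hl => ?_
    obtain ⟨h1, h2⟩ := hh l hl
    set h := (nu k M b c l : ℝ) / l
    have h0 : 0 ≤ h := by positivity
    have h3 := Real.one_sub_inv_le_log_of_pos (show 0 < 1 - h by linarith)
    rw [← Real.le_log_iff_exp_le (by linarith)]
    refine le_trans ?_ h3
    have h4 : h ^ 2 ≤ (3 / (l:ℝ)) ^ 2 := pow_le_pow_left₀ h0 h1 2
    have h5 : (1 - h)⁻¹ ≤ 1 + h + 2 * h ^ 2 := by
      rw [inv_le_iff_one_le_mul₀ (by linarith)]; nlinarith [mul_nonneg (sq_nonneg h) (show 0 ≤ 1 - 2 * h by linarith)]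
    linarith
  refine le_trans ?_ e1
  have e2 : ∑ l ∈ SV.pr W z, (nu k M b c l : ℝ) / l ≤ Real.log (Real.log z) + C0 + 3 := by
    have : ∀ l ∈ SV.pr W z, (nu k M b c l : ℝ) / l ≤ (ME.rho k l : ℝ) / l + 3 * (if (l:ℤ) ∣ k.F b c then (1:ℝ) / l else 0) := fun l hl => by
      obtain ⟨⟨h1, h2⟩, h3⟩ := SV.mem_pr.1 hl
      split_ifs with h
      · have := (hh l hl).1
        have h4 : 0 ≤ (ME.rho k l : ℝ) / l := by positivity
        linarith [show (3:ℝ) / l = 3 * (1 / l) by ring]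
      · rw [mul_zero, add_zero]; gcongr; exact nu_rho k h3 (hM l h3 h1) h
    refine (sum_le_sum this).trans ?_
    rw [sum_add_distrib, ← mul_sum, ← sum_filter]
    have h1 := hC0 z (by omega)
    have h2 : ∑ l ∈ SV.pr W z, (ME.rho k l : ℝ) / l ≤ ∑ p ∈ Nat.primesLE z, (ME.rho k p : ℝ) / p :=
      sum_le_sum_of_subset_of_nonneg (fun l hl => by
        obtain ⟨⟨h1, h2⟩, h3⟩ := SV.mem_pr.1 hl
        exact Nat.mem_primesLE.2 ⟨h2, h3⟩) fun _ _ _ => by positivity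
    linarith
  have e3 : ∑ l ∈ SV.pr W z, 2 * (3 / (l:ℝ)) ^ 2 ≤ 9 := by
    have h1 : ∀ l : ℕ, 2 * (3 / (l:ℝ)) ^ 2 = 18 * (1 / (l:ℝ) ^ 2) := fun l => by ring
    simp only [h1]; rw [← mul_sum]
    have h2 := inv2 (T := z) (show W ≠ 0 by omega)
    have h3 : (1:ℝ) / W ≤ 1 / 8 := one_div_le_one_div_of_le (by norm_num) (by exact_mod_cast hW)
    linarith
  rw [sum_add_distrib, div_eq_mul_inv, ← Real.exp_log (inv_pos.2 hlz), ← Real.exp_add, Real.log_inv]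
  exact Real.exp_le_exp.2 (by linarith)
set_option maxHeartbeats 1000000 in
lemma He (k : Cub) {C0 : ℝ} (hC0 : ∀ n : ℕ, 3 ≤ n → ∑ p ∈ Nat.primesLE n, (ME.rho k p : ℝ) / p ≤ Real.log (Real.log n) + C0)
    {W M K1 K : ℕ} (hW : 8 ≤ W) (hM : ∀ l : ℕ, l.Prime → W < l → ¬ l ∣ M) (hM2 : ∀ l : ℕ, l.Prime → l ≤ W → l ∣ M)
    {ε : ℝ} (hε : 0 < ε) (hε1 : ε ≤ 1 / 10 ^ 7)
    (hF0 : ∀ T : ℕ, 1 ≤ T → ∀ x ∈ bx T, 0 < k.F (bb M ((K1 * T : ℕ):ℤ) x) (cc M x)) :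
    ∃ η : ℝ, 0 < η ∧ ∃ cV : ℝ, 0 < cV ∧ ∀ᶠ T : ℕ in atTop, ∃ z : ℕ, (T:ℝ) ^ η ≤ z ∧
      ∀ θ : ℝ, (T:ℝ) ^ (-η) ≤ θ → θ ≤ 1 → ∀ x ∈ bx T, OK k W M K1 T ε x →
      cV * θ * T / Real.log T ≤ #(GS k M (bb M ((K1 * T : ℕ):ℤ) x) (cc M x) W z θ ((K * T : ℕ):ℤ) T) := by
  obtain ⟨κ, hκ⟩ := pert
  set σ := ε / 8192 with hσ
  have hσ0 : 0 < σ := by positivity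
  set η1 := σ / (2 * (κ + 1)) with hη1
  have hη0 : 0 < η1 := by positivity
  have hησ : η1 * (κ + 1) = σ / 2 := by rw [hη1]; field_simp
  have hησ' : η1 ≤ σ / 2 := by nlinarith [(Nat.cast_nonneg κ : (0:ℝ) ≤ κ)]
  set c0 := Real.exp (-(C0 + 12)) with hc0
  have hc00 : 0 < c0 := Real.exp_pos _
  set SF : ℕ := SS k * (1 + M * (K1 + 1)) ^ 3 with hSF
  refine ⟨η1 / 8, by positivity, c0 / 100, by positivity, ?_⟩
  filter_upwards [eventually_ge_atTop 3, (fl_tendsto hη0).eventually_ge_atTop W, (rpow_nat (show 0 < ε / 8 by positivity)).eventually_ge_atTop 1000,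
    (rpow_nat (show 0 < ε / 8 by positivity)).eventually_ge_atTop (2 * (GB.CZ 9 0 : ℝ)),
    (rpow_nat (show (0:ℝ) < 1 / 20 by norm_num)).eventually_ge_atTop 2, eventually_ge_atTop SF,
    polylog 0 1 (η1 / 4) 2 (by positivity) (10000 / c0)] with T hT3 hTW hT1 hTC hT2 hTS hTp
  have hT0 : (0:ℝ) < T := by positivity
  have hT1' : (1:ℝ) ≤ T := by exact_mod_cast (by omega : 1 ≤ T)
  have hL1 : 1 ≤ Real.log T := by
    rw [Real.le_log_iff_exp_le hT0]
    have : (3:ℝ) ≤ T := by exact_mod_cast hT3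
    linarith [Real.exp_one_lt_d9]
  have mono : ∀ {u v : ℝ}, u ≤ v → (T:ℝ) ^ u ≤ (T:ℝ) ^ v := fun h => Real.rpow_le_rpow_of_exponent_le hT1' h
  set J := Nat.log 2 (Nat.log W (fl T η1)) with hJ
  have hlog : Nat.log W (fl T η1) ≠ 0 := by
    have := Nat.log_mono_right (b := W) hTW
    have h2 : 0 < Nat.log W W := Nat.log_pos (by omega) le_rfl
    omega
  have hzu : W ^ 2 ^ J ≤ fl T η1 := (Nat.pow_le_pow_right (by omega) (Nat.pow_log_le_self 2 hlog)).trans (Nat.pow_log_le_self W (by omega))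
  have hzl : fl T η1 < W ^ 2 ^ (J + 1) := (Nat.lt_pow_succ_log_self (by omega) _).trans_le
    (Nat.pow_le_pow_right (by omega) (Nat.lt_pow_succ_log_self (by norm_num) _))
  have hJz : J + 1 ≤ W ^ 2 ^ J := (Nat.lt_two_pow_self (n := J)).trans_le (Nat.lt_pow_self (by omega)).le
  have hzW : W ≤ W ^ 2 ^ J := Nat.le_self_pow (by positivity) W
  set z := W ^ 2 ^ J with hz
  have hzu' : (z:ℝ) ≤ (T:ℝ) ^ η1 := le_fl.1 hzu
  have hzl' : (T:ℝ) ^ (η1 / 2) ≤ z := by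
    have h1 : fl T η1 + 1 ≤ z ^ 2 := by rw [hz, ← pow_mul, ← pow_succ]; exact hzl
    have h2 : (T:ℝ) ^ η1 ≤ (z:ℝ) ^ 2 := by
      refine (Nat.lt_floor_add_one _).le.trans ?_
      exact_mod_cast h1
    refine le_of_sq_le_sq ?_ (by positivity)
    rw [← Real.rpow_natCast, ← Real.rpow_mul hT0.le]
    rwa [Nat.cast_ofNat, div_mul_cancel₀ _ two_ne_zero]
  have hz0 : (0:ℝ) < z := by exact_mod_cast (by omega : 0 < z)
  have hzT : (z:ℝ) ≤ T := by
    refine hzu'.trans ((mono (show η1 ≤ 1 by linarith)).trans (Real.rpow_one _).le)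
  refine ⟨z, (mono (by linarith)).trans hzl', fun θ hθ hθ1 x hx hOK => ?_⟩
  obtain ⟨hbc, ⟨p, ⟨hpl, hpu⟩, hp, hpF, hpF2⟩, hpp, hS⟩ := hOK
  have hF := hF0 T (by omega) x hx
  set b := bb M ((K1 * T : ℕ):ℤ) x
  set c := cc M x
  have hpl' : (T:ℝ) ^ (ε / 4) < p := fl_lt.1 hpl
  have hpu' : (p:ℝ) ≤ (T:ℝ) ^ (ε / 2) := le_fl.1 hpu
  have hp0 : (0:ℝ) < p := by exact_mod_cast hp.pos
  have hθ0 : 0 < θ := lt_of_lt_of_le (by positivity) hθ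
  have hFT : (k.F b c : ℝ) ≤ (T:ℝ) ^ 4 := by
    obtain ⟨h1, h2⟩ := bc_bd M K1 T (by omega) hx
    have h3 := (le_abs_self _).trans (F_bd k h1 h2)
    have h4 : k.F b c ≤ ((SF * T ^ 3 : ℕ):ℤ) := by
      refine h3.trans ?_
      rw [hSF]; push_cast
      rw [mul_pow, mul_assoc]
    have h5 : SF * T ^ 3 ≤ T ^ 4 := by rw [pow_succ' T 3]; exact Nat.mul_le_mul_right _ hTS
    exact_mod_cast h4.trans (by exact_mod_cast h5)
  have hYl : (T:ℝ) ^ (9 / 10 : ℝ) ≤ fl T (1 - ε) := by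
    refine le_trans ?_ (fl_ge (Real.one_le_rpow hT1' (by linarith)))
    rw [le_div_iff₀ two_pos]
    calc (T:ℝ) ^ (9 / 10 : ℝ) * 2 ≤ (T:ℝ) ^ (9 / 10 : ℝ) * (T:ℝ) ^ (1 / 20 : ℝ) := by gcongr
      _ ≤ _ := by rw [← Real.rpow_add hT0]; exact mono (by linarith)
  have hYu : (fl T (1 - ε) : ℝ) ≤ (T:ℝ) ^ (1 - ε) := fl_le
  set Y := fl T (1 - ε)
  have hsplit : ∀ u v : ℝ, (T:ℝ) ^ (u + v) = (T:ℝ) ^ u * (T:ℝ) ^ v := fun u v => Real.rpow_add hT0 u v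
  have key := hκ k W J M b c p 9 Y θ ((T:ℝ) ^ (-σ)) ((K * T : ℕ):ℤ) T hW hM
    (fun l hl hlF => by by_contra! h; exact gW k hl hlF (hM2 l hl h)) hF hbc hp hpF hpF2
    (by
      have : (1:ℝ) ≤ Y := le_trans (Real.one_le_rpow hT1' (by norm_num)) hYl
      exact_mod_cast this) hpp (by
      have h1 : (k.F b c : ℝ) ^ 2 < (Y:ℝ) ^ (9 + 1) := by
        calc (k.F b c : ℝ) ^ 2 ≤ ((T:ℝ) ^ 4) ^ 2 := by gcongr
          _ < (T:ℝ) ^ 9 := by rw [← pow_mul]; exact pow_lt_pow_right₀ (by exact_mod_cast (by omega : 1 < T)) (by norm_num)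
          _ = ((T:ℝ) ^ (9 / 10 : ℝ)) ^ (9 + 1) := by
            rw [← Real.rpow_natCast, ← Real.rpow_natCast, ← Real.rpow_mul hT0.le]; norm_num
          _ ≤ _ := by gcongr
      exact_mod_cast h1) (by
      have : (z:ℝ) < p := hzu'.trans_lt ((mono (by linarith)).trans_lt hpl')
      exact_mod_cast this) hθ1 (by
      rw [div_le_iff₀ hp0]; push_cast
      have : (1000:ℝ) ≤ θ * p := by
        calc (1000:ℝ) ≤ (T:ℝ) ^ (ε / 8) := hT1
          _ ≤ (T:ℝ) ^ (-(η1 / 8)) * (T:ℝ) ^ (ε / 4) := by rw [← hsplit]; exact mono (by linarith)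
          _ ≤ _ := by gcongr
      linarith) (by positivity) (by
      rw [div_le_iff₀ hp0, ← Real.rpow_natCast, ← Real.rpow_mul hT0.le]
      calc 2 * (GB.CZ 9 0 : ℝ) ≤ (T:ℝ) ^ (ε / 8) := hTC
        _ = (T:ℝ) ^ (-σ * ((2 ^ (9 + 1) : ℕ):ℝ)) * (T:ℝ) ^ (ε / 4) := by
          rw [← hsplit]; congr 1; rw [hσ]; push_cast; ring
        _ ≤ _ := by gcongr)
  rw [← hz] at key
  refine le_trans ?_ key
  have hV := Vlow k hC0 hW hzW hM (b := b) (c := c) (le_trans (sum_le_sum_of_subset_of_nonneg (filter_subset_filter _ fun l hl => by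
    obtain ⟨⟨h1, h2⟩, h3⟩ := SV.mem_pr.1 hl
    exact SV.mem_pr.2 ⟨⟨h1, h2.trans (by exact_mod_cast hzT)⟩, h3⟩) fun _ _ _ => by positivity) hS)
  have m1 : c0 / 50 * θ * T / Real.log T ≤ T * (θ / 50) * ∏ l ∈ SV.pr W z, (1 - (nu k M b c l : ℝ) / l) := by
    have h1 : c0 / Real.log T ≤ c0 / Real.log z := by
      have : 0 < Real.log z := Real.log_pos (by exact_mod_cast (by omega : 1 < z))
      gcongr
    calc c0 / 50 * θ * T / Real.log T = T * (θ / 50) * (c0 / Real.log T) := by ring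
      _ ≤ _ := by gcongr; exact h1.trans hV
  have m2 : (J + 1) * ((T * (T:ℝ) ^ (-σ) + 2 * ((9:ℕ) + 1) * p * Y + 2) * (z:ℝ) ^ κ) ≤ 23 * (T:ℝ) ^ (1 - σ / 2) := by
    have h1 : (J:ℝ) + 1 ≤ z := by exact_mod_cast hJz
    have h2 : T * (T:ℝ) ^ (-σ) = (T:ℝ) ^ (1 - σ) := by rw [sub_eq_add_neg, hsplit, Real.rpow_one]
    have h3 : (p:ℝ) * Y ≤ (T:ℝ) ^ (1 - σ) := by
      calc (p:ℝ) * Y ≤ (T:ℝ) ^ (ε / 2) * (T:ℝ) ^ (1 - ε) := by gcongr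
        _ ≤ _ := by rw [← hsplit]; exact mono (by rw [hσ]; linarith)
    have h4 : 1 ≤ (T:ℝ) ^ (1 - σ) := Real.one_le_rpow hT1' (by rw [hσ]; linarith)
    have h5 : T * (T:ℝ) ^ (-σ) + 2 * ((9:ℕ) + 1) * p * Y + 2 ≤ 23 * (T:ℝ) ^ (1 - σ) := by
      rw [h2]; push_cast; linarith [show 2 * ((9:ℝ) + 1) * p * Y = 20 * (p * Y) by ring]
    have h6 : (z:ℝ) ^ (κ + 1) ≤ (T:ℝ) ^ (σ / 2) := by
      calc (z:ℝ) ^ (κ + 1) ≤ ((T:ℝ) ^ η1) ^ (κ + 1) := by gcongr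
        _ = _ := by rw [← Real.rpow_natCast, ← Real.rpow_mul hT0.le]; push_cast; rw [hησ]
    calc (J + 1) * ((T * (T:ℝ) ^ (-σ) + 2 * ((9:ℕ) + 1) * p * Y + 2) * (z:ℝ) ^ κ)
        ≤ z * (23 * (T:ℝ) ^ (1 - σ) * (z:ℝ) ^ κ) := by gcongr
      _ = 23 * (T:ℝ) ^ (1 - σ) * (z:ℝ) ^ (κ + 1) := by ring
      _ ≤ 23 * (T:ℝ) ^ (1 - σ) * (T:ℝ) ^ (σ / 2) := by gcongr
      _ = _ := by rw [mul_assoc, ← hsplit]; congr 2; ring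
  have m3 : (Nat.log 2 (k.F b c).natAbs:ℝ) * (T / z + 1) ≤ 16 * Real.log T * (T:ℝ) ^ (1 - η1 / 2) := by
    have h1 : (Nat.log 2 (k.F b c).natAbs : ℝ) ≤ 8 * Real.log T := by
      refine (Real.natLog_le_logb _ _).trans ?_
      have h2 : Real.log ((k.F b c).natAbs : ℝ) ≤ 4 * Real.log T := by
        have h3 : (((k.F b c).natAbs : ℕ) : ℝ) = k.F b c := by
          rw [Nat.cast_natAbs, abs_of_pos hF]
        rw [h3]
        refine (Real.log_le_log (by exact_mod_cast hF) hFT).trans ?_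
        rw [Real.log_pow]; norm_num
      rw [Real.logb, div_le_iff₀ (Real.log_pos (by norm_num))]
      have := Real.log_two_gt_d9
      push_cast
      nlinarith only [h2, this, hL1]
    have h2 : (T:ℝ) / z + 1 ≤ 2 * (T:ℝ) ^ (1 - η1 / 2) := by
      have h3 : (1:ℝ) ≤ T / z := by rwa [one_le_div hz0]
      have h4 : (T:ℝ) / z ≤ (T:ℝ) ^ (1 - η1 / 2) := by
        rw [Real.rpow_sub hT0, Real.rpow_one]; gcongr
      linarith
    calc _ ≤ 8 * Real.log T * (2 * (T:ℝ) ^ (1 - η1 / 2)) := by gcongr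
      _ = _ := by ring
  have m4 : 39 * Real.log T * (T:ℝ) ^ (1 - η1 / 2) ≤ c0 / 100 * θ * T / Real.log T := by
    rw [le_div_iff₀ (by linarith)]
    have h1 : 10000 * Real.log T ^ 2 ≤ c0 * (T:ℝ) ^ (η1 / 4) := by
      rw [zero_add, one_mul, div_mul_eq_mul_div, div_le_iff₀ hc00] at hTp; linarith
    calc 39 * Real.log T * (T:ℝ) ^ (1 - η1 / 2) * Real.log T = (39 * Real.log T ^ 2) * (T:ℝ) ^ (1 - η1 / 2) := by ring
      _ ≤ (c0 / 100 * (T:ℝ) ^ (η1 / 4)) * (T:ℝ) ^ (1 - η1 / 2) := by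
        refine mul_le_mul_of_nonneg_right ?_ (by positivity); linarith [sq_nonneg (Real.log T)]
      _ = c0 / 100 * ((T:ℝ) ^ (-(η1 / 4)) * T) := by
        rw [mul_assoc, ← hsplit]; nth_rw 3 [← Real.rpow_one (T:ℝ)]; rw [← hsplit]; congr 2; ring
      _ ≤ c0 / 100 * (θ * T) := by gcongr; exact (mono (by linarith)).trans hθ
      _ = _ := by ring
  have m5 : (T:ℝ) ^ (1 - σ / 2) ≤ Real.log T * (T:ℝ) ^ (1 - η1 / 2) := by
    have h1 : (T:ℝ) ^ (1 - σ / 2) ≤ (T:ℝ) ^ (1 - η1 / 2) := mono (by linarith)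
    exact h1.trans (le_mul_of_one_le_left (by positivity) hL1)
  have e : c0 / 100 * θ * T / Real.log T + c0 / 100 * θ * T / Real.log T = c0 / 50 * θ * T / Real.log T := by ring
  refine le_trans ?_ (sub_le_sub (sub_le_sub m1 m2) m3)
  rw [← e]
  linarith only [m4, m5]
end LV

set_option linter.unusedSectionVars false
namespace LV
open Finset Filter Topology
lemma ba {x y X Y : ℤ} (h : |x| ≤ X) (h' : |y| ≤ Y) : |x + y| ≤ X + Y := (abs_add_le _ _).trans (add_le_add h h')
lemma bs {x y X Y : ℤ} (h : |x| ≤ X) (h' : |y| ≤ Y) : |x - y| ≤ X + Y := (abs_sub _ _).trans (add_le_add h h')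
lemma bn {x X : ℤ} (h : |x| ≤ X) : |-x| ≤ X := by rwa [abs_neg]
lemma bm {x y X Y : ℤ} (h : |x| ≤ X) (h' : |y| ≤ Y) : |x * y| ≤ X * Y := by
  rw [abs_mul]; exact mul_le_mul h h' (abs_nonneg _) ((abs_nonneg _).trans h)
lemma bp {x X : ℤ} (n : ℕ) (h : |x| ≤ X) : |x ^ n| ≤ X ^ n := by
  rw [abs_pow]; exact pow_le_pow_left₀ (abs_nonneg _) h n
lemma SS_bd (k : Cub) : |k.c0| ≤ SS k ∧ |k.c1| ≤ SS k ∧ |k.c2| ≤ SS k ∧ (1:ℤ) ≤ SS k := by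
  unfold SS; simp only [Int.abs_eq_natAbs]; omega
lemma q_bd (k : Cub) {a b c A β : ℤ} (ha : |a| ≤ A) (hb : |b| ≤ β) (hc : |c| ≤ β) (hβ : β ≤ A) :
    |k.q a b c - a ^ 3| ≤ 17 * SS k ^ 3 * A ^ 2 * β := by
  obtain ⟨h0, h1, h2, hs⟩ := SS_bd k
  generalize (SS k : ℤ) = s at *
  have e : k.q a b c - a ^ 3 = a ^ 2 * (-b * k.c2 - 2 * c * k.c1)
    + a * (b ^ 2 * k.c1 + 3 * b * c * k.c0 + b * c * k.c1 * k.c2 + c ^ 2 * k.c0 * k.c2 + c ^ 2 * k.c1 ^ 2)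
    + (- b ^ 3 * k.c0 - 2 * b ^ 2 * c * k.c0 * k.c2 - b * c ^ 2 * k.c0 * k.c1
    - b * c ^ 2 * k.c0 * k.c2 ^ 2 + c ^ 3 * k.c0 ^ 2 - c ^ 3 * k.c0 * k.c1 * k.c2) := by unfold Cub.q; ring
  have n2 : |(2:ℤ)| ≤ 2 := by norm_num
  have n3 : |(3:ℤ)| ≤ 3 := by norm_num
  have h : |k.q a b c - a ^ 3| ≤ A ^ 2 * (β * s + 2 * β * s) + A * (β ^ 2 * s + 3 * β * β * s + β * β * s * s + β ^ 2 * s * s + β ^ 2 * s ^ 2)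
    + (β ^ 3 * s + 2 * β ^ 2 * β * s * s + β * β ^ 2 * s * s + β * β ^ 2 * s * s ^ 2 + β ^ 3 * s ^ 2 + β ^ 3 * s * s * s) := by
    rw [e]
    with_reducible (repeat' first | assumption | apply ba | apply bs | apply bm | apply bp | apply bn)
  have hβ0 : 0 ≤ β := (abs_nonneg _).trans hb
  have hA0 : 0 ≤ A := hβ0.trans hβ
  have t1 : A * β ^ 2 ≤ A ^ 2 * β := by nlinarith [mul_nonneg hA0 hβ0]
  have t2 : β ^ 3 ≤ A ^ 2 * β := by nlinarith [mul_nonneg hA0 hβ0, mul_nonneg hβ0 hβ0]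
  have s1 : s ≤ s ^ 3 := le_self_pow₀ hs (by norm_num)
  have s2 : s ^ 2 ≤ s ^ 3 := pow_le_pow_right₀ hs (by norm_num)
  have hX : 0 ≤ A ^ 2 * β := by positivity
  calc _ ≤ _ := h
    _ = A ^ 2 * β * (3 * s) + A * β ^ 2 * (4 * s + 3 * s ^ 2) + β ^ 3 * (s + 4 * s ^ 2 + 2 * s ^ 3) := by ring
    _ ≤ A ^ 2 * β * (3 * s) + A ^ 2 * β * (4 * s + 3 * s ^ 2) + A ^ 2 * β * (s + 4 * s ^ 2 + 2 * s ^ 3) := by gcongr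
    _ = A ^ 2 * β * (8 * s + 7 * s ^ 2 + 2 * s ^ 3) := by ring
    _ ≤ A ^ 2 * β * (17 * s ^ 3) := by gcongr; linarith
    _ = _ := by ring
lemma e_bd (k : Cub) {a b c A : ℤ} (ha : |a| ≤ A) (hb : |b| ≤ A) (hc : |c| ≤ A) : |k.e a b c| ≤ 12 * SS k ^ 2 * A ^ 3 := by
  obtain ⟨h0, h1, h2, hs⟩ := SS_bd k
  generalize (SS k : ℤ) = s at *
  have n2 : |(2:ℤ)| ≤ 2 := by norm_num
  have h : |k.e a b c| ≤ A * (A * A + A ^ 2 + s * A * A + s * A ^ 2) + (2 * A + s * A) * (A * A + s * A ^ 2) := by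
    unfold Cub.e Cub.Cc Cub.B
    with_reducible (repeat' first | assumption | apply ba | apply bs | apply bm | apply bp | apply bn)
  have hA0 : 0 ≤ A := (abs_nonneg _).trans hb
  calc _ ≤ _ := h
    _ = A ^ 3 * (4 + 5 * s + s ^ 2) := by ring
    _ ≤ A ^ 3 * (12 * s ^ 2) := by gcongr; nlinarith
    _ = _ := by ring
def KK1 (k : Cub) : ℕ := 6 * SS k
def KK (k : Cub) : ℕ := 17000 * SS k ^ 3 * (KK1 k + 2)
set_option maxHeartbeats 2000000 in
lemma sz (k : Cub) {M T : ℕ} (hM : 1 ≤ M) (hT : 1 ≤ T) {x : ℕ × ℕ} (hx : x ∈ bx T) :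
    0 < k.F (bb M ((KK1 k * T : ℕ):ℤ) x) (cc M x) ∧ ∀ t : ℕ, t < T →
      99 * ((KK k * M * T : ℕ):ℤ) ^ 3 ≤ 100 * k.q (M * (((KK k * T : ℕ):ℤ) + t)) (bb M ((KK1 k * T : ℕ):ℤ) x) (cc M x) ∧
      100 * k.q (M * (((KK k * T : ℕ):ℤ) + t)) (bb M ((KK1 k * T : ℕ):ℤ) x) (cc M x) ≤ 103 * ((KK k * M * T : ℕ):ℤ) ^ 3 ∧
      |k.e (M * (((KK k * T : ℕ):ℤ) + t)) (bb M ((KK1 k * T : ℕ):ℤ) x) (cc M x)| ≤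
        24 * SS k ^ 2 * (KK k + 1) ^ 3 * k.F (bb M ((KK1 k * T : ℕ):ℤ) x) (cc M x) := by
  obtain ⟨h0, h1, h2, hs⟩ := SS_bd k
  obtain ⟨hx1, hx2⟩ := mem_product.1 hx
  rw [mem_range] at hx1 hx2
  have hK1 : (KK1 k : ℤ) = 6 * SS k := by unfold KK1; push_cast; ring
  have hK : (KK k : ℤ) = 17000 * SS k ^ 3 * (KK1 k + 2) := by unfold KK; push_cast; ring
  have hs3 : (1:ℤ) ≤ SS k ^ 3 := one_le_pow₀ hs
  set N : ℤ := M * T with hN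
  have hM' : (1:ℤ) ≤ M := by exact_mod_cast hM
  have hT' : (1:ℤ) ≤ T := by exact_mod_cast hT
  have hN1 : 1 ≤ N := one_le_mul_of_one_le_of_one_le hM' hT'
  have hMN : (M:ℤ) ≤ N := le_mul_of_one_le_right (by positivity) hT'
  have hc1 : 0 < cc M x := by unfold cc; positivity
  have hc2 : cc M x ≤ N := by unfold cc; rw [hN]; gcongr; exact_mod_cast (by omega : 1 + x.2 ≤ T)
  have hb1 : KK1 k * N ≤ bb M ((KK1 k * T : ℕ):ℤ) x := by
    unfold bb; rw [hN]; push_cast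
    have : (0:ℤ) ≤ M * x.1 := by positivity
    linarith
  have hb2 : bb M ((KK1 k * T : ℕ):ℤ) x ≤ (KK1 k + 2) * N := by
    unfold bb; push_cast
    have : (M:ℤ) * x.1 ≤ N := by rw [hN]; gcongr
    rw [hN] at *; linarith
  set b := bb M ((KK1 k * T : ℕ):ℤ) x
  set c := cc M x
  clear_value N b c
  have hNb : N ≤ b := (le_mul_of_one_le_left (by linarith) (by linarith)).trans hb1
  have hF : b ^ 3 ≤ 2 * k.F b c := by
    have e : k.F b c = b ^ 3 + c * (k.c2 * b ^ 2 + k.c1 * b * c + k.c0 * c ^ 2) := by unfold Cub.F; ring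
    have hb : |b| ≤ b := (abs_of_nonneg (by linarith)).le
    have hc : |c| ≤ N := by rwa [abs_of_pos hc1]
    have h3 : |c * (k.c2 * b ^ 2 + k.c1 * b * c + k.c0 * c ^ 2)| ≤ N * (SS k * b ^ 2 + SS k * b * N + SS k * N ^ 2) := by
      with_reducible (repeat' first | assumption | apply ba | apply bs | apply bm | apply bp | apply bn)
    have h4 : (SS k : ℤ) * b * N ≤ SS k * b ^ 2 := by
      rw [sq, ← mul_assoc]; exact mul_le_mul_of_nonneg_left hNb (mul_nonneg (by positivity) (hN1.trans hNb |>.trans' zero_le_one))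
    have h5 : (SS k : ℤ) * N ^ 2 ≤ SS k * b ^ 2 := by gcongr
    have h6 : N * (SS k * b ^ 2 + SS k * b * N + SS k * N ^ 2) ≤ N * (3 * SS k * b ^ 2) := by gcongr; linarith
    have h7 : 2 * (N * (3 * SS k * b ^ 2)) ≤ b ^ 3 := by
      rw [hK1] at hb1
      linarith [mul_le_mul_of_nonneg_right hb1 (sq_nonneg b)]
    have := (abs_le.1 h3).1
    linarith
  have hN3 : N ^ 3 ≤ b ^ 3 := by gcongr
  have hN30 : 0 < N ^ 3 := by positivity
  refine ⟨by linarith, fun t ht => ?_⟩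
  set K : ℤ := ((KK k : ℕ) : ℤ)
  have hKl : 51000 * SS k ^ 3 ≤ K := by
    rw [hK, hK1]; linarith [le_mul_of_one_le_right (by linarith : (0:ℤ) ≤ SS k ^ 3) hs]
  have ha1 : K * N ≤ M * (((KK k * T : ℕ):ℤ) + t) := by
    rw [hN]; push_cast; have : (0:ℤ) ≤ M * t := by positivity
    linarith
  have ha2 : M * (((KK k * T : ℕ):ℤ) + t) ≤ (K + 1) * N := by
    have : (M:ℤ) * t ≤ N := by rw [hN]; gcongr
    rw [hN] at *; push_cast; linarith
  have hQ : ((KK k * M * T : ℕ):ℤ) = K * N := by rw [hN]; push_cast; ring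
  rw [hQ]
  set a := M * (((KK k * T : ℕ):ℤ) + t)
  clear_value K a
  have hK0 : 0 < K := by linarith
  have hKN0 : 0 < K * N := by positivity
  have hβ' : (KK1 k : ℤ) + 2 ≤ K := by rw [hK]; exact le_mul_of_one_le_left (by positivity) (by linarith)
  have hβK : (KK1 k + 2) * N ≤ K * N := by gcongr
  have ha0 : 0 ≤ a := hKN0.le.trans ha1
  have haa : |a| ≤ a := (abs_of_nonneg ha0).le
  have hbb : |b| ≤ (KK1 k + 2) * N := by rwa [abs_of_nonneg (by linarith)]
  have hcc : |c| ≤ (KK1 k + 2) * N := by rw [abs_of_pos hc1]; linarith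
  have h3 := q_bd k haa hbb hcc (hβK.trans ha1)
  have h4 : 1000 * (17 * SS k ^ 3 * a ^ 2 * ((KK1 k + 2) * N)) ≤ a ^ 3 := by
    calc 1000 * (17 * SS k ^ 3 * a ^ 2 * ((KK1 k + 2) * N)) = a ^ 2 * (K * N) := by rw [hK]; ring
      _ ≤ a ^ 2 * a := by gcongr
      _ = a ^ 3 := by ring
  have h5 : (K * N) ^ 3 ≤ a ^ 3 := by gcongr
  have h6 : a ^ 3 ≤ ((K + 1) * N) ^ 3 := by gcongr
  have h7 : 1000 * ((K + 1) * N) ^ 3 ≤ 1010 * (K * N) ^ 3 := by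
    rw [mul_pow, mul_pow, ← mul_assoc, ← mul_assoc]
    have hK5 : 51000 ≤ K := by linarith
    gcongr ?_ * N ^ 3
    have p := mul_le_mul_of_nonneg_right hK5 (sq_nonneg K)
    have p' := mul_le_mul_of_nonneg_right hK5 hK0.le
    linarith
  obtain ⟨h8, h9⟩ := abs_le.1 h3
  have hq0 : 0 ≤ (K * N) ^ 3 := by positivity
  refine ⟨by linarith, by linarith, ?_⟩
  have hKN : 0 ≤ (K + 1) * N := by positivity
  have h10 := e_bd k (a := a) (b := b) (c := c) (A := (K + 1) * N) (by rw [abs_of_nonneg ha0]; exact ha2)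
    (hbb.trans (by linarith)) (hcc.trans (by linarith))
  refine h10.trans ?_
  rw [mul_pow]
  calc 12 * (SS k : ℤ) ^ 2 * ((K + 1) ^ 3 * N ^ 3) = 12 * (SS k : ℤ) ^ 2 * (K + 1) ^ 3 * N ^ 3 := by ring
    _ ≤ 12 * (SS k : ℤ) ^ 2 * (K + 1) ^ 3 * (2 * k.F b c) := by gcongr; linarith
    _ = _ := by ring
lemma sz2 (k : Cub) {M T : ℕ} (hM : 1 ≤ M) (hT : 1 ≤ T) {a b c : ℤ} (ha : |a| ≤ (M * T : ℕ)) (hb : |b| ≤ (M * T : ℕ)) (hc : |c| ≤ (M * T : ℕ)) :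
    100 * |k.q a b c| < 99 * ((KK k * M * T : ℕ):ℤ) ^ 3 := by
  obtain ⟨h0, h1, h2, hs⟩ := SS_bd k
  have h := q_bd k ha hb hc le_rfl
  set N : ℤ := ((M * T : ℕ):ℤ) with hN
  have hN1 : 1 ≤ N := by rw [hN]; exact_mod_cast Nat.mul_pos hM hT
  have h3 : |a ^ 3| ≤ N ^ 3 := bp 3 ha
  have h4 := abs_le.1 h
  have h5 : |k.q a b c| ≤ 18 * SS k ^ 3 * N ^ 3 := by
    have hs3 : (1:ℤ) ≤ SS k ^ 3 := one_le_pow₀ hs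
    have : N ^ 3 ≤ SS k ^ 3 * N ^ 3 := le_mul_of_one_le_left (by positivity) hs3
    have h6 := abs_le.1 h3
    rw [abs_le]; constructor <;> linarith
  have e : ((KK k * M * T : ℕ):ℤ) = KK k * N := by rw [hN]; push_cast; ring
  have hK : 100 * (SS k : ℤ) ≤ KK k := by
    unfold KK; push_cast
    have : (SS k : ℤ) ≤ SS k ^ 3 := le_self_pow₀ hs (by norm_num)
    nlinarith
  rw [e, mul_pow]
  have h6 : (100 * (SS k : ℤ)) ^ 3 ≤ (KK k : ℤ) ^ 3 := by gcongr
  have h7 : 0 < N ^ 3 := by positivity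
  have h8 : 0 < (SS k : ℤ) ^ 3 := by positivity
  nlinarith [mul_le_mul_of_nonneg_right h6 h7.le, mul_pos h8 h7]
end LV

namespace LV
open Finset Filter Topology
lemma mlt {m s : ℕ} {Z : ℝ} (hm : m ≠ 0) (hZ : 1 < Z) (h : (m:ℝ) < Z ^ (s + 1)) {S : Finset ℕ}
    (hS : ∀ d ∈ S, d ∣ m ∧ ∀ p : ℕ, p.Prime → p ∣ d → Z < p) : #S ≤ 2 ^ s := by
  classical
  set L : Multiset ℕ := (m.primeFactorsList : Multiset ℕ).filter (fun p => Z < p)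
  have h1 : S ⊆ (L.powerset.map Multiset.prod).toFinset := fun d hd => by
    obtain ⟨h1, h2⟩ := hS d hd
    have hd0 : d ≠ 0 := ne_zero_of_dvd_ne_zero hm h1
    rw [Multiset.mem_toFinset, Multiset.mem_map]
    refine ⟨d.primeFactorsList, Multiset.mem_powerset.2 ?_, by rw [Multiset.prod_coe, Nat.prod_primeFactorsList hd0]⟩
    rw [← Multiset.filter_eq_self.2 (fun p hp => h2 p (Nat.prime_of_mem_primeFactorsList hp) (Nat.dvd_of_mem_primeFactorsList hp) :
      ∀ p ∈ (d.primeFactorsList : Multiset ℕ), Z < p)]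
    exact Multiset.filter_le_filter _ (Nat.primeFactorsList_sublist_of_dvd h1 hm).subperm
  have key : ∀ L : Multiset ℕ, (∀ p ∈ L, Z < p) → Z ^ L.card ≤ (L.prod : ℕ) := fun L => by
    induction L using Multiset.induction with
    | empty => simp
    | cons a L ih =>
      intro h
      rw [Multiset.card_cons, pow_succ', Multiset.prod_cons, Nat.cast_mul]
      exact mul_le_mul (h a (Multiset.mem_cons_self _ _)).le
        (ih fun p hp => h p (Multiset.mem_cons_of_mem hp)) (by positivity) (by positivity)
  have h2 : Z ^ L.card ≤ m := by
    have e : L.prod ≤ m := Nat.le_of_dvd hm.bot_lt (by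
      have := Multiset.prod_dvd_prod_of_le (Multiset.filter_le (fun p : ℕ => Z < p) (m.primeFactorsList : Multiset ℕ))
      rwa [Multiset.prod_coe, Nat.prod_primeFactorsList hm] at this)
    refine le_trans ?_ (Nat.cast_le.2 e)
    exact key L fun p hp => (Multiset.mem_filter.1 hp).2
  have h3 : L.card ≤ s := Nat.lt_succ_iff.1 ((pow_lt_pow_iff_right₀ hZ).1 (h2.trans_lt h))
  calc #S ≤ _ := card_le_card h1
    _ ≤ _ := Multiset.toFinset_card_le _
    _ = 2 ^ L.card := by rw [Multiset.card_map, Multiset.card_powerset]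
    _ ≤ _ := Nat.pow_le_pow_right (by norm_num) h3
def qq (k : Cub) (M T : ℕ) (x : ℕ × ℕ) (t : ℕ) : ℤ :=
  k.q (M * (((KK k * T : ℕ):ℤ) + t)) (bb M ((KK1 k * T : ℕ):ℤ) x) (cc M x)
def al (k : Cub) (M T : ℕ) (x : ℕ × ℕ) (t : ℕ) (n : ℤ) : ℤ :=
  M * (((KK k * T : ℕ):ℤ) + t) + (bb M ((KK1 k * T : ℕ):ℤ) x + k.c2 * cc M x) * n + cc M x * n ^ 2
lemma uq (k : Cub) (hk : k.Good) {M T : ℕ} (hM : 1 ≤ M) (hT : 1 ≤ T) {x y : ℕ × ℕ} {t s : ℕ} {n : ℤ} (hx : x ∈ bx T) (hy : y ∈ bx T)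
    (ht : t < T) (hs : s < T) (h : qq k M T x t ∣ k.f n) (h1 : qq k M T x t ∣ al k M T x t n) (h2 : qq k M T x t ∣ al k M T y s n) :
    x = y ∧ t = s := by
  have h3 := k.q_dvd_sub h h1 h2
  have hM' : (0:ℤ) < M := by exact_mod_cast hM
  have e : ∀ {u v : ℕ}, u < T → v < T → |(M:ℤ) * ((u:ℤ) - v)| ≤ (M * T : ℕ) := fun {u v} hu hv => by
    rw [abs_mul, abs_of_pos hM']; push_cast; gcongr; rw [abs_le]; omega
  obtain ⟨hx1, hx2⟩ := mem_product.1 hx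
  obtain ⟨hy1, hy2⟩ := mem_product.1 hy
  rw [mem_range] at *
  have ea : (M:ℤ) * (((KK k * T : ℕ):ℤ) + t) - M * (((KK k * T : ℕ):ℤ) + s) = M * ((t:ℤ) - s) := by ring
  have eb : bb M ((KK1 k * T : ℕ):ℤ) x - bb M ((KK1 k * T : ℕ):ℤ) y = M * ((x.1:ℤ) - y.1) := by unfold bb; ring
  have ec : cc M x - cc M y = M * ((x.2:ℤ) - y.2) := by unfold cc; ring
  rw [ea, eb, ec] at h3
  have h4 := sz2 k hM hT (e ht hs) (e hx1 hy1) (e hx2 hy2)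
  have h5 := ((sz k hM hT hx).2 t ht).1
  have h6 := k.q_eq_zero hk (Int.eq_zero_of_abs_lt_dvd h3 (by unfold qq; linarith))
  simp only [mul_eq_zero, hM'.ne', false_or] at h6
  exact ⟨Prod.ext (by omega) (by omega), by omega⟩
lemma uq2 (k : Cub) {M i j : ℕ} (hM : 1 ≤ M) {x y : ℕ × ℕ} {t s : ℕ} (hx : x ∈ bx (2 ^ i)) (hy : y ∈ bx (2 ^ j))
    (ht : t < 2 ^ i) (hs : s < 2 ^ j) (h : qq k M (2 ^ i) x t = qq k M (2 ^ j) y s) : j ≤ i := by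
  by_contra! hij
  have h1 := ((sz k hM Nat.one_le_two_pow hx).2 t ht).2.1
  have h2 := ((sz k hM Nat.one_le_two_pow hy).2 s hs).1
  unfold qq at h
  have h3 : ((KK k * M * 2 ^ j : ℕ) : ℤ) ^ 3 ≥ (2 * (KK k * M * 2 ^ i : ℕ) : ℤ) ^ 3 := by
    have : 2 * (KK k * M * 2 ^ i) ≤ KK k * M * 2 ^ j := by
      calc _ = KK k * M * 2 ^ (i + 1) := by ring
        _ ≤ _ := by gcongr <;> omega
    gcongr; exact_mod_cast this
  have h4 : (0:ℤ) < ((KK k * M * 2 ^ i : ℕ):ℤ) ^ 3 := by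
    have : 0 < SS k := by unfold SS; omega
    have : 0 < KK k := by unfold KK; positivity
    positivity
  rw [mul_pow] at h3
  linarith
lemma tri (k : Cub) {W M T z t : ℕ} {θ X : ℝ} {x : ℕ × ℕ} (h0 : k.c0 ≠ 0) (hM : M = W.factorial * k.c0.natAbs) (hT : 1 ≤ T) (hx : x ∈ bx T)
    (ht : t ∈ GS k M (bb M ((KK1 k * T : ℕ):ℤ) x) (cc M x) W z θ ((KK k * T : ℕ):ℤ) T)
    (hX : X = θ * ((KK k * M * T : ℕ):ℝ) ^ 3) (hX1 : 2400 * (SS k : ℝ) ^ 2 * (KK k + 1) ^ 3 ≤ X) :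
    ∃ (n : ℤ) (d : ℕ), (X < n ∧ n ≤ 2 * X) ∧ qq k M T x t ∣ k.f n ∧ qq k M T x t ∣ al k M T x t n ∧ qq k M T x t = k.c0.natAbs * d ∧
      ∀ P : ℕ, P.Prime → P ∣ d → W < P ∧ z < P := by
  unfold qq al
  classical
  have hM1 : 1 ≤ M := by rw [hM]; exact Nat.mul_pos (Nat.factorial_pos _) (Int.natAbs_pos.2 h0)
  obtain ⟨ht, hg, hC, R, hR, hR1, hR2⟩ := mem_filter.1 ht
  obtain ⟨hF, hs⟩ := sz k hM1 hT hx
  obtain ⟨q1, q2, he⟩ := hs t (mem_range.1 ht)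
  have hma : (M:ℤ) ∣ M * (((KK k * T : ℕ):ℤ) + t) := dvd_mul_right _ _
  have hmb : (M:ℤ) ∣ bb M ((KK1 k * T : ℕ):ℤ) x - 1 := by simp [bb]
  have hmc : (M:ℤ) ∣ cc M x := dvd_mul_right _ _
  have hS1 : (1:ℝ) ≤ SS k := by exact_mod_cast (SS_bd k).2.2.2
  have hQ0 : (0:ℝ) < ((KK k * M * T : ℕ):ℝ) ^ 3 := by
    have : 0 < KK k * M * T := by
      have : 0 < SS k := by exact_mod_cast hS1
      unfold KK; positivity
    positivity
  generalize (M:ℤ) * (((KK k * T : ℕ):ℤ) + t) = a at *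
  generalize bb M ((KK1 k * T : ℕ):ℤ) x = b at *
  generalize cc M x = c at *
  obtain ⟨n, hn, n1, n2⟩ := Cub.exists_n k hF.ne' hC hR
  have hq0 : 0 < k.q a b c := by
    have : (0:ℤ) < ((KK k * M * T : ℕ):ℤ) ^ 3 := by exact_mod_cast hQ0
    linarith
  have hd : (M:ℤ) ∣ k.q a b c + k.c0 := by
    have : k.q a b c + k.c0 = a * (a ^ 2 + a * (-b * k.c2 - 2 * c * k.c1) + (b ^ 2 * k.c1 + 3 * b * c * k.c0 + b * c * k.c1 * k.c2 + c ^ 2 * k.c0 * k.c2 + c ^ 2 * k.c1 ^ 2))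
      + c * (- 2 * b ^ 2 * k.c0 * k.c2 - b * c * k.c0 * k.c1 - b * c * k.c0 * k.c2 ^ 2 + c ^ 2 * k.c0 ^ 2 - c ^ 2 * k.c0 * k.c1 * k.c2)
      + (b - 1) * (- k.c0 * (b ^ 2 + b + 1)) := by unfold Cub.q; ring
    rw [this]
    exact dvd_add (dvd_add (hma.mul_right _) (hmc.mul_right _)) (hmb.mul_right _)
  have hd2 : k.c0 * W.factorial ∣ k.q a b c + k.c0 := by
    refine dvd_trans ?_ hd
    rw [hM, mul_comm]; push_cast
    exact mul_dvd_mul_left _ (by simp)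
  obtain ⟨m, hm⟩ : k.c0 ∣ k.q a b c := (dvd_add_left dvd_rfl).1 ((dvd_mul_right _ _).trans hd2)
  have hd3 : (W.factorial : ℤ) ∣ m + 1 := by
    rw [hm, ← mul_add_one] at hd2
    exact (mul_dvd_mul_iff_left h0).1 hd2
  refine ⟨n, m.natAbs, ⟨?_, ?_⟩, n1, n2, by rw [← Nat.cast_mul, ← Int.natAbs_mul, ← hm, Int.natAbs_of_nonneg hq0.le], fun P hP hPd => ?_⟩
  rotate_right
  · have hPm : (P:ℤ) ∣ m := Int.natCast_dvd.2 hPd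
    have hW : W < P := by
      by_contra! h
      have h2 : (P:ℤ) ∣ W.factorial := by exact_mod_cast (Nat.Prime.dvd_factorial hP).2 h
      have h3 := (dvd_add_right hPm).1 (h2.trans hd3)
      exact hP.one_lt.ne' (by exact_mod_cast Int.eq_one_of_dvd_one (by positivity) h3)
    refine ⟨hW, ?_⟩
    by_contra! h
    exact hg P hP hW h (hm ▸ hPm.mul_left _)
  all_goals
    have hF' : (0:ℝ) < k.F b c := by exact_mod_cast hF
    have hn' : (n:ℝ) = (R:ℝ) / k.F b c * k.q a b c + k.e a b c / k.F b c := by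
      field_simp; exact_mod_cast (by rw [mul_comm]; exact hn)
    have he' : |(k.e a b c : ℝ) / k.F b c| ≤ X / 100 := by
      rw [abs_div, abs_of_pos hF', div_le_iff₀ hF']
      have : (|k.e a b c| : ℝ) ≤ 24 * SS k ^ 2 * (KK k + 1) ^ 3 * k.F b c := by exact_mod_cast he
      refine this.trans ?_; gcongr; linarith
    have q1' : 99 * ((KK k * M * T : ℕ):ℝ) ^ 3 ≤ 100 * k.q a b c := by exact_mod_cast q1
    have q2' : 100 * (k.q a b c : ℝ) ≤ 103 * ((KK k * M * T : ℕ):ℝ) ^ 3 := by exact_mod_cast q2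
    have hX0 : 0 < X := lt_of_lt_of_le (by positivity) hX1
    have hθ : 0 < θ := by rw [hX] at hX0; exact (pos_iff_pos_of_mul_pos hX0).2 hQ0
    have hqr : (0:ℝ) < k.q a b c := by exact_mod_cast hq0
    have m1 := mul_le_mul_of_nonneg_right hR1 hqr.le
    have m2 := mul_le_mul_of_nonneg_right hR2 hqr.le
    have m3 := mul_le_mul_of_nonneg_left q1' hθ.le
    have m4 := mul_le_mul_of_nonneg_left q2' hθ.le
    have := abs_le.1 he'
    rw [hn']
    nlinarith
end LV

namespace LV
open Finset Filter Topology
lemma f_bd (k : Cub) {n : ℤ} {Y : ℝ} (hY : 1 ≤ Y) (hn : |(n:ℝ)| ≤ Y) : ((k.f n).natAbs : ℝ) ≤ SS k * Y ^ 3 := by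
  rw [Nat.cast_natAbs, Int.cast_abs]
  have e : (SS k : ℝ) = 1 + |(k.c0:ℝ)| + |(k.c1:ℝ)| + |(k.c2:ℝ)| := by unfold SS; push_cast [Nat.cast_natAbs]; ring
  have h1 : Y ≤ Y ^ 3 := le_self_pow₀ hY (by norm_num)
  have h2 : Y ^ 2 ≤ Y ^ 3 := pow_le_pow_right₀ hY (by norm_num)
  unfold Cub.f; push_cast
  calc _ ≤ |(n:ℝ)| ^ 3 + |(k.c2:ℝ)| * |(n:ℝ)| ^ 2 + |(k.c1:ℝ)| * |(n:ℝ)| + |(k.c0:ℝ)| := by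
        simp only [← abs_pow, ← abs_mul]
        exact (abs_add_le _ _).trans (add_le_add_left ((abs_add_le _ _).trans (add_le_add_left (abs_add_le _ _) _)) _)
    _ ≤ Y ^ 3 + |(k.c2:ℝ)| * Y ^ 3 + |(k.c1:ℝ)| * Y ^ 3 + |(k.c0:ℝ)| * Y ^ 3 := by
        gcongr
        · exact (pow_le_pow_left₀ (abs_nonneg _) hn 2).trans h2
        · exact hn.trans h1
        · exact le_mul_of_one_le_right (abs_nonneg _) (hY.trans h1)
    _ = _ := by rw [e]; ring
noncomputable def gs (k : Cub) (M W : ℕ) (X : ℝ) (z j : ℕ) (x : ℕ × ℕ) : Finset ℕ := GS k M (bb M ((KK1 k * 2 ^ j : ℕ):ℤ) x) (cc M x) W z (X / (((KK k * M * 2 ^ j : ℕ):ℝ)) ^ 3) ((KK k * 2 ^ j : ℕ):ℤ) (2 ^ j)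
open Classical in
lemma big (k : Cub) (hk : k.Good) (h0 : k.c0 ≠ 0) {W M : ℕ} (hM : M = W.factorial * k.c0.natAbs) {η cV κ : ℝ} (hη : 0 < η) (hcV : 0 < cV) (hκ : 0 < κ)
    (hT : ∀ᶠ T : ℕ in atTop, ∃ z : ℕ, (T:ℝ) ^ η ≤ z ∧ ∀ θ : ℝ, (T:ℝ) ^ (-η) ≤ θ → θ ≤ 1 → ∃ A ⊆ bx T, κ * (T:ℝ) ^ 2 ≤ #A ∧
      ∀ x ∈ A, cV * θ * T / Real.log T ≤ #(GS k M (bb M ((KK1 k * T : ℕ):ℤ) x) (cc M x) W z θ ((KK k * T : ℕ):ℤ) T)) :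
    ∃ κ0 : ℝ, 0 < κ0 ∧ ∃ δ : ℝ, 0 < δ ∧ ∀ᶠ X : ℝ in atTop, κ0 * X ≤ #((Ioc ⌊X⌋ ⌊2 * X⌋ : Finset ℤ).filter fun n =>
      ∃ d : ℕ, (d:ℤ) ∣ k.f n ∧ X ^ (1 + δ) ≤ d ∧ (d.Prime ∨ ∀ P : ℕ, P.Prime → P ∣ d → W < P ∧ (P:ℝ) ≤ X)) := by
  have hM1 : 1 ≤ M := by rw [hM]; exact Nat.mul_pos (Nat.factorial_pos _) (Int.natAbs_pos.2 h0)
  have hSS : 0 < SS k := by unfold SS; omega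
  have hKK : 2 ≤ KK k := by
    have := Nat.one_le_pow 3 _ hSS
    unfold KK; nlinarith [Nat.zero_le (KK1 k)]
  obtain ⟨δ, hδ, hδη, hδ1⟩ : ∃ δ : ℝ, 0 < δ ∧ 12 * δ ≤ η ∧ δ ≤ 1 :=
    ⟨min (η / 12) 1, by positivity, by linarith [min_le_left (η / 12) 1], min_le_right _ _⟩
  set G : ℝ := (((KK k * M : ℕ):ℝ)) ^ 3 with hG
  have hG2 : 2 * (k.c0.natAbs : ℝ) ≤ G := by
    have : 2 * k.c0.natAbs ≤ KK k * M := by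
      have : k.c0.natAbs ≤ M := hM ▸ Nat.le_mul_of_pos_left _ (Nat.factorial_pos _)
      exact Nat.mul_le_mul hKK this
    rw [hG]; exact_mod_cast this.trans (Nat.le_self_pow (n := 3) (by norm_num) _)
  have hc1 : (1:ℝ) ≤ k.c0.natAbs := by exact_mod_cast Int.natAbs_pos.2 h0
  have hG0 : 0 < G := by linarith
  obtain ⟨s, hs⟩ := exists_nat_gt (1 / δ)
  obtain ⟨T0, hT0⟩ := eventually_atTop.1 hT
  refine ⟨κ * cV * δ / (4 * G * 2 ^ s), by positivity, δ, hδ, ?_⟩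
  have t1 : Tendsto (fun X : ℝ => X ^ δ) atTop atTop := tendsto_rpow_atTop hδ
  have t2 : Tendsto (fun X : ℝ => X ^ (1/3:ℝ)) atTop atTop := tendsto_rpow_atTop (by norm_num)
  filter_upwards [t1.eventually_ge_atTop (2 * G), t2.eventually_ge_atTop (max T0 2), Real.tendsto_log_atTop.eventually_ge_atTop (10 / δ),
    eventually_ge_atTop (2400 * (SS k : ℝ) ^ 2 * (KK k + 1) ^ 3), eventually_gt_atTop 1, eventually_ge_atTop ((40 * SS k : ℝ))] with X hX1 hX2 hX3 hX4 hX5 hX6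
  have hX0 : 0 < X := by linarith
  set L := Real.log X with hL
  have l8 : 0 < Real.log 8 ∧ Real.log 8 < 2.1 := by
    rw [show (8:ℝ) = 2 ^ 3 by norm_num, Real.log_pow]
    have := Real.log_two_lt_d9; have := Real.log_two_gt_d9
    push_cast; constructor <;> linarith
  have hL0 : 0 < L := Real.log_pos hX5
  set J := Ioc ⌊(1 + δ) * L / Real.log 8⌋₊ ⌊(1 + 2 * δ) * L / Real.log 8⌋₊
  have hJ : ∀ j ∈ J, X ^ (1 + δ) ≤ (((2 ^ j : ℕ)):ℝ) ^ 3 ∧ (((2 ^ j : ℕ)):ℝ) ^ 3 ≤ X ^ (1 + 2 * δ) := fun j hj => by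
    obtain ⟨j1, j2⟩ := mem_Ioc.1 hj
    have e : (((2 ^ j : ℕ)):ℝ) ^ 3 = Real.exp (j * Real.log 8) := by
      rw [mul_comm, Real.exp_mul, Real.exp_log (by norm_num), Real.rpow_natCast]; push_cast; rw [← pow_mul, mul_comm, pow_mul]; norm_num
    have j1' := (Nat.floor_lt (by positivity)).1 j1
    have j2' := (Nat.le_floor_iff (by have := l8.1; positivity)).1 j2
    rw [div_lt_iff₀ l8.1] at j1'
    rw [le_div_iff₀ l8.1] at j2'
    rw [e, Real.rpow_def_of_pos hX0, Real.rpow_def_of_pos hX0]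
    constructor <;> rw [Real.exp_le_exp] <;> linarith
  have hJc : δ * L / 4 ≤ #J := by
    rw [Nat.card_Ioc]
    have h1 := Nat.floor_le (show 0 ≤ (1 + δ) * L / Real.log 8 by have := l8.1; positivity)
    have h2 := Nat.lt_floor_add_one ((1 + 2 * δ) * L / Real.log 8)
    have h3 : ((1 + 2 * δ) * L / Real.log 8) - (1 + δ) * L / Real.log 8 = δ * L / Real.log 8 := by ring
    have h4 : 10 ≤ δ * L := by rwa [div_le_iff₀' hδ] at hX3
    have h5 : δ * L / 2.1 ≤ δ * L / Real.log 8 := by gcongr <;> linarith [l8.1, l8.2]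
    have h7 : (⌊(1 + 2 * δ) * L / Real.log 8⌋₊ : ℝ) ≤ (⌊(1 + 2 * δ) * L / Real.log 8⌋₊ - ⌊(1 + δ) * L / Real.log 8⌋₊ : ℕ) + ⌊(1 + δ) * L / Real.log 8⌋₊ := by
      exact_mod_cast le_tsub_add
    norm_num at h5; linarith
  have hT1 : ∀ j ∈ J, X ^ (1/3:ℝ) ≤ ((2 ^ j : ℕ):ℝ) := fun j hj => by
    refine le_of_pow_le_pow_left₀ (n := 3) (by norm_num) (by positivity) (le_trans ?_ (hJ j hj).1)
    rw [← Real.rpow_mul_natCast hX0.le]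
    exact Real.rpow_le_rpow_of_exponent_le hX5.le (by push_cast; linarith)
  have hTη : ∀ j ∈ J, X ^ (4 * δ) ≤ ((2 ^ j : ℕ):ℝ) ^ η := fun j hj => by
    have h1 : (1:ℝ) ≤ ((2 ^ j : ℕ):ℝ) := by exact_mod_cast Nat.one_le_two_pow
    calc X ^ (4 * δ) = (X ^ (1/3:ℝ)) ^ (12 * δ) := by rw [← Real.rpow_mul hX0.le]; ring_nf
      _ ≤ ((2 ^ j : ℕ):ℝ) ^ (12 * δ) := Real.rpow_le_rpow (by positivity) (hT1 j hj) (by positivity)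
      _ ≤ _ := Real.rpow_le_rpow_of_exponent_le h1 hδη
  have hmain : ∀ j : ℕ, ∃ (z : ℕ) (A : Finset (ℕ × ℕ)), j ∈ J → X ^ (4 * δ) ≤ z ∧ A ⊆ bx (2 ^ j) ∧ κ * ((2 ^ j : ℕ):ℝ) ^ 2 ≤ #A ∧ ∀ x ∈ A,
      cV * (X / (((KK k * M * 2 ^ j : ℕ):ℝ)) ^ 3) * (2 ^ j : ℕ) / Real.log ((2 ^ j : ℕ):ℝ) ≤ #(gs k M W X z j x) := fun j => by
    by_cases hj : j ∈ J
    swap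
    · exact ⟨0, ∅, fun h => absurd h hj⟩
    have h1 := (le_max_left _ _).trans (hX2.trans (hT1 j hj))
    obtain ⟨z, hz, h⟩ := hT0 (2 ^ j) (by exact_mod_cast h1)
    have eG : (((KK k * M * 2 ^ j : ℕ):ℝ)) ^ 3 = G * ((2 ^ j : ℕ):ℝ) ^ 3 := by rw [hG]; push_cast; ring
    have hp : (0:ℝ) < ((2 ^ j : ℕ):ℝ) := by positivity
    obtain ⟨A, hA, hA1, hA2⟩ := h (X / (((KK k * M * 2 ^ j : ℕ):ℝ)) ^ 3) (by
      rw [eG, Real.rpow_neg hp.le, ← one_div, div_le_div_iff₀ (by positivity) (by positivity), one_mul]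
      calc G * ((2 ^ j : ℕ):ℝ) ^ 3 ≤ X ^ δ * X ^ (1 + 2 * δ) := by gcongr; linarith; exact (hJ j hj).2
        _ = X ^ (1 + 3 * δ) := by rw [← Real.rpow_add hX0]; ring_nf
        _ ≤ X ^ (1 + 4 * δ) := Real.rpow_le_rpow_of_exponent_le hX5.le (by linarith)
        _ = X * X ^ (4 * δ) := by rw [Real.rpow_add hX0, Real.rpow_one]
        _ ≤ _ := by gcongr; exact hTη j hj) (by
      rw [eG, div_le_one (by positivity)]
      calc X = X ^ (1:ℝ) := (Real.rpow_one X).symm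
        _ ≤ X ^ (1 + δ) := Real.rpow_le_rpow_of_exponent_le hX5.le (by linarith)
        _ ≤ _ := (hJ j hj).1
        _ ≤ _ := le_mul_of_one_le_left (by positivity) (by linarith))
    exact ⟨z, A, fun _ => ⟨(hTη j hj).trans hz, hA, hA1, hA2⟩⟩
  choose z A hA using hmain
  clear hT0 hT
  set P : Finset (Σ _ : ℕ, Σ _ : ℕ × ℕ, ℕ) := J.sigma fun j => (A j).sigma fun x => gs k M W X (z j) j x with hP
  have hPc : κ * cV * δ / (4 * G) * X ≤ #P := by
    rw [hP, card_sigma]; push_cast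
    have : ∀ j ∈ J, κ * cV / G * X / L ≤ #((A j).sigma fun x => gs k M W X (z j) j x) := fun j hj => by
      obtain ⟨-, -, h2, h3⟩ := hA j hj
      rw [card_sigma, Nat.cast_sum]
      have eG : (((KK k * M * 2 ^ j : ℕ):ℝ)) ^ 3 = G * ((2 ^ j : ℕ):ℝ) ^ 3 := by rw [hG]; push_cast; ring
      have hp : (2:ℝ) ≤ ((2 ^ j : ℕ):ℝ) := (le_max_right _ _).trans (hX2.trans (hT1 j hj))
      have hp' : ((2 ^ j : ℕ):ℝ) ≤ X := by
        refine le_of_pow_le_pow_left₀ (n := 3) (by norm_num) hX0.le ((hJ j hj).2.trans ?_)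
        rw [← Real.rpow_natCast]
        exact Real.rpow_le_rpow_of_exponent_le hX5.le (by push_cast; linarith)
      refine le_trans ?_ (card_nsmul_le_sum _ _ _ h3)
      rw [nsmul_eq_mul, eG]
      generalize ((2 ^ j : ℕ):ℝ) = T at *
      have hl : 0 < Real.log T := Real.log_pos (by linarith)
      have hl' : Real.log T ≤ L := Real.log_le_log (by linarith) hp'
      calc κ * cV / G * X / L ≤ κ * cV / G * X / Real.log T := by gcongr
        _ = κ * T ^ 2 * (cV * (X / (G * T ^ 3)) * T / Real.log T) := by field_simp
        _ ≤ _ := by gcongr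
    refine le_trans ?_ (card_nsmul_le_sum _ _ _ this)
    rw [nsmul_eq_mul]
    calc κ * cV * δ / (4 * G) * X = δ * L / 4 * (κ * cV / G * X / L) := by field_simp
      _ ≤ _ := by gcongr
  have hPm : ∀ p ∈ P, (p.1 ∈ J ∧ p.2.1 ∈ bx (2 ^ p.1) ∧ p.2.2 < 2 ^ p.1) ∧ X ^ (4 * δ) ≤ z p.1 ∧ p.2.2 ∈ gs k M W X (z p.1) p.1 p.2.1 := fun p hp => by
    obtain ⟨h1, h2⟩ := mem_sigma.1 hp
    obtain ⟨h2, h3⟩ := mem_sigma.1 h2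
    exact ⟨⟨h1, (hA _ h1).2.1 h2, mem_range.1 (mem_filter.1 h3).1⟩, (hA _ h1).1, h3⟩
  have hn : ∀ p ∈ P, ∃ (n : ℤ) (d : ℕ), _ := fun p hp => tri k h0 hM Nat.one_le_two_pow (hPm p hp).1.2.1 (hPm p hp).2.2
    (by rw [div_mul_cancel₀]; positivity) hX4
  choose! n d hnd using hn
  have hq : ∀ p ∈ P, ((2 ^ p.1 : ℕ):ℝ) ^ 3 ≤ d p ∧ (d p : ℝ) ≤ 1.03 * (G * ((2 ^ p.1 : ℕ):ℝ) ^ 3) := fun p hp => by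
    obtain ⟨-, -, -, h4, -⟩ := hnd p hp
    obtain ⟨g1, g2, -⟩ := (sz k hM1 Nat.one_le_two_pow (hPm p hp).1.2.1).2 _ (hPm p hp).1.2.2
    change _ ≤ 100 * qq k M (2 ^ p.1) p.2.1 p.2.2 at g1
    change 100 * qq k M (2 ^ p.1) p.2.1 p.2.2 ≤ _ at g2
    rw [h4] at g1 g2
    have eG : (((KK k * M * 2 ^ p.1 : ℕ):ℝ)) ^ 3 = G * ((2 ^ p.1 : ℕ):ℝ) ^ 3 := by rw [hG]; push_cast; ring
    have g1' : 99 * (((KK k * M * 2 ^ p.1 : ℕ):ℝ)) ^ 3 ≤ 100 * (k.c0.natAbs * d p) := by exact_mod_cast g1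
    have g2' : 100 * ((k.c0.natAbs:ℝ) * d p) ≤ 103 * (((KK k * M * 2 ^ p.1 : ℕ):ℝ)) ^ 3 := by exact_mod_cast g2
    rw [eG] at g1' g2'
    have hp3 : (0:ℝ) < ((2 ^ p.1 : ℕ):ℝ) ^ 3 := by positivity
    constructor
    · have := mul_le_mul_of_nonneg_right hG2 hp3.le
      refine le_of_mul_le_mul_left (a := (k.c0.natAbs : ℝ)) ?_ (by linarith)
      nlinarith
    · linarith [le_mul_of_one_le_left (Nat.cast_nonneg (α := ℝ) (d p)) hc1]
  have hZ1 : 1 < X ^ (4 * δ) := Real.one_lt_rpow hX5 (by positivity)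
  have h2 : ∀ m ∈ P.image n, #{p ∈ P | n p = m} ≤ 2 ^ s := fun m hm => by
    obtain ⟨p0, hp0, rfl⟩ := mem_image.1 hm
    set m := n p0
    have hm0 : k.f m ≠ 0 := fun h => by
      have := hk m 1 (by rw [← h]; unfold Cub.F Cub.f; ring)
      omega
    have hm1 : ((k.f m).natAbs : ℝ) < (X ^ (4 * δ)) ^ (s + 1) := by
      have h3 : X ^ 4 ≤ (X ^ (4 * δ)) ^ (s + 1) := by
        rw [← Real.rpow_mul_natCast hX0.le, ← Real.rpow_natCast]
        refine Real.rpow_le_rpow_of_exponent_le hX5.le ?_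
        push_cast
        have := (div_lt_iff₀ hδ).1 hs
        nlinarith
      refine lt_of_lt_of_le ?_ h3
      obtain ⟨⟨m1, m2⟩, -⟩ := hnd p0 hp0
      have := f_bd k (n := m) (Y := 2 * X) (by linarith) (by rw [abs_of_nonneg] <;> linarith)
      nlinarith [pow_pos hX0 3]
    rw [← card_image_of_injOn (f := d)]
    · refine mlt (Int.natAbs_ne_zero.2 hm0) hZ1 hm1 fun d' hd' => ?_
      obtain ⟨p, hp, rfl⟩ := mem_image.1 hd'
      obtain ⟨hp, hpm⟩ := mem_filter.1 hp
      obtain ⟨-, h1, -, h4, h5⟩ := hnd p hp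
      rw [h4, hpm] at h1
      exact ⟨Int.natCast_dvd.1 ((dvd_mul_left _ _).trans h1), fun q hq hqd => (hPm p hp).2.1.trans_lt (by exact_mod_cast (h5 q hq hqd).2)⟩
    · intro p hp p' hp' hd
      obtain ⟨hp, hpm⟩ := mem_filter.1 hp
      obtain ⟨hp', hpm'⟩ := mem_filter.1 hp'
      obtain ⟨-, h1, h3, h4, -⟩ := hnd p hp
      obtain ⟨-, h1', h3', h4', -⟩ := hnd p' hp'
      obtain ⟨⟨-, b1, b2⟩, -⟩ := hPm p hp
      obtain ⟨⟨-, b1', b2'⟩, -⟩ := hPm p' hp'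
      rw [hpm] at h1 h3
      rw [hpm'] at h1' h3'
      rw [hd, ← h4'] at h4
      obtain ⟨i, x, t⟩ := p
      obtain ⟨j, y, u⟩ := p'
      obtain rfl := (uq2 k hM1 b1' b1 b2' b2 h4.symm).antisymm (uq2 k hM1 b1 b1' b2 b2' h4)
      simp only at *
      rw [← h4] at h3'
      obtain ⟨rfl, rfl⟩ := uq k hk hM1 Nat.one_le_two_pow b1 b1' b2 b2' h1 h3 h3'
      rfl
  have h1 : P.image n ⊆ (Ioc ⌊X⌋ ⌊2 * X⌋ : Finset ℤ).filter fun n =>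
      ∃ d : ℕ, (d:ℤ) ∣ k.f n ∧ X ^ (1 + δ) ≤ d ∧ (d.Prime ∨ ∀ P : ℕ, P.Prime → P ∣ d → W < P ∧ (P:ℝ) ≤ X) := fun m hm => by
    obtain ⟨p, hp, rfl⟩ := mem_image.1 hm
    obtain ⟨⟨m1, m2⟩, h1, -, h4, h5⟩ := hnd p hp
    obtain ⟨⟨b0, b1, b2⟩, b3, -⟩ := hPm p hp
    obtain ⟨q1, q2⟩ := hq p hp
    refine mem_filter.2 ⟨mem_Ioc.2 ⟨Int.floor_lt.2 m1, Int.le_floor.2 m2⟩, d p, (dvd_mul_left _ _).trans (h4 ▸ h1), (hJ _ b0).1.trans q1, ?_⟩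
    by_contra! hc
    obtain ⟨hd, r, hr, hrd, hc⟩ := hc
    obtain ⟨e, he⟩ := hrd
    have hrX := hc (h5 r hr (Dvd.intro _ he.symm)).1
    have he1 : e ≠ 1 := fun h => hd (by rwa [he, h, mul_one])
    have hmf := (h5 _ (Nat.minFac_prime he1) (he ▸ (Nat.minFac_dvd e).mul_left r)).2
    have he0 : 0 < e := by
      refine Nat.pos_of_ne_zero fun h => ?_
      rw [h, mul_zero] at he
      rw [he, Nat.cast_zero] at q1
      exact absurd q1 (not_le.2 (by positivity))
    have h7 : X ^ (4 * δ) < e := b3.trans_lt (by exact_mod_cast hmf.trans_le (Nat.minFac_le he0))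
    have h8 : X * X ^ (4 * δ) < d p := by
      rw [he, Nat.cast_mul]; exact mul_lt_mul'' hrX h7 hX0.le (by positivity)
    have h9 : 1.03 * (G * ((2 ^ p.1 : ℕ):ℝ) ^ 3) ≤ X ^ δ * X ^ (1 + 2 * δ) := by
      rw [← mul_assoc]; gcongr; linarith; exact (hJ _ b0).2
    have h10 : X ^ δ * X ^ (1 + 2 * δ) ≤ X * X ^ (4 * δ) := by
      nth_rw 3 [← Real.rpow_one X]
      rw [← Real.rpow_add hX0, ← Real.rpow_add hX0]
      exact Real.rpow_le_rpow_of_exponent_le hX5.le (by linarith)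
    linarith
  have h3 : (#P : ℝ) ≤ 2 ^ s * #((Ioc ⌊X⌋ ⌊2 * X⌋ : Finset ℤ).filter fun n =>
      ∃ d : ℕ, (d:ℤ) ∣ k.f n ∧ X ^ (1 + δ) ≤ d ∧ (d.Prime ∨ ∀ P : ℕ, P.Prime → P ∣ d → W < P ∧ (P:ℝ) ≤ X)) := by
    exact_mod_cast (card_le_mul_card_image P _ h2).trans (Nat.mul_le_mul_left _ (card_le_card h1))
  refine le_of_mul_le_mul_left ?_ (by positivity : (0:ℝ) < 2 ^ s)
  refine le_trans (le_of_eq ?_) (hPc.trans h3)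
  field_simp
end LV

namespace LV
open Finset Filter Topology Polynomial
open Classical in
lemma out (k : Cub) (hf : Irreducible (X^3 + C k.c2 * X^2 + C k.c1 * X + C k.c0 : ℤ[X])) :
    ∃ W : ℕ, (∀ n : ℤ, ∀ l : ℕ, W < l → (l:ℤ) ∣ k.f n → ¬ (l:ℤ) ∣ 3 * n ^ 2 + 2 * k.c2 * n + k.c1) ∧
    ∃ κ0 : ℝ, 0 < κ0 ∧ ∃ δ : ℝ, 0 < δ ∧ ∀ᶠ X : ℝ in atTop, κ0 * X ≤ #((Ioc ⌊X⌋ ⌊2 * X⌋ : Finset ℤ).filter fun n =>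
      ∃ d : ℕ, (d:ℤ) ∣ k.f n ∧ X ^ (1 + δ) ≤ d ∧ (d.Prime ∨ ∀ P : ℕ, P.Prime → P ∣ d → W < P ∧ (P:ℝ) ≤ X)) := by
  have hk := k.good_of_irreducible hf
  have h0 : k.c0 ≠ 0 := fun h => absurd (hk 0 1 (by simp [Cub.F, h])).2 one_ne_zero
  obtain ⟨hR, C0, hC0⟩ := ME.rho_main k hf
  obtain ⟨D, hD0, hD⟩ := sep k hf
  obtain ⟨m0, hm0⟩ := exists_nat_gt (12 * 10 ^ 7 : ℝ)
  set ε : ℝ := 1 / 10 ^ 7 with hε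
  set κ : ℝ := 4 / 10 ^ 4 * ε / ((3 * m0 : ℕ) * 441) with hκ
  have hm0' : 0 < m0 := by exact_mod_cast (by linarith : (0:ℝ) < m0)
  have hε0 : 0 < ε := by positivity
  have hκ0 : 0 < κ := by positivity
  obtain ⟨W0, hW0⟩ := exists_nat_gt (40 / κ)
  set W := k.c0.natAbs + D + 8 + W0 with hW
  set M := W.factorial * k.c0.natAbs with hM
  have hM1 : 1 ≤ M := Nat.mul_pos (Nat.factorial_pos _) (Int.natAbs_pos.2 h0)
  have a1 : ∀ l : ℕ, l.Prime → W < l → ¬ l ∣ M := fun l hl hlW h => by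
    rcases hl.dvd_mul.1 h with h | h
    · exact absurd (hl.dvd_factorial.1 h) (by omega)
    · have := Nat.le_of_dvd (Int.natAbs_pos.2 h0) h
      omega
  have a2 : ∀ l : ℕ, l.Prime → l ≤ W → l ∣ M := fun l hl h => ((hl.dvd_factorial).2 h).mul_right _
  have g2 := G2 k hk hR D hD hD0 W M (KK1 k) hM1 (by omega) (by omega) a1 a2 ε hε0 le_rfl m0 (by rw [hε]; linarith) κ hκ0
    (by rw [hκ]; field_simp; rfl) (hW0.le.trans (by exact_mod_cast (by omega : W0 ≤ W)))
  obtain ⟨η, hη, cV, hcV, he⟩ := He (K := KK k) k hC0 (by omega) a1 a2 hε0 le_rfl (fun T hT x hx => (sz k hM1 hT hx).1)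
  refine ⟨W, fun n l hl h h' => absurd (Nat.le_of_dvd hD0.bot_lt (hD n l h h')) (by omega),
    big k hk h0 hM hη hcV (half_pos hκ0) ?_⟩
  filter_upwards [g2, he] with T h1 ⟨z, hz, h2⟩
  exact ⟨z, hz, fun θ t1 t2 => ⟨_, filter_subset _ _, h1, fun x hx => h2 θ t1 t2 x (mem_filter.1 hx).1 (mem_filter.1 hx).2⟩⟩
end LV

namespace LV
open Finset Filter Topology
lemma four (k : Cub) {m a b c d : ℤ} (h1 : m ∣ k.f a) (h2 : m ∣ k.f b) (h3 : m ∣ k.f c) (h4 : m ∣ k.f d) :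
    m ∣ (b - a) * (c - a) * (d - a) * (c - b) * (d - b) * (d - c) := by
  have : (b - a) * (c - a) * (d - a) * (c - b) * (d - b) * (d - c) = k.f d * ((b - a) * (c - a) * (c - b)) - k.f c * ((b - a) * (d - a) * (d - b))
    + k.f b * ((c - a) * (d - a) * (d - c)) - k.f a * ((c - b) * (d - b) * (d - c)) := by unfold Cub.f; ring
  rw [this]
  exact dvd_sub (dvd_add (dvd_sub (h4.mul_right _) (h3.mul_right _)) (h2.mul_right _)) (h1.mul_right _)
lemma cntH (k : Cub) {m H : ℕ} (hH : 0 < H) (hm : H ^ 6 < m) (s : ℤ) (T : ℕ) :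
    #{t ∈ range T | (m:ℤ) ∣ k.f (s + (t:ℕ))} ≤ 3 * (T / H + 1) := by
  rw [← card_range (T / H + 1)]
  refine card_le_mul_card_image_of_maps_to (f := fun t => t / H) (fun t ht => ?_) 3 fun i _ => ?_
  · exact mem_range.2 (Nat.lt_succ_of_le (Nat.div_le_div_right (mem_range.1 (mem_filter.1 ht).1).le))
  by_contra! h
  have hm' := orderEmbOfCardLe_mem _ (h : 4 ≤ _)
  set g := orderEmbOfCardLe _ (h : 4 ≤ _)
  simp only [mem_filter] at hm'
  have hlt : ∀ i j : Fin 4, i < j → 0 < (s + (g j : ℕ)) - (s + (g i : ℕ)) ∧ (s + (g j : ℕ)) - (s + (g i : ℕ)) ≤ H := fun i j hij => by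
    have := g.strictMono hij
    have h1 := (hm' i).2
    have h2 := (hm' j).2
    have h3 := Nat.div_add_mod (g i) H
    have h4 := Nat.div_add_mod (g j) H
    have := Nat.mod_lt (g j) hH
    rw [h1] at h3; rw [h2] at h4
    omega
  have h1 := four k (hm' 0).1.2 (hm' 1).1.2 (hm' 2).1.2 (hm' 3).1.2
  have p1 := hlt 0 1 (by decide)
  have p2 := hlt 0 2 (by decide)
  have p3 := hlt 0 3 (by decide)
  have p4 := hlt 1 2 (by decide)
  have p5 := hlt 1 3 (by decide)
  have p6 := hlt 2 3 (by decide)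
  generalize s + (g 1 : ℕ) - (s + (g 0 : ℕ)) = u1 at *
  generalize s + (g 2 : ℕ) - (s + (g 0 : ℕ)) = u2 at *
  generalize s + (g 3 : ℕ) - (s + (g 0 : ℕ)) = u3 at *
  generalize s + (g 2 : ℕ) - (s + (g 1 : ℕ)) = u4 at *
  generalize s + (g 3 : ℕ) - (s + (g 1 : ℕ)) = u5 at *
  generalize s + (g 3 : ℕ) - (s + (g 2 : ℕ)) = u6 at *
  obtain ⟨p1, r1⟩ := p1
  obtain ⟨p2, r2⟩ := p2
  obtain ⟨p3, r3⟩ := p3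
  obtain ⟨p4, r4⟩ := p4
  obtain ⟨p5, r5⟩ := p5
  obtain ⟨p6, r6⟩ := p6
  have h2 := Int.le_of_dvd (by positivity) h1
  have h3 : u1 * u2 * u3 * u4 * u5 * u6 ≤ (H:ℤ) * H * H * H * H * H := by gcongr
  have h4 : (H:ℤ) ^ 6 < m := by exact_mod_cast hm
  linarith [show (H:ℤ) * H * H * H * H * H = H ^ 6 by ring]
lemma vsum (k : Cub) {p M0 : ℕ} (hp : p.Prime) (s : ℤ) (T : ℕ) (h : ∀ t < T, k.f (s + (t:ℕ)) ≠ 0 ∧ (k.f (s + (t:ℕ))).natAbs ≤ M0) :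
    ∑ t ∈ range T, (k.f (s + (t:ℕ))).natAbs.factorization p =
      ∑ j ∈ Ico 1 (Nat.log p M0 + 1), #{t ∈ range T | ((p ^ j : ℕ):ℤ) ∣ k.f (s + (t:ℕ))} := by
  simp only [card_filter]
  rw [sum_comm]
  refine sum_congr rfl fun t ht => ?_
  obtain ⟨h1, h2⟩ := h t (mem_range.1 ht)
  rw [Nat.factorization_eq_card_pow_dvd_of_lt hp (Int.natAbs_pos.2 h1) (h2.trans_lt (Nat.lt_pow_succ_log_self hp.one_lt M0)), card_filter]
  simp only [Int.natCast_dvd]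
lemma lgM {p M0 : ℕ} (hp : p.Prime) (hM : M0 ≠ 0) : Nat.log p M0 * Real.log p ≤ Real.log M0 := by
  rw [← Real.log_pow]
  exact Real.log_le_log (pow_pos (Nat.cast_pos.2 hp.pos) _) (by exact_mod_cast Nat.pow_log_le_self p hM)
lemma vW (k : Cub) {p M0 H : ℕ} (hp : p.Prime) (hM : M0 ≠ 0) (hH : 0 < H) (s : ℤ) (T : ℕ) (h : ∀ t < T, k.f (s + (t:ℕ)) ≠ 0 ∧ (k.f (s + (t:ℕ))).natAbs ≤ M0) :
    (∑ t ∈ range T, (k.f (s + (t:ℕ))).natAbs.factorization p : ℕ) * Real.log p ≤ 6 * H * T * Real.log p + 3 * ((T:ℝ) / H + 1) * Real.log M0 := by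
  rw [vsum k hp s T h]
  have h1 : ∑ j ∈ Ico 1 (Nat.log p M0 + 1), #{t ∈ range T | ((p ^ j : ℕ):ℤ) ∣ k.f (s + (t:ℕ))} ≤ 6 * H * T + Nat.log p M0 * (3 * (T / H + 1)) := by
    calc _ ≤ ∑ j ∈ Ico 1 (Nat.log p M0 + 1), ((if j < 6 * H then T else 0) + 3 * (T / H + 1)) := sum_le_sum fun j hj => by
          split_ifs with h2
          · exact (card_filter_le _ _).trans (by rw [card_range]; omega)
          · rw [zero_add]; refine cntH k hH ?_ s T
            calc H ^ 6 < (2 ^ H) ^ 6 := Nat.pow_lt_pow_left Nat.lt_two_pow_self (by norm_num)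
              _ = 2 ^ (6 * H) := by rw [← pow_mul, mul_comm]
              _ ≤ p ^ (6 * H) := Nat.pow_le_pow_left hp.two_le _
              _ ≤ _ := Nat.pow_le_pow_right hp.pos (by omega)
      _ ≤ _ := by
        rw [sum_add_distrib, sum_const, Nat.card_Ico, smul_eq_mul, Nat.add_sub_cancel, ← sum_filter]
        gcongr
        rw [sum_const, smul_eq_mul]
        gcongr
        refine (card_le_card (t := range (6 * H)) fun j hj => mem_range.2 (mem_filter.1 hj).2).trans (card_range _).le
  have hl : 0 ≤ Real.log p := Real.log_natCast_nonneg p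
  calc _ ≤ ((6 * H * T + Nat.log p M0 * (3 * (T / H + 1)) : ℕ):ℝ) * Real.log p := by gcongr
    _ = 6 * H * T * Real.log p + 3 * ((T / H : ℕ) + 1) * (Nat.log p M0 * Real.log p) := by push_cast; ring
    _ ≤ _ := by gcongr; exact Nat.cast_div_le; exact lgM hp hM
lemma vB (k : Cub) {p M0 : ℕ} (hp : p.Prime) (hM : M0 ≠ 0) (hs : ∀ n : ℤ, (p:ℤ) ∣ k.f n → ¬ (p:ℤ) ∣ 3 * n ^ 2 + 2 * k.c2 * n + k.c1)
    (s : ℤ) (T : ℕ) (h : ∀ t < T, k.f (s + (t:ℕ)) ≠ 0 ∧ (k.f (s + (t:ℕ))).natAbs ≤ M0) :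
    (∑ t ∈ range T, (k.f (s + (t:ℕ))).natAbs.factorization p : ℕ) * Real.log p ≤
      T * (ME.rho k p * Real.log p / p) + T * (6 * (Real.log p / p ^ 2)) + 3 * Real.log M0 := by
  rw [vsum k hp s T h]
  have hp2 : (2:ℝ) ≤ p := by exact_mod_cast hp.two_le
  have hr : (ME.rho k p : ℝ) ≤ 3 := by exact_mod_cast ME.rho_le k hp
  have hl : 0 ≤ Real.log p := Real.log_natCast_nonneg p
  have h1 : ∀ j ∈ Ico 1 (Nat.log p M0 + 1), (#{t ∈ range T | ((p ^ j : ℕ):ℤ) ∣ k.f (s + (t:ℕ))} : ℝ) ≤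
      ((if j = 1 then T * (ME.rho k p / p : ℝ) else 0) + if j ∈ Ico 2 (Nat.log p M0 + 1) then 3 * T * (1 / p : ℝ) ^ j else 0) + 3 := fun j hj => by
    obtain ⟨j1, j2⟩ := mem_Ico.1 hj
    have h2 := cnt k (pow_ne_zero j hp.ne_zero) s 1 isCoprime_one_left T
    simp only [one_mul] at h2
    have h3 := h2.trans (Nat.mul_le_mul_left _ (rho_pow k hp j1 (.inr hs)))
    have h4 : (#{t ∈ range T | ((p ^ j : ℕ):ℤ) ∣ k.f (s + (t:ℕ))} : ℝ) ≤ (T / p ^ j + 1) * ME.rho k p := by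
      refine (Nat.cast_le.2 h3).trans ?_
      push_cast; gcongr
      refine Nat.cast_div_le.trans ?_
      push_cast; gcongr; exact_mod_cast Nat.sub_le T 1
    rcases eq_or_lt_of_le j1 with rfl | hj'
    · rw [if_pos rfl, if_neg (by simp)]
      calc _ ≤ _ := h4
        _ = T * (ME.rho k p / p : ℝ) + ME.rho k p := by rw [pow_one]; ring
        _ ≤ _ := by linarith
    · rw [if_neg (by omega), if_pos (mem_Ico.2 ⟨hj', j2⟩)]
      calc _ ≤ _ := h4
        _ ≤ (T / p ^ j + 1) * 3 := by gcongr
        _ = _ := by rw [one_div_pow]; ring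
  have h2 : (∑ j ∈ Ico 1 (Nat.log p M0 + 1), #{t ∈ range T | ((p ^ j : ℕ):ℤ) ∣ k.f (s + (t:ℕ))} : ℕ) ≤
      T * (ME.rho k p / p : ℝ) + 6 * T / p ^ 2 + Nat.log p M0 * 3 := by
    rw [Nat.cast_sum]
    refine (sum_le_sum h1).trans ?_
    rw [sum_add_distrib, sum_add_distrib, sum_const, Nat.card_Ico, Nat.add_sub_cancel, nsmul_eq_mul, sum_ite_eq', ← sum_filter, ← mul_sum]
    gcongr
    · split_ifs <;> first | rfl | positivity
    · have : filter (fun j => j ∈ Ico 2 (Nat.log p M0 + 1)) (Ico 1 (Nat.log p M0 + 1)) ⊆ Ico 2 (Nat.log p M0 + 1) := fun j hj => (mem_filter.1 hj).2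
      have h3 := (sum_le_sum_of_subset_of_nonneg this (f := fun j => (1 / p : ℝ) ^ j) fun _ _ _ => by positivity).trans
        (geom_sum_Ico_le_of_lt_one (by positivity) (by rw [div_lt_one] <;> linarith))
      have h4 : (1 / p : ℝ) ^ 2 / (1 - 1 / p) ≤ 2 / p ^ 2 := by
        have : (1/2:ℝ) ≤ 1 - 1 / p := by
          have : (1:ℝ) / p ≤ 1 / 2 := by gcongr
          linarith
        calc (1 / p : ℝ) ^ 2 / (1 - 1 / p) ≤ (1 / p : ℝ) ^ 2 / (1 / 2) := by gcongr
          _ = _ := by field_simp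
      calc _ ≤ 3 * (T:ℝ) * (2 / p ^ 2) := by gcongr; exact h3.trans h4
        _ = _ := by ring
  calc _ ≤ (T * (ME.rho k p / p : ℝ) + 6 * T / p ^ 2 + Nat.log p M0 * 3) * Real.log p := by gcongr
    _ = T * (ME.rho k p * Real.log p / p) + T * (6 * (Real.log p / p ^ 2)) + 3 * (Nat.log p M0 * Real.log p) := by ring
    _ ≤ _ := by gcongr; exact lgM hp hM
end LV

namespace LV
open Finset Filter Topology Polynomial
lemma slg : ∃ c : ℝ, 0 ≤ c ∧ ∀ S : Finset ℕ, ∑ p ∈ S, Real.log p / (p:ℝ) ^ 2 ≤ c := by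
  have hs : Summable fun n : ℕ => 1 / (n:ℝ) ^ (3/2:ℝ) := Real.summable_one_div_nat_rpow.2 (by norm_num)
  refine ⟨2 * ∑' n : ℕ, 1 / (n:ℝ) ^ (3/2:ℝ), by positivity, fun S => ?_⟩
  refine le_trans ?_ (mul_le_mul_of_nonneg_left (hs.sum_le_tsum S fun _ _ => by positivity) zero_le_two)
  rw [mul_sum]
  refine sum_le_sum fun p _ => ?_
  rcases p.eq_zero_or_pos with rfl | h
  · simp
  have hp : (0:ℝ) < p := by exact_mod_cast h
  have h1 := Real.log_le_rpow_div hp.le (by norm_num : (0:ℝ) < 1 / 2)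
  calc _ ≤ ((p:ℝ) ^ (1/2:ℝ) / (1/2)) / (p:ℝ) ^ 2 := by gcongr
    _ = 2 * ((p:ℝ) ^ (1/2:ℝ) / (p:ℝ) ^ (2:ℝ)) := by rw [Real.rpow_two]; ring
    _ = _ := by rw [← Real.rpow_sub hp, one_div (_ ^ _), ← Real.rpow_neg hp.le]; norm_num
lemma U (k : Cub) (hf : Irreducible (X^3 + C k.c2 * X^2 + C k.c1 * X + C k.c0 : ℤ[X])) {W : ℕ}
    (hW : ∀ n : ℤ, ∀ l : ℕ, W < l → (l:ℤ) ∣ k.f n → ¬ (l:ℤ) ∣ 3 * n ^ 2 + 2 * k.c2 * n + k.c1) {η : ℝ} (hη : 0 < η) :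
    ∀ᶠ y : ℕ in atTop, ∀ T ≤ y + 1, ∑ p ∈ Nat.primesLE y,
      (∑ t ∈ range T, (k.f ((y:ℤ) + 1 + (t:ℕ))).natAbs.factorization p : ℕ) * Real.log p ≤ (1 + η) * y * Real.log y := by
  have hk := k.good_of_irreducible hf
  obtain ⟨c, hc, hcs⟩ := slg
  obtain ⟨H, hH⟩ := exists_nat_gt (96 * (W + 1) / η)
  have hH0 : (0:ℝ) < H := lt_of_le_of_lt (by positivity) hH
  have hH1 : 24 * (W + 1) / H ≤ η / 4 := by rw [div_lt_iff₀ hη] at hH; rw [div_le_iff₀ hH0]; linarith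
  have hR := (ME.rho_main k hf).1.eventually_le_const (show (1:ℝ) < 1 + η / 4 by linarith)
  have hπ := tendsto_natCast_atTop_atTop.eventually (Chebyshev.eventually_primeCounting_le (ε := 1) one_pos)
  set A : ℝ := 12 * c + 36 + (W + 1) * (12 * H * Real.log (W + 1)) with hA
  filter_upwards [hR, hπ, log_nat.eventually_ge_atTop (4 / η * A), log_nat.eventually_ge_atTop 1, eventually_ge_atTop (27 * SS k + 2),
    tendsto_natCast_atTop_atTop.eventually_ge_atTop (4 / η * (1 + η / 4 + 12 * (W + 1)))] with y h1 h2 h3 h4 h5 h6 T hT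
  set L := Real.log y with hL
  have y1 : (1:ℝ) ≤ y := by exact_mod_cast (by omega : 1 ≤ y)
  have hS : 1 ≤ SS k := by unfold SS; omega
  set M0 := SS k * (3 * y) ^ 3 with hM0
  have hM : M0 ≠ 0 := mul_ne_zero (by omega) (pow_ne_zero _ (by omega))
  have hml : Real.log M0 ≤ 4 * L := by
    rw [hL, ← Nat.cast_ofNat, ← Real.log_pow]
    refine Real.log_le_log (by positivity) ?_
    rw [hM0]
    norm_cast
    calc SS k * (3 * y) ^ 3 = (27 * SS k) * y ^ 3 := by ring
      _ ≤ y * y ^ 3 := by gcongr; omega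
      _ = y ^ 4 := by ring
  have hml0 : 0 ≤ Real.log M0 := Real.log_natCast_nonneg _
  have hb : ∀ t < T, k.f ((y:ℤ) + 1 + (t:ℕ)) ≠ 0 ∧ (k.f ((y:ℤ) + 1 + (t:ℕ))).natAbs ≤ M0 := fun t ht => by
    refine ⟨fun h => absurd (hk _ 1 (by simpa [Cub.F, Cub.f] using h)).2 one_ne_zero, ?_⟩
    have h7 := f_bd k (n := (y:ℤ) + 1 + (t:ℕ)) (Y := ((3 * y : ℕ):ℝ)) (by exact_mod_cast (by omega : 1 ≤ 3 * y)) (by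
      rw [abs_of_nonneg (by positivity)]; exact_mod_cast (by omega : y + 1 + t ≤ 3 * y))
    rw [hM0]; exact_mod_cast h7
  have hT2 : (T:ℝ) ≤ 2 * y := by exact_mod_cast (by omega : T ≤ 2 * y)
  have hT1 : (T:ℝ) ≤ y + 1 := by exact_mod_cast hT
  set B : ℝ := 6 * H * (2 * y) * Real.log (W + 1) + 3 * ((2 * y:ℝ) / H + 1) * (4 * L) with hB
  have hW0 : 0 ≤ Real.log ((W:ℝ) + 1) := Real.log_nonneg (by linarith [(Nat.cast_nonneg W : (0:ℝ) ≤ W)])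
  have hB0 : 0 ≤ B := by positivity
  have key : ∀ p ∈ Nat.primesLE y, (∑ t ∈ range T, (k.f ((y:ℤ) + 1 + (t:ℕ))).natAbs.factorization p : ℕ) * Real.log p ≤
      (T * (ME.rho k p * Real.log p / p) + T * 6 * (Real.log p / p ^ 2) + 3 * Real.log M0) + if p ∈ range (W + 1) then B else 0 := fun p hp => by
    have hpp := (Nat.mem_primesLE.1 hp).2
    have hl := Real.log_natCast_nonneg p
    split_ifs with h7
    · have h8 := vW k hpp hM (by exact_mod_cast hH0) _ T hb
      have h9 : Real.log p ≤ Real.log (W + 1) := Real.log_le_log (by exact_mod_cast hpp.pos) (by exact_mod_cast (mem_range.1 h7).le)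
      have : 6 * H * T * Real.log p + 3 * ((T:ℝ) / H + 1) * Real.log M0 ≤ B := by rw [hB]; gcongr
      have : 0 ≤ T * (ME.rho k p * Real.log p / p) + T * 6 * (Real.log p / p ^ 2) + 3 * Real.log M0 := by positivity
      linarith
    · have h8 := vB k hpp hM (fun n => hW n p (by rw [mem_range] at h7; omega)) _ T hb
      linarith
  refine (sum_le_sum key).trans ?_
  rw [sum_add_distrib, sum_add_distrib, sum_add_distrib, ← mul_sum, ← mul_sum, sum_const, nsmul_eq_mul, Nat.primesLE_card_eq_primeCounting,
    ← sum_filter, sum_const, nsmul_eq_mul]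
  have e1 : (#{p ∈ Nat.primesLE y | p ∈ range (W + 1)} : ℝ) ≤ W + 1 := by
    have := card_le_card (t := range (W + 1)) fun p (hp : p ∈ {p ∈ Nat.primesLE y | p ∈ range (W + 1)}) => (mem_filter.1 hp).2
    rw [card_range] at this; exact_mod_cast this
  rw [Nat.floor_natCast] at h2
  have l4 : Real.log 4 ≤ 2 := by
    rw [show (4:ℝ) = 2 ^ 2 by norm_num, Real.log_pow]; push_cast; linarith [Real.log_two_lt_d9]
  have e2 : (Nat.primeCounting y : ℝ) * L ≤ 3 * y := by
    calc _ ≤ (Real.log 4 + 1) * y / L * L := by gcongr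
      _ = (Real.log 4 + 1) * y := by field_simp
      _ ≤ _ := by gcongr; linarith
  rw [div_le_iff₀ (by linarith)] at h1
  have e3 := hcs (Nat.primesLE y)
  have e4 : 0 ≤ ∑ p ∈ Nat.primesLE y, Real.log p / (p:ℝ) ^ 2 := by positivity
  have f1 : (T:ℝ) * ∑ p ∈ Nat.primesLE y, (ME.rho k p * Real.log p / p) ≤ (y + 1) * ((1 + η / 4) * L) := by gcongr
  have f2 : (T:ℝ) * 6 * ∑ p ∈ Nat.primesLE y, Real.log p / (p:ℝ) ^ 2 ≤ 2 * y * 6 * c := by gcongr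
  have f3 : (Nat.primeCounting y : ℝ) * (3 * Real.log M0) ≤ 36 * y := by
    calc _ ≤ (Nat.primeCounting y : ℝ) * (3 * (4 * L)) := by gcongr
      _ ≤ _ := by linarith
  have f4 : (#{p ∈ Nat.primesLE y | p ∈ range (W + 1)} : ℝ) * B ≤ (W + 1) * B := by gcongr
  have f5 : (W + 1) * B = (W + 1) * (12 * H * Real.log (W + 1)) * y + (24 * (W + 1) / H) * (y * L) + 12 * (W + 1) * L := by rw [hB]; ring
  have f6 : (24 * (W + 1) / H) * (y * L) ≤ η / 4 * (y * L) := by gcongr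
  have f7 : A * y ≤ η / 4 * L * y := by
    have : A ≤ η / 4 * L := by rw [div_mul_eq_mul_div, div_le_iff₀ hη] at h3; linarith
    gcongr
  have f8 : (1 + η / 4 + 12 * (W + 1)) * L ≤ η / 4 * y * L := by
    have : (1 + η / 4 + 12 * (W + 1)) ≤ η / 4 * y := by rw [div_mul_eq_mul_div, div_le_iff₀ hη] at h6; linarith
    gcongr
  rw [hA] at f7
  linarith
end LV

namespace LV
open Finset Filter Topology Polynomial
lemma lowS {m y : ℕ} {Z B : ℝ} (hm : m ≠ 0) (hZ : 1 < Z) (hB : 0 ≤ B) (hlt : Real.log m < 3 * Real.log Z)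
    (hp : ∀ p : ℕ, p.Prime → p ∣ m → y < p → Z ≤ p ∧ Real.log p ≤ B) :
    Real.log m ≤ ∑ p ∈ Nat.primesLE y, m.factorization p * Real.log p + 2 * B := by
  have h0 := Real.log_nat_eq_sum_factorization m
  rw [Finsupp.sum, Nat.support_factorization, ← sum_filter_add_sum_filter_not _ (fun p => p ≤ y)] at h0
  have hl : 0 < Real.log Z := Real.log_pos hZ
  have hs : ∀ S : Finset ℕ, 0 ≤ ∑ p ∈ S, (m.factorization p:ℝ) * Real.log p := fun S => by positivity
  have h1 : ∑ p ∈ m.primeFactors with p ≤ y, (m.factorization p:ℝ) * Real.log p ≤ ∑ p ∈ Nat.primesLE y, m.factorization p * Real.log p :=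
    sum_le_sum_of_subset_of_nonneg (fun p h => by
      rw [mem_filter, Nat.mem_primeFactors] at h; exact Nat.mem_primesLE.2 ⟨h.2, h.1.1⟩) fun _ _ _ => by positivity
  have hq : ∀ p ∈ {p ∈ m.primeFactors | ¬ p ≤ y}, Z ≤ p ∧ Real.log p ≤ B := fun p h => by
    rw [mem_filter, Nat.mem_primeFactors] at h; exact hp p h.1.1 h.1.2.1 (by omega)
  have h2 : ((∑ p ∈ m.primeFactors with ¬ p ≤ y, m.factorization p : ℕ):ℝ) * Real.log Z ≤ ∑ p ∈ m.primeFactors with ¬ p ≤ y, (m.factorization p:ℝ) * Real.log p := by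
    rw [Nat.cast_sum, sum_mul]
    exact sum_le_sum fun p h => by gcongr; exact (hq p h).1
  have h3 : ∑ p ∈ m.primeFactors with ¬ p ≤ y, m.factorization p ≤ 2 := by
    have := hs {p ∈ m.primeFactors | p ≤ y}
    have := lt_of_mul_lt_mul_right (lt_of_le_of_lt h2 (by linarith : _ < 3 * Real.log Z)) hl.le
    exact Nat.le_of_lt_succ (by exact_mod_cast this)
  have h4 : ∑ p ∈ m.primeFactors with ¬ p ≤ y, (m.factorization p:ℝ) * Real.log p ≤ ((∑ p ∈ m.primeFactors with ¬ p ≤ y, m.factorization p : ℕ):ℝ) * B := by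
    rw [Nat.cast_sum, sum_mul]
    exact sum_le_sum fun p h => by gcongr; exact (hq p h).2
  have h5 : ((∑ p ∈ m.primeFactors with ¬ p ≤ y, m.factorization p : ℕ):ℝ) * B ≤ 2 * B := by gcongr; exact_mod_cast h3
  linarith
lemma highS {m d y : ℕ} (hm : m ≠ 0) (hd : d ∣ m) (hp : ∀ p : ℕ, p.Prime → p ∣ d → p ≤ y) :
    Real.log d ≤ ∑ p ∈ Nat.primesLE y, m.factorization p * Real.log p := by
  rw [Real.log_nat_eq_sum_factorization d, Finsupp.sum, Nat.support_factorization]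
  calc _ ≤ ∑ p ∈ d.primeFactors, (m.factorization p:ℝ) * Real.log p := sum_le_sum fun p _ => by
        gcongr; exact (Nat.factorization_le_iff_dvd (ne_zero_of_dvd_ne_zero hm hd) hm).2 hd p
    _ ≤ _ := sum_le_sum_of_subset_of_nonneg (fun p h => by
      rw [Nat.mem_primeFactors] at h; exact Nat.mem_primesLE.2 ⟨hp p h.1 h.2.1, h.1⟩) fun _ _ _ => by positivity
open Classical in
lemma ioc_card (P : ℤ → Prop) (a b : ℤ) : #((Ioc a b : Finset ℤ).filter P) = #{t ∈ range (b - a).toNat | P (a + 1 + (t:ℕ))} := by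
  symm
  refine card_bij (fun t _ => a + 1 + (t:ℕ)) (fun t h => ?_) (fun t _ u _ h => by simpa using h) fun n h => ?_
  · simp only [mem_filter, mem_range, mem_Ioc] at h ⊢; exact ⟨by omega, h.2⟩
  · simp only [mem_filter, mem_range, mem_Ioc] at h
    refine ⟨(n - a - 1).toNat, ?_, by omega⟩
    have : a + 1 + ((n - a - 1).toNat : ℕ) = n := by omega
    simp only [mem_filter, mem_range, this]; exact ⟨by omega, h.2⟩
open Classical in
lemma exc (k : Cub) {y T C : ℕ} (hT : T ≤ y + 1) (hy : 1 ≤ y) :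
    (#{t ∈ range T | ∃ p : ℕ, p.Prime ∧ y < p ∧ p ≤ C ∧ (p:ℤ) ∣ k.f ((y:ℤ) + 1 + (t:ℕ))} : ℝ) * Real.log y ≤ 6 * C := by
  have h1 : #{t ∈ range T | ∃ p : ℕ, p.Prime ∧ y < p ∧ p ≤ C ∧ (p:ℤ) ∣ k.f ((y:ℤ) + 1 + (t:ℕ))} ≤ #{p ∈ Nat.primesLE C | y < p} * 3 := by
    refine (card_le_card (t := {p ∈ Nat.primesLE C | y < p}.biUnion fun p => {t ∈ range T | (p:ℤ) ∣ k.f ((y:ℤ) + 1 + (t:ℕ))}) fun t ht => ?_).trans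
      (card_biUnion_le_card_mul _ _ 3 fun p hp => ?_)
    · obtain ⟨h, p, h1, h2, h3, h4⟩ := mem_filter.1 ht
      exact mem_biUnion.2 ⟨p, mem_filter.2 ⟨Nat.mem_primesLE.2 ⟨h3, h1⟩, h2⟩, mem_filter.2 ⟨h, h4⟩⟩
    · obtain ⟨h, h2⟩ := mem_filter.1 hp
      have h1 := (Nat.mem_primesLE.1 h).2
      have h3 := cnt k h1.ne_zero ((y:ℤ) + 1) 1 isCoprime_one_left T
      simp only [one_mul] at h3
      rw [Nat.div_eq_of_lt (by omega), zero_add, one_mul] at h3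
      exact h3.trans (ME.rho_le k h1)
  have h2 : (#{p ∈ Nat.primesLE C | y < p} : ℝ) * Real.log y ≤ 2 * C := by
    rw [← nsmul_eq_mul]
    refine le_trans ?_ (ME.theta_le C)
    refine le_trans ?_ (sum_le_sum_of_subset_of_nonneg (filter_subset (fun p => y < p) _) fun p _ _ => Real.log_natCast_nonneg p)
    exact card_nsmul_le_sum _ _ _ fun p hp => Real.log_le_log (by exact_mod_cast hy) (by exact_mod_cast (mem_filter.1 hp).2.le)
  have := Real.log_natCast_nonneg y
  calc _ ≤ ((#{p ∈ Nat.primesLE C | y < p} * 3 : ℕ):ℝ) * Real.log y := by gcongr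
    _ ≤ _ := by push_cast; linarith
lemma f_low (k : Cub) {n : ℤ} {x : ℝ} (hx : 2 * SS k ≤ x) (hn : x < n) : x ^ 3 / 2 ≤ ((k.f n).natAbs : ℝ) := by
  rw [Nat.cast_natAbs, Int.cast_abs]
  have e : (SS k : ℝ) = 1 + |(k.c0:ℝ)| + |(k.c1:ℝ)| + |(k.c2:ℝ)| := by unfold SS; push_cast [Nat.cast_natAbs]; ring
  have p0 := abs_nonneg (k.c0:ℝ)
  have p1 := abs_nonneg (k.c1:ℝ)
  have p2 := abs_nonneg (k.c2:ℝ)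
  have hx1 : 1 ≤ x := by linarith
  have hn1 : (1:ℝ) ≤ n := by linarith
  refine le_trans ?_ (le_abs_self _)
  unfold Cub.f; push_cast
  have q0 : -|(k.c0:ℝ)| * (n:ℝ) ^ 2 ≤ k.c0 := by nlinarith [neg_abs_le (k.c0:ℝ), one_le_pow₀ hn1 (n := 2)]
  have q1 : -|(k.c1:ℝ)| * (n:ℝ) ^ 2 ≤ k.c1 * n := by nlinarith [neg_abs_le (k.c1:ℝ), mul_nonneg (by linarith : (0:ℝ) ≤ n) (by linarith : (0:ℝ) ≤ n - 1)]
  have q2 : -|(k.c2:ℝ)| * (n:ℝ) ^ 2 ≤ k.c2 * (n:ℝ) ^ 2 := by gcongr; exact neg_abs_le _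
  have q3 : (SS k:ℝ) * (n:ℝ) ^ 2 ≤ n / 2 * (n:ℝ) ^ 2 := by gcongr; linarith
  have q4 : x ^ 3 ≤ (n:ℝ) ^ 3 := by gcongr
  rw [e] at q3
  nlinarith [sq_nonneg (n:ℝ)]
end LV

namespace LV
open Finset Filter Topology Polynomial
lemma pt0 {a b s u v w : ℝ} (a0 : 0 ≤ a) (b0 : 0 ≤ b) (s0 : 0 ≤ s) (hv : 0 ≤ v) (hw : 0 ≤ w) (hw1 : w ≤ 1) (h : u = 1 ∨ u = 0 ∧ (w = 1 ∧ b ≤ s ∨ w = 0 ∧ (v = 1 ∨ v = 0 ∧ a ≤ s))) :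
    a * (1 - u - v - w) + b * (w - u) ≤ s := by
  have := mul_nonneg a0 hv
  have := mul_nonneg a0 hw
  have := mul_nonneg b0 (sub_nonneg.2 hw1)
  rcases h with rfl | ⟨rfl, ⟨rfl, h⟩ | ⟨rfl, rfl | ⟨rfl, h⟩⟩⟩ <;> linarith
lemma pt1 (k : Cub) {x c : ℝ} (c0 : 0 < c) (hx : 2 * SS k + 1 ≤ x) {n : ℤ} (hA : ∀ p : ℕ, p.Prime → (p:ℤ) ∣ k.f n → (p:ℝ) ≤ x ^ (1 + c))
    (hE : ¬ ∃ p : ℕ, p.Prime ∧ ⌊x⌋₊ < p ∧ p ≤ ⌊3 * SS k * x⌋₊ ∧ (p:ℤ) ∣ k.f n) (n1 : x < n) (n2 : n ≤ 2 * x) (hne : (k.f n).natAbs ≠ 0) :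
    (1 - 2 * c) * Real.log x - Real.log 2 ≤ ∑ p ∈ Nat.primesLE ⌊x⌋₊, (k.f n).natAbs.factorization p * Real.log p := by
  have hS : (1:ℝ) ≤ SS k := by unfold SS; exact_mod_cast (by omega)
  have hx1 : 1 ≤ x := by linarith
  have m1 := f_low k (by linarith) n1
  have m2 := f_bd k (by linarith : 1 ≤ 2 * x) (by rw [abs_of_pos (by linarith)]; exact n2)
  have := mul_le_mul hS hx1 zero_le_one (by linarith)
  have := Real.log_nonneg hx1
  have hl := lowS (y := ⌊x⌋₊) (Z := 3 * SS k * x) (B := (1 + c) * Real.log x) hne (by linarith) (by positivity) (by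
    rw [show (3:ℝ) = ((3:ℕ):ℝ) by norm_num, ← Real.log_pow]
    refine Real.log_lt_log (by exact_mod_cast Nat.pos_of_ne_zero hne) (m2.trans_lt ?_)
    have : (SS k : ℝ) ≤ (SS k:ℝ) ^ 3 := le_self_pow₀ hS (by norm_num)
    calc (SS k:ℝ) * (2 * x) ^ 3 = SS k * (8 * x ^ 3) := by ring
      _ < SS k * (27 * x ^ 3) := by gcongr; norm_num
      _ ≤ SS k ^ 3 * (27 * x ^ 3) := by gcongr
      _ = _ := by push_cast; ring) (fun p hp hpd hyp => by
    rw [← Int.natCast_dvd] at hpd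
    refine ⟨?_, ?_⟩
    · by_contra! h; exact hE ⟨p, hp, hyp, Nat.le_floor h.le, hpd⟩
    · rw [← Real.log_rpow (by linarith)]
      exact Real.log_le_log (by exact_mod_cast hp.pos) (hA p hp hpd))
  have m3 := Real.log_le_log (by positivity) m1
  rw [Real.log_div (by positivity) (by norm_num), Real.log_pow] at m3
  push_cast at m3
  linarith
lemma ar {x q c L l a b g e h κ0 δ T Y : ℝ} (q0 : 0 < q) (hq : q = δ * κ0) (hδ : 0 < δ) (hκ : 0 < κ0) (c0 : 0 < c) (c2 : c ≤ q / 8) (c3 : c ≤ 1 / 8)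
    (l1 : 0 < l) (l2 : l < 1) (hx : 1 ≤ x) (L0 : 16 / q + 2 ≤ L) (h5 : 16 / q ≤ x) (t2 : x - 1 ≤ T) (ha : a = (1 - 2 * c) * L - l) (hb : b = (1 + δ) * L)
    (a0 : 0 ≤ a) (g0 : 0 ≤ g) (e0 : e ≤ q / 16 * x) (h1 : κ0 * x ≤ h) (hY : Y ≤ x * L)
    (h7 : a * (T - g - e - h) + b * (h - g) ≤ (1 + q / 8) * Y) : q / (4 * (2 + δ)) * x ≤ g := by
  have : 0 ≤ 16 / q := by positivity
  have L1 : 0 < L := by linarith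
  have i8 : 0 < x * L := by positivity
  have i0 : (1 + q / 8) * Y ≤ (1 + q / 8) * (x * L) := by gcongr
  have i1 : a * (x - 1) ≤ a * T := by gcongr
  have aL : a ≤ L := by rw [ha]; nlinarith
  have i2 : a * g ≤ L * g := by gcongr
  have i3 : a * e ≤ a * (q / 16 * x) := by gcongr
  have i3' : a * (q / 16 * x) ≤ L * (q / 16 * x) := by gcongr
  have i4 : δ * L * (κ0 * x) ≤ (b - a) * h := by
    have : δ * L ≤ b - a := by rw [hb, ha]; nlinarith
    exact mul_le_mul this h1 (by positivity) (le_trans (by positivity) this)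
  have i5 : l * x ≤ q / 16 * (x * L) := by
    have : 16 / q ≤ L := by linarith
    rw [div_le_iff₀ q0] at this
    have := mul_le_mul_of_nonneg_right this (by linarith : 0 ≤ x)
    have := mul_le_mul_of_nonneg_right l2.le (by linarith : 0 ≤ x)
    linarith
  have i6 : a ≤ q / 16 * (x * L) := by
    rw [div_le_iff₀ q0] at h5
    have := mul_le_mul_of_nonneg_right h5 L1.le
    linarith
  have i7 : 2 * c * (x * L) ≤ q / 4 * (x * L) := by gcongr; linarith
  have e1 : a * x = x * L - 2 * c * (x * L) - l * x := by rw [ha]; ring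
  have e2 : b * g = (1 + δ) * g * L := by rw [hb]; ring
  have e3 : δ * L * (κ0 * x) = q * (x * L) := by rw [hq]; ring
  have i9 : q / 4 * x * L ≤ (2 + δ) * g * L := by linarith
  have := le_of_mul_le_mul_right i9 (by linarith)
  rw [div_mul_eq_mul_div, div_le_iff₀ (by positivity)]
  linarith
open Classical in
lemma fin (k : Cub) (hf : Irreducible (X^3 + C k.c2 * X^2 + C k.c1 * X + C k.c0 : ℤ[X])) :
    ∃ c > (0:ℝ), ∃ κ > (0:ℝ), ∀ᶠ x : ℝ in atTop, κ * x ≤ #((Ioc ⌊x⌋ ⌊2 * x⌋ : Finset ℤ).filter fun n =>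
      ∃ p : ℕ, p.Prime ∧ (p:ℤ) ∣ k.f n ∧ x ^ (1 + c) < p) := by
  have hk := k.good_of_irreducible hf
  obtain ⟨W, hW, κ0, hκ, δ, hδ, ho⟩ := out k hf
  obtain ⟨q, hq⟩ : ∃ q, q = δ * κ0 := ⟨_, rfl⟩
  have q0 : 0 < q := hq ▸ mul_pos hδ hκ
  obtain ⟨c, c0, c1, c2, c3⟩ : ∃ c : ℝ, 0 < c ∧ c < δ ∧ c ≤ q / 8 ∧ c ≤ 1 / 8 :=
    ⟨min (δ / 2) (min (q / 8) (1 / 8)), by positivity, (min_le_left _ _).trans_lt (by linarith),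
      (min_le_right _ _).trans (min_le_left _ _), (min_le_right _ _).trans (min_le_right _ _)⟩
  have hu := tendsto_nat_floor_atTop (α := ℝ) |>.eventually (U k hf hW (η := q / 8) (by positivity))
  refine ⟨c, c0, q / (4 * (2 + δ)), by positivity, ?_⟩
  have hS : (1:ℝ) ≤ SS k := by unfold SS; exact_mod_cast (by omega)
  filter_upwards [ho, hu, (log_nat.comp (tendsto_nat_floor_atTop (α := ℝ))).eventually_ge_atTop (288 * SS k / q + 1),
    Real.tendsto_log_atTop.eventually_ge_atTop (16 / q + 2), eventually_ge_atTop (16 / q), eventually_ge_atTop (2 * SS k + 1 : ℝ)] with x h1 h2 h3 h4 h5 h6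
  have hx : 1 ≤ x := by linarith
  have z2 : 288 * SS k / q ≤ Real.log ⌊x⌋₊ := by simp only [Function.comp] at h3; linarith
  have hp := @pt1 k x c c0 h6
  obtain ⟨y, hy⟩ : ∃ y, y = ⌊x⌋₊ := ⟨_, rfl⟩
  have hfl : ⌊x⌋ = (y:ℤ) := by rw [hy, Int.natCast_floor_eq_floor (by linarith)]
  have y1 : 1 ≤ y := hy ▸ Nat.le_floor (by simpa using hx)
  have yx : (y:ℝ) ≤ x := hy ▸ Nat.floor_le (by linarith)
  have xy : x < y + 1 := hy ▸ Nat.lt_floor_add_one x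
  have yf : ∀ p : ℕ, (p:ℝ) ≤ x → p ≤ y := fun p h => hy ▸ Nat.le_floor h
  rw [← hy] at h2 z2 hp
  clear hy h3 hu ho
  rw [ioc_card, hfl] at h1 ⊢
  obtain ⟨T, hT⟩ : ∃ T, T = (⌊2 * x⌋ - (y:ℤ)).toNat := ⟨_, rfl⟩
  have t1 : T ≤ y + 1 := by
    have : ⌊2 * x⌋ < 2 * (y:ℤ) + 2 := Int.floor_lt.2 (by push_cast; linarith)
    omega
  have t2 : x - 1 ≤ T := by
    have h : 2 * x < ⌊2 * x⌋ + 1 := Int.lt_floor_add_one _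
    have h' : ((⌊2 * x⌋ - (y:ℤ) : ℤ):ℝ) ≤ ((T:ℤ):ℝ) := by rw [hT]; exact_mod_cast Int.self_le_toNat _
    push_cast at h'; linarith
  have t3 : ∀ t < T, (((y:ℤ) + 1 + (t:ℕ) : ℤ):ℝ) ≤ 2 * x := fun t ht => Int.le_floor.1 (by omega)
  rw [← hT] at h1 ⊢
  clear hT
  have he := exc k (C := ⌊3 * SS k * x⌋₊) t1 y1
  replace he : (#{t ∈ range T | ∃ p : ℕ, p.Prime ∧ y < p ∧ p ≤ ⌊3 * SS k * x⌋₊ ∧ (p:ℤ) ∣ k.f ((y:ℤ) + 1 + (t:ℕ))} : ℝ) ≤ q / 16 * x := by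
    have z1 : (⌊3 * SS k * x⌋₊ : ℝ) ≤ 3 * SS k * x := Nat.floor_le (by positivity)
    have z3 := (mul_le_mul_of_nonneg_left z2 (Nat.cast_nonneg _)).trans he
    rw [mul_div_assoc', div_le_iff₀ q0] at z3
    refine le_of_mul_le_mul_right (z3.trans ?_) (by positivity : (0:ℝ) < 288 * SS k)
    have := mul_le_mul_of_nonneg_right z1 q0.le
    linarith
  have l2 := Real.log_two_lt_d9
  have l2' := Real.log_two_gt_d9
  have L0 : 2 ≤ Real.log x := by linarith [show 0 ≤ 16 / q by positivity]
  have a0 : 0 ≤ (1 - 2 * c) * Real.log x - Real.log 2 := by nlinarith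
  have b0 : 0 ≤ (1 + δ) * Real.log x := by positivity
  refine ar (b := (1 + δ) * Real.log x) q0 hq hδ hκ c0 c2 c3 (by linarith) (by linarith) hx h4 h5 t2 rfl rfl a0 (Nat.cast_nonneg _) he h1
    (mul_le_mul yx (Real.log_le_log (by exact_mod_cast y1) yx) (Real.log_natCast_nonneg _) (by linarith))
    (le_trans ?_ ((h2 T t1).trans (mul_assoc _ _ _).le))
  have hs : ∀ P : ℕ → Prop, (#{t ∈ range T | P t} : ℝ) = ∑ t ∈ range T, (if P t then (1:ℝ) else 0) := fun P => by rw [card_filter]; push_cast; rfl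
  have hT' : (T:ℝ) = ∑ t ∈ range T, (1:ℝ) := by simp
  rw [hs, hs, hs, hT', ← sum_sub_distrib, ← sum_sub_distrib, ← sum_sub_distrib, ← sum_sub_distrib, mul_sum, mul_sum, ← sum_add_distrib]
  refine le_of_le_of_eq (sum_le_sum (g := fun t => ∑ p ∈ Nat.primesLE y, (k.f ((y:ℤ) + 1 + (t:ℕ))).natAbs.factorization p * Real.log p) fun t ht => ?_) ?_
  swap
  · rw [sum_comm]; exact sum_congr rfl fun p _ => by rw [Nat.cast_sum, sum_mul]
  have hne : (k.f ((y:ℤ) + 1 + (t:ℕ))).natAbs ≠ 0 := fun h =>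
    absurd (hk _ 1 (by simpa [Cub.F, Cub.f] using h)).2 one_ne_zero
  have n1 : x < (((y:ℤ) + 1 + (t:ℕ) : ℤ):ℝ) := by push_cast; linarith [(Nat.cast_nonneg t : (0:ℝ) ≤ t)]
  have n2 := t3 t (mem_range.1 ht)
  generalize (y:ℤ) + 1 + (t:ℕ) = n at *
  refine pt0 a0 b0 (by positivity) (by positivity) (by positivity) (by split_ifs <;> norm_num) ?_
  by_cases hA' : ∃ p : ℕ, p.Prime ∧ (p:ℤ) ∣ k.f n ∧ x ^ (1 + c) < p
  · exact .inl (if_pos hA')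
  refine .inr ⟨if_neg hA', ?_⟩
  have hA2 : ∀ p : ℕ, p.Prime → (p:ℤ) ∣ k.f n → (p:ℝ) ≤ x ^ (1 + c) := fun p h h' => by
    by_contra! h2; exact hA' ⟨p, h, h', h2⟩
  by_cases hH : ∃ d : ℕ, (d:ℤ) ∣ k.f n ∧ x ^ (1 + δ) ≤ d ∧ (d.Prime ∨ ∀ P : ℕ, P.Prime → P ∣ d → W < P ∧ (P:ℝ) ≤ x)
  · refine .inl ⟨if_pos hH, ?_⟩
    obtain ⟨d, d1, d2, d3⟩ := hH
    rcases d3 with d3 | d3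
    · exact absurd (d2.trans (hA2 d d3 d1)) (not_le.2 (Real.rpow_lt_rpow_of_exponent_lt (by linarith) (by linarith)))
    · refine le_trans ?_ (highS hne (Int.natCast_dvd.1 d1) fun p hp hpd => yf p (d3 p hp hpd).2)
      rw [← Real.log_rpow (by linarith)]
      exact Real.log_le_log (by positivity) d2
  refine .inr ⟨if_neg hH, ?_⟩
  by_cases hE : ∃ p : ℕ, p.Prime ∧ y < p ∧ p ≤ ⌊3 * SS k * x⌋₊ ∧ (p:ℤ) ∣ k.f n
  · exact .inl (if_pos hE)
  · exact .inr ⟨if_neg hE, hp hA2 hE n1 n2 hne⟩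
end LV
open Polynomial
theorem stmt_0 (c₀ c₁ c₂ : ℤ)
    (hf : Irreducible (X ^ 3 + C c₂ * X ^ 2 + C c₁ * X + C c₀ : ℤ[X])) :
    ∃ c > (0 : ℝ), ∃ κ > (0 : ℝ), ∃ x₀ : ℝ, 1 ≤ x₀ ∧ ∀ x : ℝ, x₀ ≤ x →
      κ * x ≤ Nat.card {n : ℤ // x < (n : ℝ) ∧ (n : ℝ) ≤ 2 * x ∧
        ∃ p : ℕ, p.Prime ∧ (p : ℤ) ∣ (X ^ 3 + C c₂ * X ^ 2 + C c₁ * X + C c₀ : ℤ[X]).eval n ∧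
          x ^ (1 + c) < (p : ℝ)} := by
  classical
  obtain ⟨c, hc, κ, hκ, h⟩ := LV.fin ⟨c₀, c₁, c₂⟩ hf
  obtain ⟨x₀, hx⟩ := Filter.eventually_atTop.1 h
  refine ⟨c, hc, κ, hκ, max 1 x₀, le_max_left _ _, fun x h => (hx x ((le_max_right _ _).trans h)).trans (le_of_eq ?_)⟩
  rw [Nat.subtype_card _ fun n => ?_]
  rw [Finset.mem_filter]
  simp only [Finset.mem_Ioc, Int.floor_lt, Int.le_floor, and_assoc, Cub.f, eval_add, eval_mul, eval_pow, eval_X, eval_C]
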